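/- Let k be a field of characteristic zero and R = k[X_1,...,X_n]/I a standard graded k-algebra where I is generated by a homogeneous regular sequence, with d = dim R ≥ 1. Assume (i) edim R_p ≤ 2·dim R_p for every prime p not containing the irrelevant ideal R_+, and (ii) the Rees algebra R(Ω_{R/k}) is Cohen-Macaulay. Then edim R_p ≤ 2·dim R_p − 1 for every non-minimal homogeneous prime p of R. -/

import Mathlib

noncomputable section

/-- The minimal number of generators of an `R`-module `M`. -/
def minGens (R M : Type) [Semiring R] [AddCommMonoid M] [Module R M] : ℕ :=
  sInf {n | ∃ s : Finset M, s.card = n ∧ Submodule.span R (s : Set M) = ⊤}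

/-- The embedding dimension of a local ring: the minimal number of generators of its
maximal ideal. -/
def embDim (A : Type) [CommRing A] [IsLocalRing A] : ℕ :=
  sInf {n | ∃ s : Finset A, s.card = n ∧ Ideal.span (s : Set A) = IsLocalRing.maximalIdeal A}

/-- A Noetherian local ring is Cohen-Macaulay if its maximal ideal contains a regular
sequence whose length equals its Krull dimension. -/
def IsCohenMacaulayLocalRing (A : Type) [CommRing A] [IsLocalRing A] : Prop :=
  ∃ rs : List A, (∀ r ∈ rs, r ∈ IsLocalRing.maximalIdeal A) ∧
    RingTheory.Sequence.IsRegular A rs ∧ (rs.length : WithBot ℕ∞) = ringKrullDim A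

/-- A ring is Cohen-Macaulay if all its localizations at primes are Cohen-Macaulay
local rings. -/
def IsCohenMacaulayRing (A : Type) [CommRing A] : Prop :=
  ∀ (p : Ideal A) (hp : p.IsPrime),
    letI := hp
    IsCohenMacaulayLocalRing (Localization.AtPrime p)

/-- The defining relations of the symmetric algebra of a module, inside the polynomial
ring on the underlying set of the module. -/
def symRels (R M : Type) [CommRing R] [AddCommGroup M] [Module R M] :
    Set (MvPolynomial M R) :=
  {p | ∃ x y : M, p = MvPolynomial.X (x + y) - MvPolynomial.X x - MvPolynomial.X y} ∪
    {p | ∃ (r : R) (x : M), p = MvPolynomial.X (r • x) - MvPolynomial.C r * MvPolynomial.X x}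

/-- The symmetric algebra of an `R`-module `M`. -/
abbrev SymmAlgebra (R M : Type) [CommRing R] [AddCommGroup M] [Module R M] : Type :=
  MvPolynomial M R ⧸ Ideal.span (symRels R M)

/-- The Rees algebra of a module: the symmetric algebra modulo (the ideal generated by)
its `R`-torsion. -/
abbrev ReesAlgebraOfModule (R M : Type) [CommRing R] [AddCommGroup M] [Module R M] : Type :=
  SymmAlgebra R M ⧸ Ideal.span
    ((Submodule.torsion R (SymmAlgebra R M) : Submodule R (SymmAlgebra R M)) : Set (SymmAlgebra R M))

section

open CategoryTheory CategoryTheory.Abelian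

/-- Every element of `M` is killed by an element outside the prime `Q`. -/
def QTors {A : Type} [CommRing A] (Q : Ideal A) (M : Type*) [AddCommGroup M] [Module A M] : Prop :=
  ∀ x : M, ∃ s : A, s ∉ Q ∧ s • x = 0

/-- `M` localized at `Q` has depth at least `t`, expressed by the vanishing up to `Q`-torsion of
the modules `Ext A (A ⧸ Q) M`. -/
def DepthAt {A : Type} [CommRing A] (Q : Ideal A) (t : ℕ) (M : Type) [AddCommGroup M]
    [Module A M] : Prop :=
  ∀ i < t, QTors Q (Ext (ModuleCat.of A (A ⧸ Q)) (ModuleCat.of A M) i)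

section QTors

variable {A : Type} [CommRing A] {Q : Ideal A} [hQ : Q.IsPrime]
variable {M N P : Type*} [AddCommGroup M] [Module A M] [AddCommGroup N] [Module A N]
  [AddCommGroup P] [Module A P]

theorem QTors.middle {f : M → N} {g : N → P} (hM : QTors Q M) (hP : QTors Q P)
    (hf : ∀ (s : A) x, f (s • x) = s • f x) (hf0 : f 0 = 0)
    (hg : ∀ (s : A) x, g (s • x) = s • g x)
    (h : ∀ y, g y = 0 → ∃ x, f x = y) : QTors Q N := by
  intro y
  obtain ⟨s, hs, hsy⟩ := hP (g y)
  obtain ⟨x, hx⟩ := h (s • y) (by rw [hg, hsy])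
  obtain ⟨t, ht, htx⟩ := hM x
  refine ⟨t * s, fun h => (hQ.mem_or_mem h).elim ht hs, ?_⟩
  rw [mul_smul, ← hx, ← hf, htx, hf0]

theorem QTors.exists_smul_eq_zero [Module.Finite A M] (h : QTors Q M) :
    ∃ s : A, s ∉ Q ∧ ∀ x : M, s • x = 0 := by
  classical
  obtain ⟨S, hS⟩ := Module.Finite.fg_top (R := A) (M := M)
  choose s hs hsx using h
  refine ⟨∏ y ∈ S, s y, fun h => ?_, fun x => ?_⟩
  · obtain ⟨y, -, hy⟩ := hQ.prod_mem_iff.mp h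
    exact hs y hy
  · have hx : x ∈ Submodule.span A (S : Set M) := hS ▸ Submodule.mem_top
    induction hx using Submodule.span_induction with
    | mem y hy =>
      rw [← Finset.prod_erase_mul _ _ hy, mul_smul, hsx, smul_zero]
    | zero => simp
    | add y z _ _ hy hz => rw [smul_add, hy, hz, add_zero]
    | smul a y _ hy => rw [smul_comm, hy, smul_zero]

end QTors

section Depth

variable {A : Type} [CommRing A] {Q : Ideal A}
variable {M N P : Type} [AddCommGroup M] [Module A M] [AddCommGroup N] [Module A N]
  [AddCommGroup P] [Module A P]

theorem DepthAt.mono {t u : ℕ} (h : DepthAt Q t M) (hu : u ≤ t) : DepthAt Q u M :=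
  fun i hi => h i (hi.trans_le hu)

theorem DepthAt.of_linearEquiv {t : ℕ} (e : M ≃ₗ[A] N) (h : DepthAt Q t M) : DepthAt Q t N := by
  intro i hi x
  obtain ⟨s, hs, hx⟩ := h i hi (x.comp (Ext.mk₀ (ModuleCat.ofHom e.symm.toLinearMap)) (add_zero i))
  refine ⟨s, hs, ?_⟩
  have := congrArg (fun y => y.comp (Ext.mk₀ (ModuleCat.ofHom e.toLinearMap)) (add_zero i)) hx
  simp only [Ext.smul_comp, Ext.comp_assoc_of_third_deg_zero, Ext.mk₀_comp_mk₀,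
    ← ModuleCat.ofHom_comp, Ext.zero_comp] at this
  simpa [← ModuleCat.ofHom_comp, LinearEquiv.comp_symm, ModuleCat.ofHom_id] using this

theorem DepthAt.of_smul_eq_zero {t : ℕ} {s : A} (hs : s ∉ Q) (h : ∀ x : M, s • x = 0) :
    DepthAt Q t M := by
  intro i _ x
  refine ⟨s, hs, ?_⟩
  rw [Ext.smul_eq_comp_mk₀]
  have : s • 𝟙 (ModuleCat.of A M) = 0 := by
    ext x
    simpa using h x
  rw [this]
  simp

variable [Q.IsPrime]

theorem QTors.depthAt [Module.Finite A M] (h : QTors Q M) (t : ℕ) : DepthAt Q t M := by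
  obtain ⟨s, hs, hx⟩ := h.exists_smul_eq_zero
  exact DepthAt.of_smul_eq_zero hs hx

variable {f : M →ₗ[A] N} {g : N →ₗ[A] P}

theorem shortExact_of (hf : Function.Injective f) (hg : Function.Surjective g)
    (h : Function.Exact f g) :
    (ShortComplex.mk (ModuleCat.ofHom f) (ModuleCat.ofHom g)
      (by rw [← ModuleCat.ofHom_comp, h.linearMap_comp_eq_zero]; rfl)).ShortExact where
  exact := (ShortComplex.ShortExact.moduleCat_exact_iff_function_exact _).mpr h
  mono_f := (ModuleCat.mono_iff_injective _).mpr hf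
  epi_g := (ModuleCat.epi_iff_surjective _).mpr hg

theorem DepthAt.middle {t : ℕ} (hf : Function.Injective f) (hg : Function.Surjective g)
    (h : Function.Exact f g) (h1 : DepthAt Q t M) (h3 : DepthAt Q t P) : DepthAt Q t N := by
  intro i hi
  have S := shortExact_of hf hg h
  refine QTors.middle (f := fun x => x.comp (Ext.mk₀ (ModuleCat.ofHom f)) (add_zero i))
    (g := fun x => x.comp (Ext.mk₀ (ModuleCat.ofHom g)) (add_zero i)) (h1 i hi) (h3 i hi)
    (fun s x => Ext.smul_comp ..) (by simp) (fun s x => Ext.smul_comp ..) (fun y hy => ?_)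
  exact Ext.covariant_sequence_exact₂ _ S y hy

theorem DepthAt.left {t : ℕ} (hf : Function.Injective f) (hg : Function.Surjective g)
    (h : Function.Exact f g) (h2 : DepthAt Q t N) (h3 : DepthAt Q (t - 1) P) : DepthAt Q t M := by
  intro i hi
  have S := shortExact_of hf hg h
  cases i with
  | zero =>
    intro x
    obtain ⟨s, hs, hx⟩ := h2 0 hi (x.comp (Ext.mk₀ (ModuleCat.ofHom f)) (add_zero 0))
    refine ⟨s, hs, ?_⟩
    have := S.mono_f
    obtain ⟨x, rfl⟩ := Ext.homEquiv₀.symm.surjective x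
    simp only [Ext.homEquiv₀, Equiv.symm_symm] at hx ⊢
    have key : ∀ u : (ModuleCat.of A (A ⧸ Q) ⟶ ModuleCat.of A M), Ext.mk₀ u =
        (Ext.homEquiv₀.symm u) := fun _ => rfl
    have hx' : Ext.mk₀ ((s • x) ≫ ModuleCat.ofHom f) = 0 := by
      simpa [Ext.mk₀_smul, ← Ext.mk₀_comp_mk₀] using hx
    have h0 : (s • x) ≫ ModuleCat.ofHom f = 0 := by simpa using hx'
    have : s • x = 0 := by
      rw [← cancel_mono (ModuleCat.ofHom f), h0, Limits.zero_comp]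
    have := congrArg Ext.mk₀ this
    simpa [Ext.mk₀_smul] using this
  | succ i =>
    refine QTors.middle (f := fun x => x.comp S.extClass (rfl : i + 1 = i + 1))
      (g := fun x => x.comp (Ext.mk₀ (ModuleCat.ofHom f)) (add_zero (i + 1)))
      (h3 i (by omega)) (h2 _ hi)
      (fun s x => Ext.smul_comp ..) (by simp) (fun s x => Ext.smul_comp ..) (fun y hy => ?_)
    exact Ext.covariant_sequence_exact₁ _ S y hy rfl

theorem DepthAt.right {t : ℕ} (hf : Function.Injective f) (hg : Function.Surjective g)
    (h : Function.Exact f g) (h1 : DepthAt Q (t + 1) M) (h2 : DepthAt Q t N) : DepthAt Q t P := by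
  intro i hi
  have S := shortExact_of hf hg h
  refine QTors.middle (f := fun x => x.comp (Ext.mk₀ (ModuleCat.ofHom g)) (add_zero i))
      (g := fun x => x.comp S.extClass (rfl : i + 1 = i + 1))
      (h2 i hi) (h1 (i + 1) (by omega))
      (fun s x => Ext.smul_comp ..) (by simp) (fun s x => Ext.smul_comp ..) (fun y hy => ?_)
  exact Ext.covariant_sequence_exact₃ _ S y rfl hy

end Depth

end

section

open CategoryTheory CategoryTheory.Abelian
open scoped Pointwise

variable {A : Type} [CommRing A] {Q : Ideal A} [hQ : Q.IsPrime]
variable {M N P : Type} [AddCommGroup M] [Module A M] [AddCommGroup N] [Module A N]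
  [AddCommGroup P] [Module A P]

theorem depthAt_quotient_iff {K : Submodule A M} [Module.Finite A K] (hK : QTors Q K) {t : ℕ} :
    DepthAt Q t (M ⧸ K) ↔ DepthAt Q t M := by
  have hex : Function.Exact K.subtype K.mkQ := LinearMap.exact_subtype_mkQ K
  exact ⟨fun h => DepthAt.middle K.subtype_injective K.mkQ_surjective hex (hK.depthAt t) h,
    fun h => DepthAt.right K.subtype_injective K.mkQ_surjective hex (hK.depthAt (t + 1)) h⟩

variable {f : M →ₗ[A] N} {g : N →ₗ[A] P}

theorem kerQuot_exact (h : Function.Exact f g) :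
    Function.Injective ((LinearMap.ker f).liftQ f le_rfl) ∧
      Function.Exact ((LinearMap.ker f).liftQ f le_rfl) g := by
  refine ⟨LinearMap.ker_eq_bot.mp (Submodule.ker_liftQ_eq_bot _ _ _ le_rfl), fun y => ?_⟩
  rw [h y]
  constructor
  · rintro ⟨x, rfl⟩
    exact ⟨Submodule.Quotient.mk x, rfl⟩
  · rintro ⟨x, rfl⟩
    obtain ⟨x, rfl⟩ := Submodule.Quotient.mk_surjective _ x
    exact ⟨x, rfl⟩

variable [IsNoetherianRing A] [Module.Finite A M]

theorem DepthAt.right_of_qTors {t : ℕ} (hf : QTors Q (LinearMap.ker f))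
    (hg : Function.Surjective g)
    (h : Function.Exact f g) (h1 : DepthAt Q (t + 1) M) (h2 : DepthAt Q t N) : DepthAt Q t P :=
  DepthAt.right (kerQuot_exact h).1 hg (kerQuot_exact h).2 ((depthAt_quotient_iff hf).2 h1) h2

omit hQ [IsNoetherianRing A] [Module.Finite A M] in
theorem smul_ext_eq_zero {x : A} (hx : x ∈ Q) {i : ℕ}
    (y : Ext (ModuleCat.of A (A ⧸ Q)) (ModuleCat.of A M) i) : x • y = 0 := by
  have h0 : x • 𝟙 (ModuleCat.of A (A ⧸ Q)) = 0 := by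
    refine ModuleCat.hom_ext (LinearMap.ext fun z => ?_)
    obtain ⟨z, rfl⟩ := Ideal.Quotient.mk_surjective z
    simp only [ModuleCat.hom_smul, ModuleCat.hom_id, LinearMap.smul_apply, LinearMap.id_coe, id_eq,
      ModuleCat.hom_zero, LinearMap.zero_apply]
    rw [← Ideal.Quotient.mkₐ_eq_mk A, ← map_smul, Ideal.Quotient.mkₐ_eq_mk,
      Ideal.Quotient.eq_zero_iff_mem]
    exact Q.mul_mem_right _ hx
  have : x • (Ext.mk₀ (𝟙 (ModuleCat.of A (A ⧸ Q)))).comp y (zero_add i) = 0 := by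
    rw [← Ext.smul_comp, ← Ext.mk₀_smul, h0]
    simp
  simpa using this

theorem depthAt_of_quotSMulTop {t : ℕ} {x : A} (hx : x ∈ Q)
    (hK : QTors Q (LinearMap.ker (LinearMap.lsmul A M x)))
    (h : DepthAt Q t (QuotSMulTop x M)) : DepthAt Q (t + 1) M := by
  have hex : Function.Exact (LinearMap.lsmul A M x) (Submodule.mkQ (x • (⊤ : Submodule A M))) := by
    intro y
    rw [Submodule.mkQ_apply, Submodule.Quotient.mk_eq_zero,
      Submodule.mem_smul_pointwise_iff_exists]
    simp
  obtain ⟨hinj, hex'⟩ := kerQuot_exact hex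
  set K := LinearMap.ker (LinearMap.lsmul A M x)
  have S := shortExact_of hinj (Submodule.mkQ_surjective _) hex'
  have S2 := shortExact_of K.subtype_injective K.mkQ_surjective (LinearMap.exact_subtype_mkQ K)
  intro i hi y
  have hfac : (K.liftQ (LinearMap.lsmul A M x) le_rfl).comp K.mkQ = x • LinearMap.id := by
    ext z; simp
  set w := y.comp (Ext.mk₀ (ModuleCat.ofHom K.mkQ)) (add_zero i) with hw
  have hwf : w.comp (Ext.mk₀ (ModuleCat.ofHom (K.liftQ (LinearMap.lsmul A M x) le_rfl)))
      (add_zero i) = 0 := by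
    rw [hw, Ext.comp_assoc_of_third_deg_zero, Ext.mk₀_comp_mk₀, ← ModuleCat.ofHom_comp, hfac]
    have : ModuleCat.ofHom (x • LinearMap.id : M →ₗ[A] M) = x • 𝟙 (ModuleCat.of A M) := by
      ext; simp
    rw [this, ← Ext.smul_eq_comp_mk₀, smul_ext_eq_zero hx]
  have hs : ∃ s : A, s ∉ Q ∧ s • w = 0 := by
    cases i with
    | zero =>
      refine ⟨1, hQ.one_notMem, ?_⟩
      have := S.mono_f
      generalize w = w at hwf
      obtain ⟨u, rfl⟩ : ∃ u, Ext.mk₀ u = w := Ext.homEquiv₀.symm.surjective w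
      rw [Ext.mk₀_comp_mk₀, Ext.mk₀_eq_zero_iff] at hwf
      have h0 : u = 0 := by
        rw [← cancel_mono (ModuleCat.ofHom (K.liftQ (LinearMap.lsmul A M x) le_rfl)), hwf,
          Limits.zero_comp]
      simp [h0]
    | succ i =>
      obtain ⟨z, hz⟩ := Ext.covariant_sequence_exact₁ _ S w hwf rfl
      obtain ⟨s, hs, hsz⟩ := h i (by omega) z
      exact ⟨s, hs, by rw [← hz, ← Ext.smul_comp, hsz, Ext.zero_comp]⟩
  obtain ⟨s, hs, hsw⟩ := hs
  obtain ⟨z, hz⟩ := Ext.covariant_sequence_exact₂ _ S2 (s • y) (by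
    dsimp only
    rw [Ext.smul_comp, ← hw, hsw])
  obtain ⟨s', hs', hz'⟩ := (hK.depthAt (i + 1)) i (by omega) z
  refine ⟨s' * s, fun h => (hQ.mem_or_mem h).elim hs' hs, ?_⟩
  rw [mul_smul, ← hz, ← Ext.smul_comp, hz', Ext.zero_comp]

theorem DepthAt.quotSMulTop {t : ℕ} {x : A}
    (hK : QTors Q (LinearMap.ker (LinearMap.lsmul A M x)))
    (h : DepthAt Q (t + 1) M) : DepthAt Q t (QuotSMulTop x M) := by
  have hex : Function.Exact (LinearMap.lsmul A M x) (Submodule.mkQ (x • (⊤ : Submodule A M))) := by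
    intro y
    rw [Submodule.mkQ_apply, Submodule.Quotient.mk_eq_zero,
      Submodule.mem_smul_pointwise_iff_exists]
    simp
  exact h.right_of_qTors hK (Submodule.mkQ_surjective _) hex (h.mono (Nat.le_succ t))

omit hQ [IsNoetherianRing A] [Module.Finite A M] in
theorem DepthAt.annihilator_ne (h : DepthAt Q 1 M) (y : M) :
    Q ≠ LinearMap.ker (LinearMap.toSpanSingleton A M y) := by
  intro hy
  obtain ⟨s, hs, h0⟩ := h 0 one_pos
    (Ext.mk₀ (ModuleCat.ofHom (Q.liftQ (LinearMap.toSpanSingleton A M y) hy.le)))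
  rw [← Ext.mk₀_smul, Ext.mk₀_eq_zero_iff] at h0
  have := congrArg (fun u => u.hom (Ideal.Quotient.mk Q 1)) h0
  apply hs
  rw [hy, LinearMap.mem_ker]
  have h1 : s • Q.liftQ (LinearMap.toSpanSingleton A M y) hy.le (Submodule.Quotient.mk 1) = 0 :=
    this
  rw [Submodule.liftQ_apply] at h1
  simpa using h1

end

section

open scoped Pointwise

variable {A : Type} [CommRing A] [IsNoetherianRing A] {Q : Ideal A} [hQ : Q.IsPrime]
variable {M : Type} [AddCommGroup M] [Module A M] [Module.Finite A M]

omit hQ [Module.Finite A M] in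
theorem mem_associatedPrimes_iff {P : Ideal A} :
    P ∈ associatedPrimes A M ↔ P.IsPrime ∧ ∃ y : M, ∀ a : A, a ∈ P ↔ a • y = 0 := by
  rw [AssociatedPrimes.mem_iff, isAssociatedPrime_iff]
  refine and_congr_right fun _ => exists_congr fun y => ?_
  rw [Ideal.ext_iff]
  simp [Submodule.mem_colon_singleton]

omit [Module.Finite A M] in
theorem exists_associatedPrimes_le {y : M} (hy : ∀ s : A, s ∉ Q → s • y ≠ 0) :
    ∃ P ∈ associatedPrimes A M, P ≤ Q ∧ (∀ a : A, a • y = 0 → a ∈ P) ∧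
      P ∈ (Module.annihilator A (Submodule.span A {y})).minimalPrimes := by
  have hann : ∀ a : A, a ∈ Module.annihilator A (Submodule.span A {y}) ↔ a • y = 0 := by
    intro a
    rw [← Submodule.annihilator, Submodule.mem_annihilator_span_singleton]
  have hle : Module.annihilator A (Submodule.span A {y}) ≤ Q := by
    intro a ha
    by_contra h
    exact hy a h ((hann a).1 ha)
  obtain ⟨P, hP, hPQ⟩ := Ideal.exists_minimalPrimes_le hle
  refine ⟨P, ?_, hPQ, fun a ha => hP.1.2 ((hann a).2 ha), hP⟩
  exact IsAssociatedPrime.map_of_injective (Submodule.span A {y}).subtype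
    (Module.associatedPrimes.minimalPrimes_annihilator_subset_associatedPrimes A _ hP)
    (Submodule.subtype_injective _)

omit [Module.Finite A M] in
theorem qTors_ker_of_forall_associatedPrimes {x : A}
    (h : ∀ P ∈ associatedPrimes A M, P ≤ Q → x ∉ P) :
    QTors Q (LinearMap.ker (LinearMap.lsmul A M x)) := by
  rintro ⟨y, hy⟩
  by_contra! hc
  obtain ⟨P, hP, hPQ, hPy, -⟩ := exists_associatedPrimes_le (Q := Q) (y := y) (fun s hs h0 =>
    hc s hs (Subtype.ext h0))
  exact h P hP hPQ (hPy x hy)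

theorem exists_mem_qTors_ker (h : DepthAt Q 1 M) :
    ∃ x ∈ Q, QTors Q (LinearMap.ker (LinearMap.lsmul A M x)) := by
  by_contra! hc
  have hfin := (associatedPrimes.finite A M).subset
    (Set.sep_subset (associatedPrimes A M) (fun P => P ≤ Q))
  have hsub : (Q : Set A) ⊆ ⋃ P ∈ ((hfin.toFinset : Finset (Ideal A)) : Set (Ideal A)), (P : Set A) := by
    intro x hx
    by_contra hx'
    refine hc x hx (qTors_ker_of_forall_associatedPrimes fun P hP hPQ hxP => hx' ?_)
    simp only [Set.mem_iUnion]
    exact ⟨P, by simpa using ⟨hP, hPQ⟩, hxP⟩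
  rw [Ideal.subset_union_prime (⊥ : Ideal A) ⊥] at hsub
  · obtain ⟨P, hP, hQP⟩ := hsub
    have hP' : P ∈ associatedPrimes A M ∧ P ≤ Q := by simpa using hP
    obtain ⟨-, y, hy⟩ := mem_associatedPrimes_iff.1 hP'.1
    refine h.annihilator_ne y ?_
    rw [← le_antisymm hP'.2 hQP]
    ext a
    simp [hy]
  · intro P hP _ _
    have hP' : P ∈ associatedPrimes A M ∧ P ≤ Q := by simpa using hP
    exact hP'.1.1

omit [IsNoetherianRing A] in
/-- If a finite module is divisible by `x ∈ Q` up to an element outside `Q`, it is killed by an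
element outside `Q`. -/
theorem exists_notMem_smul_eq_zero {x s : A} (hx : x ∈ Q) (hs : s ∉ Q)
    (h : ∀ y : M, ∃ z : M, s • y = x • z) : ∃ u : A, u ∉ Q ∧ ∀ y : M, u • y = 0 := by
  obtain ⟨p, hp, -, hc, h0⟩ :=
    LinearMap.exists_monic_and_natDegree_eq_and_coeff_mem_pow_and_aeval_eq_zero A
      (s • LinearMap.id : Module.End A M) (Ideal.span {x}) (by
        rintro - ⟨y, rfl⟩
        obtain ⟨z, hz⟩ := h y
        simp only [LinearMap.smul_apply, LinearMap.id_coe, id_eq, hz]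
        exact Submodule.smul_mem_smul (Ideal.mem_span_singleton_self x) Submodule.mem_top)
  refine ⟨p.eval s, fun hmem => hs ?_, fun y => ?_⟩
  · rw [Polynomial.eval_eq_sum_range, Finset.sum_range_succ] at hmem
    have : s ^ p.natDegree ∈ Q := by
      have h2 := (Ideal.add_mem_iff_right Q (Ideal.sum_mem Q (fun i hi => ?_))).1 hmem
      · simpa [hp.coeff_natDegree] using h2
      · refine Q.mul_mem_right _ ?_
        have h1 : Ideal.span {x} ≤ Q := by simpa [Ideal.span_le] using hx
        refine h1 (Ideal.pow_le_self ?_ (hc i))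
        have := Finset.mem_range.1 hi
        omega
    exact hQ.mem_of_pow_mem _ this
  · have h1 : Polynomial.aeval (s • LinearMap.id : Module.End A M) p = p.eval s • LinearMap.id := by
      have : (s • LinearMap.id : Module.End A M) = algebraMap A (Module.End A M) s := by
        ext; simp
      rw [this, Polynomial.aeval_algebraMap_apply]
      ext; simp [Polynomial.aeval_def]
    rw [h1] at h0
    simpa using LinearMap.congr_fun h0 y

/-- Ischebeck: an associated prime `P ≤ Q` of a module of depth at least `t` at `Q` satisfies
`ht P + t ≤ ht Q`. -/
theorem height_add_le_of_depthAt {t : ℕ} (h : DepthAt Q t M) {P : Ideal A}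
    (hP : P ∈ associatedPrimes A M) (hPQ : P ≤ Q) : P.height + t ≤ Q.height := by
  induction t generalizing M P with
  | zero => simpa using Ideal.height_mono hPQ
  | succ t ih =>
    obtain ⟨x, hxQ, hK⟩ := exists_mem_qTors_ker (h.mono (by omega))
    obtain ⟨hPp, y, hy⟩ := mem_associatedPrimes_iff.1 hP
    have hxP : x ∉ P := by
      intro hx
      obtain ⟨s, hs, hs0⟩ := hK ⟨y, by simpa using (hy x).1 hx⟩
      exact hs (hPQ ((hy s).2 (congrArg Subtype.val hs0)))
    let N : Submodule A M := Submodule.torsionBySet A M P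
    have hN : ∀ z : M, z ∈ N ↔ ∀ a ∈ P, a • z = 0 := by simp [N]
    have hyN : y ∈ N := (hN y).2 fun a ha => (hy a).1 ha
    obtain ⟨s₁, hs₁, hKs⟩ := hK.exists_smul_eq_zero
    have key : ∃ z ∈ N, ∀ s : A, s ∉ Q →
        s • (Submodule.Quotient.mk z : QuotSMulTop x M) ≠ 0 := by
      by_contra! hc
      have hT : QTors Q (N.map (Submodule.mkQ (x • (⊤ : Submodule A M)))) := by
        rintro ⟨-, z, hz, rfl⟩
        obtain ⟨s, hs, h0⟩ := hc z hz
        exact ⟨s, hs, Subtype.ext h0⟩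
      obtain ⟨s, hs, h0⟩ := hT.exists_smul_eq_zero
      obtain ⟨u, hu, hu0⟩ := exists_notMem_smul_eq_zero (M := N) hxQ
        (fun h => (hQ.mem_or_mem h).elim hs₁ hs : s₁ * s ∉ Q) (by
          rintro ⟨z, hz⟩
          have h1 := congrArg Subtype.val (h0 ⟨_, z, hz, rfl⟩)
          have h2 : s • z ∈ x • (⊤ : Submodule A M) := by
            rw [← Submodule.Quotient.mk_eq_zero]
            simpa using h1
          obtain ⟨w, -, hw⟩ := (Submodule.mem_smul_pointwise_iff_exists _ _ _).1 h2
          refine ⟨⟨s₁ • w, (hN _).2 fun a ha => ?_⟩, Subtype.ext ?_⟩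
          · rw [smul_comm]
            have : x • (a • w) = 0 := by
              rw [smul_comm, hw, smul_comm, (hN z).1 hz a ha, smul_zero]
            exact congrArg Subtype.val (hKs ⟨a • w, LinearMap.mem_ker.2 this⟩)
          · simp only [SetLike.mk_smul_mk]
            rw [mul_smul, ← hw, smul_comm])
      exact hu (hPQ ((hy u).2 (congrArg Subtype.val (hu0 ⟨y, hyN⟩))))
    obtain ⟨z, hz, hz0⟩ := key
    obtain ⟨P', hP', hPQ', hann, -⟩ := exists_associatedPrimes_le hz0
    have hlt : P < P' := by
      refine lt_of_le_of_ne (fun a ha => hann a ?_) ?_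
      · rw [← Submodule.Quotient.mk_smul, (hN z).1 hz a ha, Submodule.Quotient.mk_zero]
      · rintro rfl
        refine hxP (hann x ?_)
        rw [← Submodule.Quotient.mk_smul, Submodule.Quotient.mk_eq_zero]
        exact Submodule.smul_mem_pointwise_smul _ _ _ Submodule.mem_top
    have := ih (DepthAt.quotSMulTop hK h) hP' hPQ'
    have hp' : P'.IsPrime := hP'.1
    calc P.height + (t + 1 : ℕ) = P.height + 1 + t := by push_cast; ring
      _ ≤ P'.height + t := by gcongr; exact Ideal.height_add_one_le_of_lt_of_isPrime hlt
      _ ≤ _ := this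

end

section

open IsLocalRing
open scoped Pointwise

theorem le_ringKrullDim_quotient_span_singleton {A : Type*} [CommRing A] [IsLocalRing A]
    [IsNoetherianRing A] {n : ℕ} {x : A} (hx : x ∈ maximalIdeal A)
    (h : ((n + 1 : ℕ) : WithBot ℕ∞) ≤ ringKrullDim A) :
    (n : WithBot ℕ∞) ≤ ringKrullDim (A ⧸ Ideal.span {x}) := by
  have h1 := h.trans (ringKrullDim_le_ringKrullDim_quotSMulTop_succ hx)
  rw [← Submodule.ideal_span_singleton_smul, smul_eq_mul, Ideal.mul_top] at h1
  push_cast at h1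
  exact ENat.WithBot.add_le_add_one_right_iff.1 h1

theorem map_maximalIdeal_quotient {A : Type*} [CommRing A] [IsLocalRing A] {x : A}
    [IsLocalRing (A ⧸ Ideal.span {x})] :
    maximalIdeal (A ⧸ Ideal.span {x}) = (maximalIdeal A).map (Ideal.Quotient.mk (Ideal.span {x})) := by
  have : IsLocalHom (Ideal.Quotient.mk (Ideal.span {x})) :=
    IsLocalHom.of_surjective _ Ideal.Quotient.mk_surjective
  exact (((local_hom_TFAE (Ideal.Quotient.mk (Ideal.span {x}))).out 0 4).1 this ▸
    (Ideal.map_comap_of_surjective _ Ideal.Quotient.mk_surjective _)).symm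

theorem isDomain_of_span_range_eq_maximalIdeal (n : ℕ) (A : Type) [CommRing A] [IsLocalRing A]
    [IsNoetherianRing A] (s : Fin n → A) (hs : Ideal.span (Set.range s) = maximalIdeal A)
    (hn : (n : WithBot ℕ∞) ≤ ringKrullDim A) : IsDomain A := by
  induction n generalizing A with
  | zero =>
    have h : maximalIdeal A = ⊥ := by rw [← hs]; simp
    exact (isField_iff_maximalIdeal_eq.2 h).isDomain
  | succ n ih =>
    have hht : (maximalIdeal A).height ≠ 0 := by
      intro h0
      rw [← maximalIdeal_height_eq_ringKrullDim, h0] at hn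
      norm_cast at hn
    have hfin := minimalPrimes.finite_of_isNoetherianRing A
    obtain ⟨x, hx, hx2, hxp⟩ : ∃ x ∈ maximalIdeal A, x ∉ maximalIdeal A ^ 2 ∧
        ∀ p ∈ minimalPrimes A, x ∉ p := by
      by_contra! hcon
      have h2 : ¬ maximalIdeal A ≤ maximalIdeal A ^ 2 := by
        intro h
        have : maximalIdeal A = ⊥ := Submodule.eq_bot_of_le_smul_of_le_jacobson_bot
          (maximalIdeal A) _ (IsNoetherian.noetherian _) (by rwa [smul_eq_mul, ← sq])
          (maximalIdeal_le_jacobson _)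
        exact hht (Ideal.height_eq_zero_iff.2 (this ▸ ⟨⟨(this ▸ inferInstance), bot_le⟩,
          fun _ _ _ => bot_le⟩))
      have h3 := (Ideal.subset_union_prime' (f := id) (a := maximalIdeal A ^ 2)
        (b := maximalIdeal A ^ 2) (s := hfin.toFinset) (I := maximalIdeal A)
        (fun i hi => ((hfin.mem_toFinset).1 hi).1.1)).1 (by
          intro x hx
          by_cases hx2 : x ∈ maximalIdeal A ^ 2
          · exact Or.inl (Or.inl hx2)
          · obtain ⟨p, hp, hxp⟩ := hcon x hx hx2
            exact Or.inr (Set.mem_iUnion₂.2 ⟨p, by simpa using hp, hxp⟩))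
      rcases h3 with (h | h | ⟨p, hp, h⟩)
      · exact h2 h
      · exact h2 h
      · have hp' := (hfin.mem_toFinset).1 hp
        have := hp'.1.1
        have hpe : p = maximalIdeal A := le_antisymm (le_maximalIdeal this.ne_top) h
        exact hht (Ideal.height_eq_zero_iff.2 (hpe ▸ hp'))
    rw [← hs, Ideal.mem_span_range_iff_exists_fun] at hx
    obtain ⟨a, ha⟩ := hx
    have hmem : ∀ i, s i ∈ maximalIdeal A := fun i => hs ▸ Ideal.subset_span ⟨i, rfl⟩
    obtain ⟨i, hi⟩ : ∃ i, IsUnit (a i) := by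
      by_contra! hc
      refine hx2 (ha ▸ Ideal.sum_mem _ fun i _ => ?_)
      rw [sq]
      exact Ideal.mul_mem_mul ((mem_maximalIdeal _).2 (hc i)) (hmem i)
    have hxm : x ∈ maximalIdeal A := ha ▸ Ideal.sum_mem _ fun i _ => Ideal.mul_mem_left _ _ (hmem i)
    have : Nontrivial (A ⧸ Ideal.span {x}) := by
      refine Ideal.Quotient.nontrivial_iff.2 fun h => ?_
      rw [Ideal.span_singleton_eq_top] at h
      exact hxm h
    have : IsLocalRing (A ⧸ Ideal.span {x}) :=
      IsLocalRing.of_surjective' (Ideal.Quotient.mk _) Ideal.Quotient.mk_surjective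
    have hdom := ih (A ⧸ Ideal.span {x}) (fun j => Ideal.Quotient.mk _ (s (i.succAbove j))) (by
      rw [map_maximalIdeal_quotient, ← hs, Ideal.map_span]
      refine le_antisymm (Ideal.span_mono ?_) (Ideal.span_le.2 ?_)
      · rintro - ⟨j, rfl⟩
        exact ⟨_, ⟨_, rfl⟩, rfl⟩
      · rintro - ⟨-, ⟨j, rfl⟩, rfl⟩
        rcases eq_or_ne j i with rfl | hj
        · have h0 : Ideal.Quotient.mk (Ideal.span {x}) x = 0 :=
            Ideal.Quotient.eq_zero_iff_mem.2 (Ideal.mem_span_singleton_self x)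
          generalize Ideal.Quotient.mk (Ideal.span {x}) = π at h0 ⊢
          replace h0 : π (a j * s j + ∑ i, a (j.succAbove i) * s (j.succAbove i)) = 0 := by
            rw [← Fin.sum_univ_succAbove (fun i => a i * s i) j, ha]
            exact h0
          rw [map_add, map_mul, add_eq_zero_iff_eq_neg] at h0
          obtain ⟨u, hu⟩ := hi
          have h1 : π (s j) =
              π (↑u⁻¹ : A) * -(π (∑ i, a (j.succAbove i) * s (j.succAbove i))) := by
            rw [← h0, ← hu, ← map_mul, ← map_mul, Units.inv_mul_cancel_left]
          rw [SetLike.mem_coe, h1, map_sum]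
          refine Ideal.mul_mem_left _ _ (neg_mem (Ideal.sum_mem _ fun l _ => ?_))
          rw [map_mul]
          exact Ideal.mul_mem_left _ _ (Ideal.subset_span ⟨l, rfl⟩)
        · obtain ⟨l, rfl⟩ := Fin.exists_succAbove_eq hj
          exact Ideal.subset_span ⟨l, rfl⟩)
      (le_ringKrullDim_quotient_span_singleton hxm hn)
    have hprime : (Ideal.span {x}).IsPrime := (Ideal.Quotient.isDomain_iff_prime _).1 hdom
    obtain ⟨p, hp, hpx⟩ := Ideal.exists_minimalPrimes_le (bot_le : ⊥ ≤ Ideal.span {x})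
    have hxp' : x ∉ p := hxp p (by simpa using hp)
    have hp1 := hp.1.1
    have : p = ⊥ := Submodule.eq_bot_of_le_smul_of_le_jacobson_bot
      (maximalIdeal A) _ (IsNoetherian.noetherian _) (fun y hy => by
        obtain ⟨b, rfl⟩ := Ideal.mem_span_singleton'.1 (hpx hy)
        rw [mul_comm]
        exact Submodule.smul_mem_smul hxm ((hp1.mem_or_mem hy).resolve_right hxp'))
          (maximalIdeal_le_jacobson _)
    have : (⊥ : Ideal A).IsPrime := this ▸ hp1
    exact IsDomain.of_bot_isPrime A

theorem isWeaklyRegular_of_span_range_eq_maximalIdeal (n : ℕ) (A : Type) [CommRing A]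
    [IsLocalRing A]
    [IsNoetherianRing A] (s : Fin n → A) (hs : Ideal.span (Set.range s) = maximalIdeal A)
    (hn : (n : WithBot ℕ∞) ≤ ringKrullDim A) :
    RingTheory.Sequence.IsWeaklyRegular A (List.ofFn s) := by
  induction n generalizing A with
  | zero => simp
  | succ n ih =>
    have hdom := isDomain_of_span_range_eq_maximalIdeal _ A s hs hn
    have hmem : ∀ i, s i ∈ maximalIdeal A := fun i => hs ▸ Ideal.subset_span ⟨i, rfl⟩
    have : Nontrivial (A ⧸ Ideal.span {s 0}) := by
      refine Ideal.Quotient.nontrivial_iff.2 fun h => ?_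
      rw [Ideal.span_singleton_eq_top] at h
      exact hmem 0 h
    have : IsLocalRing (A ⧸ Ideal.span {s 0}) :=
      IsLocalRing.of_surjective' (Ideal.Quotient.mk _) Ideal.Quotient.mk_surjective
    have hspan : Ideal.span (Set.range fun j : Fin n => Ideal.Quotient.mk (Ideal.span {s 0})
        (s j.succ)) = maximalIdeal (A ⧸ Ideal.span {s 0}) := by
      rw [map_maximalIdeal_quotient, ← hs, Ideal.map_span]
      refine le_antisymm (Ideal.span_mono ?_) (Ideal.span_le.2 ?_)
      · rintro - ⟨j, rfl⟩
        exact ⟨_, ⟨_, rfl⟩, rfl⟩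
      · rintro - ⟨-, ⟨j, rfl⟩, rfl⟩
        refine Fin.cases ?_ (fun j => Ideal.subset_span ⟨j, rfl⟩) j
        rw [Ideal.Quotient.eq_zero_iff_mem.2 (Ideal.mem_span_singleton_self _)]
        exact zero_mem _
    have h := ih (A ⧸ Ideal.span {s 0}) _ hspan (le_ringKrullDim_quotient_span_singleton (hmem 0) hn)
    have hs0 : s 0 ≠ 0 := by
      intro h0
      have h1 := ringKrullDim_le_spanFinrank_maximalIdeal (R := A)
      have hle : (maximalIdeal A).spanFinrank ≤ n := by
        have hs' : maximalIdeal A = Ideal.span (Set.range fun j : Fin n => s j.succ) := by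
          rw [← hs]
          refine le_antisymm (Ideal.span_le.2 ?_) (Ideal.span_mono ?_)
          · rintro - ⟨j, rfl⟩
            refine Fin.cases ?_ (fun j => Ideal.subset_span ⟨j, rfl⟩) j
            rw [h0]
            exact zero_mem _
          · rintro - ⟨j, rfl⟩
            exact ⟨_, rfl⟩
        rw [hs']
        refine (Submodule.spanFinrank_span_le_ncard_of_finite (Set.finite_range _)).trans ?_
        rw [← Set.image_univ]
        exact (Set.ncard_image_le Set.finite_univ).trans (by simp [Set.ncard_univ])
      have h2 := hn.trans (h1.trans (by exact_mod_cast hle : ((_ : ℕ) : WithBot ℕ∞) ≤ (n : ℕ)))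
      norm_cast at h2
      omega
    rw [List.ofFn_succ, RingTheory.Sequence.isWeaklyRegular_cons_iff']
    refine ⟨IsSMulRegular.of_ne_zero hs0, ?_⟩
    rw [List.map_ofFn]
    have e : QuotSMulTop (s 0) A ≃ₗ[A ⧸ Ideal.span {s 0}] (A ⧸ Ideal.span {s 0}) := by
      refine LinearEquiv.extendScalarsOfSurjective (R := A) Ideal.Quotient.mk_surjective
        (Submodule.quotEquivOfEq _ _ ?_)
      rw [← Submodule.ideal_span_singleton_smul, smul_eq_mul, Ideal.mul_top]
    exact (LinearEquiv.isWeaklyRegular_congr e _).2 h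

theorem exists_isWeaklyRegular_length_eq (A : Type) [CommRing A] [IsRegularLocalRing A] :
    ∃ rs : List A, (∀ r ∈ rs, ¬ IsUnit r) ∧ RingTheory.Sequence.IsWeaklyRegular A rs ∧
      (rs.length : WithBot ℕ∞) = ringKrullDim A := by
  obtain ⟨s, hs, hspan⟩ := Submodule.FG.exists_span_finset_card_eq_spanFinrank
    (IsNoetherian.noetherian (maximalIdeal A))
  have hd := IsRegularLocalRing.spanFinrank_maximalIdeal (R := A)
  rw [← hs] at hd
  have hspan' : Ideal.span (Set.range fun i => ((s.equivFin.symm i : s) : A)) = maximalIdeal A := by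
    rw [← hspan, Ideal.span]
    congr 1
    ext x
    simp only [Set.mem_range, SetLike.mem_coe]
    refine ⟨fun ⟨i, hi⟩ => hi ▸ (s.equivFin.symm i).2, fun h => ⟨s.equivFin ⟨x, h⟩, by simp⟩⟩
  refine ⟨List.ofFn _, fun r hr => ?_,
    isWeaklyRegular_of_span_range_eq_maximalIdeal _ A _ hspan' hd.le, by simpa using hd⟩
  rw [List.mem_ofFn] at hr
  obtain ⟨i, rfl⟩ := hr
  have : ((s.equivFin.symm i : s) : A) ∈ maximalIdeal A := hspan' ▸ Ideal.subset_span ⟨i, rfl⟩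
  simpa using this

end

section

open IsLocalRing
open scoped Pointwise

/-- Killing `r` on `A ⧸ J` amounts to adding `r` to `J`. -/
noncomputable def quotSMulTopQuotientEquiv {A : Type*} [CommRing A] (J : Ideal A) (r : A) :
    QuotSMulTop r (A ⧸ J) ≃ₗ[A] A ⧸ (J ⊔ Ideal.span {r}) :=
  Submodule.quotEquivOfEq _ _ (by
    rw [← Submodule.ideal_span_singleton_smul]
    refine le_antisymm (Submodule.smul_le.2 fun a ha y _ => ?_) ?_
    · obtain ⟨y, rfl⟩ := Submodule.mkQ_surjective _ y
      rw [← map_smul]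
      exact Submodule.mem_map_of_mem (Ideal.mul_mem_right _ _ ha)
    · rintro - ⟨a, ha, rfl⟩
      have : (Submodule.mkQ J) a = a • (Submodule.mkQ J) 1 := by
        rw [← map_smul, smul_eq_mul, mul_one]
      rw [this]
      exact Submodule.smul_mem_smul ha trivial) ≪≫ₗ
  Submodule.quotientQuotientEquivQuotientSup J (Ideal.span {r})

theorem DepthAt.of_isWeaklyRegular {A B : Type} [CommRing A] [IsNoetherianRing A] [CommRing B]
    (φ : A →+* B) (Q : Ideal A) [Q.IsPrime]
    (hsurj : ∀ b, ∃ a s, s ∉ Q ∧ φ s * b = φ a) (hunit : ∀ s, s ∉ Q → IsUnit (φ s))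
    (rs : List B) (hrs : ∀ r ∈ rs, ¬ IsUnit r) (J : Ideal A) (K : Ideal B)
    (hJK : ∀ a, φ a ∈ K ↔ ∃ s ∉ Q, s * a ∈ J)
    (h : RingTheory.Sequence.IsWeaklyRegular (B ⧸ K) rs) : DepthAt Q rs.length (A ⧸ J) := by
  induction rs generalizing J K with
  | nil => intro i hi; simp at hi
  | cons r rs ih =>
    rw [RingTheory.Sequence.isWeaklyRegular_cons_iff] at h
    obtain ⟨hr, h⟩ := h
    obtain ⟨x, s, hs, hx⟩ := hsurj r
    have hxQ : x ∈ Q := by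
      by_contra hxQ
      refine hrs r (by simp) ?_
      have := hunit x hxQ
      rw [← hx] at this
      exact isUnit_of_mul_isUnit_right this
    have hmemJ : ∀ a ∈ J, φ a ∈ K := fun a ha => (hJK a).2 ⟨1, Q.one_notMem, by rwa [one_mul]⟩
    refine depthAt_of_quotSMulTop hxQ ?_ ?_
    · rintro ⟨y, hy⟩
      obtain ⟨y, rfl⟩ := Ideal.Quotient.mk_surjective y
      have h1 : x * y ∈ J := by
        rw [← Ideal.Quotient.eq_zero_iff_mem]
        exact hy
      have h2 := hmemJ _ h1
      rw [map_mul, ← hx, mul_assoc, Ideal.unit_mul_mem_iff_mem _ (hunit s hs),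
        ← Ideal.Quotient.eq_zero_iff_mem] at h2
      have h3 := hr (a₁ := Ideal.Quotient.mk K (φ y)) (a₂ := 0) (by
        simp only [smul_zero]
        exact h2)
      rw [Ideal.Quotient.eq_zero_iff_mem, hJK] at h3
      obtain ⟨u, hu, huy⟩ := h3
      refine ⟨u, hu, Subtype.ext ?_⟩
      rw [← Ideal.Quotient.eq_zero_iff_mem] at huy
      exact huy
    · refine DepthAt.of_linearEquiv (quotSMulTopQuotientEquiv J x).symm
        (ih (fun r hr => hrs r (by simp [hr])) _ (K ⊔ Ideal.span {r}) (fun a => ?_)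
          ((LinearEquiv.isWeaklyRegular_congr (quotSMulTopQuotientEquiv K r) rs).1 h))
      constructor
      · intro ha
        obtain ⟨κ, hκ, br, hb, hab⟩ := Submodule.mem_sup.1 ha
        obtain ⟨b, rfl⟩ := Ideal.mem_span_singleton'.1 hb
        obtain ⟨a1, s1, hs1, hb1⟩ := hsurj b
        have h1 : φ (s1 * s * a - a1 * x) ∈ K := by
          have : φ (s1 * s * a - a1 * x) = φ s1 * φ s * κ := by
            rw [map_sub, map_mul, map_mul, map_mul, ← hab, ← hb1, ← hx]
            ring
          rw [this]
          exact Ideal.mul_mem_left _ _ hκ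
        obtain ⟨s2, hs2, h2⟩ := (hJK _).1 h1
        refine ⟨s2 * (s1 * s), fun hc => ?_, ?_⟩
        · rcases Ideal.IsPrime.mem_or_mem ‹_› hc with hc | hc
          · exact hs2 hc
          · exact (Ideal.IsPrime.mem_or_mem ‹_› hc).elim hs1 hs
        · rw [show s2 * (s1 * s) * a = s2 * (s1 * s * a - a1 * x) + (s2 * a1) * x by ring]
          exact add_mem (Ideal.mem_sup_left h2) (Ideal.mem_sup_right
            (Ideal.mul_mem_left _ _ (Ideal.mem_span_singleton_self x)))
      · rintro ⟨u, hu, hua⟩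
        obtain ⟨j, hj, br, hb, hab⟩ := Submodule.mem_sup.1 hua
        obtain ⟨b, rfl⟩ := Ideal.mem_span_singleton'.1 hb
        rw [← Ideal.unit_mul_mem_iff_mem _ (hunit u hu), ← map_mul, ← hab, map_add, map_mul, ← hx]
        refine add_mem (Ideal.mem_sup_left (hmemJ _ hj)) (Ideal.mem_sup_right ?_)
        exact Ideal.mul_mem_left _ _ (Ideal.mul_mem_left _ _ (Ideal.mem_span_singleton_self r))

theorem depthAt_height {A : Type} [CommRing A] [IsRegularRing A] (Q : Ideal A) [Q.IsPrime]
    {t : ℕ} (ht : Q.height = t) : DepthAt Q t A := by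
  have : IsRegularLocalRing (Localization.AtPrime Q) := inferInstance
  obtain ⟨rs, h1, h2, h3⟩ := exists_isWeaklyRegular_length_eq (Localization.AtPrime Q)
  rw [IsLocalization.AtPrime.ringKrullDim_eq_height Q, ht] at h3
  norm_cast at h3
  have e1 : (Localization.AtPrime Q ⧸ (⊥ : Ideal (Localization.AtPrime Q)))
      ≃ₗ[Localization.AtPrime Q] Localization.AtPrime Q := Submodule.quotEquivOfEqBot _ rfl
  have e2 : (A ⧸ (⊥ : Ideal A)) ≃ₗ[A] A := Submodule.quotEquivOfEqBot _ rfl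
  rw [← h3]
  refine DepthAt.of_linearEquiv e2 (DepthAt.of_isWeaklyRegular
    (algebraMap A (Localization.AtPrime Q)) Q (fun b => ?_) (fun s hs =>
      IsLocalization.map_units _ (⟨s, hs⟩ : Q.primeCompl)) rs h1 ⊥ ⊥ (fun a => ?_)
      ((LinearEquiv.isWeaklyRegular_congr e1 rs).2 h2))
  · obtain ⟨⟨a, s⟩, h⟩ := IsLocalization.surj Q.primeCompl b
    exact ⟨a, s, s.2, by rw [mul_comm]; exact h⟩
  · rw [Ideal.mem_bot, IsLocalization.map_eq_zero_iff Q.primeCompl]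
    exact ⟨fun ⟨s, hs⟩ => ⟨s, s.2, hs⟩, fun ⟨s, hs, h⟩ => ⟨⟨s, hs⟩, h⟩⟩

end

section

open MvPolynomial

/-- The linear form with coefficient vector `v`. -/
noncomputable def linForm {O : Type*} [CommRing O] {N : ℕ} (v : Fin N → O) :
    MvPolynomial (Fin N) O :=
  ∑ i, C (v i) * X i

/-- The rank of a family of vectors over the residue field of a prime. -/
noncomputable def rankAt {O : Type*} [CommRing O] {N : ℕ} {ι : Type*} (Q : Ideal O) [Q.IsPrime]
    (v : ι → Fin N → O) : ℕ :=
  Module.finrank Q.ResidueField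
    (Submodule.span Q.ResidueField (Set.range fun j i => algebraMap O Q.ResidueField (v j i)))

/-- The ideal of polynomials whose constant coefficient is in `Q`. -/
noncomputable def irr {O : Type*} [CommRing O] (N : ℕ) (Q : Ideal O) : Ideal (MvPolynomial (Fin N) O) :=
  Q.comap constantCoeff

instance {O : Type*} [CommRing O] (N : ℕ) (Q : Ideal O) [Q.IsPrime] : (irr N Q).IsPrime :=
  inferInstanceAs (Q.comap constantCoeff).IsPrime

theorem exists_rightInverse_of_span {κ : Type*} [Field κ] {N : ℕ} {ι : Type*}
    (v : ι → Fin N → κ) :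
    ∃ (s : Fin (Module.finrank κ (Submodule.span κ (Set.range v))) → ι)
      (U : Fin N → Fin (Module.finrank κ (Submodule.span κ (Set.range v))) → κ),
      ∀ a b, ∑ i, v (s a) i * U i b = if a = b then 1 else 0 := by
  obtain ⟨f, hf, -, hli⟩ := Submodule.exists_fun_fin_finrank_span_eq κ (Set.range v)
  choose s hs using hf
  obtain ⟨L, hL⟩ := (Fintype.linearCombination κ f).exists_leftInverse_of_injective
    (by rw [LinearMap.ker_eq_bot]; exact hli.fintypeLinearCombination_injective)
  refine ⟨s, fun i b => L (Pi.single i 1) b, fun a b => ?_⟩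
  have h1 : L (f a) = Pi.single a 1 := by
    have := LinearMap.congr_fun hL (Pi.single a 1)
    simpa [Fintype.linearCombination_apply_single] using this
  have h2 : f a = ∑ i, v (s a) i • (Pi.single i 1 : Fin N → κ) := by
    rw [hs]
    exact pi_eq_sum_univ' _
  have h3 := congr_fun h1 b
  rw [h2, map_sum] at h3
  simp only [map_smul, Finset.sum_apply, Pi.smul_apply, smul_eq_mul] at h3
  rw [h3, Pi.single_apply]
  simp [eq_comm]

theorem height_comap_C_le {O : Type*} [CommRing O] [IsNoetherianRing O] {N : ℕ}
    (Q : Ideal O) [Q.IsPrime] (Q' : Ideal (MvPolynomial (Fin N) O)) [Q'.IsPrime]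
    (h : Q'.comap C = Q) : Q.height ≤ Q'.height := by
  have : Q'.LiesOver Q := ⟨h.symm⟩
  rw [Ideal.height_eq_height_add_of_liesOver_of_hasGoingDown Q Q']
  exact le_self_add

theorem height_add_le_of_rightInverse {O : Type*} [CommRing O] [IsNoetherianRing O] {N : ℕ}
    (Q : Ideal O) [Q.IsPrime] (ρ : ℕ) (v : Fin ρ → Fin N → O)
    (U : Fin N → Fin ρ → Q.ResidueField)
    (hU : ∀ a b, ∑ i, algebraMap O Q.ResidueField (v a i) * U i b = if a = b then 1 else 0)
    (Q' : Ideal (MvPolynomial (Fin N) O)) [Q'.IsPrime]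
    (h : Q'.comap C = Q) (hv : ∀ a, linForm (v a) ∈ Q') : Q.height + ρ ≤ Q'.height := by
  induction ρ generalizing Q' with
  | zero => simpa using height_comap_C_le Q Q' h
  | succ ρ ih =>
    let K := Q'.ResidueField
    let g : Q.ResidueField →+* K := Ideal.ResidueField.map Q Q' C h.symm
    have hg : ∀ r, g (algebraMap O _ r) = algebraMap (MvPolynomial (Fin N) O) K (C r) :=
      Ideal.ResidueField.map_algebraMap Q Q' C h.symm
    let Φ : MvPolynomial (Fin N) O →+* Polynomial K :=
      eval₂Hom (Polynomial.C.comp ((algebraMap (MvPolynomial (Fin N) O) K).comp C))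
        (fun i => Polynomial.C (algebraMap (MvPolynomial (Fin N) O) K (X i)) +
          Polynomial.C (g (U i (Fin.last ρ))) * Polynomial.X)
    have hΦ0 : (Polynomial.evalRingHom 0).comp Φ = algebraMap (MvPolynomial (Fin N) O) K := by
      refine MvPolynomial.ringHom_ext (fun r => ?_) (fun i => ?_) <;> simp [Φ]
    have hΦlin : ∀ a, Φ (linForm (v a)) =
        if a = Fin.last ρ then Polynomial.X else 0 := by
      intro a
      have h1 : Φ (linForm (v a)) = Polynomial.C (algebraMap (MvPolynomial (Fin N) O) K (linForm (v a))) +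
          Polynomial.C (g (∑ i, algebraMap O Q.ResidueField (v a i) * U i (Fin.last ρ))) *
            Polynomial.X := by
        simp only [linForm, map_sum, map_mul, hg, Finset.sum_mul, ← Finset.sum_add_distrib]
        refine Finset.sum_congr rfl fun i _ => ?_
        simp [Φ]
        ring
      rw [h1, hU, (Ideal.algebraMap_residueField_eq_zero).2 (hv a)]
      split_ifs <;> simp
    have hP : RingHom.ker Φ < Q' := by
      refine lt_of_le_of_ne (fun F hF => ?_) fun heq => ?_
      · rw [← Ideal.algebraMap_residueField_eq_zero, ← hΦ0, RingHom.comp_apply,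
          RingHom.mem_ker.1 hF, map_zero]
      · have := hv (Fin.last ρ)
        rw [← heq, RingHom.mem_ker, hΦlin] at this
        simp at this
    have hprime : (RingHom.ker Φ).IsPrime := RingHom.ker_isPrime Φ
    have hcomap : (RingHom.ker Φ).comap C = Q := by
      ext r
      have hΦC : Φ (C r) = Polynomial.C (algebraMap (MvPolynomial (Fin N) O) K (C r)) := by
        simp [Φ]
      rw [Ideal.mem_comap, RingHom.mem_ker, ← h, Ideal.mem_comap, hΦC, Polynomial.C_eq_zero,
        Ideal.algebraMap_residueField_eq_zero]
    have := ih (fun a => v a.castSucc) (fun i b => U i b.castSucc)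
      (fun a b => by rw [hU]; simp) (RingHom.ker Φ) hcomap
      (fun a => by rw [RingHom.mem_ker, hΦlin]; simp [Fin.castSucc_ne_last])
    calc Q.height + ((ρ + 1 : ℕ) : ℕ∞) = Q.height + ρ + 1 := by push_cast; rw [add_assoc]
      _ ≤ (RingHom.ker Φ).height + 1 := by gcongr
      _ ≤ Q'.height := Ideal.height_add_one_le_of_lt_of_isPrime hP

/-- Linear forms in a prime push its height up by their rank. -/
theorem height_add_rankAt_le {O : Type*} [CommRing O] [IsNoetherianRing O] {N : ℕ} {ι : Type*}
    (v : ι → Fin N → O) (Q : Ideal O) [Q.IsPrime] (Q' : Ideal (MvPolynomial (Fin N) O))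
    [Q'.IsPrime] (h : Q'.comap C = Q) (hv : ∀ a, linForm (v a) ∈ Q') :
    Q.height + rankAt Q v ≤ Q'.height := by
  obtain ⟨s, U, hU⟩ := exists_rightInverse_of_span
    (fun j i => algebraMap O Q.ResidueField (v j i))
  exact height_add_le_of_rightInverse Q _ (fun a => v (s a)) U hU Q' h fun a => hv _

theorem height_irr {O : Type*} [CommRing O] [IsNoetherianRing O] (N : ℕ) (Q : Ideal O)
    [Q.IsPrime] : (irr N Q).height = Q.height + N := by
  have hc : (irr N Q).comap C = Q := by ext; simp [irr]
  have : (irr N Q).LiesOver Q := ⟨hc.symm⟩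
  apply le_antisymm
  · rw [Ideal.height_eq_height_add_of_liesOver_of_hasGoingDown Q (irr N Q)]
    gcongr
    have hspan : (irr N Q).map (Ideal.Quotient.mk (Q.map (algebraMap O _))) =
        Ideal.span (Set.range fun i => Ideal.Quotient.mk (Q.map (algebraMap O _)) (X i)) := by
      refine le_antisymm (Ideal.map_le_iff_le_comap.2 fun F hF => ?_) (Ideal.span_le.2 ?_)
      · obtain ⟨G, hG, hF'⟩ : ∃ G ∈ Ideal.span (Set.range X), F = G + C (constantCoeff F) := by
          refine ⟨F - C (constantCoeff F), ?_, by ring⟩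
          rw [← pow_one (Ideal.span _), mem_pow_idealOfVars_iff']
          intro x hx
          obtain rfl : x = 0 := by simpa [Finsupp.degree_eq_zero_iff] using hx
          simp [constantCoeff_eq]
        have h0 : Ideal.Quotient.mk (Q.map (algebraMap O (MvPolynomial (Fin N) O)))
            (C (constantCoeff F)) = 0 :=
          Ideal.Quotient.eq_zero_iff_mem.2 (Ideal.mem_map_of_mem (algebraMap O _) hF)
        rw [Ideal.mem_comap, hF', map_add, h0, add_zero]
        have := Ideal.mem_map_of_mem
          (Ideal.Quotient.mk (Q.map (algebraMap O (MvPolynomial (Fin N) O)))) hG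
        rwa [Ideal.map_span, ← Set.range_comp] at this
      · rintro - ⟨i, rfl⟩
        exact Ideal.mem_map_of_mem _ (by simp [irr])
    have hne : (irr N Q).map (Ideal.Quotient.mk (Q.map (algebraMap O _))) ≠ ⊤ := by
      have := Ideal.isPrime_map_quotientMk_of_isPrime (I := Q.map (algebraMap O _))
        (p := irr N Q) (Ideal.map_le_iff_le_comap.2 hc.ge)
      exact this.ne_top
    refine (Ideal.height_le_spanFinrank _ hne).trans ?_
    rw [hspan]
    refine Nat.cast_le.2 ((Submodule.spanFinrank_span_le_ncard_of_finite
      (Set.finite_range _)).trans ?_)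
    rw [← Set.image_univ]
    exact (Set.ncard_image_le Set.finite_univ).trans (by simp [Set.ncard_univ])
  · refine height_add_le_of_rightInverse Q N (fun a => Pi.single a 1) (fun i b => if i = b then 1 else 0)
      (fun a b => ?_) (irr N Q) hc (fun a => ?_)
    · simp [Pi.single_apply, eq_comm]
    · simp [irr, linForm]

end

section

/-- The subquotient `U / (V ∩ U)` of a ring. -/
abbrev SubQuot {A : Type*} [CommRing A] (U V : Ideal A) : Type _ := U ⧸ V.submoduleOf U

theorem SubQuot.mk_eq_zero {A : Type*} [CommRing A] {U V : Ideal A} (u : U) :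
    (V.submoduleOf U).mkQ u = 0 ↔ (u : A) ∈ V := by
  rw [Submodule.mkQ_apply, Submodule.Quotient.mk_eq_zero]
  rfl

theorem SubQuot.smul_mk_eq_zero {A : Type*} [CommRing A] {U V : Ideal A} (a : A) (u : U) :
    a • (V.submoduleOf U).mkQ u = 0 ↔ a * u ∈ V := by
  rw [← map_smul, SubQuot.mk_eq_zero]
  rfl

theorem DepthAt.subQuot_congr {A : Type} [CommRing A] {Q : Ideal A} {U V V' : Ideal A} {t : ℕ}
    (h : ∀ u ∈ U, u ∈ V ↔ u ∈ V') (hd : DepthAt Q t (SubQuot U V)) :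
    DepthAt Q t (SubQuot U V') :=
  hd.of_linearEquiv (Submodule.quotEquivOfEq _ _ (by
    ext ⟨u, hu⟩
    exact h u hu))

/-- Multiplication by `z` between subquotients. -/
def SubQuot.mul {A : Type*} [CommRing A] {U V U' V' : Ideal A} (z : A)
    (hU : ∀ u ∈ U, z * u ∈ U') (hV : ∀ u ∈ U, u ∈ V → z * u ∈ V') :
    SubQuot U V →ₗ[A] SubQuot U' V' :=
  Submodule.mapQ _ _ ((LinearMap.mul A A z).restrict hU) fun u hu => hV u u.2 hu

theorem SubQuot.mul_injective {A : Type*} [CommRing A] {U V U' V' : Ideal A} (z : A)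
    (hU : ∀ u ∈ U, z * u ∈ U') (hV : ∀ u ∈ U, u ∈ V → z * u ∈ V')
    (hinj : ∀ u ∈ U, z * u ∈ V' → u ∈ V) : Function.Injective (SubQuot.mul z hU hV) := by
  rw [injective_iff_map_eq_zero]
  intro y hy
  obtain ⟨u, rfl⟩ := Submodule.mkQ_surjective _ y
  rw [SubQuot.mk_eq_zero]
  exact hinj u u.2 ((SubQuot.mk_eq_zero (V := V') _).1 hy)

theorem SubQuot.exact {A : Type*} [CommRing A] {U V U' V' W : Ideal A} (z : A)
    (hU : ∀ u ∈ U, z * u ∈ U') (hV : ∀ u ∈ U, u ∈ V → z * u ∈ V')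
    (hW : ∀ w ∈ U', w ∈ W ↔ ∃ u ∈ U, w - z * u ∈ V') (h : V'.submoduleOf U' ≤ W.submoduleOf U') :
    Function.Exact (SubQuot.mul z hU hV) (Submodule.factor h) := by
  intro y
  obtain ⟨w, rfl⟩ := Submodule.mkQ_surjective _ y
  have h1 : Submodule.factor h ((V'.submoduleOf U').mkQ w) = (W.submoduleOf U').mkQ w := rfl
  rw [h1, SubQuot.mk_eq_zero, hW w w.2]
  constructor
  · rintro ⟨u, hu, huw⟩
    refine ⟨(V.submoduleOf U).mkQ ⟨u, hu⟩, ?_⟩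
    symm
    rw [← sub_eq_zero]
    exact (SubQuot.mk_eq_zero (U := U') (V := V') (w - ⟨z * u, hU u hu⟩)).2 huw
  · rintro ⟨x, hx⟩
    obtain ⟨u, rfl⟩ := Submodule.mkQ_surjective _ x
    refine ⟨u, u.2, ?_⟩
    have h2 := sub_eq_zero.2 hx.symm
    exact (SubQuot.mk_eq_zero (U := U') (V := V') (w - ⟨z * u, hU u u.2⟩)).1 h2

theorem submoduleOf_le_of_iff {A : Type*} [CommRing A] {U U' V' W : Ideal A} {z : A}
    (hW : ∀ w ∈ U', w ∈ W ↔ ∃ u ∈ U, w - z * u ∈ V') :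
    V'.submoduleOf U' ≤ W.submoduleOf U' := fun w hw =>
  (hW w w.2).2 ⟨0, zero_mem _, by rw [mul_zero, sub_zero]; exact hw⟩

theorem DepthAt.subQuot_right {A : Type} [CommRing A] {Q : Ideal A} [Q.IsPrime] {U V U' V' W : Ideal A} {t : ℕ}
    (z : A) (hU : ∀ u ∈ U, z * u ∈ U') (hV : ∀ u ∈ U, u ∈ V → z * u ∈ V')
    (hinj : ∀ u ∈ U, z * u ∈ V' → u ∈ V) (hW : ∀ w ∈ U', w ∈ W ↔ ∃ u ∈ U, w - z * u ∈ V')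
    (h1 : DepthAt Q (t + 1) (SubQuot U V)) (h2 : DepthAt Q t (SubQuot U' V')) :
    DepthAt Q t (SubQuot U' W) :=
  DepthAt.right (SubQuot.mul_injective z hU hV hinj)
    (Submodule.factor_surjective _) (SubQuot.exact z hU hV hW (submoduleOf_le_of_iff hW)) h1 h2

theorem DepthAt.subQuot_left {A : Type} [CommRing A] {Q : Ideal A} [Q.IsPrime] {U V U' V' W : Ideal A} {t : ℕ}
    (z : A) (hU : ∀ u ∈ U, z * u ∈ U') (hV : ∀ u ∈ U, u ∈ V → z * u ∈ V')
    (hinj : ∀ u ∈ U, z * u ∈ V' → u ∈ V) (hW : ∀ w ∈ U', w ∈ W ↔ ∃ u ∈ U, w - z * u ∈ V')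
    (h1 : DepthAt Q t (SubQuot U' V')) (h2 : DepthAt Q (t - 1) (SubQuot U' W)) :
    DepthAt Q t (SubQuot U V) :=
  DepthAt.left (SubQuot.mul_injective z hU hV hinj)
    (Submodule.factor_surjective _) (SubQuot.exact z hU hV hW (submoduleOf_le_of_iff hW)) h1 h2

theorem SubQuot.exists_associatedPrimes_le {A : Type} [CommRing A] [IsNoetherianRing A]
    {Q : Ideal A} [Q.IsPrime] {U V : Ideal A} {w : A} (hw : w ∈ U)
    (h : ∀ s, s ∉ Q → s * w ∉ V) :
    ∃ P ∈ associatedPrimes A (SubQuot U V), P ≤ Q ∧ ∀ a, a * w ∈ V → a ∈ P := by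
  obtain ⟨P, hP, hPQ, hann, -⟩ := _root_.exists_associatedPrimes_le (Q := Q)
    (y := (V.submoduleOf U).mkQ ⟨w, hw⟩) (fun s hs h0 => h s hs ((SubQuot.smul_mk_eq_zero _ _).1 h0))
  exact ⟨P, hP, hPQ, fun a ha => hann a ((SubQuot.smul_mk_eq_zero (V := V) (U := U) _ _).2 ha)⟩

theorem SubQuot.mem_of_forall_mul_mem {A : Type} [CommRing A] [IsNoetherianRing A] {U V P : Ideal A}
    (hP : P ∈ associatedPrimes A (SubQuot U V)) {a : A} (h : ∀ u ∈ U, a * u ∈ V) : a ∈ P := by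
  obtain ⟨-, y, hy⟩ := mem_associatedPrimes_iff.1 hP
  obtain ⟨u, rfl⟩ := Submodule.mkQ_surjective _ y
  exact (hy a).2 ((SubQuot.smul_mk_eq_zero _ _).2 (h u u.2))

end

section

open MvPolynomial

/-- The ideal of polynomials without terms of degree less than `j`. -/
noncomputable abbrev geIdeal (O : Type*) [CommRing O] (N j : ℕ) : Ideal (MvPolynomial (Fin N) O) :=
  idealOfVars (Fin N) O ^ j

/-- Homogeneity of an ideal of a polynomial ring for the total degree. -/
def HomogIdeal {O : Type*} [CommRing O] {N : ℕ} (I : Ideal (MvPolynomial (Fin N) O)) : Prop :=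
  ∀ F ∈ I, ∀ j, homogeneousComponent j F ∈ I

variable {O : Type*} [CommRing O] {N : ℕ}

theorem mem_geIdeal_iff {j : ℕ} {F : MvPolynomial (Fin N) O} :
    F ∈ geIdeal O N j ↔ ∀ i < j, homogeneousComponent i F = 0 := by
  rw [mem_pow_idealOfVars_iff']
  constructor
  · intro h i hi
    ext x
    rw [coeff_homogeneousComponent]
    split_ifs with hx
    · rw [h x (hx ▸ hi), coeff_zero]
    · rw [coeff_zero]
  · intro h x hx
    have h1 := congr_arg (coeff x) (h _ hx)
    rwa [coeff_homogeneousComponent, if_pos rfl, coeff_zero] at h1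

theorem mem_geIdeal_of_isHomogeneous {j i : ℕ} {F : MvPolynomial (Fin N) O} (hF : F.IsHomogeneous i)
    (h : j ≤ i) : F ∈ geIdeal O N j := by
  rw [mem_geIdeal_iff]
  intro l hl
  rw [homogeneousComponent_of_mem hF, if_neg (by omega)]

theorem geIdeal_le {i j : ℕ} (h : i ≤ j) : geIdeal O N j ≤ geIdeal O N i := Ideal.pow_le_pow_right h

theorem homogeneousComponent_mem_geIdeal (j : ℕ) (F : MvPolynomial (Fin N) O) :
    homogeneousComponent j F ∈ geIdeal O N j :=
  mem_geIdeal_of_isHomogeneous (homogeneousComponent_isHomogeneous j F) le_rfl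

theorem homogeneousComponent_homogeneousComponent (i j : ℕ) (F : MvPolynomial (Fin N) O) :
    homogeneousComponent i (homogeneousComponent j F) =
      if i = j then homogeneousComponent j F else 0 :=
  homogeneousComponent_of_mem (homogeneousComponent_isHomogeneous j F)

theorem sub_homogeneousComponent_mem_geIdeal {j : ℕ} {F : MvPolynomial (Fin N) O}
    (hF : F ∈ geIdeal O N j) : F - homogeneousComponent j F ∈ geIdeal O N (j + 1) := by
  rw [mem_geIdeal_iff] at hF ⊢
  intro i hi
  rw [map_sub, homogeneousComponent_homogeneousComponent]
  split_ifs with h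
  · rw [h, sub_self]
  · rw [hF i (by omega), sub_zero]

theorem mem_of_forall_homogeneousComponent_mem {I : Ideal (MvPolynomial (Fin N) O)}
    {F : MvPolynomial (Fin N) O} (h : ∀ j, homogeneousComponent j F ∈ I) : F ∈ I := by
  rw [← sum_homogeneousComponent F]
  exact sum_mem fun j _ => h j

theorem homogeneousComponent_isHomogeneous_mul {z : MvPolynomial (Fin N) O} {a : ℕ}
    (hz : z.IsHomogeneous a) (F : MvPolynomial (Fin N) O) (j : ℕ) :
    homogeneousComponent (a + j) (z * F) = z * homogeneousComponent j F := by
  conv_lhs => rw [← sum_homogeneousComponent F, Finset.mul_sum, map_sum]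
  have h1 : ∀ i, homogeneousComponent (a + j) (z * homogeneousComponent i F) =
      if j = i then z * homogeneousComponent j F else 0 := by
    intro i
    rw [homogeneousComponent_of_mem (hz.mul (homogeneousComponent_isHomogeneous i F))]
    by_cases h : j = i
    · subst h
      rw [if_pos rfl, if_pos rfl]
    · rw [if_neg (by omega), if_neg h]
  simp_rw [h1]
  rw [Finset.sum_ite_eq]
  split_ifs with h
  · rfl
  · rw [homogeneousComponent_eq_zero, mul_zero]
    simpa using h

theorem homogeneousComponent_isHomogeneous_mul_of_lt {z : MvPolynomial (Fin N) O} {a : ℕ}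
    (hz : z.IsHomogeneous a) (F : MvPolynomial (Fin N) O) {j : ℕ} (hj : j < a) :
    homogeneousComponent j (z * F) = 0 := by
  have h1 := Ideal.mul_mem_right F _ (mem_geIdeal_of_isHomogeneous hz le_rfl)
  exact mem_geIdeal_iff.1 h1 j hj

theorem homogeneousComponent_mul_of_mem {j : ℕ} (s : MvPolynomial (Fin N) O)
    {F : MvPolynomial (Fin N) O} (hF : F ∈ geIdeal O N j) :
    homogeneousComponent j (s * F) = C (constantCoeff s) * homogeneousComponent j F := by
  have h1 : s - C (constantCoeff s) ∈ geIdeal O N 1 := by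
    rw [mem_geIdeal_iff]
    intro i hi
    obtain rfl : i = 0 := by omega
    rw [homogeneousComponent_zero, coeff_sub, coeff_C, if_pos rfl, constantCoeff_eq, sub_self, C_0]
  have h2 : (s - C (constantCoeff s)) * F ∈ geIdeal O N (1 + j) := by
    rw [geIdeal, pow_add]
    exact Ideal.mul_mem_mul h1 hF
  have h3 : s * F = (s - C (constantCoeff s)) * F + C (constantCoeff s) * F := by ring
  rw [h3, map_add, mem_geIdeal_iff.1 h2 j (by omega), zero_add, homogeneousComponent_C_mul]

namespace HomogIdeal

theorem sup {I J : Ideal (MvPolynomial (Fin N) O)} (hI : HomogIdeal I) (hJ : HomogIdeal J) :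
    HomogIdeal (I ⊔ J) := fun F hF j => by
  obtain ⟨a, ha, b, hb, rfl⟩ := Submodule.mem_sup.1 hF
  rw [map_add]
  exact Submodule.add_mem_sup (hI a ha j) (hJ b hb j)

theorem span {S : Set (MvPolynomial (Fin N) O)} (hS : ∀ z ∈ S, ∃ a, z.IsHomogeneous a) :
    HomogIdeal (Ideal.span S) := fun F hF j => by
  induction hF using Submodule.span_induction generalizing j with
  | zero => rw [map_zero]; exact zero_mem _
  | add x y _ _ hx hy => rw [map_add]; exact add_mem (hx j) (hy j)
  | smul a x hx h =>
    rw [smul_eq_mul, ← sum_homogeneousComponent a, Finset.sum_mul, map_sum]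
    refine sum_mem fun i _ => ?_
    by_cases hij : i ≤ j
    · obtain ⟨l, rfl⟩ := Nat.exists_eq_add_of_le hij
      rw [homogeneousComponent_isHomogeneous_mul (homogeneousComponent_isHomogeneous i a)]
      exact Ideal.mul_mem_left _ _ (h l)
    · rw [homogeneousComponent_isHomogeneous_mul_of_lt (homogeneousComponent_isHomogeneous i a) _
        (by omega)]
      exact zero_mem _
  | mem x hx =>
    obtain ⟨a, ha⟩ := hS x hx
    rw [homogeneousComponent_of_mem ha]
    split_ifs
    · exact Ideal.subset_span hx
    · exact zero_mem _

theorem mem_sup_geIdeal_iff {I : Ideal (MvPolynomial (Fin N) O)} (hI : HomogIdeal I) {j : ℕ}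
    {F : MvPolynomial (Fin N) O} (hF : F ∈ _root_.geIdeal O N j) :
    F ∈ I ⊔ _root_.geIdeal O N (j + 1) ↔ homogeneousComponent j F ∈ I := by
  constructor
  · intro h
    obtain ⟨a, ha, b, hb, rfl⟩ := Submodule.mem_sup.1 h
    rw [map_add, mem_geIdeal_iff.1 hb j (by omega), add_zero]
    exact hI a ha j
  · intro h
    have := Submodule.add_mem_sup h (sub_homogeneousComponent_mem_geIdeal hF)
    rwa [add_sub_cancel] at this

end HomogIdeal

theorem isHomogeneous_linForm (v : Fin N → O) : (linForm v).IsHomogeneous 1 :=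
  IsHomogeneous.sum _ _ _ fun i _ => by
    simpa using (isHomogeneous_C (Fin N) (v i)).mul (isHomogeneous_X O i)

theorem exists_homogIdeal_isPrime_le (P : Ideal (MvPolynomial (Fin N) O)) [P.IsPrime] :
    ∃ P' : Ideal (MvPolynomial (Fin N) O), P'.IsPrime ∧ HomogIdeal P' ∧ P' ≤ P ∧
      ∀ J, HomogIdeal J → J ≤ P → J ≤ P' := by
  let _ : GradedAlgebra (homogeneousSubmodule (Fin N) O) := MvPolynomial.gradedAlgebra
  refine ⟨(P.homogeneousCore (homogeneousSubmodule (Fin N) O)).toIdeal,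
    Ideal.IsPrime.homogeneousCore inferInstance, fun F hF j => ?_,
    Ideal.toIdeal_homogeneousCore_le _ _, fun J hJ hJP F hF => ?_⟩
  · exact homogeneousComponent_mem_of_mem (HomogeneousIdeal.isHomogeneous _) hF j
  · refine mem_of_forall_homogeneousComponent_mem fun j => ?_
    exact Ideal.mem_homogeneousCore_of_homogeneous_of_mem
      ⟨j, homogeneousComponent_isHomogeneous j F⟩ (hJP (hJ F hF j))

/-- The part of degree `j` of the quotient by a homogeneous ideal. -/
abbrev Piece (I : Ideal (MvPolynomial (Fin N) O)) (j : ℕ) : Type _ :=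
  SubQuot (geIdeal O N j) (I ⊔ geIdeal O N (j + 1))

end

section

open MvPolynomial IsLocalRing

theorem length_le_height_of_isWeaklyRegular {A : Type*} [CommRing A] [IsNoetherianRing A]
    {rs : List A} (h : RingTheory.Sequence.IsWeaklyRegular A rs) (Q : Ideal A) [Q.IsPrime]
    (hQ : ∀ r ∈ rs, r ∈ Q) : (rs.length : ℕ∞) ≤ Q.height := by
  have h1 := h.isRegular_of_isLocalization_of_mem (Localization.AtPrime Q) (p := Q) hQ
  have h2 := ringKrullDim_add_length_eq_ringKrullDim_of_isRegular _ h1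
  rw [IsLocalization.AtPrime.ringKrullDim_eq_height Q (Localization.AtPrime Q), List.length_map] at h2
  have h3 : (0 : WithBot ℕ∞) ≤ ringKrullDim (Localization.AtPrime Q ⧸
      Ideal.ofList (rs.map (algebraMap A (Localization.AtPrime Q)))) := by
    have h4 := h1.top_ne_smul
    have : Nontrivial (Localization.AtPrime Q ⧸
      Ideal.ofList (rs.map (algebraMap A (Localization.AtPrime Q)))) := by
      rw [Ideal.Quotient.nontrivial_iff]
      intro h5
      apply h4
      rw [h5]
      simp
    exact ringKrullDim_nonneg_of_nontrivial
  have h5 : ((rs.length : ℕ∞) : WithBot ℕ∞) ≤ (Q.height : WithBot ℕ∞) := by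
    rw [← h2]
    exact le_add_of_nonneg_left h3
  exact_mod_cast h5

theorem qTors_ker_lsmul_of_isSMulRegular {A M : Type} [CommRing A] [AddCommGroup M] [Module A M]
    (Q : Ideal A) [Q.IsPrime] {x : A} (h : IsSMulRegular M x) :
    QTors Q (LinearMap.ker (LinearMap.lsmul A M x)) := by
  rintro ⟨y, hy⟩
  refine ⟨1, Q.one_notMem, Subtype.ext ?_⟩
  rw [one_smul]
  exact h (by simpa using hy)

theorem DepthAt.quotient_sup_ofList {A : Type} [CommRing A] [IsNoetherianRing A] {Q : Ideal A}
    [Q.IsPrime] (rs : List A) (J : Ideal A) {t : ℕ} (hd : DepthAt Q (t + rs.length) (A ⧸ J))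
    (h : RingTheory.Sequence.IsWeaklyRegular (A ⧸ J) rs) :
    DepthAt Q t (A ⧸ (J ⊔ Ideal.ofList rs)) := by
  induction rs generalizing J with
  | nil => 
    rw [Ideal.ofList_nil, sup_bot_eq]
    exact hd
  | cons r rs ih =>
    rw [RingTheory.Sequence.isWeaklyRegular_cons_iff] at h
    rw [Ideal.ofList_cons, ← sup_assoc]
    refine ih _ ?_ ((LinearEquiv.isWeaklyRegular_congr (quotSMulTopQuotientEquiv J r) rs).1 h.2)
    exact (DepthAt.quotSMulTop (qTors_ker_lsmul_of_isSMulRegular Q h.1) hd).of_linearEquiv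
      (quotSMulTopQuotientEquiv J r)

/-- The quotient by `irr N K` is the quotient of the coefficient ring by `K`. -/
noncomputable def quotIrrEquiv {O : Type*} [CommRing O] (N : ℕ) (K : Ideal O) :
    (O ⧸ K) ≃ₗ[O] MvPolynomial (Fin N) O ⧸ irr N K :=
  LinearEquiv.ofBijective
    (Submodule.liftQ K (Algebra.linearMap O (MvPolynomial (Fin N) O ⧸ irr N K)) (fun a ha => by
      rw [LinearMap.mem_ker, Algebra.linearMap_apply]
      refine Ideal.Quotient.eq_zero_iff_mem.2 ?_
      simpa [irr] using ha)) (by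
    constructor
    · rw [injective_iff_map_eq_zero]
      intro a ha
      obtain ⟨a, rfl⟩ := Submodule.mkQ_surjective _ a
      rw [Submodule.mkQ_apply, Submodule.Quotient.mk_eq_zero]
      have := Ideal.Quotient.eq_zero_iff_mem.1 (show Ideal.Quotient.mk (irr N K) (C a) = 0 from ha)
      simpa [irr] using this
    · intro y
      obtain ⟨F, rfl⟩ := Ideal.Quotient.mk_surjective y
      refine ⟨Submodule.mkQ _ (constantCoeff F), ?_⟩
      refine Eq.trans (b := Ideal.Quotient.mk (irr N K) (C (constantCoeff F))) rfl ?_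
      rw [Ideal.Quotient.eq]
      simp [irr])

theorem depthAt_quotient_irr {O : Type} [CommRing O] [IsRegularLocalRing O] (N : ℕ)
    {t : ℕ} (rs : List O) (ht : (maximalIdeal O).height = (t + rs.length : ℕ))
    (h : RingTheory.Sequence.IsWeaklyRegular O rs) :
    DepthAt (irr N (maximalIdeal O)) t (MvPolynomial (Fin N) O ⧸ irr N (Ideal.ofList rs)) := by
  have hbot : (O ⧸ (⊥ : Ideal O)) ≃ₗ[O] O := Submodule.quotEquivOfEqBot _ rfl
  have h1 : DepthAt (irr N (maximalIdeal O)) (t + rs.length)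
      (MvPolynomial (Fin N) O ⧸ irr N (⊥ : Ideal O)) := by
    obtain ⟨xs, hx1, hx2, hx3⟩ := exists_isWeaklyRegular_length_eq O
    rw [← IsLocalRing.maximalIdeal_height_eq_ringKrullDim, ht] at hx3
    norm_cast at hx3
    rw [← hx3]
    have hu : ∀ s, s ∉ irr N (maximalIdeal O) → IsUnit (constantCoeff s) := fun s hs => by
      by_contra hc
      exact hs ((IsLocalRing.mem_maximalIdeal _).2 hc)
    refine DepthAt.of_isWeaklyRegular constantCoeff _ (fun b => ⟨C b, 1, ?_, by simp⟩) hu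
      xs hx1 _ ⊥ (fun a => ?_) ((LinearEquiv.isWeaklyRegular_congr hbot xs).2 hx2)
    · exact Ideal.one_notMem _
    · constructor
      · intro ha
        exact ⟨1, Ideal.one_notMem _, by rw [one_mul]; exact ha⟩
      · rintro ⟨s, hs, hsa⟩
        have h2 : constantCoeff (s * a) = 0 := hsa
        rw [map_mul, (hu s hs).mul_right_eq_zero] at h2
        exact h2
  have h3 : RingTheory.Sequence.IsWeaklyRegular (MvPolynomial (Fin N) O ⧸ irr N (⊥ : Ideal O))
      (rs.map (algebraMap O (MvPolynomial (Fin N) O))) := by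
    rw [RingTheory.Sequence.isWeaklyRegular_map_algebraMap_iff]
    exact (LinearEquiv.isWeaklyRegular_congr (hbot.symm ≪≫ₗ quotIrrEquiv N ⊥) rs).1 h
  have h4 := DepthAt.quotient_sup_ofList _ _ (by rwa [List.length_map]) h3
  refine DepthAt.of_linearEquiv (Submodule.quotEquivOfEq _ _ ?_) h4
  apply le_antisymm
  · refine sup_le (Ideal.comap_mono bot_le) (Ideal.span_le.2 ?_)
    intro x hx
    obtain ⟨r, hr, rfl⟩ := List.mem_map.1 (show x ∈ rs.map _ from hx)
    refine show constantCoeff (C r) ∈ Ideal.ofList rs from ?_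
    rw [constantCoeff_C]
    exact Ideal.subset_span hr
  · intro F hF
    rw [← sub_add_cancel F (C (constantCoeff F))]
    refine Submodule.add_mem_sup ?_ ?_
    · simp [irr]
    · rw [← Ideal.map_ofList]
      exact Ideal.mem_map_of_mem _ hF

theorem DepthAt.pi {A : Type} [CommRing A] {Q : Ideal A} [Q.IsPrime] [IsNoetherianRing A] {M : Type}
    [AddCommGroup M] [Module A M] {t : ℕ} (h : DepthAt Q t M) (ι : Type) [Finite ι] :
    DepthAt Q t (ι → M) := by
  have key : ∀ n : ℕ, DepthAt Q t (Fin n → M) := by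
    intro n
    induction n with
    | zero => exact QTors.depthAt (fun x => ⟨1, Q.one_notMem, Subsingleton.elim _ _⟩) t
    | succ n ih =>
      have e : (M × (Fin n → M)) ≃ₗ[A] (Fin (n + 1) → M) := Fin.consLinearEquiv A (fun _ => M)
      refine DepthAt.of_linearEquiv e ?_
      exact DepthAt.middle (f := LinearMap.inl A M (Fin n → M)) (g := LinearMap.snd A M _)
        LinearMap.inl_injective LinearMap.snd_surjective Function.Exact.inl_snd h ih
  obtain ⟨n, ⟨e⟩⟩ := Finite.exists_equiv_fin ι
  exact (key n).of_linearEquiv (LinearEquiv.funCongrLeft A M e)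

theorem homogIdeal_map_C {O : Type*} [CommRing O] {N : ℕ} (K : Ideal O) :
    HomogIdeal (K.map (C : O →+* MvPolynomial (Fin N) O)) := fun F hF j => by
  rw [mem_map_C_iff] at hF ⊢
  intro x
  rw [coeff_homogeneousComponent]
  split_ifs
  · exact hF x
  · exact zero_mem _

theorem DepthAt.piece_map_C {O : Type} [CommRing O] [IsNoetherianRing O] {N : ℕ} {K : Ideal O}
    {Q : Ideal O} [Q.IsPrime] {t : ℕ} (h : DepthAt (irr N Q) t (MvPolynomial (Fin N) O ⧸ irr N K))
    (j : ℕ) : DepthAt (irr N Q) t (Piece (K.map (C : O →+* MvPolynomial (Fin N) O)) j) := by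
  let ι := {x : Fin N →₀ ℕ // x.degree = j}
  have : Finite ι := Finsupp.finite_of_degree_le (σ := Fin N) j |>.subset (fun x hx => le_of_eq hx) |>.to_subtype
  let g : geIdeal O N j →ₗ[MvPolynomial (Fin N) O] (ι → MvPolynomial (Fin N) O ⧸ irr N K) :=
    { toFun := fun F x => Ideal.Quotient.mk _ (C (coeff x.1 (F : MvPolynomial (Fin N) O)))
      map_add' := fun F G => by ext x; simp
      map_smul' := fun s F => by
        ext x
        have h1 := congr_arg (coeff x.1) (homogeneousComponent_mul_of_mem s F.2)
        rw [coeff_homogeneousComponent, if_pos x.2, coeff_C_mul, coeff_homogeneousComponent,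
          if_pos x.2] at h1
        rw [Submodule.coe_smul, smul_eq_mul, h1, C_mul]
        refine Ideal.Quotient.eq.2 ?_
        simp [irr, mul_comm] }
  have hker : ∀ F, g F = 0 ↔ (F : MvPolynomial (Fin N) O) ∈
      K.map (C : O →+* MvPolynomial (Fin N) O) ⊔ geIdeal O N (j + 1) := by
    intro F
    rw [HomogIdeal.mem_sup_geIdeal_iff (homogIdeal_map_C K) F.2, mem_map_C_iff, funext_iff]
    constructor
    · intro hF x
      rw [coeff_homogeneousComponent]
      split_ifs with hx
      · have := Ideal.Quotient.eq_zero_iff_mem.1 (hF ⟨x, hx⟩)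
        simpa [irr] using this
      · exact zero_mem _
    · intro hF x
      refine Ideal.Quotient.eq_zero_iff_mem.2 ?_
      have := hF x.1
      rw [coeff_homogeneousComponent, if_pos x.2] at this
      simpa [irr] using this
  have hsurj : Function.Surjective g := by
    intro y
    choose F hF using fun x => Ideal.Quotient.mk_surjective (I := irr N K) (y x)
    have := Fintype.ofFinite ι
    refine ⟨∑ x : ι, ⟨monomial x.1 (constantCoeff (F x)),
      mem_geIdeal_of_isHomogeneous (isHomogeneous_monomial _ x.2) le_rfl⟩, ?_⟩
    ext x
    rw [← hF]
    refine Ideal.Quotient.eq.2 ?_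
    classical
    rw [Submodule.coe_sum, coeff_sum, irr, Ideal.mem_comap, map_sub, constantCoeff_C]
    have h1 : ∀ z : ι, coeff x.1 (monomial z.1 (constantCoeff (F z))) =
        if z = x then constantCoeff (F z) else 0 := fun z => by
      rw [coeff_monomial]
      simp only [Subtype.coe_inj]
    rw [Finset.sum_congr rfl (fun z _ => h1 z)]
    rw [Finset.sum_ite_eq', if_pos (Finset.mem_univ x), sub_self]
    exact zero_mem _
  have e : Piece (K.map (C : O →+* MvPolynomial (Fin N) O)) j ≃ₗ[MvPolynomial (Fin N) O]
      (ι → MvPolynomial (Fin N) O ⧸ irr N K) :=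
    (Submodule.quotEquivOfEq _ _ (by ext F; exact (hker F).symm)) ≪≫ₗ
      g.quotKerEquivOfSurjective hsurj
  exact (h.pi ι).of_linearEquiv e.symm

end

section

open MvPolynomial IsLocalRing
open scoped Pointwise

theorem exists_nat_height_eq {A : Type*} [CommRing A] [IsNoetherianRing A] (Q : Ideal A) [Q.IsPrime] :
    ∃ t : ℕ, Q.height = t :=
  ⟨_, (ENat.natCast_toNat (Ideal.height_lt_top_of_isPrime).ne).symm⟩

theorem rankAt_le_add {O : Type*} [CommRing O] {N : ℕ} {ι : Type*} [Fintype ι] (Q : Ideal O)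
    [Q.IsPrime] (v : ι → Fin N → O) (p : ι → Prop) [DecidablePred p] :
    rankAt Q v ≤ rankAt Q (fun j : {j // p j} => v j) + Fintype.card {j // ¬ p j} := by
  have h1 : (Set.range fun j i => algebraMap O Q.ResidueField (v j i)) ⊆
      (Set.range fun (j : {j // p j}) i => algebraMap O Q.ResidueField (v j i)) ∪
      (Set.range fun (j : {j // ¬ p j}) i => algebraMap O Q.ResidueField (v j i)) := by
    rintro - ⟨j, rfl⟩
    by_cases hj : p j
    · exact Or.inl ⟨⟨j, hj⟩, rfl⟩
    · exact Or.inr ⟨⟨j, hj⟩, rfl⟩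
  have h2 := Submodule.finrank_mono (Submodule.span_mono (R := Q.ResidueField) h1)
  rw [Submodule.span_union] at h2
  have h3 := Submodule.finrank_add_le_finrank_add_finrank
    (Submodule.span Q.ResidueField
      (Set.range fun (j : {j // p j}) i => algebraMap O Q.ResidueField (v j i)))
    (Submodule.span Q.ResidueField
      (Set.range fun (j : {j // ¬ p j}) i => algebraMap O Q.ResidueField (v j i)))
  have h4 := finrank_range_le_card (R := Q.ResidueField)
    (fun (j : {j // ¬ p j}) i => algebraMap O Q.ResidueField (v j i))
  rw [Set.finrank] at h4
  exact h2.trans (h3.trans (Nat.add_le_add_left h4 _))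

variable {O : Type} [CommRing O] {N : ℕ}

theorem comap_C_irr (Q : Ideal O) : (irr N Q).comap C = Q := by ext; simp [irr]

theorem comap_C_le_of_le_irr {Q : Ideal O} {P : Ideal (MvPolynomial (Fin N) O)} (h : P ≤ irr N Q) :
    P.comap C ≤ Q := (Ideal.comap_mono h).trans (comap_C_irr Q).le

theorem mem_of_sub_C_mem {V : Ideal (MvPolynomial (Fin N) O)} {w : MvPolynomial (Fin N) O}
    (hY : ∀ i, X i * w ∈ V) (s : MvPolynomial (Fin N) O) : (s - C (constantCoeff s)) * w ∈ V := by
  have h : s - C (constantCoeff s) ∈ idealOfVars (Fin N) O := by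
    rw [← pow_one (idealOfVars _ _), mem_pow_idealOfVars_iff']
    intro x hx
    obtain rfl : x = 0 := by
      rw [Nat.lt_one_iff, Finsupp.degree_eq_zero_iff] at hx
      exact hx
    rw [coeff_sub, coeff_C, if_pos rfl, constantCoeff_eq, sub_self]
  generalize s - C (constantCoeff s) = y at h
  induction h using Submodule.span_induction with
  | zero => rw [zero_mul]; exact zero_mem _
  | add x y _ _ hx hy => rw [add_mul]; exact add_mem hx hy
  | smul a x _ h => rw [smul_mul_assoc]; exact Submodule.smul_mem _ _ h
  | mem x hx =>
    obtain ⟨i, rfl⟩ := hx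
    exact hY i

theorem irr_le_of_X_mem {P : Ideal (MvPolynomial (Fin N) O)} (hY : ∀ i, X i ∈ P) :
    irr N (P.comap C) ≤ P := by
  intro F hF
  have h1 := mem_of_sub_C_mem (V := P) (w := 1) (fun i => by rw [mul_one]; exact hY i) F
  rw [mul_one] at h1
  have h2 : C (constantCoeff F) ∈ P := hF
  have := add_mem h1 h2
  rwa [sub_add_cancel] at this

theorem eq_irr_of_X_mem {P : Ideal (MvPolynomial (Fin N) O)} (hY : ∀ i, X i ∈ P) :
    P = irr N (P.comap C) := by
  refine le_antisymm (fun F hF => ?_) (irr_le_of_X_mem hY)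
  have h1 := mem_of_sub_C_mem (V := P) (w := 1) (fun i => by rw [mul_one]; exact hY i) F
  rw [mul_one] at h1
  have := sub_mem hF h1
  rwa [sub_sub_cancel] at this

theorem mem_of_forall_prime_exists [IsLocalRing O] [IsNoetherianRing O]
    {U V : Ideal (MvPolynomial (Fin N) O)}
    (hd : DepthAt (irr N (maximalIdeal O)) 1 (SubQuot U V)) {w : MvPolynomial (Fin N) O} (hw : w ∈ U)
    (hY : ∀ i, X i * w ∈ V)
    (hQ : ∀ Q : Ideal O, Q.IsPrime → Q ≠ maximalIdeal O → ∃ s ∉ Q, C s * w ∈ V) : w ∈ V := by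
  by_contra hwV
  obtain ⟨P, hP, hPM, hann⟩ := SubQuot.exists_associatedPrimes_le (Q := irr N (maximalIdeal O)) hw
    (V := V) (fun s hs hsw => by
      have h1 := sub_mem hsw (mem_of_sub_C_mem hY s)
      rw [← sub_mul, sub_sub_cancel] at h1
      have hu : IsUnit (constantCoeff s) := by
        by_contra hc
        exact hs ((IsLocalRing.mem_maximalIdeal _).2 hc)
      exact hwV ((Ideal.unit_mul_mem_iff_mem _ (hu.map C)).1 h1))
  have hprime := (mem_associatedPrimes_iff.1 hP).1
  have h1 : P.comap C = maximalIdeal O := by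
    by_contra hne
    obtain ⟨s, hs, hsw⟩ := hQ _ (hprime.comap C) hne
    exact hs (hann _ hsw)
  have h2 := irr_le_of_X_mem (P := P) fun i => hann _ (hY i)
  rw [h1] at h2
  obtain rfl := le_antisymm hPM h2
  have h3 := height_add_le_of_depthAt hd hP hPM
  obtain ⟨t, ht⟩ := exists_nat_height_eq (irr N (maximalIdeal O))
  rw [ht] at h3
  norm_cast at h3
  omega

/-- The ideal generated by the `f j` and the first `g` linear forms of `φ`. -/
noncomputable def relIdeal {m : ℕ} (f : Fin m → O) (φ : Fin m → Fin N → O) (g : ℕ) :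
    Ideal (MvPolynomial (Fin N) O) :=
  (Ideal.span (Set.range f)).map C ⊔ Ideal.span {z | ∃ i : Fin m, i.1 < g ∧ z = linForm (φ i)}

theorem homogIdeal_relIdeal {m : ℕ} (f : Fin m → O) (φ : Fin m → Fin N → O) (g : ℕ) :
    HomogIdeal (relIdeal f φ g) := by
  refine (homogIdeal_map_C _).sup (HomogIdeal.span ?_)
  rintro z ⟨i, -, rfl⟩
  exact ⟨1, isHomogeneous_linForm _⟩

theorem relIdeal_zero {m : ℕ} (f : Fin m → O) (φ : Fin m → Fin N → O) :
    relIdeal f φ 0 = (Ideal.span (Set.range f)).map C := by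
  rw [relIdeal, sup_eq_left, Ideal.span_le]
  rintro z ⟨i, h, -⟩
  omega

theorem relIdeal_succ {m : ℕ} (f : Fin m → O) (φ : Fin m → Fin N → O) {g : ℕ} (hg : g < m) :
    relIdeal f φ (g + 1) = relIdeal f φ g ⊔ Ideal.span {linForm (φ ⟨g, hg⟩)} := by
  rw [relIdeal, relIdeal, sup_assoc, ← Ideal.span_union]
  congr 2
  ext z
  constructor
  · rintro ⟨i, hi, rfl⟩
    by_cases h : i.1 < g
    · exact Or.inl ⟨i, h, rfl⟩
    · refine Or.inr ?_
      obtain rfl : i = ⟨g, hg⟩ := Fin.ext (by simp; omega)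
      exact Set.mem_singleton _
  · rintro (⟨i, hi, rfl⟩ | h)
    · exact ⟨i, by omega, rfl⟩
    · exact ⟨⟨g, hg⟩, by simp, h⟩

theorem C_mem_relIdeal {m : ℕ} (f : Fin m → O) (φ : Fin m → Fin N → O) (g : ℕ) (j : Fin m) :
    C (f j) ∈ relIdeal f φ g :=
  Ideal.mem_sup_left (Ideal.mem_map_of_mem _ (Ideal.subset_span ⟨j, rfl⟩))

theorem linForm_mem_relIdeal {m : ℕ} (f : Fin m → O) (φ : Fin m → Fin N → O) {g : ℕ} (j : Fin m)
    (h : j.1 < g) : linForm (φ j) ∈ relIdeal f φ g :=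
  Ideal.mem_sup_right (Ideal.subset_span ⟨j, h, rfl⟩)

theorem HomogIdeal.mem_sup_span_singleton_iff {I : Ideal (MvPolynomial (Fin N) O)} (hI : HomogIdeal I)
    {z : MvPolynomial (Fin N) O} (hz : z.IsHomogeneous 1) {j : ℕ} {w : MvPolynomial (Fin N) O}
    (hw : w ∈ _root_.geIdeal O N (j + 1)) :
    w ∈ (I ⊔ Ideal.span {z}) ⊔ _root_.geIdeal O N (j + 2) ↔
      ∃ u ∈ _root_.geIdeal O N j, w - z * u ∈ I ⊔ _root_.geIdeal O N (j + 2) := by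
  have hI' : HomogIdeal (I ⊔ Ideal.span {z}) :=
    hI.sup (HomogIdeal.span (by rintro x rfl; exact ⟨1, hz⟩))
  constructor
  · intro h
    rw [hI'.mem_sup_geIdeal_iff hw] at h
    obtain ⟨a, ha, b, hb, hab⟩ := Submodule.mem_sup.1 h
    obtain ⟨b, rfl⟩ := Ideal.mem_span_singleton'.1 hb
    refine ⟨homogeneousComponent j b, homogeneousComponent_mem_geIdeal j b, ?_⟩
    have h1 := congr_arg (homogeneousComponent (1 + j)) hab
    rw [map_add, mul_comm b z, homogeneousComponent_isHomogeneous_mul hz,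
      homogeneousComponent_homogeneousComponent, if_pos (add_comm 1 j)] at h1
    have h2 : w - z * homogeneousComponent j b =
        homogeneousComponent (1 + j) a + (w - homogeneousComponent (j + 1) w) := by
      rw [← h1]; ring
    rw [h2]
    exact Submodule.add_mem_sup (hI a ha _) (sub_homogeneousComponent_mem_geIdeal hw)
  · rintro ⟨u, hu, h⟩
    rw [sup_right_comm, ← sub_add_cancel w (z * u)]
    exact Submodule.add_mem_sup h (Ideal.mul_mem_right _ _ (Ideal.mem_span_singleton_self z))

theorem mul_mem_geIdeal_succ {z u : MvPolynomial (Fin N) O} (hz : z.IsHomogeneous 1) {j : ℕ}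
    (hu : u ∈ geIdeal O N j) : z * u ∈ geIdeal O N (j + 1) := by
  have := Ideal.mul_mem_mul (mem_geIdeal_of_isHomogeneous hz le_rfl) hu
  rwa [geIdeal, geIdeal, ← pow_add, add_comm] at this

theorem HomogIdeal.mul_mem_sup_iff {I : Ideal (MvPolynomial (Fin N) O)} (hI : HomogIdeal I)
    {z : MvPolynomial (Fin N) O} (hz : z.IsHomogeneous 1) {j : ℕ} {u : MvPolynomial (Fin N) O}
    (hu : u ∈ _root_.geIdeal O N j) :
    z * u ∈ I ⊔ _root_.geIdeal O N (j + 2) ↔ z * homogeneousComponent j u ∈ I := by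
  rw [hI.mem_sup_geIdeal_iff (mul_mem_geIdeal_succ hz hu), add_comm j 1,
    homogeneousComponent_isHomogeneous_mul hz]

/-- Passing to the quotient by a linear form on the graded pieces. -/
theorem HomogIdeal.depthAt_piece_sup {I : Ideal (MvPolynomial (Fin N) O)} (hI : HomogIdeal I)
    {z : MvPolynomial (Fin N) O} (hz : z.IsHomogeneous 1) {j t : ℕ}
    {Q : Ideal (MvPolynomial (Fin N) O)} [Q.IsPrime]
    (hinj : ∀ u, u.IsHomogeneous j → z * u ∈ I → u ∈ I)
    (h1 : DepthAt Q (t + 1) (Piece I j)) (h2 : DepthAt Q t (Piece I (j + 1))) :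
    DepthAt Q t (Piece (I ⊔ Ideal.span {z}) (j + 1)) := by
  refine DepthAt.subQuot_right z (fun u hu => mul_mem_geIdeal_succ hz hu) (fun u hu h => ?_)
    (fun u hu h => ?_) (fun w hw => hI.mem_sup_span_singleton_iff hz hw) h1 h2
  · rw [hI.mem_sup_geIdeal_iff hu] at h
    exact (hI.mul_mem_sup_iff hz hu).2 (Ideal.mul_mem_left _ _ h)
  · rw [hI.mem_sup_geIdeal_iff hu]
    exact hinj _ (homogeneousComponent_isHomogeneous _ _) ((hI.mul_mem_sup_iff hz hu).1 h)

/-- The case of degree zero of `HomogIdeal.depthAt_piece_sup`. -/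
theorem depthAt_piece_zero_sup {I : Ideal (MvPolynomial (Fin N) O)}
    {z : MvPolynomial (Fin N) O} (hz : z.IsHomogeneous 1) {t : ℕ}
    {Q : Ideal (MvPolynomial (Fin N) O)} (h : DepthAt Q t (Piece I 0)) :
    DepthAt Q t (Piece (I ⊔ Ideal.span {z}) 0) := by
  refine h.subQuot_congr fun u _ => ?_
  rw [sup_assoc, sup_eq_right.2 (show Ideal.span {z} ≤ geIdeal O N (0 + 1) from ?_)]
  rw [Ideal.span_singleton_le_iff_mem]
  exact mem_geIdeal_of_isHomogeneous hz le_rfl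

end

section

open MvPolynomial IsLocalRing
open scoped Pointwise

set_option linter.unusedSectionVars false

variable {O : Type} [CommRing O] [IsRegularLocalRing O] [IsRegularRing O] {N c m e : ℕ}
  {f : Fin m → O} {φ : Fin m → Fin N → O} {I : Ideal (MvPolynomial (Fin N) O)}

/-- The local situation: `f` is a regular sequence of length `m` in a regular local ring of
dimension `c + m`, the rows of `φ` define linear forms satisfying a rank condition at all
non-maximal primes, and `I` is the torsion of the algebra defined by these linear forms over
the quotient by `f`, assumed to have large depth. -/
structure LocalSetup (c e : ℕ) (f : Fin m → O) (φ : Fin m → Fin N → O)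
    (I : Ideal (MvPolynomial (Fin N) O)) : Prop where
  eq_add : N = m + e
  one_le_c : 1 ≤ c
  one_le_e : 1 ≤ e
  height_eq : (maximalIdeal O).height = (c + m : ℕ)
  mem : ∀ j, f j ∈ maximalIdeal O
  regular : RingTheory.Sequence.IsWeaklyRegular O (List.ofFn f)
  rank : ∀ (Q : Ideal O) [Q.IsPrime], Q ≠ maximalIdeal O → (∀ j, f j ∈ Q) →
    ((2 * m : ℕ) : ℕ∞) ≤ Q.height + rankAt Q φ
  rank' : ∀ (Q : Ideal O) [Q.IsPrime], Q ≠ maximalIdeal O → (∀ j, f j ∈ Q) → (m : ℕ∞) < Q.height →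
    ((2 * m + 1 : ℕ) : ℕ∞) ≤ Q.height + rankAt Q φ
  mem_iff : ∀ F, F ∈ I ↔ ∃ r, (∀ a, r * a ∈ Ideal.span (Set.range f) → a ∈ Ideal.span (Set.range f)) ∧
    C r * F ∈ relIdeal f φ m
  depth : DepthAt (irr N (maximalIdeal O)) (c + e) (MvPolynomial (Fin N) O ⧸ I)

theorem ofList_ofFn {A : Type*} [CommRing A] {m : ℕ} (f : Fin m → A) :
    Ideal.ofList (List.ofFn f) = Ideal.span (Set.range f) := by
  rw [Ideal.ofList]
  congr 1
  ext x
  simp [List.mem_ofFn]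

namespace LocalSetup

theorem homogIdeal (S : LocalSetup c e f φ I) : HomogIdeal I := fun F hF j => by
  obtain ⟨r, hr, h⟩ := (S.mem_iff F).1 hF
  refine (S.mem_iff _).2 ⟨r, hr, ?_⟩
  rw [← homogeneousComponent_C_mul]
  exact homogIdeal_relIdeal f φ m _ h j

theorem relIdeal_le (S : LocalSetup c e f φ I) : relIdeal f φ m ≤ I := fun F hF =>
  (S.mem_iff F).2 ⟨1, fun a ha => by rwa [one_mul] at ha, by rwa [C_1, one_mul]⟩

omit [IsRegularRing O] in
theorem ne_of_le {Q Q' : Ideal O} (hQ : Q.IsPrime) (hne : Q ≠ maximalIdeal O) (h : Q' ≤ Q) :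
    Q' ≠ maximalIdeal O := by
  rintro rfl
  exact hne (le_antisymm (IsLocalRing.le_maximalIdeal hQ.ne_top) h)

theorem linForm_notMem (S : LocalSetup c e f φ I) {Q : Ideal O} [Q.IsPrime]
    (hne : Q ≠ maximalIdeal O) {g : ℕ} (hg : g < m) {P : Ideal (MvPolynomial (Fin N) O)}
    (hprime : P.IsPrime) (hrel : relIdeal f φ g ≤ P) (hPQ : P ≤ irr N Q)
    (hht : P.height ≤ (m + g : ℕ)) : linForm (φ ⟨g, hg⟩) ∉ P := by
  intro hmem
  have hp' : (P.comap C).IsPrime := hprime.comap C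
  have hrank := S.rank (P.comap C) (ne_of_le ‹_› hne (comap_C_le_of_le_irr hPQ))
    fun j => hrel (C_mem_relIdeal f φ g j)
  have h1 := rankAt_le_add (P.comap C) φ (fun j => j.1 < g + 1)
  have h2 := height_add_rankAt_le (fun j : {j : Fin m // j.1 < g + 1} => φ j) (P.comap C) P rfl (by
    rintro ⟨j, hj⟩
    by_cases hjg : j.1 < g
    · exact hrel (linForm_mem_relIdeal f φ j hjg)
    · obtain rfl : j = ⟨g, hg⟩ := Fin.ext (by simp; omega)
      exact hmem)
  have h3 : Fintype.card {j : Fin m // ¬ j.1 < g + 1} = m - (g + 1) := by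
    rw [Fintype.card_subtype_compl, Fintype.card_fin, Fintype.card_subtype,
      Fin.card_filter_val_lt, min_eq_right (by omega)]
  rw [h3] at h1
  obtain ⟨a, ha⟩ := exists_nat_height_eq (P.comap C)
  obtain ⟨b, hb⟩ := exists_nat_height_eq P
  rw [ha] at hrank
  rw [ha, hb] at h2
  rw [hb] at hht
  norm_cast at *
  omega

theorem isWeaklyRegular_map_C (S : LocalSetup c e f φ I) :
    RingTheory.Sequence.IsWeaklyRegular (MvPolynomial (Fin N) O) ((List.ofFn f).map (C : O →+* MvPolynomial (Fin N) O)) :=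
  S.regular.of_flat

theorem depthAt_relIdeal (S : LocalSetup c e f φ I) {Q : Ideal O} [Q.IsPrime]
    (hne : Q ≠ maximalIdeal O) {t g : ℕ} (hg : g ≤ m)
    (ht : (irr N Q).height = (t + (m + g) : ℕ)) :
    DepthAt (irr N Q) t (MvPolynomial (Fin N) O ⧸ relIdeal f φ g) := by
  induction g generalizing t with
  | zero =>
    have hbot : (MvPolynomial (Fin N) O ⧸ (⊥ : Ideal (MvPolynomial (Fin N) O)))
      ≃ₗ[MvPolynomial (Fin N) O] MvPolynomial (Fin N) O := Submodule.quotEquivOfEqBot _ rfl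
    have h1 := DepthAt.quotient_sup_ofList (Q := irr N Q) (t := t) ((List.ofFn f).map C) ⊥
      ((depthAt_height (irr N Q) (by rw [ht]; simp)).of_linearEquiv hbot.symm)
      ((LinearEquiv.isWeaklyRegular_congr hbot _).2 S.isWeaklyRegular_map_C)
    refine DepthAt.of_linearEquiv (Submodule.quotEquivOfEq _ _ ?_) h1
    rw [bot_sup_eq, relIdeal_zero, ← ofList_ofFn, Ideal.map_ofList]
  | succ g ih =>
    have h1 := ih (t := t + 1) (by omega) (by rw [ht]; congr 1; ring)
    refine DepthAt.of_linearEquiv (quotSMulTopQuotientEquiv _ (linForm (φ ⟨g, hg⟩)) ≪≫ₗ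
      Submodule.quotEquivOfEq _ _ (relIdeal_succ f φ hg).symm) (DepthAt.quotSMulTop ?_ h1)
    refine qTors_ker_of_forall_associatedPrimes fun P hP hPQ => ?_
    have hprime := (mem_associatedPrimes_iff.1 hP).1
    have hht := height_add_le_of_depthAt h1 hP hPQ
    obtain ⟨-, y, hy⟩ := mem_associatedPrimes_iff.1 hP
    refine S.linForm_notMem hne hg hprime (fun a ha => (hy a).2 ?_) hPQ ?_
    · obtain ⟨y, rfl⟩ := Ideal.Quotient.mk_surjective y
      exact Ideal.Quotient.eq_zero_iff_mem.2 (Ideal.mul_mem_right _ _ ha)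
    · obtain ⟨b, hb⟩ := exists_nat_height_eq P
      rw [ht, hb] at hht
      rw [hb]
      norm_cast at *
      omega

omit [IsRegularLocalRing O] [IsRegularRing O] in
theorem exists_C_smul_of_notMem {Q : Ideal O} {g : ℕ} {j : Fin m} (h : f j ∉ Q)
    (w : MvPolynomial (Fin N) O) : ∃ s ∉ irr N Q, s * w ∈ relIdeal f φ g :=
  ⟨C (f j), by simpa [irr] using h, Ideal.mul_mem_right _ _ (C_mem_relIdeal f φ g j)⟩

theorem exists_mul_mem_of_linForm_mul_mem (S : LocalSetup c e f φ I) {Q : Ideal O} [Q.IsPrime]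
    (hne : Q ≠ maximalIdeal O) {g : ℕ} (hg : g < m) {w : MvPolynomial (Fin N) O}
    (hw : linForm (φ ⟨g, hg⟩) * w ∈ relIdeal f φ g) : ∃ s ∉ irr N Q, s * w ∈ relIdeal f φ g := by
  by_cases hfQ : ∀ j, f j ∈ Q
  swap
  · push Not at hfQ
    obtain ⟨j, hj⟩ := hfQ
    exact exists_C_smul_of_notMem hj w
  by_contra! hc
  obtain ⟨P, hP, hPQ, hann, -⟩ := exists_associatedPrimes_le (Q := irr N Q)
    (y := Ideal.Quotient.mk (relIdeal f φ g) w) (fun s hs h0 => hc s hs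
      (Ideal.Quotient.eq_zero_iff_mem.1 h0))
  have hprime := (mem_associatedPrimes_iff.1 hP).1
  have hle : relIdeal f φ g ≤ P := fun a ha =>
    hann a (Ideal.Quotient.eq_zero_iff_mem.2 (Ideal.mul_mem_right _ _ ha))
  obtain ⟨H, hH⟩ := exists_nat_height_eq (irr N Q)
  have hHm : m + g ≤ H := by
    have h1 := S.rank Q hne hfQ
    have h2 := height_irr N Q
    obtain ⟨a, ha⟩ := exists_nat_height_eq Q
    have h3 := length_le_height_of_isWeaklyRegular S.regular Q (by
      intro r hr
      obtain ⟨j, rfl⟩ := List.mem_ofFn.1 hr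
      exact hfQ j)
    rw [hH, ha] at h2
    rw [ha] at h1 h3
    have := S.eq_add
    have := S.one_le_e
    simp only [List.length_ofFn] at h3
    norm_cast at *
    omega
  have h1 := S.depthAt_relIdeal hne hg.le (t := H - (m + g)) (by rw [hH]; congr 1; omega)
  have hht := height_add_le_of_depthAt h1 hP hPQ
  refine S.linForm_notMem hne hg hprime hle hPQ ?_ (hann _ (Ideal.Quotient.eq_zero_iff_mem.2 hw))
  obtain ⟨b, hb⟩ := exists_nat_height_eq P
  rw [hH, hb] at hht
  rw [hb]
  norm_cast at *
  omega

theorem exists_C_mul_mem {K : Ideal (MvPolynomial (Fin N) O)} (hK : HomogIdeal K) {Q : Ideal O}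
    {j : ℕ} {w : MvPolynomial (Fin N) O} (hw : w.IsHomogeneous j)
    (h : ∃ s ∉ irr N Q, s * w ∈ K) : ∃ s ∉ Q, C s * w ∈ K := by
  obtain ⟨s, hs, hsw⟩ := h
  refine ⟨constantCoeff s, hs, ?_⟩
  have := hK _ hsw j
  rwa [homogeneousComponent_mul_of_mem s (mem_geIdeal_of_isHomogeneous hw le_rfl),
    homogeneousComponent_of_mem hw, if_pos rfl] at this

theorem _root_.HomogIdeal.mem_of_forall_prime_exists {K : Ideal (MvPolynomial (Fin N) O)}
    (hK : HomogIdeal K) {j : ℕ} (hd : DepthAt (irr N (maximalIdeal O)) 1 (Piece K j))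
    {w : MvPolynomial (Fin N) O} (hw : w.IsHomogeneous j)
    (hQ : ∀ Q : Ideal O, Q.IsPrime → Q ≠ maximalIdeal O → ∃ s ∉ irr N Q, s * w ∈ K) : w ∈ K := by
  have hwj := mem_geIdeal_of_isHomogeneous hw le_rfl
  have h1 := _root_.mem_of_forall_prime_exists hd hwj
    (fun i => Ideal.mem_sup_right (mul_mem_geIdeal_succ (isHomogeneous_X O i) hwj))
    (fun Q hQp hne => by
      obtain ⟨s, hs, h⟩ := exists_C_mul_mem hK hw (hQ Q hQp hne)
      exact ⟨s, hs, Ideal.mem_sup_left h⟩)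
  rwa [hK.mem_sup_geIdeal_iff hwj, homogeneousComponent_of_mem hw, if_pos rfl] at h1

theorem depthAt_piece_relIdeal (S : LocalSetup c e f φ I) {g : ℕ} (hg : g ≤ m) (j : ℕ) :
    DepthAt (irr N (maximalIdeal O)) (c - j) (Piece (relIdeal f φ g) j) := by
  induction g generalizing j with
  | zero =>
    rw [relIdeal_zero, ← ofList_ofFn]
    refine ((depthAt_quotient_irr N (List.ofFn f) (t := c) ?_ S.regular).piece_map_C j).mono
      (Nat.sub_le c j)
    rw [S.height_eq, List.length_ofFn]
  | succ g ih =>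
    rw [relIdeal_succ f φ hg]
    cases j with
    | zero => exact depthAt_piece_zero_sup (isHomogeneous_linForm _) (ih (by omega) 0)
    | succ j =>
      by_cases hj : j + 1 ≤ c
      · have h1 := ih (by omega) j
        have h3 : c - j = c - (j + 1) + 1 := by omega
        rw [h3] at h1
        refine (homogIdeal_relIdeal f φ g).depthAt_piece_sup (isHomogeneous_linForm _)
          (fun u hu hzu => ?_) h1 (ih (by omega) (j + 1))
        exact (homogIdeal_relIdeal f φ g).mem_of_forall_prime_exists (h1.mono (by omega)) hu
          fun Q hQ hne => S.exists_mul_mem_of_linForm_mul_mem hne hg hzu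
      · intro i hi
        omega

theorem exists_mul_mem_relIdeal (S : LocalSetup c e f φ I) {Q : Ideal O} [Q.IsPrime]
    (hne : Q ≠ maximalIdeal O) {w : MvPolynomial (Fin N) O}
    (hw : w ∈ I) : ∃ s ∉ irr N Q, s * w ∈ relIdeal f φ m := by
  by_cases hfQ : ∀ j, f j ∈ Q
  swap
  · push Not at hfQ
    obtain ⟨j, hj⟩ := hfQ
    exact exists_C_smul_of_notMem hj w
  by_contra! hc
  obtain ⟨P, hP, hPQ, hann, -⟩ := exists_associatedPrimes_le (Q := irr N Q)
    (y := Ideal.Quotient.mk (relIdeal f φ m) w) (fun s hs h0 => hc s hs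
      (Ideal.Quotient.eq_zero_iff_mem.1 h0))
  have hprime := (mem_associatedPrimes_iff.1 hP).1
  have hle : relIdeal f φ m ≤ P := fun a ha =>
    hann a (Ideal.Quotient.eq_zero_iff_mem.2 (Ideal.mul_mem_right _ _ ha))
  have hp' : (P.comap C).IsPrime := hprime.comap C
  have hfP : ∀ j, f j ∈ P.comap C := fun j => hle (C_mem_relIdeal f φ m j)
  obtain ⟨r, hr, hrw⟩ := (S.mem_iff w).1 hw
  have hrP : r ∈ P.comap C := hann _ (Ideal.Quotient.eq_zero_iff_mem.2 hrw)
  have hPne := ne_of_le ‹Q.IsPrime› hne (comap_C_le_of_le_irr hPQ)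
  have hreg : RingTheory.Sequence.IsWeaklyRegular O (List.ofFn f ++ [r]) := by
    rw [RingTheory.Sequence.isWeaklyRegular_append_iff]
    refine ⟨S.regular, ?_⟩
    rw [RingTheory.Sequence.isWeaklyRegular_singleton_iff, isSMulRegular_iff_right_eq_zero_of_smul]
    intro y hy
    obtain ⟨y, rfl⟩ := Submodule.mkQ_surjective _ y
    rw [← map_smul, Submodule.mkQ_apply, Submodule.Quotient.mk_eq_zero] at hy
    rw [Submodule.mkQ_apply, Submodule.Quotient.mk_eq_zero]
    rw [ofList_ofFn, smul_eq_mul, Ideal.mul_top] at hy ⊢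
    exact hr y hy
  have h5 := length_le_height_of_isWeaklyRegular hreg (P.comap C) (by
    intro x hx
    rw [List.mem_append] at hx
    rcases hx with hx | hx
    · obtain ⟨j, rfl⟩ := List.mem_ofFn.1 hx
      exact hfP j
    · rw [List.mem_singleton] at hx
      rwa [hx])
  have h6 := S.rank' (P.comap C) hPne hfP (by
    refine lt_of_lt_of_le ?_ h5
    rw [List.length_append, List.length_ofFn, List.length_singleton]
    exact_mod_cast Nat.lt_succ_self m)
  have h7 := height_add_rankAt_le φ (P.comap C) P rfl fun j =>
    hle (linForm_mem_relIdeal f φ j j.2)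
  obtain ⟨H, hH⟩ := exists_nat_height_eq (irr N Q)
  obtain ⟨b, hb⟩ := exists_nat_height_eq P
  have hmono := Ideal.height_mono hPQ
  have h8 := h6.trans h7
  rw [hb] at h8 hmono
  rw [hH] at hmono
  norm_cast at h8 hmono
  have h1 := S.depthAt_relIdeal hne le_rfl (t := H - (m + m)) (by rw [hH]; congr 1; omega)
  have hht := height_add_le_of_depthAt h1 hP hPQ
  rw [hH, hb] at hht
  norm_cast at hht
  omega

theorem mem_relIdeal_of_isHomogeneous (S : LocalSetup c e f φ I) {j : ℕ} (hj : j < c)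
    {w : MvPolynomial (Fin N) O} (hw : w.IsHomogeneous j) (hI : w ∈ I) : w ∈ relIdeal f φ m :=
  (homogIdeal_relIdeal f φ m).mem_of_forall_prime_exists
    ((S.depthAt_piece_relIdeal le_rfl j).mono (by omega)) hw
    fun _ _ hne => S.exists_mul_mem_relIdeal hne hI

theorem depthAt_piece (S : LocalSetup c e f φ I) (j : ℕ) :
    DepthAt (irr N (maximalIdeal O)) (c - j) (Piece I j) := by
  by_cases hj : j < c
  · refine (S.depthAt_piece_relIdeal le_rfl j).subQuot_congr fun u hu => ?_
    rw [S.homogIdeal.mem_sup_geIdeal_iff hu, (homogIdeal_relIdeal f φ m).mem_sup_geIdeal_iff hu]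
    exact ⟨fun h => S.relIdeal_le h,
      S.mem_relIdeal_of_isHomogeneous hj (homogeneousComponent_isHomogeneous _ _)⟩
  · intro i hi
    omega

end LocalSetup

end

section

open MvPolynomial IsLocalRing
open scoped Pointwise

set_option linter.unusedSectionVars false

variable {k : Type} [Field k]
variable {O : Type} [CommRing O] [Algebra k O] {N : ℕ}

/-- The linear form with coefficients in `k`. -/
noncomputable def kForm (O : Type) [CommRing O] [Algebra k O] (x : Fin N → k) :
    MvPolynomial (Fin N) O :=
  linForm fun i => algebraMap k O (x i)

/-- The ideal generated by linear forms with coefficients in `k`. -/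
noncomputable def formIdeal (O : Type) [CommRing O] [Algebra k O] (L : List (Fin N → k)) :
    Ideal (MvPolynomial (Fin N) O) :=
  Ideal.span {z | ∃ x ∈ L, z = kForm O x}

theorem isHomogeneous_kForm (x : Fin N → k) : (kForm O x).IsHomogeneous 1 := isHomogeneous_linForm _

theorem homogIdeal_formIdeal (L : List (Fin N → k)) : HomogIdeal (formIdeal O L) :=
  HomogIdeal.span (by rintro z ⟨x, -, rfl⟩; exact ⟨1, isHomogeneous_kForm x⟩)

theorem formIdeal_nil : formIdeal O ([] : List (Fin N → k)) = ⊥ := by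
  rw [formIdeal, Ideal.span_eq_bot]
  rintro z ⟨x, hx, -⟩
  simp at hx

theorem formIdeal_cons (x : Fin N → k) (L : List (Fin N → k)) :
    formIdeal O (x :: L) = formIdeal O L ⊔ Ideal.span {kForm O x} := by
  rw [formIdeal, formIdeal, ← Ideal.span_union]
  congr 1
  ext z
  constructor
  · rintro ⟨y, hy, rfl⟩
    rcases List.mem_cons.1 hy with rfl | hy
    · exact Or.inr rfl
    · exact Or.inl ⟨y, hy, rfl⟩
  · rintro (⟨y, hy, rfl⟩ | h)
    · exact ⟨y, List.mem_cons_of_mem _ hy, rfl⟩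
    · exact ⟨x, List.mem_cons_self, h⟩

theorem kForm_mem_formIdeal {x : Fin N → k} {L : List (Fin N → k)} (h : x ∈ L) :
    kForm O x ∈ formIdeal O L := Ideal.subset_span ⟨x, h, rfl⟩

theorem linForm_add (v w : Fin N → O) : linForm (v + w) = linForm v + linForm w := by
  simp [linForm, add_mul, Finset.sum_add_distrib]

theorem linForm_smul (a : O) (v : Fin N → O) : linForm (a • v) = C a * linForm v := by
  simp [linForm, Finset.mul_sum, mul_assoc]

theorem linForm_zero : linForm (0 : Fin N → O) = 0 := by simp [linForm]

theorem linForm_single [DecidableEq (Fin N)] (i : Fin N) : linForm (Pi.single i (1 : O)) = X i := by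
  simp only [linForm]
  rw [Finset.sum_eq_single i]
  · simp
  · intro j _ hj
    rw [Pi.single_eq_of_ne hj, C_0, zero_mul]
  · simp

theorem kForm_single (i : Fin N) : kForm O (Pi.single i (1 : k)) = X i := by
  rw [kForm, ← linForm_single i]
  congr 1
  ext j
  by_cases h : j = i
  · subst h; simp
  · simp [Pi.single_eq_of_ne h]

/-- The vectors whose linear form is in a given ideal. -/
noncomputable def formSubspace (P : Ideal (MvPolynomial (Fin N) O)) : Submodule k (Fin N → k) where
  carrier := {x | kForm O x ∈ P}
  add_mem' {x y} hx hy := by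
    have : kForm O (x + y) = kForm O x + kForm O y := by
      rw [kForm, kForm, kForm, ← linForm_add]
      congr 1
      ext i
      simp
    rw [Set.mem_ofPred_eq, this]
    exact add_mem hx hy
  zero_mem' := by
    have : kForm O (0 : Fin N → k) = 0 := by
      rw [kForm, ← linForm_zero]
      congr 1
      ext i
      simp
    rw [Set.mem_ofPred_eq, this]
    exact zero_mem _
  smul_mem' a x hx := by
    have : kForm O (a • x) = C (algebraMap k O a) * kForm O x := by
      rw [kForm, kForm, ← linForm_smul]
      congr 1
      ext i
      simp
    rw [Set.mem_ofPred_eq, this]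
    exact Ideal.mul_mem_left _ _ hx

theorem mem_formSubspace {P : Ideal (MvPolynomial (Fin N) O)} {x : Fin N → k} :
    x ∈ formSubspace (k := k) P ↔ kForm O x ∈ P := Iff.rfl

theorem formSubspace_ne_top {P : Ideal (MvPolynomial (Fin N) O)} (h : ¬ ∀ i, X i ∈ P) :
    formSubspace (k := k) P ≠ ⊤ := fun h1 => h fun i => by
  have : (Pi.single i 1 : Fin N → k) ∈ formSubspace (k := k) P := by rw [h1]; trivial
  rwa [mem_formSubspace, kForm_single] at this

theorem exists_list_forall_sublist_notMem [Infinite k] {V : Type*} [AddCommGroup V] [Module k V]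
    (B : List V → Set (Submodule k V)) (hfin : ∀ l, (B l).Finite)
    (M : ℕ) (htop : ∀ l, l.length < M → ∀ W ∈ B l, W ≠ ⊤) :
    ∃ xs : List V, xs.length = M ∧ ∀ x l, (x :: l).Sublist xs → ∀ W ∈ B l, x ∉ W := by
  induction M with
  | zero => exact ⟨[], rfl, fun x l h => by simp at h⟩
  | succ M ih =>
    obtain ⟨xs, hlen, hxs⟩ := ih fun l hl => htop l (by omega)
    have hf : (⋃ l ∈ {l | l.Sublist xs}, B l).Finite := by
      refine Set.Finite.biUnion ?_ fun l _ => hfin l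
      refine (List.finite_toSet xs.sublists).subset fun l hl => ?_
      exact List.mem_sublists.2 hl
    have hne := Subspace.biUnion_ne_univ_of_top_notMem (s := hf.toFinset) (fun h => by
      rw [Set.Finite.mem_toFinset] at h
      simp only [Set.mem_iUnion] at h
      obtain ⟨l, hl, h⟩ := h
      exact htop l (by have := List.Sublist.length_le hl; omega) _ h rfl)
    obtain ⟨x, hx⟩ := (Set.ne_univ_iff_exists_notMem _).1 hne
    refine ⟨x :: xs, by simp [hlen], fun y l h W hW hy => ?_⟩
    rcases List.sublist_cons_iff.1 h with h | ⟨r, hr, h⟩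
    · exact hxs y l h W hW hy
    · obtain ⟨rfl, rfl⟩ := List.cons.inj hr
      apply hx
      simp only [Set.mem_iUnion]
      exact ⟨W, hf.mem_toFinset.2 (Set.mem_biUnion (x := l) h hW), hy⟩

end

section

open MvPolynomial IsLocalRing
open scoped Pointwise

set_option linter.unusedSectionVars false

variable {k : Type} [Field k]
variable {O : Type} [CommRing O] [Algebra k O] [IsRegularLocalRing O] [IsRegularRing O]
  {N c m e : ℕ} {f : Fin m → O} {φ : Fin m → Fin N → O} {I : Ideal (MvPolynomial (Fin N) O)}

/-- The ideal obtained by adding linear forms with coefficients in `k`. -/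
noncomputable def cutIdeal (I : Ideal (MvPolynomial (Fin N) O)) (L : List (Fin N → k)) :
    Ideal (MvPolynomial (Fin N) O) :=
  I ⊔ formIdeal O L

theorem cutIdeal_cons (x : Fin N → k) (L : List (Fin N → k)) :
    cutIdeal I (x :: L) = cutIdeal I L ⊔ Ideal.span {kForm O x} := by
  rw [cutIdeal, cutIdeal, formIdeal_cons, sup_assoc]

/-- The primes to be avoided by the next linear form. -/
def avoidedPrimes (e : ℕ) (I : Ideal (MvPolynomial (Fin N) O)) (L : List (Fin N → k)) :
    Set (Ideal (MvPolynomial (Fin N) O)) :=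
  {P | (P ∈ associatedPrimes (MvPolynomial (Fin N) O)
      (SubQuot (geIdeal O N (L.length + 1 - e)) (cutIdeal I L)) ∨
    P ∈ (cutIdeal I L).minimalPrimes ∨
    P ∈ (cutIdeal I L ⊔ (maximalIdeal O).map C).minimalPrimes) ∧ ¬ ∀ i, X i ∈ P}

theorem finite_avoidedPrimes (e : ℕ) (I : Ideal (MvPolynomial (Fin N) O))
    (L : List (Fin N → k)) : (avoidedPrimes e I L).Finite := by
  refine (((associatedPrimes.finite (MvPolynomial (Fin N) O)
    (SubQuot (geIdeal O N (L.length + 1 - e)) (cutIdeal I L))).union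
    (((cutIdeal I L).finite_minimalPrimes_of_isNoetherianRing).union
    ((cutIdeal I L ⊔ (maximalIdeal O).map C).finite_minimalPrimes_of_isNoetherianRing)))).subset ?_
  rintro P ⟨h | h | h, -⟩
  · exact Or.inl h
  · exact Or.inr (Or.inl h)
  · exact Or.inr (Or.inr h)

/-- The properties kept under adding general linear forms. -/
structure CutSetup (c e m : ℕ) (I : Ideal (MvPolynomial (Fin N) O)) (L : List (Fin N → k)) : Prop where
  depth : DepthAt (irr N (maximalIdeal O)) (c + e - L.length)
    (SubQuot (geIdeal O N (L.length + 1 - e)) (cutIdeal I L))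
  depth_piece : ∀ j, L.length + 1 - e ≤ j →
    DepthAt (irr N (maximalIdeal O)) (c - j) (Piece (cutIdeal I L) j)
  le_height : ∀ P : Ideal (MvPolynomial (Fin N) O), P.IsPrime → cutIdeal I L ≤ P →
    (¬ ∀ i, X i ∈ P) → ((2 * m + L.length : ℕ) : ℕ∞) ≤ P.height
  le_height' : ∀ P : Ideal (MvPolynomial (Fin N) O), P.IsPrime → cutIdeal I L ≤ P →
    (¬ ∀ i, X i ∈ P) → (maximalIdeal O).map C ≤ P → ((2 * m + 1 + L.length : ℕ) : ℕ∞) ≤ P.height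

namespace LocalSetup

theorem homogIdeal_cutIdeal (S : LocalSetup c e f φ I) (L : List (Fin N → k)) :
    HomogIdeal (cutIdeal I L) := S.homogIdeal.sup (homogIdeal_formIdeal L)

theorem height_irr (S : LocalSetup c e f φ I) :
    (irr N (maximalIdeal O)).height = (c + 2 * m + e : ℕ) := by
  rw [_root_.height_irr, S.height_eq, S.eq_add]
  norm_cast
  ring

theorem depthAt_quotient_span (S : LocalSetup c e f φ I) :
    DepthAt (maximalIdeal O) c (O ⧸ Ideal.span (Set.range f)) := by
  have hbot : (O ⧸ (⊥ : Ideal O)) ≃ₗ[O] O := Submodule.quotEquivOfEqBot _ rfl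
  have h1 := DepthAt.quotient_sup_ofList (Q := maximalIdeal O) (t := c) (List.ofFn f) ⊥
    ((depthAt_height (maximalIdeal O) (by rw [S.height_eq]; simp)).of_linearEquiv hbot.symm)
    ((LinearEquiv.isWeaklyRegular_congr hbot _).2 S.regular)
  refine DepthAt.of_linearEquiv (Submodule.quotEquivOfEq _ _ ?_) h1
  rw [bot_sup_eq, ofList_ofFn]

theorem comap_C_ne_of_mem_minimalPrimes (S : LocalSetup c e f φ I)
    {P : Ideal (MvPolynomial (Fin N) O)} (hP : P ∈ I.minimalPrimes) :
    P.comap C ≠ maximalIdeal O := by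
  intro heq
  obtain ⟨x, hx, hker⟩ := exists_mem_qTors_ker (S.depthAt_quotient_span.mono S.one_le_c)
  have hxr : ∀ a, x * a ∈ Ideal.span (Set.range f) → a ∈ Ideal.span (Set.range f) := by
    intro a ha
    obtain ⟨s, hs, h⟩ := hker ⟨Ideal.Quotient.mk _ a, by
      rw [LinearMap.mem_ker, LinearMap.lsmul_apply]
      exact Ideal.Quotient.eq_zero_iff_mem.2 ha⟩
    have hu : IsUnit s := by simpa using hs
    have h' := congrArg Subtype.val h
    have h2 : s * a ∈ Ideal.span (Set.range f) := Ideal.Quotient.eq_zero_iff_mem.1 h'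
    exact (Ideal.unit_mul_mem_iff_mem _ hu).1 h2
  have hass : P ∈ associatedPrimes (MvPolynomial (Fin N) O) (MvPolynomial (Fin N) O ⧸ I) := by
    apply Module.associatedPrimes.minimalPrimes_annihilator_subset_associatedPrimes
    rwa [Ideal.annihilator_quotient]
  obtain ⟨hprime, y, hy⟩ := mem_associatedPrimes_iff.1 hass
  obtain ⟨y, rfl⟩ := Ideal.Quotient.mk_surjective y
  have hyI : y ∈ I := by
    have h1 : C x ∈ P := by rw [← Ideal.mem_comap, heq]; exact hx
    have h2 : C x * y ∈ I := Ideal.Quotient.eq_zero_iff_mem.1 ((hy _).1 h1)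
    obtain ⟨r, hr, h3⟩ := (S.mem_iff _).1 h2
    refine (S.mem_iff _).2 ⟨r * x, fun a ha => hxr a (hr _ (by rwa [← mul_assoc])), ?_⟩
    rwa [C_mul, mul_assoc]
  exact hprime.ne_top ((Ideal.eq_top_iff_one _).2 ((hy 1).2 (by
    rw [one_smul]; exact Ideal.Quotient.eq_zero_iff_mem.2 hyI)))

theorem cutSetup_nil (S : LocalSetup c e f φ I) : CutSetup c e m I ([] : List (Fin N → k)) := by
  have hcut : cutIdeal I ([] : List (Fin N → k)) = I := by
    rw [cutIdeal, formIdeal_nil, sup_bot_eq]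
  have key : ∀ P : Ideal (MvPolynomial (Fin N) O), P ∈ I.minimalPrimes →
      ((2 * m : ℕ) : ℕ∞) ≤ P.height := by
    intro P hP
    have := hP.1.1
    have hle : relIdeal f φ m ≤ P := S.relIdeal_le.trans hP.1.2
    exact (S.rank (P.comap C) (S.comap_C_ne_of_mem_minimalPrimes hP)
      fun j => hle (C_mem_relIdeal f φ m j)).trans (height_add_rankAt_le φ _ P rfl fun j =>
        hle (linForm_mem_relIdeal f φ j j.2))
  constructor
  · rw [hcut]
    have h0 : ([] : List (Fin N → k)).length + 1 - e = 0 := by simp [S.one_le_e]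
    rw [h0]
    have htop : geIdeal O N 0 = ⊤ := by simp [geIdeal]
    rw [htop]
    refine DepthAt.of_linearEquiv ?_ S.depth
    exact (Submodule.Quotient.equiv _ _ Submodule.topEquiv (by
      ext x; simp [Submodule.submoduleOf])).symm
  · intro j _
    rw [hcut]
    exact S.depthAt_piece j
  · intro P hP hle _
    rw [hcut] at hle
    obtain ⟨P0, hP0, h⟩ := Ideal.exists_minimalPrimes_le hle
    exact (key P0 hP0).trans (Ideal.height_mono h)
  · intro P hP hle _ hn
    rw [hcut] at hle
    obtain ⟨P0, hP0, h⟩ := Ideal.exists_minimalPrimes_le hle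
    have := hP0.1.1
    have hlt : P0 < P := lt_of_le_of_ne h fun heq => by
      apply S.comap_C_ne_of_mem_minimalPrimes hP0
      have h1 : maximalIdeal O ≤ P0.comap C := by rw [heq, ← Ideal.map_le_iff_le_comap]; exact hn
      exact le_antisymm (le_maximalIdeal (this.comap C).ne_top) h1
    calc ((2 * m + 1 + 0 : ℕ) : ℕ∞) = (2 * m : ℕ) + 1 := by push_cast; ring
      _ ≤ P0.height + 1 := by gcongr; exact key P0 hP0
      _ ≤ P.height := Ideal.height_add_one_le_of_lt_of_isPrime hlt

end LocalSetup

end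

section

open MvPolynomial IsLocalRing
open scoped Pointwise

set_option linter.unusedSectionVars false

/-- The prime of polynomials vanishing on the line through a vector over the residue field. -/
noncomputable def linePrime {O : Type*} [CommRing O] {N : ℕ} (Q : Ideal O) [Q.IsPrime]
    (u : Fin N → Q.ResidueField) : Ideal (MvPolynomial (Fin N) O) :=
  RingHom.ker (eval₂Hom ((Polynomial.C).comp (algebraMap O Q.ResidueField))
    fun i => Polynomial.C (u i) * Polynomial.X)

section

variable {O : Type*} [CommRing O] {N : ℕ} {Q : Ideal O} [Q.IsPrime] {u : Fin N → Q.ResidueField}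

instance : (linePrime Q u).IsPrime := RingHom.ker_isPrime _

theorem linePrime_le_irr : linePrime Q u ≤ irr N Q := by
  intro F hF
  have h1 : (Polynomial.evalRingHom (0 : Q.ResidueField)).comp
      (eval₂Hom ((Polynomial.C).comp (algebraMap O Q.ResidueField))
        fun i => Polynomial.C (u i) * Polynomial.X) =
      (algebraMap O Q.ResidueField).comp constantCoeff := by
    ext <;> simp
  have h2 := congrArg (fun g => g F) h1
  simp only [RingHom.comp_apply] at h2
  rw [RingHom.mem_ker.1 hF, map_zero] at h2
  exact (Ideal.algebraMap_residueField_eq_zero (I := Q)).1 h2.symm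

theorem C_mem_linePrime {a : O} (ha : a ∈ Q) : C a ∈ linePrime Q u := by
  rw [linePrime, RingHom.mem_ker, coe_eval₂Hom, eval₂_C, RingHom.comp_apply,
    Ideal.algebraMap_residueField_eq_zero.2 ha, map_zero]

theorem linForm_mem_linePrime {v : Fin N → O}
    (h : ∑ i, algebraMap O Q.ResidueField (v i) * u i = 0) : linForm v ∈ linePrime Q u := by
  rw [linePrime, RingHom.mem_ker, linForm, map_sum]
  have : ∀ i, (eval₂Hom ((Polynomial.C).comp (algebraMap O Q.ResidueField))
      fun i => Polynomial.C (u i) * Polynomial.X) (C (v i) * X i) =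
      Polynomial.C (algebraMap O Q.ResidueField (v i) * u i) * Polynomial.X := by
    intro i
    simp [mul_assoc]
  simp_rw [this]
  rw [← Finset.sum_mul, ← map_sum, h, map_zero, zero_mul]

theorem X_notMem_linePrime {i : Fin N} (h : u i ≠ 0) : X i ∉ linePrime Q u := by
  rw [linePrime, RingHom.mem_ker, coe_eval₂Hom, eval₂_X]
  simp [h]

end

/-- Either a determinant outside the prime multiplies all variables into the ideal generated by
the linear forms, or the forms vanish on a common line. -/
theorem exists_det_or_exists_ne_zero {O : Type*} [CommRing O] {N : ℕ} {ι : Type*} (Q : Ideal O)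
    [Q.IsPrime] (v : ι → Fin N → O) :
    (∃ s ∉ Q, ∀ i, C s * X i ∈ Ideal.span (Set.range fun a => linForm (v a))) ∨
      ∃ u : Fin N → Q.ResidueField, u ≠ 0 ∧
        ∀ a, ∑ i, algebraMap O Q.ResidueField (v a i) * u i = 0 := by
  classical
  by_cases htop : Submodule.span Q.ResidueField
      (Set.range fun a i => algebraMap O Q.ResidueField (v a i)) = ⊤
  · left
    have hN : Module.finrank Q.ResidueField (Submodule.span Q.ResidueField
      (Set.range fun a i => algebraMap O Q.ResidueField (v a i))) = N := by
      rw [htop, finrank_top, Module.finrank_fin_fun]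
    obtain ⟨s, U, h⟩ := exists_rightInverse_of_span
      (fun a i => algebraMap O Q.ResidueField (v a i))
    generalize Module.finrank Q.ResidueField (Submodule.span Q.ResidueField
      (Set.range fun a i => algebraMap O Q.ResidueField (v a i))) = ρ at s U h hN
    subst hN
    let A : Matrix (Fin ρ) (Fin ρ) O := Matrix.of fun a i => v (s a) i
    have hAU : A.map (algebraMap O Q.ResidueField) * Matrix.of U = 1 := by
      ext a b
      rw [Matrix.mul_apply, Matrix.one_apply]
      exact h a b
    refine ⟨A.det, fun hdet => ?_, fun i => ?_⟩
    · have h1 := congrArg Matrix.det hAU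
      rw [Matrix.det_mul, ← RingHom.mapMatrix_apply, ← RingHom.map_det,
        Ideal.algebraMap_residueField_eq_zero.2 hdet, zero_mul, Matrix.det_one] at h1
      exact zero_ne_one h1
    · have h1 : C A.det * X i = ∑ a, C (A.adjugate i a) * linForm (v (s a)) := by
        simp only [linForm, Finset.mul_sum]
        rw [Finset.sum_comm]
        have h2 : ∀ j, ∑ a, A.adjugate i a * v (s a) j = if i = j then A.det else 0 := by
          intro j
          have := congrFun (congrFun (Matrix.adjugate_mul A) i) j
          rw [Matrix.mul_apply, Matrix.smul_apply, Matrix.one_apply] at this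
          simpa [A] using this
        have h3 : ∀ j, ∑ a, C (A.adjugate i a) * (C (v (s a) j) * X j) =
            C (if i = j then A.det else 0) * X j := by
          intro j
          rw [← h2, map_sum, Finset.sum_mul]
          exact Finset.sum_congr rfl fun a _ => by rw [C_mul, mul_assoc]
        rw [Finset.sum_congr rfl fun j _ => h3 j, Finset.sum_eq_single i]
        · rw [if_pos rfl]
        · intro j _ hj
          rw [if_neg (Ne.symm hj), C_0, zero_mul]
        · simp
      rw [h1]
      exact Ideal.sum_mem _ fun a _ => Ideal.mul_mem_left _ _ (Ideal.subset_span ⟨s a, rfl⟩)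
  · right
    obtain ⟨g, hg, hle⟩ := Submodule.exists_le_ker_of_lt_top _ (lt_top_iff_ne_top.2 htop)
    refine ⟨fun i => g (Pi.single i 1), fun h0 => hg ?_, fun a => ?_⟩
    · refine LinearMap.pi_ext' fun i => LinearMap.ext_ring ?_
      exact congrFun h0 i
    · have h1 := hle (Submodule.subset_span ⟨a, rfl⟩)
      beta_reduce at h1
      rw [LinearMap.mem_ker, pi_eq_sum_univ' (fun i => algebraMap O Q.ResidueField (v a i)),
        map_sum] at h1
      rw [← h1]
      refine Finset.sum_congr rfl fun i _ => ?_
      rw [map_smul, smul_eq_mul]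

theorem relIdeal_le_of_mem {O : Type} [CommRing O] {N m : ℕ} {f : Fin m → O}
    {φ : Fin m → Fin N → O} {P : Ideal (MvPolynomial (Fin N) O)} {g : ℕ} (hf : ∀ j, C (f j) ∈ P)
    (hφ : ∀ j, linForm (φ j) ∈ P) : relIdeal f φ g ≤ P := by
  refine sup_le ?_ (Ideal.span_le.2 ?_)
  · rw [Ideal.map_span, Ideal.span_le]
    rintro _ ⟨_, ⟨j, rfl⟩, rfl⟩
    exact hf j
  · rintro _ ⟨j, -, rfl⟩
    exact hφ j

namespace SubQuot

theorem le_of_mem_associatedPrimes {A : Type} [CommRing A] [IsNoetherianRing A] {U V P : Ideal A}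
    (hP : P ∈ associatedPrimes A (SubQuot U V)) : V ≤ P := fun _ ha =>
  SubQuot.mem_of_forall_mul_mem hP fun _ _ => Ideal.mul_mem_right _ _ ha

end SubQuot

variable {k : Type} [Field k]
variable {O : Type} [CommRing O] [Algebra k O] [IsRegularLocalRing O] [IsRegularRing O]
  {N c m e : ℕ} {f : Fin m → O} {φ : Fin m → Fin N → O} {I : Ideal (MvPolynomial (Fin N) O)}
  {L : List (Fin N → k)}

namespace LocalSetup

theorem le_cutIdeal : I ≤ cutIdeal I L := le_sup_left

theorem not_forall_X_mem (S : LocalSetup c e f φ I) (hL : CutSetup c e m I L)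
    (hr : L.length + 1 ≤ c + e) {P : Ideal (MvPolynomial (Fin N) O)}
    (hP : P ∈ associatedPrimes (MvPolynomial (Fin N) O)
      (SubQuot (geIdeal O N (L.length + 1 - e)) (cutIdeal I L)))
    (hPM : P ≤ irr N (maximalIdeal O)) : ¬ ∀ i, X i ∈ P := by
  intro hX
  have hprime := (mem_associatedPrimes_iff.1 hP).1
  have hq : (P.comap C).IsPrime := hprime.comap C
  have hcut : cutIdeal I L ≤ P := SubQuot.le_of_mem_associatedPrimes hP
  have hI : I ≤ P := le_cutIdeal.trans hcut
  have hPirr := eq_irr_of_X_mem hX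
  have hfQ : ∀ j, f j ∈ P.comap C := fun j => hI (S.relIdeal_le (C_mem_relIdeal f φ m j))
  obtain ⟨a, ha⟩ := exists_nat_height_eq (P.comap C)
  have hPht : P.height = (a + N : ℕ) := by
    rw [hPirr, _root_.height_irr, ha]
    norm_cast
  have h1 := height_add_le_of_depthAt hL.depth hP hPM
  rw [hPht, S.height_irr] at h1
  norm_cast at h1
  have hN := S.eq_add
  have hma := length_le_height_of_isWeaklyRegular S.regular (P.comap C) (by
    intro r hr
    obtain ⟨j, rfl⟩ := List.mem_ofFn.1 hr
    exact hfQ j)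
  rw [ha, List.length_ofFn] at hma
  norm_cast at hma
  have hre : e ≤ L.length := by omega
  have hne : P.comap C ≠ maximalIdeal O := by
    intro h
    rw [h, S.height_eq] at ha
    norm_cast at ha
    omega
  rcases exists_det_or_exists_ne_zero (P.comap C)
    (Sum.elim φ (fun a : {x // x ∈ L} => fun i => algebraMap k O (a.1 i))) with ⟨s, hs, h⟩ | ⟨u, hu, h⟩
  · apply hs
    have hle : Ideal.span (Set.range fun a => linForm (Sum.elim φ
        (fun a : {x // x ∈ L} => fun i => algebraMap k O (a.1 i)) a)) ≤ cutIdeal I L := by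
      rw [Ideal.span_le]
      rintro _ ⟨j | ⟨x, hx⟩, rfl⟩
      · exact le_cutIdeal (S.relIdeal_le (linForm_mem_relIdeal f φ j j.2))
      · exact Ideal.mem_sup_right (kForm_mem_formIdeal hx)
    have hvars : ∀ w ∈ geIdeal O N 1, C s * w ∈ cutIdeal I L := by
      intro w hw
      rw [geIdeal, pow_one] at hw
      refine Submodule.span_induction ?_ ?_ ?_ ?_ hw
      · rintro _ ⟨i, rfl⟩
        exact hle (h i)
      · simp
      · intro x y _ _ hx hy
        rw [mul_add]
        exact add_mem hx hy
      · intro b x _ hx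
        rw [smul_eq_mul, mul_left_comm]
        exact Ideal.mul_mem_left _ _ hx
    exact SubQuot.mem_of_forall_mul_mem hP fun w hw => hvars w (geIdeal_le (by omega) hw)
  · have hform : ∀ j, linForm (φ j) ∈ linePrime (P.comap C) u := fun j =>
      linForm_mem_linePrime (h (Sum.inl j))
    have hrel : relIdeal f φ m ≤ linePrime (P.comap C) u := by
      exact relIdeal_le_of_mem (fun j => C_mem_linePrime (hfQ j)) hform
    have hI1 : I ≤ linePrime (P.comap C) u := by
      intro w hw
      obtain ⟨s, hs, hsw⟩ := S.exists_mul_mem_relIdeal hne hw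
      refine (Ideal.IsPrime.mem_or_mem inferInstance (hrel hsw)).resolve_left fun h => ?_
      exact hs (linePrime_le_irr h)
    have hcut1 : cutIdeal I L ≤ linePrime (P.comap C) u := by
      refine sup_le hI1 ?_
      rw [formIdeal, Ideal.span_le]
      rintro z ⟨x, hx, rfl⟩
      exact linForm_mem_linePrime (h (Sum.inr ⟨x, hx⟩))
    obtain ⟨i, hi⟩ := Function.ne_iff.1 hu
    have hXi : X i ∉ linePrime (P.comap C) u := X_notMem_linePrime hi
    have hle : linePrime (P.comap C) u ≤ P := by
      conv_rhs => rw [hPirr]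
      exact linePrime_le_irr
    have hlt : linePrime (P.comap C) u < P := lt_of_le_of_ne hle fun h => hXi (by rw [h]; exact hX i)
    have h2 := hL.le_height _ inferInstance hcut1 (fun h => hXi (h i))
    have h3 := Ideal.height_add_one_le_of_lt_of_isPrime hlt
    have h4 := (add_le_add_left h2 1).trans h3
    rw [hPht] at h4
    norm_cast at h4
    omega

theorem C_unit_mul_mem {J : Ideal (MvPolynomial (Fin N) O)} (hJ : HomogIdeal J) {j : ℕ}
    {w : MvPolynomial (Fin N) O} (hw : w.IsHomogeneous j) {s : MvPolynomial (Fin N) O}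
    (hs : s ∉ irr N (maximalIdeal O)) (h : s * w ∈ J) : w ∈ J := by
  obtain ⟨t, ht, h⟩ := exists_C_mul_mem hJ hw ⟨s, hs, h⟩
  have hu : IsUnit (C t : MvPolynomial (Fin N) O) := by
    apply IsUnit.map
    simpa using ht
  exact (Ideal.unit_mul_mem_iff_mem _ hu).1 h

theorem mem_cutIdeal_of_kForm_mul_mem (S : LocalSetup c e f φ I) (hL : CutSetup c e m I L)
    (hr : L.length + 1 ≤ c + e) {x : Fin N → k}
    (hx : ∀ P ∈ avoidedPrimes e I L, kForm O x ∉ P) {u : MvPolynomial (Fin N) O}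
    (hu : u ∈ geIdeal O N (L.length + 1 - e)) (hxu : kForm O x * u ∈ cutIdeal I L) :
    u ∈ cutIdeal I L := by
  refine mem_of_forall_homogeneousComponent_mem fun j => ?_
  by_cases hj : j < L.length + 1 - e
  · rw [mem_geIdeal_iff.1 hu j hj]
    exact zero_mem _
  have h1 := S.homogIdeal_cutIdeal L _ hxu (1 + j)
  rw [homogeneousComponent_isHomogeneous_mul (isHomogeneous_kForm x)] at h1
  by_contra hc
  obtain ⟨P, hP, hPM, hann⟩ := SubQuot.exists_associatedPrimes_le (Q := irr N (maximalIdeal O))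
    (V := cutIdeal I L)
    (geIdeal_le (not_lt.1 hj) (homogeneousComponent_mem_geIdeal j u)) (fun s hs h => hc
      (C_unit_mul_mem (S.homogIdeal_cutIdeal L) (homogeneousComponent_isHomogeneous _ _) hs h))
  exact hx P ⟨Or.inl hP, S.not_forall_X_mem hL hr hP hPM⟩ (hann _ h1)

end LocalSetup

end

section

open MvPolynomial IsLocalRing
open scoped Pointwise

set_option linter.unusedSectionVars false

variable {k : Type} [Field k]
variable {O : Type} [CommRing O] [Algebra k O] [IsRegularLocalRing O] [IsRegularRing O]
  {N c m e : ℕ} {f : Fin m → O} {φ : Fin m → Fin N → O} {I : Ideal (MvPolynomial (Fin N) O)}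
  {L : List (Fin N → k)}

namespace LocalSetup

/-- Membership in the ideal after adding one linear form, in high degree. -/
theorem _root_.HomogIdeal.mem_sup_span_singleton_iff_of_mem_geIdeal
    {J : Ideal (MvPolynomial (Fin N) O)} (hJ : HomogIdeal J)
    {z : MvPolynomial (Fin N) O} (hz : z.IsHomogeneous 1) {i : ℕ} {w : MvPolynomial (Fin N) O}
    (hw : w ∈ _root_.geIdeal O N (i + 1)) :
    w ∈ J ⊔ Ideal.span {z} ↔ w ∈ J ⊔ Ideal.span {z} * _root_.geIdeal O N i := by
  refine ⟨fun h => ?_, fun h => sup_le_sup_left Ideal.mul_le_left J h⟩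
  obtain ⟨a, ha, _, hb, rfl⟩ := Submodule.mem_sup.1 h
  obtain ⟨b, rfl⟩ := Ideal.mem_span_singleton'.1 hb
  refine mem_of_forall_homogeneousComponent_mem fun j => ?_
  by_cases hj : j < i + 1
  · rw [mem_geIdeal_iff.1 hw j hj]
    exact zero_mem _
  obtain ⟨j, rfl⟩ : ∃ j', j = 1 + j' := ⟨j - 1, by omega⟩
  rw [map_add, mul_comm b z, homogeneousComponent_isHomogeneous_mul hz]
  exact add_mem (Ideal.mem_sup_left (hJ _ ha _)) (Ideal.mem_sup_right
    (Ideal.mul_mem_mul (Ideal.mem_span_singleton_self z)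
      (geIdeal_le (by omega) (homogeneousComponent_mem_geIdeal j b))))

theorem cutSetup_cons (S : LocalSetup c e f φ I) (hL : CutSetup c e m I L)
    (hr : L.length + 2 ≤ c + e) {x : Fin N → k}
    (hx : ∀ P ∈ avoidedPrimes e I L, kForm O x ∉ P) : CutSetup c e m I (x :: L) := by
  have hz : (kForm O x).IsHomogeneous 1 := isHomogeneous_kForm x
  have hJ := S.homogIdeal_cutIdeal L
  have hinj := fun u => S.mem_cutIdeal_of_kForm_mul_mem (u := u) hL (by omega) hx
  have hlt : ∀ (K P : Ideal (MvPolynomial (Fin N) O)), P.IsPrime → K ≤ P →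
      (∀ P0 ∈ K.minimalPrimes, (¬ ∀ i, X i ∈ P0) → kForm O x ∉ P0) →
      (¬ ∀ i, X i ∈ P) → kForm O x ∈ P → ∃ P0, P0 ∈ K.minimalPrimes ∧
        (¬ ∀ i, X i ∈ P0) ∧ P0.height + 1 ≤ P.height := by
    intro K P hP hKP hK hX hxP
    obtain ⟨P0, hP0, hle⟩ := Ideal.exists_minimalPrimes_le hKP
    have := hP0.1.1
    have hX0 : ¬ ∀ i, X i ∈ P0 := fun h => hX fun i => hle (h i)
    refine ⟨P0, hP0, hX0, Ideal.height_add_one_le_of_lt_of_isPrime (lt_of_le_of_ne hle ?_)⟩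
    rintro rfl
    exact hK P0 hP0 hX0 hxP
  constructor
  · rw [List.length_cons, cutIdeal_cons]
    by_cases hre : L.length + 2 ≤ e
    · have h0 : L.length + 1 + 1 - e = L.length + 1 - e := by omega
      rw [h0]
      have ht := hL.depth
      have h1 : c + e - L.length = c + e - (L.length + 1) + 1 := by omega
      rw [h1] at ht
      have htop : geIdeal O N (L.length + 1 - e) = ⊤ := by
        rw [Nat.sub_eq_zero_of_le (by omega)]
        simp [geIdeal]
      refine DepthAt.subQuot_right (kForm O x) (fun u hu => Ideal.mul_mem_left _ _ hu)
        (fun u _ hu => Ideal.mul_mem_left _ _ hu) hinj (fun w hw => ?_) ht (ht.mono (by omega))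
      rw [htop, sup_comm, Ideal.mem_span_singleton_sup]
      constructor
      · rintro ⟨a, b, hb, rfl⟩
        exact ⟨a, trivial, by rwa [mul_comm, add_sub_cancel_left]⟩
      · rintro ⟨a, -, h⟩
        exact ⟨a, _, h, by ring⟩
    · have h0 : L.length + 1 + 1 - e = (L.length + 1 - e) + 1 := by omega
      rw [h0]
      have ht := hL.depth
      have h1 : c + e - L.length = c + e - (L.length + 1) + 1 := by omega
      rw [h1] at ht
      have hge : ∀ w, w ∈ Ideal.span {kForm O x} * geIdeal O N (L.length + 1 - e) ↔
          ∃ u ∈ geIdeal O N (L.length + 1 - e), kForm O x * u = w := fun w =>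
        Ideal.mem_span_singleton_mul
      have hquot : DepthAt (irr N (maximalIdeal O)) (c + e - (L.length + 1))
          (SubQuot (geIdeal O N (L.length + 1 - e))
            (cutIdeal I L ⊔ Ideal.span {kForm O x} * geIdeal O N (L.length + 1 - e))) := by
        refine DepthAt.subQuot_right (kForm O x) (fun u hu => Ideal.mul_mem_left _ _ hu)
          (fun u _ hu => Ideal.mul_mem_left _ _ hu) hinj (fun w hw => ?_) ht (ht.mono (by omega))
        rw [sup_comm, Submodule.mem_sup]
        constructor
        · rintro ⟨a, ha, b, hb, rfl⟩
          obtain ⟨u, hu, rfl⟩ := (hge a).1 ha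
          exact ⟨u, hu, by rwa [add_sub_cancel_left]⟩
        · rintro ⟨u, hu, h⟩
          exact ⟨_, (hge _).2 ⟨u, hu, rfl⟩, _, h, by ring⟩
      refine DepthAt.subQuot_left 1 (fun u hu => ?_) (fun u hu hu' => ?_) (fun u hu hu' => ?_)
        (W := (cutIdeal I L ⊔ Ideal.span {kForm O x} * geIdeal O N (L.length + 1 - e)) ⊔
          geIdeal O N (L.length + 1 - e + 1)) (fun w _ => ?_) hquot ?_
      · rw [one_mul]
        exact geIdeal_le (Nat.le_succ _) hu
      · rw [one_mul]
        exact (hJ.mem_sup_span_singleton_iff_of_mem_geIdeal hz hu).1 hu'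
      · rw [one_mul] at hu'
        exact (hJ.mem_sup_span_singleton_iff_of_mem_geIdeal hz hu).2 hu'
      · rw [sup_comm, Submodule.mem_sup]
        constructor
        · rintro ⟨a, ha, b, hb, rfl⟩
          exact ⟨a, ha, by rwa [one_mul, add_sub_cancel_left]⟩
        · rintro ⟨u, hu, h⟩
          exact ⟨u, hu, _, h, by ring⟩
      · refine DepthAt.mono (DepthAt.subQuot_congr (V := cutIdeal I L ⊔
          geIdeal O N (L.length + 1 - e + 1)) (fun u _ => ?_)
          (hL.depth_piece (L.length + 1 - e) le_rfl)) (by omega)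
        rw [sup_assoc, sup_eq_right.2 (show Ideal.span {kForm O x} *
          geIdeal O N (L.length + 1 - e) ≤ geIdeal O N (L.length + 1 - e + 1) from fun w hw => by
            obtain ⟨u, hu, rfl⟩ := (hge w).1 hw
            exact mul_mem_geIdeal_succ hz hu)]
  · intro j hj
    rw [List.length_cons] at hj
    rw [cutIdeal_cons]
    cases j with
    | zero => exact depthAt_piece_zero_sup hz (hL.depth_piece 0 (by omega))
    | succ j =>
      by_cases hjc : j + 1 ≤ c
      · refine hJ.depthAt_piece_sup hz (fun u hu hzu => hinj u
          (mem_geIdeal_of_isHomogeneous hu (by omega)) hzu) ?_ (hL.depth_piece (j + 1) (by omega))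
        exact (hL.depth_piece j (by omega)).mono (by omega)
      · intro i hi
        omega
  · intro P hP hle hX
    rw [cutIdeal_cons] at hle
    obtain ⟨P0, hP0, hX0, hht⟩ := hlt (cutIdeal I L) P hP (le_sup_left.trans hle)
      (fun P0 hP0 hX0 => hx P0 ⟨Or.inr (Or.inl hP0), hX0⟩) hX
      (hle (Ideal.mem_sup_right (Ideal.mem_span_singleton_self _)))
    refine le_trans ?_ ((add_le_add_left (hL.le_height P0 hP0.1.1 hP0.1.2 hX0) 1).trans hht)
    rw [List.length_cons]
    norm_cast
  · intro P hP hle hX hn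
    rw [cutIdeal_cons] at hle
    obtain ⟨P0, hP0, hX0, hht⟩ := hlt (cutIdeal I L ⊔ (maximalIdeal O).map C) P hP
      (sup_le (le_sup_left.trans hle) hn)
      (fun P0 hP0 hX0 => hx P0 ⟨Or.inr (Or.inr hP0), hX0⟩) hX
      (hle (Ideal.mem_sup_right (Ideal.mem_span_singleton_self _)))
    refine le_trans ?_ ((add_le_add_left (hL.le_height' P0 hP0.1.1 (le_sup_left.trans hP0.1.2) hX0
      (le_sup_right.trans hP0.1.2)) 1).trans hht)
    rw [List.length_cons]
    norm_cast

/-- In large degree, nothing survives a maximal number of general linear forms. -/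
theorem mem_cutIdeal_of_isHomogeneous (S : LocalSetup c e f φ I) (hL : CutSetup c e m I L)
    (hr : L.length + 1 = c + e) {j : ℕ} (hj : c ≤ j) {w : MvPolynomial (Fin N) O}
    (hw : w.IsHomogeneous j) : w ∈ cutIdeal I L := by
  by_contra hc
  obtain ⟨P, hP, hPM, hann⟩ := SubQuot.exists_associatedPrimes_le (Q := irr N (maximalIdeal O))
    (U := geIdeal O N (L.length + 1 - e)) (V := cutIdeal I L)
    (mem_geIdeal_of_isHomogeneous hw (by omega)) (fun s hs h => hc
      (C_unit_mul_mem (S.homogIdeal_cutIdeal L) hw hs h))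
  have hprime := (mem_associatedPrimes_iff.1 hP).1
  have hcut : cutIdeal I L ≤ P := SubQuot.le_of_mem_associatedPrimes hP
  have hX := S.not_forall_X_mem hL hr.le hP hPM
  have h1 := height_add_le_of_depthAt hL.depth hP hPM
  obtain ⟨P', hP', hhom, hle, hcore⟩ := exists_homogIdeal_isPrime_le P
  have hcut' := hcore _ (S.homogIdeal_cutIdeal L) hcut
  have h2 := hL.le_height P' hP' hcut' (fun h => hX fun i => hle (h i))
  obtain ⟨a, ha⟩ := exists_nat_height_eq P
  obtain ⟨a', ha'⟩ := exists_nat_height_eq P'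
  rw [ha, S.height_irr] at h1
  norm_cast at h1
  have hPP : P' = P := by
    by_contra hne
    have h3 := Ideal.height_add_one_le_of_lt_of_isPrime (lt_of_le_of_ne hle hne)
    rw [ha'] at h2 h3
    rw [ha] at h3
    norm_cast at h2 h3
    omega
  subst hPP
  have hq : (P'.comap C).IsPrime := hprime.comap C
  have hirr : P' ≤ irr N (P'.comap C) := by
    intro F hF
    have := hhom F hF 0
    rw [homogeneousComponent_zero] at this
    exact this
  have hne : P'.comap C ≠ maximalIdeal O := by
    intro h
    have h3 := hL.le_height' P' hP' hcut' hX (by rw [Ideal.map_le_iff_le_comap, h])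
    rw [ha] at h3
    norm_cast at h3
    omega
  have hlt1 : P' < irr N (P'.comap C) := by
    refine lt_of_le_of_ne hirr fun h => hX fun i => ?_
    rw [h, irr, Ideal.mem_comap, constantCoeff_X]
    exact zero_mem _
  have hlt2 : irr N (P'.comap C) < irr N (maximalIdeal O) := by
    refine lt_of_le_of_ne (Ideal.comap_mono (le_maximalIdeal hq.ne_top)) fun h => hne ?_
    rw [← comap_C_irr (N := N) (P'.comap C), h, comap_C_irr]
  have h3 := Ideal.height_add_one_le_of_lt_of_isPrime hlt1
  have h4 := Ideal.height_add_one_le_of_lt_of_isPrime hlt2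
  have h5 := (add_le_add_left h3 1).trans h4
  rw [ha] at h2 h5
  rw [S.height_irr] at h5
  norm_cast at h2 h5
  omega

end LocalSetup

end

section

open MvPolynomial IsLocalRing
open scoped Pointwise

set_option linter.unusedSectionVars false

variable {k : Type} [Field k]
variable {O : Type} [CommRing O] [Algebra k O] [IsRegularLocalRing O] [IsRegularRing O]
  {N c m e : ℕ} {f : Fin m → O} {φ : Fin m → Fin N → O} {I : Ideal (MvPolynomial (Fin N) O)}

theorem HomogIdeal.exists_isHomogeneous_add {J K : Ideal (MvPolynomial (Fin N) O)}
    (hJ : HomogIdeal J) (hK : HomogIdeal K) {j : ℕ} {w : MvPolynomial (Fin N) O}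
    (hw : w.IsHomogeneous j) (h : w ∈ J ⊔ K) :
    ∃ a ∈ J, ∃ b ∈ K, a.IsHomogeneous j ∧ b.IsHomogeneous j ∧ w = a + b := by
  obtain ⟨a, ha, b, hb, rfl⟩ := Submodule.mem_sup.1 h
  refine ⟨_, hJ a ha j, _, hK b hb j, homogeneousComponent_isHomogeneous _ _,
    homogeneousComponent_isHomogeneous _ _, ?_⟩
  rw [← map_add, homogeneousComponent_of_mem hw, if_pos rfl]

namespace LocalSetup

theorem cutSetup_of_sublist (S : LocalSetup c e f φ I) {xs : List (Fin N → k)}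
    (hxs : ∀ x l, (x :: l).Sublist xs → ∀ P ∈ avoidedPrimes e I l, kForm O x ∉ P)
    (l : List (Fin N → k)) (hl : l.Sublist xs) (hlen : l.length + 1 ≤ c + e) :
    CutSetup c e m I l := by
  induction l with
  | nil => exact S.cutSetup_nil
  | cons x l ih =>
    rw [List.length_cons] at hlen
    exact S.cutSetup_cons (ih ((List.sublist_cons_self x l).trans hl) (by omega)) (by omega)
      (hxs x l hl)

theorem mem_relIdeal_of_mem_formIdeal (S : LocalSetup c e f φ I) {xs : List (Fin N → k)}
    (hxs : ∀ x l, (x :: l).Sublist xs → ∀ P ∈ avoidedPrimes e I l, kForm O x ∉ P)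
    (l : List (Fin N → k)) (hl : l.Sublist xs) (hlen : l.length + 1 ≤ c + e)
    {F : MvPolynomial (Fin N) O} (hF : F.IsHomogeneous c) (hFI : F ∈ I) (h : F ∈ formIdeal O l) :
    F ∈ relIdeal f φ m := by
  induction l generalizing F with
  | nil =>
    rw [formIdeal_nil, Ideal.mem_bot] at h
    rw [h]
    exact zero_mem _
  | cons x l ih =>
    rw [List.length_cons] at hlen
    have hl' := (List.sublist_cons_self x l).trans hl
    have hc1 := S.one_le_c
    obtain ⟨d, rfl⟩ : ∃ d, c = 1 + d := ⟨c - 1, by omega⟩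
    have hz : (kForm O x).IsHomogeneous 1 := isHomogeneous_kForm x
    rw [formIdeal_cons, sup_comm, Ideal.mem_span_singleton_sup] at h
    obtain ⟨a, F', hF', heq⟩ := h
    have h1 : kForm O x * homogeneousComponent d a + homogeneousComponent (1 + d) F' = F := by
      rw [← homogeneousComponent_isHomogeneous_mul hz, ← map_add, mul_comm, heq,
        homogeneousComponent_of_mem hF, if_pos rfl]
    have hF'' := homogIdeal_formIdeal l _ hF' (1 + d)
    have h2 : homogeneousComponent d a ∈ cutIdeal I l := by
      refine S.mem_cutIdeal_of_kForm_mul_mem (S.cutSetup_of_sublist hxs l hl' (by omega)) (by omega)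
        (hxs x l hl) (geIdeal_le (by omega) (homogeneousComponent_mem_geIdeal d a)) ?_
      rw [eq_sub_of_add_eq h1]
      exact sub_mem (Ideal.mem_sup_left hFI) (Ideal.mem_sup_right hF'')
    obtain ⟨b, hb, g, hg, hbh, hgh, hab⟩ := S.homogIdeal.exists_isHomogeneous_add
      (homogIdeal_formIdeal l) (homogeneousComponent_isHomogeneous d a) h2
    have h3 : kForm O x * b ∈ relIdeal f φ m :=
      Ideal.mul_mem_left _ _ (S.mem_relIdeal_of_isHomogeneous (by omega) hbh hb)
    have h4 : F - kForm O x * b ∈ relIdeal f φ m := by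
      refine ih hl' (by omega) (hF.sub (hz.mul hbh))
        (sub_mem hFI (S.relIdeal_le h3)) ?_
      rw [← h1, hab, show kForm O x * (b + g) + homogeneousComponent (1 + d) F' - kForm O x * b =
        kForm O x * g + homogeneousComponent (1 + d) F' by ring]
      exact add_mem (Ideal.mul_mem_left _ _ hg) hF''
    exact (Submodule.sub_mem_iff_left _ h3).1 h4

/-- General linear forms, modulo all but one of which the torsion contains all forms of
degree `c`, and any of whose multiples in the torsion are relations. -/
theorem exists_general_list [Infinite k] (S : LocalSetup c e f φ I)
    (B : List (Fin N → k) → Set (Submodule k (Fin N → k))) (hfin : ∀ l, (B l).Finite)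
    (htop : ∀ l, l.length < c + e → ∀ W ∈ B l, W ≠ ⊤) :
    ∃ xs : List (Fin N → k), xs.length = c + e ∧
      (∀ x l, (x :: l).Sublist xs → ∀ W ∈ B l, x ∉ W) ∧
      ∀ l, l.Sublist xs → l.length + 1 = c + e → ∀ F : MvPolynomial (Fin N) O, F.IsHomogeneous c →
        F ∈ I ⊔ formIdeal O l ∧ (F ∈ I → F ∈ formIdeal O l → F ∈ relIdeal f φ m) := by
  obtain ⟨xs, hlen, hxs⟩ := exists_list_forall_sublist_notMem
    (fun l => B l ∪ formSubspace (k := k) '' avoidedPrimes e I l)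
    (fun l => (hfin l).union ((finite_avoidedPrimes e I l).image _)) (c + e) (by
      rintro l hl W (hW | ⟨P, hP, rfl⟩)
      · exact htop l hl W hW
      · exact formSubspace_ne_top hP.2)
  have hxs' : ∀ x l, (x :: l).Sublist xs → ∀ P ∈ avoidedPrimes e I l, kForm O x ∉ P :=
    fun x l hl P hP h => hxs x l hl _ (Or.inr ⟨P, hP, rfl⟩) h
  refine ⟨xs, hlen, fun x l hl W hW => hxs x l hl W (Or.inl hW), fun l hl hl1 F hF => ⟨?_, ?_⟩⟩
  · exact S.mem_cutIdeal_of_isHomogeneous (S.cutSetup_of_sublist hxs' l hl hl1.le) hl1 le_rfl hF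
  · exact S.mem_relIdeal_of_mem_formIdeal hxs' l hl hl1.le hF

end LocalSetup

end

section

open IsLocalRing Polynomial

variable {k V : Type} [Field k] [CommRing V] [IsDomain V] [IsDiscreteValuationRing V] [Algebra k V]

theorem dvd_of_D_eq_smul {k V W : Type} [CommRing k] [CommRing V] [Algebra k V] [CommRing W]
    [Algebra k W] (ψ : V →ₐ[k] W) (δ : V →ₗ[k] W)
    (hδ : ∀ a b, δ (a * b) = ψ a * δ b + ψ b * δ a) {g : V} {ω : Ω[V⁄k]}
    (h : KaehlerDifferential.D k V g = g • ω) : ψ g ∣ δ g := by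
  let _ : Algebra V W := ψ.toRingHom.toAlgebra
  have : IsScalarTower k V W := IsScalarTower.of_algebraMap_eq fun c => (ψ.commutes c).symm
  let d : Derivation k V W := Derivation.mk' δ hδ
  have h1 := congrArg d.liftKaehlerDifferential h
  rw [map_smul, Derivation.liftKaehlerDifferential_comp_D] at h1
  exact ⟨_, h1⟩

theorem eval₂_surjective_of_section {τ : V} (hτ : Irreducible τ) {B : Type} [CommRing B]
    (q : V →+* B) (hq : Function.Surjective q) (M : ℕ) (hker : ∀ v, q v = 0 ↔ τ ^ M ∣ v)
    (σ : ResidueField V →+* B) (hσ : ∀ v w, q v = σ w → residue V v = w) :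
    Function.Surjective (eval₂RingHom σ (q τ)) := by
  have hstep : ∀ j (v : V), ∃ P w, q v = eval₂RingHom σ (q τ) P + q (τ ^ j * w) := by
    intro j
    induction j with
    | zero => exact fun v => ⟨0, v, by simp⟩
    | succ j ih =>
      intro v
      obtain ⟨P, w, h⟩ := ih v
      obtain ⟨w', hw'⟩ := hq (σ (residue V w))
      have h1 : residue V (w - w') = 0 := by rw [map_sub, hσ _ _ hw', sub_self]
      rw [residue_eq_zero_iff, hτ.maximalIdeal_eq, Ideal.mem_span_singleton] at h1
      obtain ⟨a, ha⟩ := h1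
      refine ⟨P + C (residue V w) * X ^ j, a, ?_⟩
      have : w = w' + τ * a := by rw [← ha]; ring
      rw [h, map_add, map_mul, map_pow]
      simp only [coe_eval₂RingHom, eval₂_C, eval₂_mul, eval₂_X_pow]
      conv_lhs => rw [this]
      rw [← hw']
      simp only [map_mul, map_add, map_pow]
      ring
  intro b
  obtain ⟨v, rfl⟩ := hq b
  obtain ⟨P, w, h⟩ := hstep M v
  exact ⟨P, by rw [h, (hker _).2 (dvd_mul_right _ _), add_zero]⟩

theorem X_pow_dvd_of_eval₂_eq_zero {τ : V} (hτ : Irreducible τ) {B : Type} [CommRing B]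
    (q : V →+* B) (hq : Function.Surjective q) (M : ℕ) (hker : ∀ v, q v = 0 ↔ τ ^ M ∣ v)
    (σ : ResidueField V →+* B) (hσ : ∀ v w, q v = σ w → residue V v = w)
    (P : (ResidueField V)[X]) (hP : eval₂ σ (q τ) P = 0) : X ^ M ∣ P := by
  suffices ∀ j ≤ M, X ^ j ∣ P from this M le_rfl
  intro j
  induction j with
  | zero => simp
  | succ j ih =>
    intro hj
    obtain ⟨Q, rfl⟩ := ih (by omega)
    rw [pow_succ]
    refine mul_dvd_mul_left _ (X_dvd_iff.2 ?_)
    obtain ⟨v, hv⟩ := hq (eval₂ σ (q τ) Q)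
    rw [eval₂_mul, eval₂_X_pow, ← hv, ← map_pow, ← map_mul, hker] at hP
    have h1 : τ ∣ v := by
      obtain ⟨a, ha⟩ := hP
      obtain ⟨i, rfl⟩ := Nat.exists_eq_add_of_lt hj
      refine ⟨τ ^ i * a, mul_left_cancel₀ (pow_ne_zero j hτ.ne_zero) ?_⟩
      rw [ha]; ring
    obtain ⟨a, rfl⟩ := h1
    obtain ⟨R, hR⟩ : ∃ R, Q = C (Q.coeff 0) + X * R := ⟨Q.divX, by
      conv_lhs => rw [← X_mul_divX_add Q]
      ring⟩
    obtain ⟨r, hr⟩ := hq (eval₂ σ (q τ) R)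
    rw [hR, eval₂_add, eval₂_C, eval₂_mul, eval₂_X, ← hr, ← map_mul] at hv
    have h2 := hσ (τ * a - τ * r) (Q.coeff 0) (by rw [map_sub, hv]; simp)
    rw [← h2, residue_eq_zero_iff, hτ.maximalIdeal_eq, Ideal.mem_span_singleton, ← mul_sub]
    exact dvd_mul_right _ _

variable [CharZero k] [Algebra.EssFiniteType k V]

/-- In a discrete valuation ring essentially of finite type over a field of characteristic zero,
a nonzero nonunit has no logarithmic differential. -/
theorem D_ne_smul {g : V} (hg : g ≠ 0) (hgm : g ∈ maximalIdeal V) (ω : Ω[V⁄k]) :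
    KaehlerDifferential.D k V g ≠ g • ω := by
  obtain ⟨τ, hτ⟩ := IsDiscreteValuationRing.exists_irreducible V
  obtain ⟨M, u, rfl⟩ := IsDiscreteValuationRing.eq_unit_mul_pow_irreducible hg hτ
  obtain ⟨n, rfl⟩ : ∃ n, M = n + 1 := Nat.exists_eq_succ_of_ne_zero (by
    rintro rfl
    exact (mem_maximalIdeal _).1 hgm (by simp))
  set J : Ideal V := Ideal.span {τ ^ (n + 2)} with hJ
  have hJle : J ≤ maximalIdeal V := by
    rw [hτ.maximalIdeal_eq, hJ, Ideal.span_singleton_le_span_singleton]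
    exact dvd_pow_self _ (by omega)
  have hker : ∀ v, Ideal.Quotient.mk J v = 0 ↔ τ ^ (n + 2) ∣ v := fun v => by
    rw [Ideal.Quotient.eq_zero_iff_mem, hJ, Ideal.mem_span_singleton]
  let γ : (V ⧸ J) →ₐ[k] ResidueField V := Ideal.Quotient.liftₐ J
    (IsScalarTower.toAlgHom k V (ResidueField V)) fun a ha => by
      simpa using hJle ha
  have hγ : ∀ v, γ (Ideal.Quotient.mk J v) = residue V v := fun v => rfl
  have hγs : Function.Surjective γ := fun x => by
    obtain ⟨v, rfl⟩ := residue_surjective x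
    exact ⟨_, hγ v⟩
  have hnil : IsNilpotent (RingHom.ker (γ : (V ⧸ J) →+* ResidueField V)) := by
    refine ⟨n + 2, ?_⟩
    refine le_bot_iff.1 ?_
    have : RingHom.ker (γ : (V ⧸ J) →+* ResidueField V) ≤ Ideal.span {Ideal.Quotient.mk J τ} := by
      intro x hx
      obtain ⟨v, rfl⟩ := Ideal.Quotient.mk_surjective x
      have h1 : residue V v = 0 := hx
      rw [residue_eq_zero_iff, hτ.maximalIdeal_eq, Ideal.mem_span_singleton] at h1
      exact Ideal.mem_span_singleton.2 (map_dvd _ h1)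
    refine (Ideal.pow_right_mono this _).trans ?_
    rw [Ideal.span_singleton_pow, ← map_pow, (hker _).2 dvd_rfl]
    simp
  have : Algebra.EssFiniteType k (ResidueField V) :=
    inferInstanceAs (Algebra.EssFiniteType k (V ⧸ maximalIdeal V))
  let σ : ResidueField V →ₐ[k] (V ⧸ J) :=
    Algebra.FormallySmooth.liftOfSurjective (AlgHom.id k _) γ hγs hnil
  have hσ : ∀ v w, Ideal.Quotient.mk J v = σ w → residue V v = w := fun v w h => by
    rw [← hγ, h]
    exact Algebra.FormallySmooth.liftOfSurjective_apply (AlgHom.id k _) γ hγs hnil w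
  have hsurj := eval₂_surjective_of_section hτ (Ideal.Quotient.mk J) Ideal.Quotient.mk_surjective
    (n + 2) hker (σ : ResidueField V →+* V ⧸ J) hσ
  have hdvd := X_pow_dvd_of_eval₂_eq_zero hτ (Ideal.Quotient.mk J) Ideal.Quotient.mk_surjective
    (n + 2) hker (σ : ResidueField V →+* V ⧸ J) hσ
  set Θ := eval₂RingHom (σ : ResidueField V →+* V ⧸ J) (Ideal.Quotient.mk J τ) with hΘ
  let W := (ResidueField V)[X] ⧸ Ideal.span {(X : (ResidueField V)[X]) ^ (n + 1)}
  let ρ : (ResidueField V)[X] →+* W := Ideal.Quotient.mk _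
  have hρ : ∀ P, ρ P = 0 ↔ X ^ (n + 1) ∣ P := fun P => by
    rw [Ideal.Quotient.eq_zero_iff_mem, Ideal.mem_span_singleton]
  choose P hP using fun v : V => hsurj (Ideal.Quotient.mk J v)
  have hcmp : ∀ A B, Θ A = Θ B → X ^ (n + 2) ∣ A - B := fun A B h =>
    hdvd _ (by rw [← coe_eval₂RingHom, ← hΘ, map_sub, h, sub_self])
  have hdvd' : ∀ A B, Θ A = Θ B → ρ A = ρ B := fun A B h => by
    rw [← sub_eq_zero, ← map_sub, hρ]
    exact (pow_dvd_pow _ (by omega)).trans (hcmp A B h)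
  have hdvdD : ∀ A B, Θ A = Θ B → ρ (derivative A) = ρ (derivative B) := fun A B h => by
    rw [← sub_eq_zero, ← map_sub, hρ, ← derivative_sub]
    obtain ⟨R, hR⟩ := hcmp A B h
    rw [hR, derivative_mul, derivative_X_pow]
    refine dvd_add ?_ ?_
    · simp only [show n + 2 - 1 = n + 1 by omega, mul_assoc]
      exact (dvd_mul_right _ _).mul_left _
    · exact (pow_dvd_pow _ (by omega)).mul_right _
  have hPc : ∀ c : k, Θ (P (algebraMap k V c)) = Θ (C (algebraMap k (ResidueField V) c)) := by
    intro c
    rw [hP, hΘ, coe_eval₂RingHom, eval₂_C]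
    change algebraMap k (V ⧸ J) c = σ _
    rw [AlgHom.commutes]
  let ψ : V →ₐ[k] W :=
    { toFun := fun v => ρ (P v)
      map_one' := by rw [hdvd' (P 1) 1 (by rw [hP]; simp), map_one]
      map_zero' := by rw [hdvd' (P 0) 0 (by rw [hP]; simp), map_zero]
      map_add' := fun a b => by
        rw [hdvd' (P (a + b)) (P a + P b) (by simp [hP]), map_add]
      map_mul' := fun a b => by
        rw [hdvd' (P (a * b)) (P a * P b) (by simp [hP]), map_mul]
      commutes' := fun c => by
        rw [hdvd' _ _ (hPc c)]
        rfl }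
  let δ : V →ₗ[k] W :=
    { toFun := fun v => ρ (derivative (P v))
      map_add' := fun a b => by
        rw [hdvdD (P (a + b)) (P a + P b) (by simp [hP]), derivative_add, map_add]
      map_smul' := fun c a => by
        rw [hdvdD (P (c • a)) (C (algebraMap k (ResidueField V) c) * P a) (by
          rw [map_mul, ← hPc, hP, hP, hP, Algebra.smul_def, map_mul]), derivative_C_mul, map_mul]
        exact (Algebra.smul_def c (ρ (derivative (P a)))).symm }
  intro h
  have h1 : ψ (u * τ ^ (n + 1)) ∣ δ (u * τ ^ (n + 1)) := dvd_of_D_eq_smul ψ δ (fun a b => by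
    change ρ (derivative (P (a * b))) = ρ (P a) * ρ (derivative (P b)) +
      ρ (P b) * ρ (derivative (P a))
    rw [hdvdD (P (a * b)) (P a * P b) (by simp [hP]), derivative_mul, ← map_mul,
      ← map_mul, ← map_add]
    ring_nf) h
  have h2 : Θ (P (u * τ ^ (n + 1))) = Θ (P u * X ^ (n + 1)) := by
    rw [map_mul, hP, hP, map_pow, map_mul, map_pow]
    simp [hΘ]
  have h3 : ρ (derivative (P u * X ^ (n + 1))) = 0 := by
    rw [← hdvdD _ _ h2]
    obtain ⟨w, hw⟩ := h1
    change ρ (derivative (P (u * τ ^ (n + 1)))) = ρ (P (u * τ ^ (n + 1))) * w at hw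
    rw [hw, hdvd' _ _ h2, map_mul, (hρ (X ^ (n + 1))).2 dvd_rfl, mul_zero, zero_mul]
  have : CharZero (ResidueField V) := charZero_of_injective_algebraMap (algebraMap k _).injective
  have h4 : (P u).coeff 0 = residue V u := by
    have : γ (Θ (P u)) = (P u).coeff 0 := by
      have h5 : P u = C ((P u).coeff 0) + X * (P u).divX := by
        conv_lhs => rw [← X_mul_divX_add (P u)]
        ring
      conv_lhs => rw [h5]
      rw [map_add, map_mul, map_add, map_mul]
      simp only [hΘ, coe_eval₂RingHom, eval₂_C, eval₂_X]
      rw [hγ, (residue_eq_zero_iff τ).2 (by rw [hτ.maximalIdeal_eq]; exact Ideal.mem_span_singleton_self τ),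
        zero_mul, add_zero]
      exact Algebra.FormallySmooth.liftOfSurjective_apply (AlgHom.id k _) γ hγs hnil _
    rw [← this, hP, hγ]
  rw [hρ, X_pow_dvd_iff] at h3
  have h5 := h3 n (by omega)
  rw [coeff_derivative, coeff_mul_X_pow', if_pos le_rfl, Nat.sub_self, h4] at h5
  rcases mul_eq_zero.1 h5 with h6 | h6
  · rw [residue_eq_zero_iff] at h6
    exact (mem_maximalIdeal _).1 h6 u.isUnit
  · exact Nat.cast_add_one_ne_zero n h6

end

section

open IsLocalRing

theorem exists_isDiscreteValuationRing_localization {C : Type} [CommRing C] [IsDomain C]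
    [IsNoetherianRing C] [IsIntegrallyClosed C] (Q : Ideal C) [Q.IsPrime] {g : C} (hg : g ≠ 0)
    (hgQ : g ∈ Q) : ∃ (p : Ideal C) (_ : p.IsPrime), p ≤ Q ∧ g ∈ p ∧
      IsDiscreteValuationRing (Localization.AtPrime p) := by
  obtain ⟨p, hp, hpQ⟩ := Ideal.exists_minimalPrimes_le
    ((Ideal.span_singleton_le_iff_mem Q).2 hgQ)
  have hpp : p.IsPrime := hp.1.1
  have hgp : g ∈ p := hp.1.2 (Ideal.mem_span_singleton_self g)
  have hht : p.height ≤ 1 := Ideal.height_le_one_of_isPrincipal_of_mem_minimalPrimes _ p hp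
  refine ⟨p, hpp, hpQ, hgp, ?_⟩
  have hp0 : p ≠ ⊥ := fun h => hg (by rwa [h] at hgp)
  have hnf : ¬ IsField (Localization.AtPrime p) := by
    intro h
    have h1 := (IsLocalRing.isField_iff_maximalIdeal_eq.1 h)
    have h2 : algebraMap C (Localization.AtPrime p) g ∈ maximalIdeal _ :=
      (IsLocalization.AtPrime.to_map_mem_maximal_iff _ p g).2 hgp
    rw [h1, Ideal.mem_bot] at h2
    exact hg ((IsLocalization.injective _ p.primeCompl_le_nonZeroDivisors) (by rw [h2, map_zero]))
  have key := (IsDiscreteValuationRing.TFAE (Localization.AtPrime p) hnf).out 0 3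
  rw [key]
  constructor
  · exact isIntegrallyClosed_of_isLocalization _ p.primeCompl p.primeCompl_le_nonZeroDivisors
  refine ⟨maximalIdeal (Localization.AtPrime p),
    ⟨IsLocalRing.isField_iff_maximalIdeal_eq.not.1 hnf, inferInstance⟩, ?_⟩
  rintro P ⟨hP0, hP⟩
  by_contra hne
  have hlt : P < maximalIdeal (Localization.AtPrime p) :=
    lt_of_le_of_ne (le_maximalIdeal hP.ne_top) hne
  have h1 := Ideal.height_add_one_le_of_lt_of_isPrime hlt
  have h2 := Ideal.height_add_one_le_of_lt_of_isPrime (bot_lt_iff_ne_bot.2 hP0)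
  have h3 : (maximalIdeal (Localization.AtPrime p)).height = p.height := by
    have h4 := IsLocalization.AtPrime.ringKrullDim_eq_height p (Localization.AtPrime p)
    rw [← IsLocalRing.maximalIdeal_height_eq_ringKrullDim] at h4
    exact_mod_cast h4
  have h5 : (1 : ℕ∞) + 1 ≤ 1 := by
    calc (1 : ℕ∞) + 1 ≤ (⊥ + 1) + 1 := by simp
      _ ≤ _ := (add_le_add_left (le_trans (by gcongr; exact bot_le) h2) 1).trans (h1.trans (h3.le.trans hht))
  exact absurd h5 (by decide)

theorem exists_integralClosure_of_finiteType (k : Type) {A : Type} (K : Type) [Field k] [CharZero k] [CommRing A]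
    [IsDomain A] [Algebra k A] [Algebra.FiniteType k A] [Field K] [Algebra A K]
    [IsFractionRing A K] [Algebra k K] [IsScalarTower k A K] :
    IsNoetherianRing (integralClosure A K) ∧ Algebra.FiniteType k (integralClosure A K) := by
  obtain ⟨s, g, hinj, hfin⟩ := exists_finite_inj_algHom_of_fg k A
  let P := MvPolynomial (Fin s) k
  let _ : Algebra P A := g.toRingHom.toAlgebra
  have : Module.Finite P A := hfin
  have : IsScalarTower k P A := IsScalarTower.of_algebraMap_eq fun c => (g.commutes c).symm
  have hPA : Function.Injective (algebraMap P A) := hinj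
  have : FaithfulSMul P A := (faithfulSMul_iff_algebraMap_injective P A).2 hPA
  let _ : Algebra P K := ((algebraMap A K).comp (algebraMap P A)).toAlgebra
  have : IsScalarTower P A K := IsScalarTower.of_algebraMap_eq fun _ => rfl
  have : FaithfulSMul P K := (faithfulSMul_iff_algebraMap_injective P K).2
    ((IsFractionRing.injective A K).comp hPA)
  let F := FractionRing P
  let _ : Algebra F K := FractionRing.liftAlgebra P K
  have : IsScalarTower P F K := FractionRing.isScalarTower_liftAlgebra P K
  have : Algebra.IsIntegral P A := inferInstance
  have : Module.IsTorsionFree P A := inferInstance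
  have : FiniteDimensional F K := .of_isLocalization P A (nonZeroDivisors P)
  have : CharZero F := charZero_of_injective_algebraMap (algebraMap k F).injective
  let D := integralClosure A K
  let _ : Algebra P D := ((algebraMap A D).comp (algebraMap P A)).toAlgebra
  have : IsScalarTower P A D := IsScalarTower.of_algebraMap_eq fun _ => rfl
  have : IsScalarTower P D K := IsScalarTower.of_algebraMap_eq fun _ => rfl
  have : IsIntegralClosure D P K :=
    { algebraMap_injective := Subtype.val_injective
      isIntegral_iff := by
        intro x
        constructor
        · intro h
          exact ⟨⟨x, h.tower_top⟩, rfl⟩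
        · rintro ⟨y, rfl⟩
          exact isIntegral_trans (R := P) (A := A) _ y.2 }
  have hD := IsIntegralClosure.finite P F K D
  refine ⟨IsIntegralClosure.isNoetherianRing P F K D, ?_⟩
  have : IsScalarTower k P D := IsScalarTower.of_algebraMap_eq fun c => by
    rw [IsScalarTower.algebraMap_apply P A D, ← IsScalarTower.algebraMap_apply k P A]
    exact IsScalarTower.algebraMap_apply k A D c
  exact Algebra.FiniteType.trans (S := P) inferInstance inferInstance

theorem exists_isIntegrallyClosed_of_finiteType (k A : Type) [Field k] [CharZero k] [CommRing A]
    [IsDomain A] [Algebra k A] [Algebra.FiniteType k A] :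
    ∃ (D : Type) (_ : CommRing D) (_ : Algebra k D), IsDomain D ∧ IsNoetherianRing D ∧
      IsIntegrallyClosed D ∧ Algebra.FiniteType k D ∧ ∃ ι : A →ₐ[k] D, Function.Injective ι ∧
        ι.IsIntegral := by
  obtain ⟨hN, hF⟩ := exists_integralClosure_of_finiteType k (A := A) (FractionRing A)
  refine ⟨integralClosure A (FractionRing A), inferInstance, inferInstance, inferInstance, hN,
    integralClosure.isIntegrallyClosedOfFiniteExtension (FractionRing A), hF,
    IsScalarTower.toAlgHom k A _, FaithfulSMul.algebraMap_injective A _, ?_⟩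
  exact fun x => integralClosure.isIntegral x

theorem exists_isDiscreteValuationRing_algHom_of_finiteType (k : Type) {A : Type} [Field k]
    [CharZero k] [CommRing A] [IsDomain A] [Algebra k A] [Algebra.FiniteType k A] (Q : Ideal A)
    [Q.IsPrime] {a : A} (ha : a ≠ 0) (haQ : a ∈ Q) :
    ∃ (V : Type) (_ : CommRing V) (_ : IsDomain V) (_ : IsDiscreteValuationRing V)
      (_ : Algebra k V) (_ : Algebra.EssFiniteType k V) (ψ : A →ₐ[k] V),
      ψ a ≠ 0 ∧ ψ a ∈ maximalIdeal V ∧ ∀ s, s ∉ Q → IsUnit (ψ s) := by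
  obtain ⟨D, _, _, _, _, _, _, ι, hinj, hintg⟩ := exists_isIntegrallyClosed_of_finiteType k A
  let _ : Algebra A D := ι.toRingHom.toAlgebra
  have : Algebra.IsIntegral A D := ⟨hintg⟩
  obtain ⟨Q', -, hQ', hQ'Q⟩ := Ideal.exists_ideal_over_prime_of_isIntegral Q (⊥ : Ideal D) (by
      intro x hx
      rw [Ideal.mem_comap, Ideal.mem_bot] at hx
      rw [hinj (hx.trans (map_zero _).symm)]
      exact zero_mem _)
  have hmem : ∀ x : A, ι x ∈ Q' ↔ x ∈ Q := fun x => by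
    rw [← hQ'Q, Ideal.mem_comap]
    rfl
  obtain ⟨p, hp, hpQ, hap, hV⟩ := exists_isDiscreteValuationRing_localization Q'
    (g := ι a) (fun h => ha (hinj (h.trans (map_zero _).symm))) ((hmem a).2 haQ)
  let V := Localization.AtPrime p
  refine ⟨V, inferInstance, inferInstance, hV, inferInstance, ?_,
    (IsScalarTower.toAlgHom k D V).comp ι, ?_, ?_, ?_⟩
  · exact Algebra.EssFiniteType.comp k D V
  · intro h
    exact ha (hinj (((IsLocalization.injective V p.primeCompl_le_nonZeroDivisors)
      (h.trans (map_zero _).symm)).trans (map_zero _).symm))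
  · exact (IsLocalization.AtPrime.to_map_mem_maximal_iff _ p _).2 hap
  · exact fun s hs => IsLocalization.map_units V (⟨_, fun h => hs ((hmem s).1 (hpQ h))⟩ : p.primeCompl)

/-- A nonzero element of a prime of a domain essentially of finite type over a field of
characteristic zero becomes a nonzero nonunit in some discrete valuation ring, such that the
elements outside the prime become units. -/
theorem exists_isDiscreteValuationRing_algHom (k : Type) {B : Type} [Field k] [CharZero k]
    [CommRing B] [IsDomain B] [Algebra k B] [Algebra.EssFiniteType k B] (Q : Ideal B) [Q.IsPrime]
    {g : B} (hg : g ≠ 0) (hgQ : g ∈ Q) :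
    ∃ (V : Type) (_ : CommRing V) (_ : IsDomain V) (_ : IsDiscreteValuationRing V)
      (_ : Algebra k V) (_ : Algebra.EssFiniteType k V) (ψ : B →ₐ[k] V),
      ψ g ≠ 0 ∧ ψ g ∈ maximalIdeal V ∧ ∀ s, s ∉ Q → IsUnit (ψ s) := by
  let A := Algebra.EssFiniteType.subalgebra k B
  obtain ⟨⟨a, t⟩, hat⟩ := IsLocalization.surj (Algebra.EssFiniteType.submonoid k B) g
  have hunit : ∀ t : Algebra.EssFiniteType.submonoid k B, IsUnit (algebraMap A B t) :=
    fun t => IsLocalization.map_units B t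
  have ha : a ≠ 0 := by
    rintro rfl
    rw [map_zero, (hunit t).mul_left_eq_zero] at hat
    exact hg hat
  have haQ : algebraMap A B a ∈ Q := by
    rw [← hat]
    exact Ideal.mul_mem_right _ _ hgQ
  obtain ⟨V, _, _, _, _, hE, ψ₀, h1, h2, hψ₀⟩ := exists_isDiscreteValuationRing_algHom_of_finiteType k
    (Q.comap (algebraMap A B)) ha haQ
  have hψ₀t : ∀ t : Algebra.EssFiniteType.submonoid k B, IsUnit (ψ₀ t) := fun t =>
    hψ₀ t fun h => ‹Q.IsPrime›.ne_top (Ideal.eq_top_of_isUnit_mem _ h (hunit t))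
  let ψ : B →ₐ[k] V := IsLocalization.liftAlgHom (M := Algebra.EssFiniteType.submonoid k B) hψ₀t
  have hψ : ∀ x : A, ψ (algebraMap A B x) = ψ₀ x := fun x =>
    IsLocalization.lift_eq (M := Algebra.EssFiniteType.submonoid k B) (g := (ψ₀ : A →+* V)) hψ₀t x
  have hψg : ψ g * ψ₀ t = ψ₀ a := by rw [← hψ, ← hψ, ← map_mul, hat]
  refine ⟨V, inferInstance, inferInstance, inferInstance, inferInstance, hE, ψ, ?_, ?_, ?_⟩
  · intro h
    rw [h, zero_mul] at hψg
    exact h1 hψg.symm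
  · rw [← hψg] at h2
    exact ((IsLocalRing.maximalIdeal.isMaximal V).isPrime.mem_or_mem h2).resolve_right fun h =>
      (mem_maximalIdeal _).1 h (hψ₀t t)
  · intro s hs
    obtain ⟨⟨b, u⟩, hbu⟩ := IsLocalization.surj (Algebra.EssFiniteType.submonoid k B) s
    have hb : algebraMap A B b ∉ Q := by
      rw [← hbu]
      exact fun h => (‹Q.IsPrime›.mem_or_mem h).elim hs fun h' =>
        ‹Q.IsPrime›.ne_top (Ideal.eq_top_of_isUnit_mem _ h' (hunit u))
    have h1 := hψ₀ b hb
    rw [← hψ, ← hbu, map_mul] at h1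
    exact isUnit_of_mul_isUnit_left h1

end

section

open IsLocalRing MvPolynomial

variable {k κ : Type} [Field k] [Field κ] [Algebra k κ] {N : ℕ}

/-- The vectors over `k` lying in a subspace over `κ`. -/
def descend (W : Submodule κ (Fin N → κ)) : Submodule k (Fin N → k) :=
  (W.restrictScalars k).comap ((Algebra.linearMap k κ).compLeft (Fin N))

theorem mem_descend {W : Submodule κ (Fin N → κ)} {x : Fin N → k} :
    x ∈ descend W ↔ (fun i => algebraMap k κ (x i)) ∈ W := Iff.rfl

theorem descend_ne_top {W : Submodule κ (Fin N → κ)} (h : W ≠ ⊤) :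
    (descend W : Submodule k (Fin N → k)) ≠ ⊤ := by
  classical
  intro htop
  refine h (top_le_iff.1 fun v _ => ?_)
  rw [pi_eq_sum_univ' v]
  refine Submodule.sum_mem _ fun i _ => Submodule.smul_mem _ _ ?_
  have h1 : (Pi.single i 1 : Fin N → k) ∈ (descend W : Submodule k (Fin N → k)) := htop ▸ trivial
  convert! mem_descend.1 h1 using 1
  ext j
  by_cases hij : i = j
  · subst hij; simp
  · simp [Ne.symm hij]

/-- The subspace spanned by a subspace and a list of vectors. -/
def adjoinList (W : Submodule κ (Fin N → κ)) (l : List (Fin N → k)) : Submodule κ (Fin N → κ) :=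
  W ⊔ Submodule.span κ {v | ∃ x ∈ l, v = fun i => algebraMap k κ (x i)}

theorem adjoinList_nil (W : Submodule κ (Fin N → κ)) :
    adjoinList W ([] : List (Fin N → k)) = W := by
  have : {v : Fin N → κ | ∃ x ∈ ([] : List (Fin N → k)), v = fun i => algebraMap k κ (x i)} = ∅ := by
    ext; simp
  rw [adjoinList, this, Submodule.span_empty, sup_bot_eq]

theorem adjoinList_cons (W : Submodule κ (Fin N → κ)) (x : Fin N → k) (l : List (Fin N → k)) :
    adjoinList W (x :: l) =
      adjoinList W l ⊔ Submodule.span κ {fun i => algebraMap k κ (x i)} := by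
  rw [adjoinList, adjoinList, sup_assoc, ← Submodule.span_union]
  congr 2
  ext v
  simp

theorem finrank_adjoinList_le (W : Submodule κ (Fin N → κ)) (l : List (Fin N → k)) :
    Module.finrank κ (adjoinList W l) ≤ Module.finrank κ W + l.length := by
  induction l with
  | nil => rw [adjoinList_nil, List.length_nil, add_zero]
  | cons x l ih =>
    rw [adjoinList_cons, List.length_cons]
    refine (Submodule.finrank_add_le_finrank_add_finrank _ _).trans ?_
    have := finrank_span_le_card (R := κ) ({fun i => algebraMap k κ (x i)} : Set (Fin N → κ))
    rw [Set.toFinset_singleton, Finset.card_singleton] at this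
    omega

theorem finrank_adjoinList {W : Submodule κ (Fin N → κ)} {xs : List (Fin N → k)}
    (h : ∀ x l, (x :: l).Sublist xs → x ∉ (descend (adjoinList W l) : Submodule k (Fin N → k))) :
    Module.finrank κ (adjoinList W xs) = Module.finrank κ W + xs.length := by
  induction xs with
  | nil => rw [adjoinList_nil, List.length_nil, add_zero]
  | cons x l ih =>
    have h1 := ih fun y l' hl => h y l' (hl.trans (List.sublist_cons_self x l))
    refine le_antisymm (finrank_adjoinList_le _ _) ?_
    rw [List.length_cons, ← add_assoc, ← h1]
    refine Nat.succ_le_of_lt (Submodule.finrank_lt_finrank_of_lt ?_)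
    rw [adjoinList_cons]
    refine lt_of_le_of_ne le_sup_left fun heq => h x l (List.Sublist.refl _) ?_
    rw [mem_descend, heq]
    exact le_sup_right (a := adjoinList W l) (Submodule.mem_span_singleton_self _)

theorem exists_dual_of_finrank_adjoinList {W : Submodule κ (Fin N → κ)} {xs : List (Fin N → k)}
    (h : Module.finrank κ (adjoinList W xs) = Module.finrank κ W + xs.length)
    (hN : N = Module.finrank κ W + xs.length) :
    adjoinList W xs = ⊤ ∧ ∃ Λ : (Fin N → κ) →ₗ[κ] (Fin xs.length → κ), (∀ w ∈ W, Λ w = 0) ∧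
      ∀ i : Fin xs.length, Λ (fun j => algebraMap k κ (xs[i] j)) = Pi.single i 1 := by
  have htop : adjoinList W xs = ⊤ := Submodule.eq_top_of_finrank_eq (by
    rw [h, Module.finrank_fin_fun, ← hN])
  refine ⟨htop, ?_⟩
  let b : Fin xs.length → (Fin N → κ) ⧸ W := fun i => W.mkQ fun j => algebraMap k κ (xs[i] j)
  have hcard : Fintype.card (Fin xs.length) = Module.finrank κ ((Fin N → κ) ⧸ W) := by
    have := Submodule.finrank_quotient_add_finrank W
    rw [Module.finrank_fin_fun] at this
    rw [Fintype.card_fin]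
    omega
  have hspan : ⊤ ≤ Submodule.span κ (Set.range b) := by
    rintro v -
    obtain ⟨v, rfl⟩ := W.mkQ_surjective v
    have hv : v ∈ adjoinList W xs := htop ▸ trivial
    obtain ⟨w, hw, u, hu, rfl⟩ := Submodule.mem_sup.1 hv
    rw [map_add, show W.mkQ w = 0 by simpa using hw, zero_add]
    have h1 := Submodule.mem_map_of_mem (f := W.mkQ) hu
    rw [Submodule.map_span] at h1
    refine Submodule.span_mono ?_ h1
    rintro _ ⟨_, ⟨x, hx, rfl⟩, rfl⟩
    obtain ⟨i, hi, rfl⟩ := List.getElem_of_mem hx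
    exact ⟨⟨i, hi⟩, rfl⟩
  let B := basisOfTopLeSpanOfCardEqFinrank b hspan hcard
  refine ⟨B.equivFun.toLinearMap ∘ₗ W.mkQ, fun w hw => ?_, fun i => ?_⟩
  · have : W.mkQ w = 0 := by simpa using hw
    rw [LinearMap.comp_apply, this, map_zero]
  · rw [LinearMap.comp_apply]
    change B.equivFun (b i) = _
    rw [show b i = B i from (congrFun (coe_basisOfTopLeSpanOfCardEqFinrank b hspan hcard) i).symm]
    ext j
    simp [Pi.single_apply, eq_comm]

theorem span_eq_top_of_residue {O : Type} [CommRing O] [IsLocalRing O] {ι : Type} [Finite ι]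
    (w : ι → Fin N → O)
    (h : Submodule.span (maximalIdeal O).ResidueField
      (Set.range fun a i => algebraMap O (maximalIdeal O).ResidueField (w a i)) = ⊤) :
    Submodule.span O (Set.range w) = ⊤ := by
  classical
  have := Fintype.ofFinite ι
  refine top_le_iff.1 (Submodule.le_of_le_smul_of_le_jacobson_bot (I := maximalIdeal O)
    Module.Finite.fg_top (IsLocalRing.maximalIdeal_le_jacobson _) ?_)
  rintro v -
  have hv : (fun i => algebraMap O (maximalIdeal O).ResidueField (v i)) ∈
    Submodule.span (maximalIdeal O).ResidueField
      (Set.range fun a i => algebraMap O (maximalIdeal O).ResidueField (w a i)) := h ▸ trivial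
  obtain ⟨c, hc⟩ := (Submodule.mem_span_range_iff_exists_fun _).1 hv
  choose c' hc' using fun a => Ideal.algebraMap_residueField_surjective (maximalIdeal O) (c a)
  refine Submodule.mem_sup.2 ⟨∑ a, c' a • w a, Submodule.sum_mem _ fun a _ =>
    Submodule.smul_mem _ _ (Submodule.subset_span ⟨a, rfl⟩), v - ∑ a, c' a • w a, ?_, by abel⟩
  rw [pi_eq_sum_univ' (v - ∑ a, c' a • w a)]
  refine Submodule.sum_mem _ fun i _ => Submodule.smul_mem_smul ?_ trivial
  rw [← Ideal.algebraMap_residueField_eq_zero]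
  have h1 := congrFun hc i
  simp only [Finset.sum_apply, Pi.smul_apply, smul_eq_mul] at h1
  simp [← h1, hc']

end

section

open IsLocalRing MvPolynomial

variable {k : Type} [Field k] [CharZero k]

open KaehlerDifferential in
theorem false_of_D_eq_sum {O A : Type} [CommRing O] [Algebra k O] [CommRing A] [Algebra k A]
    [Algebra.EssFiniteType k A] (η : O →ₐ[k] A) {P Q : Ideal A} [P.IsPrime] [Q.IsPrime] (hPQ : P ≤ Q)
    {m q ρ : ℕ} (f : Fin m → O) (s : Fin ρ → Fin m) (t : Fin q → A) (r : Fin m → Fin q → O)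
    (cf : Fin m → Fin ρ → O) (ω : Fin q → Ω[O⁄k])
    (hmax : ∀ P' : Ideal A, P'.IsPrime → P ≤ P' → P' ≤ Q → (∃ j, η (f j) ∉ P') → P' = P)
    (hfQ : ∀ j, η (f j) ∈ Q) (hfP : ∃ j, η (f j) ∉ P) (hs : ∀ a, η (f (s a)) ∈ P)
    (ht : ∀ i, t i ∉ Q)
    (hr : ∀ j i, η (r j i) * t i ∈ Ideal.span (Set.range fun j => η (f j)) ⊔ P)
    (hD : ∀ j, D k O (f j) = ∑ i, r j i • ω i + ∑ a, cf j a • D k O (f (s a))) : False := by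
  obtain ⟨j₀, hj₀⟩ := hfP
  have hmemQ : ∀ a : A, (Ideal.Quotient.mk P a ∈ Q.map (Ideal.Quotient.mk P) ↔ a ∈ Q) := fun a => by
    rw [← Ideal.mem_comap, Ideal.comap_map_of_surjective' _ Ideal.Quotient.mk_surjective,
      Ideal.mk_ker, sup_eq_left.2 hPQ]
  have : (Q.map (Ideal.Quotient.mk P)).IsPrime :=
    Ideal.map_isPrime_of_surjective Ideal.Quotient.mk_surjective (by rwa [Ideal.mk_ker])
  obtain ⟨V, _, _, _, _, _, ψ, hψ0, hψm, hψu⟩ :=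
    exists_isDiscreteValuationRing_algHom k (Q.map (Ideal.Quotient.mk P))
      (g := Ideal.Quotient.mk P (η (f j₀))) (by rwa [Ne, Ideal.Quotient.eq_zero_iff_mem])
      ((hmemQ _).2 (hfQ _))
  let χ : A →ₐ[k] V := ψ.comp (Ideal.Quotient.mkₐ k P)
  have hχP : ∀ a ∈ P, χ a = 0 := fun a ha => by
    change ψ (Ideal.Quotient.mk P a) = 0
    rw [Ideal.Quotient.eq_zero_iff_mem.2 ha, map_zero]
  have hχu : ∀ a, a ∉ Q → IsUnit (χ a) := fun a ha => hψu _ fun h => ha ((hmemQ a).1 h)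
  have hχm : ∀ j, χ (η (f j)) ∈ maximalIdeal V := by
    by_contra! h
    have := hmax ((maximalIdeal V).comap χ) inferInstance
      (fun a ha => by rw [Ideal.mem_comap, hχP a ha]; exact zero_mem _)
      (fun a ha => by
        by_contra haQ
        exact (mem_maximalIdeal _).1 (Ideal.mem_comap.1 ha) (hχu a haQ)) h
    exact hj₀ (this ▸ hψm)
  let Ψ : O →ₐ[k] V := χ.comp η
  let _ : Algebra O V := Ψ.toRingHom.toAlgebra
  have : IsScalarTower k O V := IsScalarTower.of_algebraMap_eq fun a => (Ψ.commutes a).symm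
  have halg : ∀ a, algebraMap O V a = Ψ a := fun a => rfl
  let J : Ideal V := Ideal.span (Set.range fun j => Ψ (f j))
  obtain ⟨γ, hγ⟩ : ∃ γ, J = Ideal.span {γ} := ⟨_, (Ideal.span_singleton_generator J).symm⟩
  have hmemJ : ∀ a, a ∈ J → ∃ b, a = γ * b := fun a ha => by
    rw [hγ, Ideal.mem_span_singleton] at ha; exact ha
  have hfJ : ∀ j, Ψ (f j) ∈ J := fun j => Ideal.subset_span ⟨j, rfl⟩
  have hγJ : γ ∈ J := hγ ▸ Ideal.mem_span_singleton_self γ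
  have hγ0 : γ ≠ 0 := by
    rintro rfl
    obtain ⟨b, hb⟩ := hmemJ _ (hfJ j₀)
    rw [zero_mul] at hb
    exact hψ0 hb
  have hJm : J ≤ maximalIdeal V := Ideal.span_le.2 (by rintro _ ⟨j, rfl⟩; exact hχm j)
  have hrJ : ∀ j i, Ψ (r j i) ∈ J := fun j i => by
    have h1 : χ (η (r j i) * t i) ∈ J := by
      obtain ⟨a, ha, b, hb, hab⟩ := Submodule.mem_sup.1 (hr j i)
      rw [← hab, map_add, hχP b hb, add_zero]
      have : Ideal.span (Set.range fun j => η (f j)) ≤ J.comap χ :=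
        Ideal.span_le.2 (by rintro _ ⟨j, rfl⟩; exact hfJ j)
      exact this ha
    rw [map_mul] at h1
    exact (Ideal.mul_unit_mem_iff_mem _ (hχu _ (ht i))).1 h1
  let U : Submodule V (Ω[V⁄k]) := LinearMap.range (LinearMap.lsmul V (Ω[V⁄k]) γ)
  have hJU : ∀ a ∈ J, ∀ w : Ω[V⁄k], a • w ∈ U := fun a ha w => by
    obtain ⟨b, rfl⟩ := hmemJ a ha
    exact ⟨b • w, by rw [LinearMap.lsmul_apply, smul_smul]⟩
  have hDf : ∀ j, D k V (Ψ (f j)) ∈ U := fun j => by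
    have h1 := congrArg (KaehlerDifferential.map k k O V) (hD j)
    have h2 : ∀ a, D k V (Ψ (f (s a))) = 0 := fun a => by
      rw [show Ψ (f (s a)) = 0 from hχP _ (hs a), map_zero]
    simp only [KaehlerDifferential.map_D, map_add, map_sum, map_smul, halg, h2, smul_zero,
      Finset.sum_const_zero, add_zero] at h1
    rw [h1]
    refine Submodule.sum_mem _ fun i _ => ?_
    rw [← algebraMap_smul V, halg]
    exact hJU _ (hrJ j i) _
  have hDJ : ∀ a ∈ J, D k V a ∈ U := fun a ha => by
    induction ha using Submodule.span_induction with
    | mem x hx => obtain ⟨j, rfl⟩ := hx; exact hDf j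
    | zero => rw [map_zero]; exact zero_mem _
    | add x y _ _ hx hy => rw [map_add]; exact add_mem hx hy
    | smul b x hxJ hx =>
      rw [smul_eq_mul, Derivation.leibniz]
      exact add_mem (Submodule.smul_mem _ _ hx) (hJU x hxJ _)
  obtain ⟨w, hw⟩ := hDJ γ hγJ
  exact D_ne_smul hγ0 (hJm hγJ) w hw.symm

end

section

open IsLocalRing MvPolynomial

/-- A prime ideal between two given primes that is maximal among those not containing a family. -/
theorem exists_maximal_prime_notMem {A ι : Type} [CommRing A] [IsNoetherianRing A] (g : ι → A)
    {P₀ Q : Ideal A} (hP₀ : P₀.IsPrime) (hQ : P₀ ≤ Q) (hg : ∃ j, g j ∉ P₀) :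
    ∃ P : Ideal A, P.IsPrime ∧ P₀ ≤ P ∧ P ≤ Q ∧ (∃ j, g j ∉ P) ∧
      ∀ P' : Ideal A, P'.IsPrime → P ≤ P' → P' ≤ Q → (∃ j, g j ∉ P') → P' = P := by
  obtain ⟨P, ⟨h1, h2, h3, h4⟩, h5⟩ := WellFounded.has_min (wellFounded_gt (α := Ideal A))
    {P | P.IsPrime ∧ P₀ ≤ P ∧ P ≤ Q ∧ ∃ j, g j ∉ P} ⟨P₀, hP₀, le_rfl, hQ, hg⟩
  refine ⟨P, h1, h2, h3, h4, fun P' h1' h2' h3' h4' => ?_⟩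
  by_contra hne
  exact h5 P' ⟨h1', h2.trans h2', h3', h4'⟩ (lt_of_le_of_ne h2' (Ne.symm hne))

theorem height_le_of_mem_minimalPrimes_span_range {A ι : Type} [CommRing A] [IsNoetherianRing A]
    [Fintype ι] (g : ι → A) {P : Ideal A} (hP : P ∈ (Ideal.span (Set.range g)).minimalPrimes) :
    P.height ≤ Fintype.card ι := by
  classical
  have h : Set.range g = ((Finset.univ.image g : Finset A) : Set A) := by simp
  rw [h] at hP
  refine (Ideal.height_le_card_of_mem_minimalPrimes_span_finset hP).trans (Nat.cast_le.2 ?_)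
  exact Finset.card_image_le

section

variable {O κ : Type} [CommRing O] [Field κ] [Algebra O κ] {N q : ℕ}

/-- Evaluation of polynomials at the coordinates given by a linear map over the residue field. -/
noncomputable def coordHom (O : Type) [CommRing O] [Algebra O κ]
    (Λ : (Fin N → κ) →ₗ[κ] (Fin q → κ)) :
    MvPolynomial (Fin N) O →+* MvPolynomial (Fin q) κ :=
  eval₂Hom (C.comp (algebraMap O κ)) fun i => linForm (Λ (Pi.single i 1))

theorem coordHom_C (Λ : (Fin N → κ) →ₗ[κ] (Fin q → κ)) (a : O) :
    coordHom O Λ (C a) = C (algebraMap O κ a) := by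
  simp [coordHom]

theorem coordHom_linForm (Λ : (Fin N → κ) →ₗ[κ] (Fin q → κ)) (v : Fin N → O) :
    coordHom O Λ (linForm v) = linForm (Λ fun i => algebraMap O κ (v i)) := by
  classical
  have h : (fun i => algebraMap O κ (v i)) = ∑ i, algebraMap O κ (v i) • Pi.single i (1 : κ) := by
    rw [pi_eq_sum_univ' fun i => algebraMap O κ (v i)]
  have hs : ∀ (t : Finset (Fin N)) (w : Fin N → Fin q → κ),
      linForm (∑ i ∈ t, w i) = ∑ i ∈ t, linForm (w i) := fun t w => by
    induction t using Finset.induction_on with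
    | empty => simp [linForm_zero]
    | insert a t ha ih => rw [Finset.sum_insert ha, Finset.sum_insert ha, linForm_add, ih]
  rw [h, map_sum, hs]
  simp only [map_smul, linForm_smul]
  rw [linForm, map_sum]
  simp [coordHom]

end

section

set_option linter.unusedSectionVars false

variable {O : Type} [CommRing O] [IsRegularLocalRing O] [IsRegularRing O] {N c m e : ℕ}
  {f : Fin m → O} {φ : Fin m → Fin N → O} {I : Ideal (MvPolynomial (Fin N) O)}

theorem LocalSetup.exists_prime_notMem (S : LocalSetup c e f φ I)
    (hrank : rankAt (maximalIdeal O) φ + c = m) {ρ : ℕ} (hρ : ρ + c = m) (s : Fin ρ → Fin m)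
    {Q : Ideal (MvPolynomial (Fin N) O)} [Q.IsPrime]
    (hC : ∀ j, C (f j) ∈ Q) (hl : ∀ j, linForm (φ j) ∈ Q) :
    ∃ P : Ideal (MvPolynomial (Fin N) O), P.IsPrime ∧ P ≤ Q ∧ (∀ j, linForm (φ j) ∈ P) ∧
      (∀ a, C (f (s a)) ∈ P) ∧ ∃ j, C (f j) ∉ P := by
  let g : Fin ρ ⊕ Fin m → MvPolynomial (Fin N) O :=
    Sum.elim (fun a => C (f (s a))) fun j => linForm (φ j)
  obtain ⟨P, hP, hPQ⟩ := Ideal.exists_minimalPrimes_le (I := Ideal.span (Set.range g)) (J := Q)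
    (Ideal.span_le.2 (by rintro _ ⟨a | j, rfl⟩; exacts [hC _, hl _]))
  have hprime : P.IsPrime := hP.1.1
  have hgP : ∀ a, g a ∈ P := fun a => hP.1.2 (Ideal.subset_span ⟨a, rfl⟩)
  refine ⟨P, hprime, hPQ, fun j => hgP (.inr j), fun a => hgP (.inl a), ?_⟩
  by_contra! hall
  have h1 := height_le_of_mem_minimalPrimes_span_range g hP
  have h2 := height_add_rankAt_le φ (P.comap C) P rfl fun j => hgP (.inr j)
  have h3 : ((2 * m : ℕ) : ℕ∞) ≤ (P.comap C).height + rankAt (P.comap C) φ := by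
    by_cases hmax : P.comap C = maximalIdeal O
    · have : ∀ (Q : Ideal O) (_ : Q.IsPrime), Q = maximalIdeal O →
          ((2 * m : ℕ) : ℕ∞) ≤ Q.height + rankAt Q φ := by
        rintro _ _ rfl
        rw [S.height_eq, ← Nat.cast_add, Nat.cast_le]
        omega
      exact this _ inferInstance hmax
    · exact S.rank _ hmax hall
  have h4 := (h3.trans h2).trans h1
  rw [Fintype.card_sum, Fintype.card_fin, Fintype.card_fin, Nat.cast_le] at h4
  have := S.one_le_c
  omega

end

end

section

open IsLocalRing MvPolynomial

set_option linter.unusedSectionVars false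

variable {k : Type} [Field k]
variable {O : Type} [CommRing O] [Algebra k O] [IsRegularLocalRing O] [IsRegularRing O]
  {N c m e : ℕ} {f : Fin m → O} {φ : Fin m → Fin N → O} {I : Ideal (MvPolynomial (Fin N) O)}

theorem exists_pivots (Q : Ideal O) [Q.IsPrime] (φ : Fin m → Fin N → O) :
    ∃ s : Fin (rankAt Q φ) → Fin m,
      Submodule.span Q.ResidueField
        (Set.range fun a i => algebraMap O Q.ResidueField (φ (s a) i)) =
      Submodule.span Q.ResidueField (Set.range fun j i => algebraMap O Q.ResidueField (φ j i)) := by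
  obtain ⟨w, hw, hspan, -⟩ := Submodule.exists_fun_fin_finrank_span_eq Q.ResidueField
    (Set.range fun j i => algebraMap O Q.ResidueField (φ j i))
  choose s hs using hw
  refine ⟨s, ?_⟩
  rw [← hspan]
  congr 2
  exact funext hs

theorem linForm_sum {ι : Type} (t : Finset ι) (w : ι → Fin N → O) :
    linForm (∑ i ∈ t, w i) = ∑ i ∈ t, linForm (w i) := by
  classical
  induction t using Finset.induction_on with
  | empty => simp [linForm_zero]
  | insert a t ha ih => rw [Finset.sum_insert ha, Finset.sum_insert ha, linForm_add, ih]

theorem kForm_mem_formIdeal_eraseIdx {xs : List (Fin N → k)} {i l : Fin xs.length} (h : l ≠ i) :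
    kForm O xs[l] ∈ formIdeal O (xs.eraseIdx i) :=
  kForm_mem_formIdeal (List.mem_eraseIdx_iff_getElem.2 ⟨l, l.2, fun h' => h (Fin.ext h'), rfl⟩)

theorem eval_coordHom_kForm {κ : Type} [Field κ] [Algebra O κ] [Algebra k κ] [IsScalarTower k O κ]
    {xs : List (Fin N → k)}
    (Λ : (Fin N → κ) →ₗ[κ] (Fin xs.length → κ))
    (hΛ : ∀ i : Fin xs.length, Λ (fun j => algebraMap k κ (xs[i] j)) = Pi.single i 1)
    (i l : Fin xs.length) :
    eval (Pi.single i (1 : κ)) (coordHom O Λ (kForm O xs[l])) = if l = i then 1 else 0 := by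
  rw [kForm, coordHom_linForm]
  simp only [← IsScalarTower.algebraMap_apply k O κ]
  rw [hΛ l, linForm_single, eval_X, Pi.single_apply]

theorem coordHom_formIdeal_eraseIdx {κ : Type} [Field κ] [Algebra O κ] [Algebra k κ]
    [IsScalarTower k O κ] {xs : List (Fin N → k)}
    (Λ : (Fin N → κ) →ₗ[κ] (Fin xs.length → κ))
    (hΛ : ∀ i : Fin xs.length, Λ (fun j => algebraMap k κ (xs[i] j)) = Pi.single i 1)
    (i : Fin xs.length) {h : MvPolynomial (Fin N) O} (hh : h ∈ formIdeal O (xs.eraseIdx i)) :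
    eval (Pi.single i (1 : κ)) (coordHom O Λ h) = 0 := by
  have : formIdeal O (xs.eraseIdx i) ≤
      RingHom.ker ((eval (Pi.single i (1 : κ))).comp (coordHom O Λ)) := by
    refine Ideal.span_le.2 ?_
    rintro _ ⟨x, hx, rfl⟩
    obtain ⟨l, hl, hne, rfl⟩ := List.mem_eraseIdx_iff_getElem.1 hx
    have := eval_coordHom_kForm (O := O) Λ hΛ i ⟨l, hl⟩
    rw [if_neg fun h' => hne (congrArg Fin.val h')] at this
    exact this
  exact this hh

/-- If the linear forms have corank exactly the dimension at the closed point, then the relations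
of the forms with the differentials of `f` are incompatible with the depth assumption. -/
theorem LocalSetup.rank_ne [CharZero k] [Algebra.EssFiniteType k O] (S : LocalSetup c e f φ I)
    (x : Fin N → O)
    (hD : ∀ j, KaehlerDifferential.D k O (f j) = ∑ i, φ j i • KaehlerDifferential.D k O (x i)) :
    rankAt (maximalIdeal O) φ + c ≠ m := by
  intro hrank
  have hc := S.one_le_c
  obtain ⟨s, hs⟩ := exists_pivots (maximalIdeal O) φ
  obtain ⟨W, hW⟩ : ∃ W, W = Submodule.span (maximalIdeal O).ResidueField
      (Set.range fun j i => algebraMap O (maximalIdeal O).ResidueField (φ j i)) := ⟨_, rfl⟩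
  have hWr : Module.finrank (maximalIdeal O).ResidueField W = rankAt (maximalIdeal O) φ := by
    rw [hW, rankAt]
  have hN := S.eq_add
  obtain ⟨xs, hlen, hgen, hF⟩ := S.exists_general_list (k := k)
    (fun l => {descend (adjoinList W l)}) (fun l => Set.finite_singleton _) (by
      rintro l hl _ rfl
      refine descend_ne_top fun htop => ?_
      have := finrank_adjoinList_le W l
      rw [htop, finrank_top, Module.finrank_fin_fun] at this
      omega)
  have hfin := finrank_adjoinList fun y l hl => hgen y l hl _ rfl
  obtain ⟨htop, Λ, hΛ0, hΛ⟩ := exists_dual_of_finrank_adjoinList hfin (by omega)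
  -- expressing the rows of `φ`
  let w : Fin xs.length ⊕ Fin (rankAt (maximalIdeal O) φ) → Fin N → O :=
    Sum.elim (fun i l => algebraMap k O (xs[i] l)) fun a => φ (s a)
  have hw : Submodule.span O (Set.range w) = ⊤ := by
    refine span_eq_top_of_residue w (top_le_iff.1 ?_)
    rw [← htop, adjoinList, hW, ← hs]
    refine sup_le (Submodule.span_mono ?_) (Submodule.span_mono ?_)
    · rintro _ ⟨a, rfl⟩
      exact ⟨.inr a, rfl⟩
    · rintro _ ⟨y, hy, rfl⟩
      obtain ⟨l, hl, rfl⟩ := List.mem_iff_getElem.1 hy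
      refine ⟨.inl ⟨l, hl⟩, funext fun i => ?_⟩
      exact (IsScalarTower.algebraMap_apply k O _ _).symm
  have hexp : ∀ j, ∃ b : Fin xs.length ⊕ Fin (rankAt (maximalIdeal O) φ) → O, ∑ a, b a • w a = φ j :=
    fun j => (Submodule.mem_span_range_iff_exists_fun O).1 (hw ▸ Submodule.mem_top)
  choose b hb using hexp
  simp only [Fintype.sum_sum_type] at hb
  -- the elements `t`
  have hpow : ∀ i : Fin xs.length, (kForm O xs[i] ^ c).IsHomogeneous c := fun i => by
    simpa using (isHomogeneous_kForm (O := O) xs[i]).pow c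
  have hlen' : ∀ i : Fin xs.length, (xs.eraseIdx i).length + 1 = c + e := fun i => by
    rw [List.length_eraseIdx_of_lt i.2]; omega
  have ht : ∀ i : Fin xs.length, ∃ t ∈ I, ∃ h ∈ formIdeal O (xs.eraseIdx i),
      t.IsHomogeneous c ∧ h.IsHomogeneous c ∧ kForm O xs[i] ^ c = t + h := fun i =>
    S.homogIdeal.exists_isHomogeneous_add (homogIdeal_formIdeal _) (hpow i)
      (hF _ (List.eraseIdx_sublist _ _) (hlen' i) _ (hpow i)).1
  choose t htI h hh htc _ hth using ht
  have hl : ∀ j, linForm (φ j) = ∑ i, C (b j (.inl i)) * kForm O xs[i] +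
      ∑ a, C (b j (.inr a)) * linForm (φ (s a)) := fun j => by
    rw [← hb j, linForm_add, linForm_sum, linForm_sum]
    simp only [linForm_smul]
    rfl
  have hr : ∀ j i, C (b j (.inl i)) * t i ∈ relIdeal f φ m := fun j i => by
    obtain ⟨v, hv⟩ : ∃ v, v = linForm (φ j) - ∑ a, C (b j (.inr a)) * linForm (φ (s a)) := ⟨_, rfl⟩
    have hv1 : v = ∑ i, C (b j (.inl i)) * kForm O xs[i] := by rw [hv, hl j]; ring
    have hvmem : v ∈ relIdeal f φ m := by
      rw [hv]
      exact sub_mem (linForm_mem_relIdeal f φ j j.2) (sum_mem fun a _ => Ideal.mul_mem_left _ _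
        (linForm_mem_relIdeal f φ _ (s a).2))
    have hvh : v.IsHomogeneous 1 := by
      rw [hv1]
      exact IsHomogeneous.sum _ _ _ fun i _ => by
        simpa using (isHomogeneous_C _ (b j (.inl i))).mul (isHomogeneous_kForm (O := O) xs[i])
    have hu : (C (b j (.inl i)) * t i - kForm O xs[i] ^ (c - 1) * v).IsHomogeneous c := by
      refine IsHomogeneous.sub (by simpa using (isHomogeneous_C _ (b j (.inl i))).mul (htc i)) ?_
      have := ((isHomogeneous_kForm (O := O) xs[i]).pow (c - 1)).mul hvh
      rwa [one_mul, Nat.sub_add_cancel hc] at this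
    have hmem := (hF _ (List.eraseIdx_sublist _ _) (hlen' i) _ hu).2
      (sub_mem (Ideal.mul_mem_left _ _ (htI i))
        (Ideal.mul_mem_left _ _ (S.relIdeal_le hvmem))) (by
        have hsplit : C (b j (.inl i)) * t i - kForm O xs[i] ^ (c - 1) * v =
            -(C (b j (.inl i)) * h i) - kForm O xs[i] ^ (c - 1) *
              ∑ l ∈ Finset.univ.erase i, C (b j (.inl l)) * kForm O xs[l] := by
          rw [hv1, ← Finset.add_sum_erase _ _ (Finset.mem_univ i), mul_add, eq_sub_of_add_eq (hth i).symm,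
            show kForm O xs[i] ^ (c - 1) * (C (b j (.inl i)) * kForm O xs[i]) =
              C (b j (.inl i)) * (kForm O xs[i] ^ (c - 1) * kForm O xs[i]) by ring, ← pow_succ,
            Nat.sub_add_cancel hc]
          ring
        rw [hsplit]
        exact sub_mem (neg_mem (Ideal.mul_mem_left _ _ (hh i))) (Ideal.mul_mem_left _ _
          (sum_mem fun l hl => Ideal.mul_mem_left _ _
            (kForm_mem_formIdeal_eraseIdx (Finset.ne_of_mem_erase hl)))))
    have := add_mem hmem (Ideal.mul_mem_left _ (kForm O xs[i] ^ (c - 1)) hvmem)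
    rwa [sub_add_cancel] at this
  -- the centre
  have hQC : ∀ j, C (f j) ∈ RingHom.ker (coordHom O Λ) := fun j => by
    rw [RingHom.mem_ker, coordHom_C, Ideal.algebraMap_residueField_eq_zero.2 (S.mem j), C_0]
  have hQl : ∀ j, linForm (φ j) ∈ RingHom.ker (coordHom O Λ) := fun j => by
    rw [RingHom.mem_ker, coordHom_linForm, hΛ0 _ (hW ▸ Submodule.subset_span ⟨j, rfl⟩), linForm_zero]
  have hQt : ∀ i, t i ∉ RingHom.ker (coordHom O Λ) := fun i hi => by
    have h1 := congrArg (fun F => eval (Pi.single i 1) (coordHom O Λ F)) (hth i)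
    simp only [map_pow, map_add, eval_coordHom_kForm Λ hΛ, RingHom.mem_ker.1 hi, map_zero,
      coordHom_formIdeal_eraseIdx Λ hΛ i (hh i), if_true, one_pow, add_zero] at h1
    exact one_ne_zero h1
  have hQ : (RingHom.ker (coordHom O Λ)).IsPrime := RingHom.ker_isPrime _
  obtain ⟨P₀, hP₀, hP₀Q, hP₀l, hP₀s, hP₀f⟩ := S.exists_prime_notMem hrank hrank s hQC hQl
  obtain ⟨P, hP, hP₀P, hPQ, hPf, hmax⟩ :=
    exists_maximal_prime_notMem (fun j => C (f j)) hP₀ hP₀Q hP₀f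
  have hEss : Algebra.EssFiniteType k (MvPolynomial (Fin N) O) := .comp k O _
  let η : O →ₐ[k] MvPolynomial (Fin N) O := IsScalarTower.toAlgHom k O _
  have hη : ∀ a, η a = C a := fun a => rfl
  refine false_of_D_eq_sum η hPQ f s t (fun j i => b j (.inl i)) (fun j a => b j (.inr a))
    (fun i => ∑ l, algebraMap k O (xs[i] l) • KaehlerDifferential.D k O (x l))
    hmax hQC hPf (fun a => hP₀P (hP₀s a)) hQt (fun j i => ?_) fun j => ?_
  · have hle : relIdeal f φ m ≤ Ideal.span (Set.range fun j => η (f j)) ⊔ P := by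
      refine sup_le ?_ (Ideal.span_le.2 ?_)
      · rw [Ideal.map_le_iff_le_comap, Ideal.span_le]
        rintro _ ⟨j, rfl⟩
        exact Ideal.mem_sup_left (Ideal.subset_span ⟨j, rfl⟩)
      · rintro _ ⟨j, _, rfl⟩
        exact Ideal.mem_sup_right (hP₀P (hP₀l j))
    exact hle (hr j i)
  · simp only [hD]
    rw [← hb j]
    simp only [Pi.add_apply, Finset.sum_apply, Pi.smul_apply, add_smul, Finset.sum_add_distrib,
      Finset.sum_smul, Finset.smul_sum, smul_eq_mul, mul_smul]
    congr 1 <;> exact Finset.sum_comm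

end

section

open IsLocalRing MvPolynomial

variable {k : Type} [CommRing k] {N : ℕ}

theorem aeval_mul_left_of_isHomogeneous {A : Type} [CommRing A] [Algebra k A]
    {G : MvPolynomial (Fin N) k} {g : ℕ} (hG : G.IsHomogeneous g) (r : A) (v : Fin N → A) :
    aeval (fun i => r * v i) G = r ^ g * aeval v G := by
  rw [aeval_def, aeval_def, eval₂_eq', eval₂_eq', Finset.mul_sum]
  refine Finset.sum_congr rfl fun d hd => ?_
  have h : ∑ i, d i = g := by
    have := hG (mem_support_iff.1 hd)
    rw [← this, Finsupp.weight_apply, Finsupp.sum_fintype _ _ (by simp)]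
    simp
  simp only [mul_pow, Finset.prod_mul_distrib, Finset.prod_pow_eq_pow_sum, h]
  ring

theorem sum_mul_aeval_pderiv {A : Type} [CommRing A] [Algebra k A]
    {G : MvPolynomial (Fin N) k} {g : ℕ} (hG : G.IsHomogeneous g) (y : Fin N → A) :
    ∑ i, y i * aeval y (pderiv i G) = g * aeval y G := by
  have := congrArg (aeval y) hG.sum_X_mul_pderiv
  simpa using this

theorem aeval_eq_of_isHomogeneous_zero {A : Type} [CommRing A] [Algebra k A]
    {G : MvPolynomial (Fin N) k} (hG : G.IsHomogeneous 0) (y z : Fin N → A) :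
    aeval y G = aeval z G := by
  rw [← totalDegree_zero_iff_isHomogeneous, totalDegree_eq_zero_iff_eq_C] at hG
  rw [hG, aeval_C, aeval_C]

theorem pderiv_pderiv_comm (i j : Fin N) (G : MvPolynomial (Fin N) k) :
    pderiv i (pderiv j G) = pderiv j (pderiv i G) := by
  classical
  have h : ⁅pderiv (R := k) i, pderiv (R := k) j⁆ = 0 := by
    refine MvPolynomial.derivation_ext fun l => ?_
    rw [Derivation.commutator_apply, pderiv_X, pderiv_X, Derivation.zero_apply]
    simp only [Pi.single_apply]
    split_ifs <;> simp
  have h' := congrArg (fun D : Derivation k _ _ => D G) h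
  rw [Derivation.commutator_apply] at h'
  exact sub_eq_zero.1 h'

/-- The polar form of a quadratic form is symmetric. -/
theorem sum_mul_aeval_pderiv_comm {A : Type} [CommRing A] [Algebra k A]
    {G : MvPolynomial (Fin N) k} (hG : G.IsHomogeneous 2) (y z : Fin N → A) :
    ∑ i, z i * aeval y (pderiv i G) = ∑ i, y i * aeval z (pderiv i G) := by
  have h : ∀ (v w : Fin N → A) i, aeval v (pderiv i G) =
      ∑ j, v j * aeval w (pderiv j (pderiv i G)) := fun v w i => by
    have := sum_mul_aeval_pderiv (IsHomogeneous.pderiv (i := i) hG) v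
    rw [Nat.cast_one, one_mul] at this
    rw [← this]
    exact Finset.sum_congr rfl fun j _ => by
      rw [aeval_eq_of_isHomogeneous_zero (IsHomogeneous.pderiv (IsHomogeneous.pderiv hG)) v w]
  simp only [h y 0, h z 0, Finset.mul_sum]
  rw [Finset.sum_comm]
  refine Finset.sum_congr rfl fun i _ => Finset.sum_congr rfl fun j _ => ?_
  rw [pderiv_pderiv_comm]
  ring

open TrivSqZeroExt in
theorem aeval_inr {A : Type} [CommRing A] [Algebra k A]
    {G : MvPolynomial (Fin N) k} {g : ℕ} (hG : G.IsHomogeneous g) (η : Fin N → A) :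
    aeval (fun i => (inr (η i) : DualNumber A)) G = DualNumber.eps ^ g * inl (aeval η G) := by
  have h1 : (fun i => (inr (η i) : DualNumber A)) = fun i => DualNumber.eps * inl (η i) := by
    funext i
    ext <;> simp
  rw [h1, aeval_mul_left_of_isHomogeneous hG]
  congr 1
  exact (MvPolynomial.map_aeval η (inlHom A A) G).trans (by simp [aeval_def]; rfl) |>.symm

end

section

open IsLocalRing MvPolynomial TrivSqZeroExt

set_option linter.unusedSectionVars false

variable {k : Type} [Field k]
variable {O : Type} [CommRing O] [Algebra k O]
  {N m : ℕ} {f : Fin m → O} {φ : Fin m → Fin N → O} {x : Fin N → O}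
  {F : Fin m → MvPolynomial (Fin N) k} {deg : Fin m → ℕ}

theorem eval₂_dualNumber_eq_zero (hF : ∀ j, (F j).IsHomogeneous (deg j)) (hdeg : ∀ j, 1 ≤ deg j)
    (hf : ∀ j, f j = aeval x (F j)) (hφ : ∀ j i, φ j i = aeval x (pderiv i (F j)))
    {A : Type} [CommRing A] [Algebra k A] {η y : Fin N → A} {h : O →ₐ[k] DualNumber A}
    (hx : ∀ i, h (x i) = inr (η i)) (h1 : ∀ j, deg j = 1 → aeval η (F j) = 0)
    (h1' : ∀ j, deg j = 1 → aeval y (F j) = 0)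
    (h2 : ∀ j, deg j = 2 → ∑ i, aeval η (pderiv i (F j)) * y i = 0)
    {P : MvPolynomial (Fin N) O} (hP : P ∈ relIdeal f φ m) :
    eval₂ (h : O →+* DualNumber A) (fun i => inl (y i)) P = 0 := by
  have hG : ∀ G : MvPolynomial (Fin N) k, ∀ g, G.IsHomogeneous g →
      h (aeval x G) = DualNumber.eps ^ g * inl (aeval η G) := fun G g hG => by
    rw [← aeval_inr hG, ← AlgHom.comp_apply, comp_aeval]
    simp only [hx]
  have heps : ∀ g, 2 ≤ g → (DualNumber.eps : DualNumber A) ^ g = 0 := fun g hg => by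
    obtain ⟨b, rfl⟩ := Nat.exists_eq_add_of_le hg
    rw [pow_add, pow_two, DualNumber.eps_mul_eps, zero_mul]
  suffices relIdeal f φ m ≤ RingHom.ker (eval₂Hom (h : O →+* DualNumber A) fun i => inl (y i)) from
    this hP
  refine sup_le ?_ ?_
  · rw [Ideal.map_span, Ideal.span_le]
    rintro _ ⟨_, ⟨j, rfl⟩, rfl⟩
    rw [SetLike.mem_coe, RingHom.mem_ker, coe_eval₂Hom, eval₂_C, hf]
    refine (hG _ _ (hF j)).trans ?_
    rcases (hdeg j).lt_or_eq with hj | hj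
    · rw [heps _ hj, zero_mul]
    · rw [h1 j hj.symm, inl_zero, mul_zero]
  · rw [Ideal.span_le]
    rintro _ ⟨j, -, rfl⟩
    have h3 : ∀ i, h (φ j i) * inl (y i) =
        DualNumber.eps ^ (deg j - 1) * inl (aeval η (pderiv i (F j)) * y i) := fun i => by
      rw [hφ, hG _ _ (IsHomogeneous.pderiv (hF j)), mul_assoc, inl_mul_inl]
    have h4 : eval₂ (h : O →+* DualNumber A) (fun i => inl (y i)) (linForm (φ j)) =
        DualNumber.eps ^ (deg j - 1) * inl (∑ i, aeval η (pderiv i (F j)) * y i) := by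
      rw [linForm, eval₂_sum, inl_sum, Finset.mul_sum]
      refine Finset.sum_congr rfl fun i _ => ?_
      rw [eval₂_mul, eval₂_C, eval₂_X]
      exact h3 i
    rw [SetLike.mem_coe, RingHom.mem_ker, coe_eval₂Hom, h4]
    rcases (hdeg j).lt_or_eq with hj | hj
    · rcases (Nat.succ_le_of_lt hj).lt_or_eq with hj' | hj'
      · rw [heps _ (by omega), zero_mul]
      · rw [h2 j hj'.symm, inl_zero, mul_zero]
    · have : ∀ i, aeval η (pderiv i (F j)) = aeval y (pderiv i (F j)) := fun i => by
        have := IsHomogeneous.pderiv (i := i) (hF j)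
        rw [← hj] at this
        exact aeval_eq_of_isHomogeneous_zero this _ _
      simp only [this]
      have h5 := sum_mul_aeval_pderiv (hF j) y
      rw [h1' j hj.symm, mul_zero] at h5
      simp only [mul_comm _ (y _), h5, inl_zero, mul_zero]

theorem fst_eval₂_dualNumber {A : Type} [CommRing A] [Algebra k A] (y : Fin N → A)
    {h : O →ₐ[k] DualNumber A} {res : O →ₐ[k] k}
    (hres : ∀ a, fst (h a) = algebraMap k A (res a)) (P : MvPolynomial (Fin N) O) :
    fst (eval₂ (h : O →+* DualNumber A) (fun i => inl (y i)) P) =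
      aeval y (map (res : O →+* k) P) := by
  rw [aeval_def, eval₂_map]
  exact MvPolynomial.hom_eq_hom
    ((fstHom k A A : DualNumber A →+* A).comp
      (eval₂Hom (h : O →+* DualNumber A) fun i => inl (y i)))
    (eval₂Hom ((algebraMap k A).comp (res : O →+* k)) y)
    (by ext a; simp [hres]) (by intro i; simp) P

theorem sum_C_mul_pderiv_mem_relIdeal (hF : ∀ j, (F j).IsHomogeneous (deg j))
    (hf : ∀ j, f j = aeval x (F j)) (hφ : ∀ j i, φ j i = aeval x (pderiv i (F j)))
    {P : MvPolynomial (Fin N) O} (hP : P ∈ relIdeal f φ m) :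
    ∑ i, C (x i) * pderiv i P ∈ relIdeal f φ m := by
  have key : ∀ z : MvPolynomial (Fin N) O, (∀ a, ∑ i, C (x i) * pderiv i (a * z) =
      a * ∑ i, C (x i) * pderiv i z + (∑ i, C (x i) * pderiv i a) * z) := fun z a => by
    rw [Finset.mul_sum, Finset.sum_mul, ← Finset.sum_add_distrib]
    refine Finset.sum_congr rfl fun i _ => ?_
    rw [Derivation.leibniz, smul_eq_mul, smul_eq_mul]
    ring
  have hle : Submodule.span (MvPolynomial (Fin N) O)
      ((C '' Set.range f) ∪ {z | ∃ i : Fin m, i.1 < m ∧ z = linForm (φ i)}) = relIdeal f φ m := by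
    rw [← Ideal.span, Ideal.span_union, ← Ideal.map_span]
    rfl
  have hP' := hle.symm ▸ hP
  induction hP' using Submodule.span_induction with
  | mem z hz =>
    rcases hz with ⟨_, ⟨j, rfl⟩, rfl⟩ | ⟨j, -, rfl⟩
    · simp
    · have : ∑ i, C (x i) * pderiv i (linForm (φ j)) = C ((deg j : O) * f j) := by
        rw [hf, ← sum_mul_aeval_pderiv (hF j) x, map_sum]
        refine Finset.sum_congr rfl fun i _ => ?_
        rw [C_mul, ← hφ]
        congr 1
        classical
        rw [linForm, map_sum, Finset.sum_eq_single i]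
        · simp
        · intro b _ hb
          simp [pderiv_X, hb]
        · simp
      rw [this, C_mul]
      exact Ideal.mul_mem_left _ _ (C_mem_relIdeal f φ m j)
  | zero => simp
  | add a b ha hb h1 h2 =>
    simp only [map_add, mul_add, Finset.sum_add_distrib]
    exact add_mem (h1 (hle ▸ ha)) (h2 (hle ▸ hb))
  | smul a b hb h1 =>
    have hb' := hle ▸ hb
    rw [smul_eq_mul, key]
    exact add_mem (Ideal.mul_mem_left _ _ (h1 hb')) (Ideal.mul_mem_left _ _ hb')

theorem LocalSetup.aeval_eq_zero [CharZero k] [IsRegularLocalRing O] [IsRegularRing O] {c e : ℕ}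
    {I : Ideal (MvPolynomial (Fin N) O)} (S : LocalSetup c e f φ I)
    (hF : ∀ j, (F j).IsHomogeneous (deg j)) (hdeg : ∀ j, 1 ≤ deg j)
    (hf : ∀ j, f j = aeval x (F j)) (hφ : ∀ j i, φ j i = aeval x (pderiv i (F j)))
    {A : Type} [CommRing A] [Algebra k A] {y : Fin N → A} {h : O →ₐ[k] DualNumber A}
    (hx : ∀ i, h (x i) = inr (y i)) {res : O →ₐ[k] k}
    (hres : ∀ a, fst (h a) = algebraMap k A (res a))
    (hy : ∀ j, deg j ≤ 2 → aeval y (F j) = 0)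
    {t : MvPolynomial (Fin N) O} (ht : t.IsHomogeneous c) (htI : t ∈ I) :
    aeval y (map (res : O →+* k) t) = 0 := by
  have hDI : ∑ i, C (x i) * pderiv i t ∈ I := by
    obtain ⟨r, hr, h1⟩ := (S.mem_iff t).1 htI
    refine (S.mem_iff _).2 ⟨r, hr, ?_⟩
    have := sum_C_mul_pderiv_mem_relIdeal hF hf hφ h1
    rw [Finset.mul_sum]
    convert this using 2 with i
    rw [pderiv_C_mul]
    ring
  have hDh : (∑ i, C (x i) * pderiv i t).IsHomogeneous (c - 1) :=
    IsHomogeneous.sum _ _ _ fun i _ => by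
      have := (isHomogeneous_C (Fin N) (x i)).mul (IsHomogeneous.pderiv (i := i) ht)
      rwa [zero_add] at this
  have hD := S.mem_relIdeal_of_isHomogeneous (by have := S.one_le_c; omega) hDh hDI
  have h2 := eval₂_dualNumber_eq_zero hF hdeg hf hφ hx (y := y) (fun j hj => hy j (by omega))
    (fun j hj => hy j (by omega)) (fun j hj => by
      simp only [mul_comm _ (y _)]
      rw [sum_mul_aeval_pderiv (hF j), hy j hj.le, mul_zero]) hD
  have h3 : ∀ i, eval₂ (h : O →+* DualNumber A) (fun i => inl (y i)) (C (x i) * pderiv i t) =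
      inr (y i * aeval y (pderiv i (map (res : O →+* k) t))) := fun i => by
    rw [eval₂_mul, eval₂_C, pderiv_map, ← fst_eval₂_dualNumber y hres]
    refine (congrArg (· * _) (hx i)).trans ?_
    ext <;> simp [mul_comm]
  rw [eval₂_sum, Finset.sum_congr rfl fun i _ => h3 i, ← inr_sum,
    sum_mul_aeval_pderiv (ht.map _)] at h2
  have h4 := congrArg snd h2
  rw [snd_inr, snd_zero] at h4
  have hu : IsUnit (c : A) := by
    have : IsUnit (c : k) := (Nat.cast_ne_zero.2 (by have := S.one_le_c; omega)).isUnit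
    simpa using this.map (algebraMap k A)
  exact hu.mul_right_eq_zero.1 h4

end

section

open IsLocalRing MvPolynomial TrivSqZeroExt

set_option linter.unusedSectionVars false

theorem Submodule.exists_dual_complement {k : Type} [Field k] {N : ℕ}
    (H : Submodule k (Fin N → k)) :
    ∃ (r : ℕ) (w e : Fin r → Fin N → k), r + Module.finrank k H = N ∧
      (∀ v v', w v ⬝ᵥ e v' = if v = v' then 1 else 0) ∧
      (∀ u ∈ H, ∀ v, u ⬝ᵥ e v = 0) ∧ ∀ u, u - ∑ v, (u ⬝ᵥ e v) • w v ∈ H := by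
  classical
  let b := Module.finBasis k ((Fin N → k) ⧸ H)
  choose w hw using fun v => H.mkQ_surjective (b v)
  have key : ∀ (u : Fin N → k) v, u ⬝ᵥ (fun i => b.repr (H.mkQ (Pi.single i 1)) v) =
      b.repr (H.mkQ u) v := fun u v => by
    conv_rhs => rw [pi_eq_sum_univ' u]
    simp [dotProduct, Finsupp.finsetSum_apply]
  refine ⟨_, w, fun v i => b.repr (H.mkQ (Pi.single i 1)) v, ?_, fun v v' => ?_, fun u hu v => ?_,
    fun u => ?_⟩
  · have := H.finrank_quotient_add_finrank
    rwa [Module.finrank_fin_fun] at this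
  · rw [key, hw, b.repr_self, Finsupp.single_apply]
  · rw [key, Submodule.mkQ_apply, (Submodule.Quotient.mk_eq_zero H).2 hu]
    simp
  · simp only [key]
    rw [← Submodule.Quotient.mk_eq_zero H, ← Submodule.mkQ_apply, map_sub, map_sum, sub_eq_zero]
    simp only [map_smul, hw]
    exact (b.sum_repr _).symm

variable {k : Type} [Field k]
variable {O : Type} [CommRing O] [Algebra k O] {N m : ℕ}

theorem aeval_map_kForm {A : Type} [CommRing A] [Algebra k A] (y : Fin N → A) (res : O →ₐ[k] k)
    (z : Fin N → k) : aeval y (map (res : O →+* k) (kForm O z)) =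
      ∑ i, algebraMap k A (z i) * y i := by
  simp [kForm, linForm]

theorem aeval_map_eq_zero_of_mem_formIdeal {A : Type} [CommRing A] [Algebra k A] {y : Fin N → A}
    {res : O →ₐ[k] k} {l : List (Fin N → k)} (hl : ∀ z ∈ l, ∑ i, algebraMap k A (z i) * y i = 0)
    {P : MvPolynomial (Fin N) O} (hP : P ∈ formIdeal O l) :
    aeval y (map (res : O →+* k) P) = 0 := by
  suffices formIdeal O l ≤
      RingHom.ker ((aeval y : MvPolynomial (Fin N) k →ₐ[k] A).toRingHom.comp
        (map (res : O →+* k))) from this hP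
  refine Ideal.span_le.2 ?_
  rintro _ ⟨z, hz, rfl⟩
  exact (aeval_map_kForm y res z).trans (hl z hz)

theorem kForm_mem_of_mem_span {s : Set (Fin N → k)} {J : Ideal (MvPolynomial (Fin N) O)}
    (hs : ∀ z ∈ s, kForm O z ∈ J) {u : Fin N → k} (hu : u ∈ Submodule.span k s) :
    kForm O u ∈ J :=
  (mem_formSubspace (P := J)).1 (Submodule.span_le.2 (fun z hz => mem_formSubspace.2 (hs z hz)) hu)

end

section

open IsLocalRing MvPolynomial TrivSqZeroExt

set_option linter.unusedSectionVars false

variable {k : Type} [Field k]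
variable {O : Type} [CommRing O] [Algebra k O] {N m : ℕ}

/-- The sequence `f` and its matrix of derivatives `φ` come from forms over `k`, and `O` has enough
homomorphisms to rings of dual numbers. -/
structure DualSetup (f : Fin m → O) (φ : Fin m → Fin N → O) (x : Fin N → O)
    (F : Fin m → MvPolynomial (Fin N) k) (deg : Fin m → ℕ) (res : O →ₐ[k] k) : Prop where
  isHomogeneous : ∀ j, (F j).IsHomogeneous (deg j)
  one_le : ∀ j, 1 ≤ deg j
  f_eq : ∀ j, f j = aeval x (F j)
  φ_eq : ∀ j i, φ j i = aeval x (pderiv i (F j))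
  exists_algHom : ∀ (A : Type) [CommRing A] [Algebra k A] (η : Fin N → A),
    ∃ h : O →ₐ[k] DualNumber A, (∀ i, h (x i) = inr (η i)) ∧
      ∀ a, fst (h a) = algebraMap k A (res a)

variable {f : Fin m → O} {φ : Fin m → Fin N → O} {x : Fin N → O}
    {F : Fin m → MvPolynomial (Fin N) k} {deg : Fin m → ℕ} {res : O →ₐ[k] k}

namespace DualSetup

/-- The span of the gradients of the linear forms and of a list of vectors. -/
def linSpan (φ : Fin m → Fin N → O) (deg : Fin m → ℕ) (res : O →ₐ[k] k) (l : List (Fin N → k)) :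
    Submodule k (Fin N → k) :=
  Submodule.span k ({u | ∃ j, deg j = 1 ∧ u = fun i => res (φ j i)} ∪ {z | z ∈ l})

theorem φ_eq_algebraMap (D : DualSetup f φ x F deg res) {j : Fin m} (hj : deg j = 1) :
    ∃ α : Fin N → k, (∀ i, pderiv i (F j) = C (α i)) ∧ (∀ i, res (φ j i) = α i) ∧
      ∀ i, φ j i = algebraMap k O (α i) := by
  have h : ∀ i, ∃ a, pderiv i (F j) = C a := fun i => by
    have := IsHomogeneous.pderiv (i := i) (D.isHomogeneous j)
    rw [hj, ← totalDegree_zero_iff_isHomogeneous, totalDegree_eq_zero_iff_eq_C] at this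
    exact ⟨_, this⟩
  choose α hα using h
  refine ⟨α, hα, fun i => ?_, fun i => ?_⟩
  · rw [D.φ_eq, hα, aeval_C, AlgHom.commutes]
    rfl
  · rw [D.φ_eq, hα, aeval_C]

theorem aeval_F_eq_zero (D : DualSetup f φ x F deg res) {l : List (Fin N → k)} {A : Type}
    [CommRing A] [Algebra k A] {y : Fin N → A}
    (hy : ∀ u ∈ linSpan φ deg res l, ∑ i, algebraMap k A (u i) * y i = 0) {j : Fin m}
    (hj : deg j = 1) : aeval y (F j) = 0 := by
  obtain ⟨α, h1, h2, -⟩ := D.φ_eq_algebraMap hj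
  have h3 := sum_mul_aeval_pderiv (D.isHomogeneous j) y
  rw [hj, Nat.cast_one, one_mul] at h3
  rw [← h3, ← hy α (Submodule.subset_span (Or.inl ⟨j, hj, (funext h2).symm⟩))]
  exact Finset.sum_congr rfl fun i _ => by rw [h1, aeval_C, mul_comm]

theorem kForm_mem_of_mem_linSpan (D : DualSetup f φ x F deg res) {l : List (Fin N → k)}
    {u : Fin N → k} (hu : u ∈ linSpan φ deg res l) :
    kForm O u ∈ formIdeal O l ⊔ relIdeal f φ m := by
  refine kForm_mem_of_mem_span ?_ hu
  rintro z (⟨j, hj, rfl⟩ | hz)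
  · obtain ⟨α, -, h2, h3⟩ := D.φ_eq_algebraMap hj
    refine Ideal.mem_sup_right ?_
    have : kForm O (fun i => res (φ j i)) = linForm (φ j) := by
      rw [kForm]
      congr 1
      funext i
      rw [h2, h3]
    rw [this]
    exact linForm_mem_relIdeal f φ j j.2
  · exact Ideal.mem_sup_left (kForm_mem_formIdeal hz)

theorem card_le [CharZero k] [IsRegularLocalRing O] [IsRegularRing O] {c e : ℕ}
    {I : Ideal (MvPolynomial (Fin N) O)} (D : DualSetup f φ x F deg res)
    (S : LocalSetup c e f φ I) {l : List (Fin N → k)} {r : ℕ} {w ε : Fin r → Fin N → k}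
    (hwε : ∀ v v', w v ⬝ᵥ ε v' = if v = v' then 1 else 0)
    (hε : ∀ u ∈ linSpan φ deg res l, ∀ v, u ⬝ᵥ ε v = 0)
    {t : Fin r → MvPolynomial (Fin N) O} (ht : ∀ v, (t v).IsHomogeneous c) (htI : ∀ v, t v ∈ I)
    (htw : ∀ v, t v - kForm O (w v) ^ c ∈ formIdeal O l) :
    r ≤ Fintype.card {j // deg j = 2} := by
  let y : Fin N → MvPolynomial (Fin r) k := fun i => ∑ v, C (ε v i) * X v
  have hsum : ∀ u : Fin N → k, ∑ i, C (u i) * y i = ∑ v, C (u ⬝ᵥ ε v) * X v := fun u => by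
    simp only [y, Finset.mul_sum]
    rw [Finset.sum_comm]
    refine Finset.sum_congr rfl fun v _ => ?_
    rw [dotProduct, map_sum, Finset.sum_mul]
    exact Finset.sum_congr rfl fun i _ => by rw [C_mul, mul_assoc]
  let g : {j // deg j = 2} → MvPolynomial (Fin r) k := fun j => aeval y (F j)
  have hle : Ideal.span (Set.range g) ≤ irr r (⊥ : Ideal k) := by
    rw [Ideal.span_le]
    rintro _ ⟨⟨j, hj⟩, rfl⟩
    have h1 : constantCoeff (aeval y (F j)) = aeval (fun i => constantCoeff (y i)) (F j) := by
      have := (comp_aeval_apply y (aeval (fun _ : Fin r => (0 : k))) (F j))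
      simpa [constantCoeff_eq, aeval_def] using this
    have h2 : (fun i => constantCoeff (y i)) = fun i => (0 : k) * (0 : k) := by
      funext i
      simp [y]
    have h3 : constantCoeff (aeval y (F j)) = 0 := by
      rw [h1, h2, aeval_mul_left_of_isHomogeneous (D.isHomogeneous j), hj]
      simp
    exact h3
  obtain ⟨P, hP, hPle⟩ := Ideal.exists_minimalPrimes_le hle
  have hprime : P.IsPrime := hP.1.1
  have hy : ∀ u : Fin N → k, ∑ i, algebraMap k (MvPolynomial (Fin r) k ⧸ P) (u i) *
      Ideal.Quotient.mk P (y i) = Ideal.Quotient.mk P (∑ v, C (u ⬝ᵥ ε v) * X v) := fun u => by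
    rw [← hsum, map_sum]
    exact Finset.sum_congr rfl fun i _ => by rw [map_mul]; rfl
  have hX : ∀ v, X v ∈ P := fun v => by
    have hker : ∀ u ∈ linSpan φ deg res l, ∑ i, algebraMap k (MvPolynomial (Fin r) k ⧸ P) (u i) *
        Ideal.Quotient.mk P (y i) = 0 := fun u hu => by
      rw [hy]
      simp [hε u hu]
    obtain ⟨h, h1, h2⟩ := D.exists_algHom (MvPolynomial (Fin r) k ⧸ P)
      fun i => Ideal.Quotient.mk P (y i)
    have h3 := S.aeval_eq_zero D.isHomogeneous D.one_le D.f_eq D.φ_eq h1 h2 (fun j hj => by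
      rcases (show deg j = 1 ∨ deg j = 2 by have := D.one_le j; omega) with hj | hj
      · exact D.aeval_F_eq_zero hker hj
      · have := (comp_aeval_apply y (Ideal.Quotient.mkₐ k P) (F j)).symm
        refine this.trans ?_
        exact Ideal.Quotient.eq_zero_iff_mem.2
          (hP.1.2 (Ideal.subset_span ⟨⟨j, hj⟩, rfl⟩))) (ht v) (htI v)
    have h4 := aeval_map_eq_zero_of_mem_formIdeal (res := res) (l := l)
      (fun z hz => hker z (Submodule.subset_span (Or.inr hz))) (htw v)
    rw [map_sub, map_sub, h3, zero_sub, neg_eq_zero, map_pow, map_pow, aeval_map_kForm, hy,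
      ← map_pow, Ideal.Quotient.eq_zero_iff_mem] at h4
    have h5 := hprime.mem_of_pow_mem _ h4
    simpa [hwε] using h5
  have := height_le_of_mem_minimalPrimes_span_range g hP
  have h6 := height_irr r (P.comap C)
  have h7 := (Ideal.height_mono (irr_le_of_X_mem hX)).trans this
  rw [h6] at h7
  exact_mod_cast le_add_self.trans h7

end DualSetup

end

section

open IsLocalRing MvPolynomial TrivSqZeroExt

set_option linter.unusedSectionVars false

variable {k : Type} [Field k]
variable {O : Type} [CommRing O] [Algebra k O] {N m : ℕ}
variable {f : Fin m → O} {φ : Fin m → Fin N → O} {x : Fin N → O}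
    {F : Fin m → MvPolynomial (Fin N) k} {deg : Fin m → ℕ} {res : O →ₐ[k] k}

namespace DualSetup

theorem sum_C_mul_mem_relIdeal [IsRegularLocalRing O] [IsRegularRing O] {c e : ℕ}
    {I : Ideal (MvPolynomial (Fin N) O)} (D : DualSetup f φ x F deg res)
    (S : LocalSetup c e f φ I) {l : List (Fin N → k)}
    (hl : ∀ P : MvPolynomial (Fin N) O, P.IsHomogeneous c → P ∈ I → P ∈ formIdeal O l →
      P ∈ relIdeal f φ m) {r : ℕ} {w ε : Fin r → Fin N → k}
    (hw : ∀ u : Fin N → k, u - ∑ v, (u ⬝ᵥ ε v) • w v ∈ linSpan φ deg res l) {w₀ : Fin N → k}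
    {t : Fin r → MvPolynomial (Fin N) O} (ht : ∀ v, (t v).IsHomogeneous c) (htI : ∀ v, t v ∈ I)
    (htw : ∀ v, t v - kForm O (w v) * kForm O w₀ ^ (c - 1) ∈ formIdeal O l) (j : Fin m) :
    ∑ v, C (∑ i, φ j i * algebraMap k O (ε v i)) * t v ∈ relIdeal f φ m := by
  classical
  have hlin : ∀ u : Fin N → O, linForm u = ∑ i, C (u i) * kForm O (Pi.single i (1 : k)) :=
    fun u => by simp only [kForm_single]; rfl
  have hsub : ∀ u u' : Fin N → k, kForm O (u - u') = kForm O u - kForm O u' := fun u u' => by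
    simp [kForm, linForm, sub_mul, Finset.sum_sub_distrib]
  have hsum : ∀ a : Fin r → k, kForm O (∑ v, a v • w v) =
      ∑ v, C (algebraMap k O (a v)) * kForm O (w v) := fun a => by
    simp only [kForm, linForm, Finset.sum_apply, Pi.smul_apply, smul_eq_mul, map_sum,
      map_mul, Finset.sum_mul, Finset.mul_sum]
    rw [Finset.sum_comm]
    simp only [mul_assoc]
  have h1 : linForm (φ j) - ∑ v, C (∑ i, φ j i * algebraMap k O (ε v i)) * kForm O (w v) ∈
      formIdeal O l ⊔ relIdeal f φ m := by
    have : linForm (φ j) - ∑ v, C (∑ i, φ j i * algebraMap k O (ε v i)) * kForm O (w v) =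
        ∑ i, C (φ j i) * kForm O (Pi.single i (1 : k) - ∑ v, (Pi.single i (1 : k) ⬝ᵥ ε v) • w v) := by
      simp only [hsub, hsum, mul_sub, Finset.sum_sub_distrib, ← hlin, single_one_dotProduct]
      congr 1
      simp only [map_sum, Finset.sum_mul, Finset.mul_sum, C_mul]
      rw [Finset.sum_comm]
      simp only [mul_assoc]
    rw [this]
    exact sum_mem fun i _ => Ideal.mul_mem_left _ _ (D.kForm_mem_of_mem_linSpan (hw _))
  have h2 : (linForm (φ j) - ∑ v, C (∑ i, φ j i * algebraMap k O (ε v i)) *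
      kForm O (w v)).IsHomogeneous 1 := by
    refine (isHomogeneous_linForm _).sub (IsHomogeneous.sum _ _ _ fun v _ => ?_)
    have := (isHomogeneous_C (Fin N) (∑ i, φ j i * algebraMap k O (ε v i))).mul
      (isHomogeneous_kForm (O := O) (w v))
    rwa [zero_add] at this
  obtain ⟨b, hb, b', hb', -, hb'h, hbb⟩ := HomogIdeal.exists_isHomogeneous_add
    (homogIdeal_formIdeal l) (homogIdeal_relIdeal f φ m) h2 h1
  have hmem : (linForm (φ j) - b') * kForm O w₀ ^ (c - 1) ∈ relIdeal f φ m :=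
    Ideal.mul_mem_right _ _ (sub_mem (linForm_mem_relIdeal f φ j j.2) hb')
  refine (Submodule.sub_mem_iff_left _ hmem).1 (hl _ ?_ ?_ ?_)
  · refine (IsHomogeneous.sum _ _ _ fun v _ => ?_).sub ?_
    · have := (isHomogeneous_C (Fin N) (∑ i, φ j i * algebraMap k O (ε v i))).mul (ht v)
      rwa [zero_add] at this
    · have := ((isHomogeneous_linForm (φ j)).sub hb'h).mul
        ((isHomogeneous_kForm (O := O) w₀).pow (c - 1))
      rwa [one_mul, Nat.add_sub_cancel' S.one_le_c] at this
  · exact sub_mem (sum_mem fun v _ => Ideal.mul_mem_left _ _ (htI v)) (S.relIdeal_le hmem)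
  · have : ∑ v, C (∑ i, φ j i * algebraMap k O (ε v i)) * t v -
        (linForm (φ j) - b') * kForm O w₀ ^ (c - 1) =
        ∑ v, C (∑ i, φ j i * algebraMap k O (ε v i)) *
          (t v - kForm O (w v) * kForm O w₀ ^ (c - 1)) - b * kForm O w₀ ^ (c - 1) := by
      rw [← sub_eq_iff_eq_add] at hbb
      rw [← hbb]
      simp only [mul_sub, Finset.sum_sub_distrib, sub_mul, Finset.sum_mul, mul_assoc]
      ring
    rw [this]
    exact sub_mem (sum_mem fun v _ => Ideal.mul_mem_left _ _ (htw v)) (Ideal.mul_mem_right _ _ hb)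

theorem sum_mul_aeval_eq_zero (D : DualSetup f φ x F deg res) {A : Type} [CommRing A] [Algebra k A]
    {η y : Fin N → A} (h1 : ∀ j, deg j = 1 → aeval η (F j) = 0)
    (h1' : ∀ j, deg j = 1 → aeval y (F j) = 0)
    (h2 : ∀ j, deg j = 2 → ∑ i, aeval η (pderiv i (F j)) * y i = 0)
    {r : ℕ} {ε : Fin r → Fin N → k} {t : Fin r → MvPolynomial (Fin N) O} {j : Fin m}
    (hj : deg j = 2)
    (hmem : ∑ v, C (∑ i, φ j i * algebraMap k O (ε v i)) * t v ∈ relIdeal f φ m) :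
    ∑ v, (∑ i, aeval η (pderiv i (F j)) * algebraMap k A (ε v i)) *
      aeval y (map (res : O →+* k) (t v)) = 0 := by
  obtain ⟨h, hx, hres⟩ := D.exists_algHom A η
  have h3 := eval₂_dualNumber_eq_zero D.isHomogeneous D.one_le D.f_eq D.φ_eq hx h1 h1' h2 hmem
  have hφ : ∀ i, h (φ j i) = inr (aeval η (pderiv i (F j))) := fun i => by
    have h4 := aeval_inr (IsHomogeneous.pderiv (i := i) (D.isHomogeneous j)) η
    rw [hj, pow_one] at h4
    rw [D.φ_eq, ← AlgHom.comp_apply, comp_aeval]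
    simp only [hx]
    rw [h4]
    ext <;> simp
  have h5 : ∀ v, h (∑ i, φ j i * algebraMap k O (ε v i)) =
      inr (∑ i, aeval η (pderiv i (F j)) * algebraMap k A (ε v i)) := fun v => by
    rw [map_sum, inr_sum]
    refine Finset.sum_congr rfl fun i _ => ?_
    rw [map_mul, hφ, AlgHom.commutes]
    ext <;> simp [TrivSqZeroExt.algebraMap_eq_inl', mul_comm]
  have h6 : ∀ v, snd (eval₂ (h : O →+* DualNumber A) (fun i => inl (y i))
      (C (∑ i, φ j i * algebraMap k O (ε v i)) * t v)) =
      (∑ i, aeval η (pderiv i (F j)) * algebraMap k A (ε v i)) *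
      aeval y (map (res : O →+* k) (t v)) := fun v => by
    rw [eval₂_mul, eval₂_C, ← fst_eval₂_dualNumber y hres]
    refine (congrArg (fun z => snd (z * _)) (h5 v)).trans ?_
    simp [mul_comm]
  have h7 := congrArg snd h3
  rw [eval₂_sum, snd_sum, Finset.sum_congr rfl fun v _ => h6 v] at h7
  exact h7

end DualSetup

end

section

open Polynomial

theorem Matrix.exists_mul_eq_one_of_mulVec_injective {K : Type} [Field K] {ι κ : Type} [Fintype ι]
    [Fintype κ] [DecidableEq ι] [DecidableEq κ] {M : Matrix ι κ K}
    (hM : ∀ u, M.mulVec u = 0 → u = 0) :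
    ∃ L : Matrix κ ι K, L * M = 1 := by
  obtain ⟨g, hg⟩ := M.mulVecLin.exists_leftInverse_of_injective
    (LinearMap.ker_eq_bot'.2 fun u hu => hM u hu)
  refine ⟨LinearMap.toMatrix' g, ?_⟩
  have := congrArg LinearMap.toMatrix' hg
  rwa [LinearMap.toMatrix'_comp, ← Matrix.toLin'_apply', LinearMap.toMatrix'_toLin',
    LinearMap.toMatrix'_id] at this

theorem Matrix.exists_mul_eq_one_of_linearIndependent {K : Type} [Field K] {ι κ : Type} [Fintype ι]
    [Fintype κ] [DecidableEq ι] [DecidableEq κ] {M : Matrix ι κ K} (hM : LinearIndependent K M) :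
    ∃ L : Matrix κ ι K, M * L = 1 := by
  obtain ⟨L, hL⟩ := Matrix.exists_mul_eq_one_of_mulVec_injective (M := M.transpose) fun u hu => by
    rw [Matrix.mulVec_transpose] at hu
    exact Matrix.vecMul_injective_iff.2 hM (by simpa using hu)
  exact ⟨L.transpose, by rw [← Matrix.transpose_inj, Matrix.transpose_mul, Matrix.transpose_transpose,
    hL, Matrix.transpose_one]⟩

theorem Matrix.eq_zero_of_mulVec_eq_zero_of_map_evalRingHom {K : Type} [Field K] {ι κ : Type}
    [Fintype ι] [Fintype κ] [DecidableEq ι] [DecidableEq κ] {M : Matrix ι κ K[X]}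
    (hM : ∀ u, (M.map (eval 0)).mulVec u = 0 → u = 0) {T : κ → K[X]} (hT : M.mulVec T = 0) :
    T = 0 := by
  obtain ⟨L, hL⟩ := Matrix.exists_mul_eq_one_of_mulVec_injective hM
  refine Matrix.eq_zero_of_mulVec_eq_zero (M := L.map C * M) (fun h => ?_) ?_
  · have h1 := congrArg (evalRingHom (0 : K)) h
    rw [RingHom.map_det, RingHom.mapMatrix_apply, Matrix.map_mul, map_zero] at h1
    have h2 : (L.map C).map (evalRingHom (0 : K)) = L := by
      ext
      simp
    have h3 : M.map (evalRingHom (0 : K)) = M.map (eval 0) := rfl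
    rw [h2, h3, hL, Matrix.det_one] at h1
    exact one_ne_zero h1
  · rw [← Matrix.mulVec_mulVec, hT, Matrix.mulVec_zero]

theorem Matrix.eq_zero_of_forall_sum_eq_zero {K : Type} [Field K] {ι κ : Type}
    [Fintype ι] [Fintype κ] (M : ι → κ → K[X])
    (hM : ∀ u : κ → K, (∀ i, ∑ v, (M i v).eval 0 * u v = 0) → u = 0) (T : κ → K[X])
    (hT : ∀ i, ∑ v, M i v * T v = 0) (v : κ) : T v = 0 := by
  classical
  exact congrFun (Matrix.eq_zero_of_mulVec_eq_zero_of_map_evalRingHom (M := Matrix.of M)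
    (fun u hu => hM u fun i => congrFun hu i) (funext hT)) v

/-- A kernel vector of the special fibre of a polynomial family of surjective matrices extends to
the family. -/
theorem Matrix.exists_mulVec_eq_zero {K : Type} [Field K] {ι κ : Type}
    [Fintype ι] [Fintype κ] [DecidableEq ι] [DecidableEq κ] {M : Matrix ι κ K[X]}
    (hM : LinearIndependent K (M.map (eval 0))) {u : κ → K} (hu : (M.map (eval 0)).mulVec u = 0) :
    ∃ η : κ → K[X], M.mulVec η = 0 ∧ ∀ i, (η i).eval 0 = u i := by
  obtain ⟨L, hL⟩ := Matrix.exists_mul_eq_one_of_linearIndependent hM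
  let P := M * L.map C
  have hP : P.map (eval 0) = 1 := by
    change P.map (evalRingHom (0 : K)) = 1
    have h2 : (L.map C).map (evalRingHom (0 : K)) = L := by
      ext
      simp
    rw [Matrix.map_mul, h2]
    exact hL
  have hdet : eval 0 P.det = 1 := by
    have := RingHom.map_det (evalRingHom (0 : K)) P
    rw [RingHom.mapMatrix_apply] at this
    refine this.trans ?_
    change (P.map (eval 0)).det = 1
    rw [hP, Matrix.det_one]
  have hMu : ∀ i, eval 0 (M.mulVec (fun i => C (u i)) i) = 0 := fun i => by
    have := congrFun hu i
    simpa [Matrix.mulVec, dotProduct, eval_finsetSum] using this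
  refine ⟨P.det • (fun i => C (u i)) -
    (L.map C).mulVec (P.adjugate.mulVec (M.mulVec fun i => C (u i))), ?_, fun i => ?_⟩
  · rw [Matrix.mulVec_sub, Matrix.mulVec_smul, Matrix.mulVec_mulVec _ M (L.map C),
      Matrix.mulVec_mulVec _ (M * L.map C), Matrix.mul_adjugate, Matrix.smul_mulVec, Matrix.one_mulVec, sub_self]
  · rw [Pi.sub_apply, Pi.smul_apply, smul_eq_mul, eval_sub, eval_mul, hdet, eval_C, one_mul]
    have : ∀ j, eval 0 (P.adjugate.mulVec (M.mulVec fun i => C (u i)) j) = 0 := fun j => by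
      rw [Matrix.mulVec, dotProduct, eval_finsetSum]
      exact Finset.sum_eq_zero fun a _ => by rw [eval_mul, hMu, mul_zero]
    rw [Matrix.mulVec, dotProduct, eval_finsetSum, Finset.sum_eq_zero, sub_zero]
    intro a _
    rw [eval_mul, this, mul_zero]

theorem coeff_aeval_add_X_mul {k K : Type} [Field k] [Field K]
    [Algebra k K] {N c : ℕ} {G : MvPolynomial (Fin N) k} (hG : G.IsHomogeneous c) (u v : Fin N → K) :
    (MvPolynomial.aeval (fun i => C (u i) + X * C (v i)) G).coeff c = MvPolynomial.aeval v G := by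
  have key : ∀ (d : Fin N → ℕ) (s : Finset (Fin N)),
      (∏ i ∈ s, (C (u i) + X * C (v i)) ^ d i).natDegree ≤ ∑ i ∈ s, d i ∧
      (∏ i ∈ s, (C (u i) + X * C (v i)) ^ d i).coeff (∑ i ∈ s, d i) = ∏ i ∈ s, v i ^ d i := by
    intro d s
    classical
    induction s using Finset.induction_on with
    | empty => simp
    | insert a s ha ih =>
      have h1 : (C (u a) + X * C (v a)).natDegree ≤ 1 := by compute_degree
      have h2 : ((C (u a) + X * C (v a)) ^ d a).natDegree ≤ d a := by
        simpa using natDegree_pow_le_of_le (d a) h1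
      have h3 : ((C (u a) + X * C (v a)) ^ d a).coeff (d a) = v a ^ d a := by
        have := coeff_pow_of_natDegree_le (m := d a) h1
        rw [mul_one] at this
        rw [this]
        simp [coeff_C]
      rw [Finset.prod_insert ha, Finset.sum_insert ha, Finset.prod_insert ha]
      refine ⟨natDegree_mul_le_of_le h2 ih.1, ?_⟩
      rw [coeff_mul_add_eq_of_natDegree_le h2 ih.1, h3, ih.2]
  rw [MvPolynomial.aeval_def, MvPolynomial.aeval_def, MvPolynomial.eval₂_eq',
    MvPolynomial.eval₂_eq', finsetSum_coeff]
  refine Finset.sum_congr rfl fun d hd => ?_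
  have h : ∑ i, d i = c := by
    have := hG (MvPolynomial.mem_support_iff.1 hd)
    rw [← this, Finsupp.weight_apply, Finsupp.sum_fintype _ _ (by simp)]
    simp
  rw [Polynomial.algebraMap_apply, coeff_C_mul]
  congr 1
  have := (key d Finset.univ).2
  rwa [h] at this

end

section

open IsLocalRing MvPolynomial TrivSqZeroExt

set_option linter.unusedSectionVars false

variable {k : Type} [Field k]
variable {O : Type} [CommRing O] [Algebra k O] {N m : ℕ}
variable {f : Fin m → O} {φ : Fin m → Fin N → O} {x : Fin N → O}
    {F : Fin m → MvPolynomial (Fin N) k} {deg : Fin m → ℕ} {res : O →ₐ[k] k}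

theorem Matrix.linearIndependent_map_algebraMap {K : Type} [Field K] [Algebra k K] {ι κ : Type}
    [Fintype ι] [Fintype κ] {M : ι → κ → k} (h : LinearIndependent k M) :
    LinearIndependent K (fun i j => algebraMap k K (M i j)) := by
  classical
  obtain ⟨L, hL⟩ := Matrix.exists_mul_eq_one_of_linearIndependent (M := Matrix.of M) h
  have h6 : (Matrix.of M).map (algebraMap k K) * L.map (algebraMap k K) = 1 := by
    rw [← Matrix.map_mul, hL]
    simp
  change LinearIndependent K ((Matrix.of M).map (algebraMap k K)).row
  rw [← Matrix.vecMul_injective_iff]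
  intro u v huv
  have := congrArg (fun w => Matrix.vecMul w (L.map (algebraMap k K))) huv
  simpa only [Matrix.vecMul_vecMul, h6, Matrix.vecMul_one] using this

theorem LocalSetup.exists_field [IsRegularLocalRing O] [IsRegularRing O] {c e : ℕ}
    {I : Ideal (MvPolynomial (Fin N) O)} (S : LocalSetup c e f φ I) :
    ∃ (K : Type) (_ : Field K) (_ : Algebra k K) (g : O →ₐ[k] K), (∀ j, g (f j) = 0) ∧
      LinearIndependent K (fun j i => g (φ j i)) := by
  have hle : Ideal.span (Set.range f) ≤ maximalIdeal O := by
    rw [Ideal.span_le]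
    rintro _ ⟨j, rfl⟩
    exact S.mem j
  obtain ⟨Q, hQ, -⟩ := Ideal.exists_minimalPrimes_le hle
  have hprime : Q.IsPrime := hQ.1.1
  have hfQ : ∀ j, f j ∈ Q := fun j => hQ.1.2 (Ideal.subset_span ⟨j, rfl⟩)
  have hht : Q.height ≤ m := by simpa using height_le_of_mem_minimalPrimes_span_range f hQ
  have hne : Q ≠ maximalIdeal O := by
    rintro rfl
    rw [S.height_eq] at hht
    have := S.one_le_c
    have : c + m ≤ m := by exact_mod_cast hht
    omega
  have h1 := S.rank Q hne hfQ
  have h2 : m ≤ rankAt Q φ := by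
    obtain ⟨t, ht⟩ := exists_nat_height_eq Q
    rw [ht] at h1 hht
    have h3 : t ≤ m := by exact_mod_cast hht
    have h4 : 2 * m ≤ t + rankAt Q φ := by exact_mod_cast h1
    omega
  let g : O →ₐ[k] Q.ResidueField := IsScalarTower.toAlgHom k O Q.ResidueField
  refine ⟨Q.ResidueField, inferInstance, inferInstance, g, fun j => ?_, ?_⟩
  · exact (Ideal.algebraMap_residueField_eq_zero (I := Q)).2 (hfQ j)
  · rw [linearIndependent_iff_card_le_finrank_span, Fintype.card_fin]
    exact h2

namespace DualSetup

theorem finrank_linSpan_le [IsLocalRing O] (D : DualSetup f φ x F deg res) (l : List (Fin N → k)) :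
    Module.finrank k (linSpan φ deg res l) ≤ rankAt (maximalIdeal O) φ + l.length ∧
    Module.finrank k (linSpan φ deg res l) ≤ Fintype.card {j // deg j = 1} + l.length := by
  classical
  let α : {j // deg j = 1} → Fin N → k := fun j i => res (φ j i)
  have hset : {u | ∃ j, deg j = 1 ∧ u = fun i => res (φ j i)} = Set.range α := by
    ext u
    constructor
    · rintro ⟨j, hj, rfl⟩
      exact ⟨⟨j, hj⟩, rfl⟩
    · rintro ⟨⟨j, hj⟩, rfl⟩
      exact ⟨j, hj, rfl⟩
  have h1 : Module.finrank k (linSpan φ deg res l) ≤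
      Module.finrank k (Submodule.span k (Set.range α)) + l.length := by
    rw [linSpan, Submodule.span_union, hset]
    refine (Submodule.finrank_add_le_finrank_add_finrank _ _).trans ?_
    gcongr
    have : {z | z ∈ l} = ((l.toFinset : Finset (Fin N → k)) : Set (Fin N → k)) := by
      ext
      simp
    rw [this]
    exact (finrank_span_finset_le_card _).trans l.toFinset_card_le
  have h2 : Module.finrank k (Submodule.span k (Set.range α)) ≤ rankAt (maximalIdeal O) φ := by
    obtain ⟨b, hb, -, hli⟩ := Submodule.exists_fun_fin_finrank_span_eq k (Set.range α)
    choose s hs using hb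
    let κ := (maximalIdeal O).ResidueField
    have h4 : LinearIndependent κ (fun a i => algebraMap O κ (φ (s a) i)) := by
      convert Matrix.linearIndependent_map_algebraMap (K := κ) hli using 3 with a i
      obtain ⟨β, -, h6, h7⟩ := D.φ_eq_algebraMap (s a).2
      rw [h7, ← IsScalarTower.algebraMap_apply, ← h6, ← hs]
    have h5 := linearIndependent_iff_card_le_finrank_span.1 h4
    rw [Fintype.card_fin] at h5
    refine h5.trans (Submodule.finrank_mono (Submodule.span_mono ?_))
    rintro _ ⟨a, rfl⟩
    exact ⟨s a, rfl⟩
  exact ⟨h1.trans (by gcongr), h1.trans (by gcongr; exact finrank_range_le_card _)⟩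

end DualSetup

theorem adjoinList_mono {K : Type} [Field K] [Algebra k K] (W : Submodule K (Fin N → K))
    {l l' : List (Fin N → k)} (h : l.Sublist l') : adjoinList W l ≤ adjoinList W l' := by
  refine sup_le_sup_left (Submodule.span_mono ?_) W
  rintro _ ⟨z, hz, rfl⟩
  exact ⟨z, h.subset hz, rfl⟩

theorem le_finrank_add_of_adjoinList_ne_top {K : Type} [Field K] [Algebra k K]
    (W : Submodule K (Fin N → K)) {l : List (Fin N → k)}
    (h : ∀ x l', (x :: l').Sublist l → adjoinList W l' ≠ ⊤ →
      x ∉ (descend (adjoinList W l') : Submodule k (Fin N → k))) (hne : adjoinList W l ≠ ⊤) :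
    Module.finrank K W + l.length < N := by
  rw [← finrank_adjoinList fun x l' hl => h x l' hl fun htop =>
    hne (top_le_iff.1 (htop ▸ adjoinList_mono W ((List.sublist_cons_self x l').trans hl)))]
  have := Submodule.finrank_lt hne
  rwa [Module.finrank_fin_fun] at this

end

section

open IsLocalRing MvPolynomial TrivSqZeroExt

set_option linter.unusedSectionVars false

variable {k : Type} [Field k]
variable {O : Type} [CommRing O] [Algebra k O] {N m : ℕ}
variable {f : Fin m → O} {φ : Fin m → Fin N → O} {x : Fin N → O}
    {F : Fin m → MvPolynomial (Fin N) k} {deg : Fin m → ℕ} {res : O →ₐ[k] k}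

namespace DualSetup

/-- The polar forms of the quadrics separate the vectors `ε v`. -/
theorem eq_zero_of_forall_sum_eq_zero (D : DualSetup f φ x F deg res) {K : Type} [Field K]
    [Algebra k K] (g : O →ₐ[k] K) {l : List (Fin N → k)}
    (htop : adjoinList (Submodule.span K
      (Set.range fun (j : {j // deg j ≤ 2}) i => g (φ j i))) l = ⊤)
    {r : ℕ} {w ε : Fin r → Fin N → k} (hwε : ∀ v v', w v ⬝ᵥ ε v' = if v = v' then 1 else 0)
    (hε : ∀ u ∈ linSpan φ deg res l, ∀ v, u ⬝ᵥ ε v = 0) {u : Fin r → K}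
    (hu : ∀ j, deg j = 2 → ∑ v, (∑ i, g (φ j i) * algebraMap k K (ε v i)) * u v = 0) : u = 0 := by
  classical
  let E : Fin N → K := fun i => ∑ v, u v * algebraMap k K (ε v i)
  have hEk : ∀ α : Fin N → k, ∑ i, algebraMap k K (α i) * E i =
      ∑ v, u v * algebraMap k K (α ⬝ᵥ ε v) := fun α => by
    simp only [E, Finset.mul_sum, dotProduct, map_sum, map_mul]
    rw [Finset.sum_comm]
    exact Finset.sum_congr rfl fun v _ => Finset.sum_congr rfl fun i _ => by ring
  let Λ : (Fin N → K) →ₗ[K] K := ∑ i, E i • LinearMap.proj i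
  have hΛ : ∀ p, Λ p = ∑ i, p i * E i := fun p => by
    simp [Λ, mul_comm]
  have hker : adjoinList (Submodule.span K
      (Set.range fun (j : {j // deg j ≤ 2}) i => g (φ j i))) l ≤ LinearMap.ker Λ := by
    refine sup_le (Submodule.span_le.2 ?_) (Submodule.span_le.2 ?_)
    · rintro _ ⟨⟨j, hj⟩, rfl⟩
      rw [SetLike.mem_coe, LinearMap.mem_ker, hΛ]
      rcases (show deg j = 1 ∨ deg j = 2 by have := D.one_le j; omega) with hj | hj
      · obtain ⟨α, -, h4, h5⟩ := D.φ_eq_algebraMap hj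
        have h6 := hε α (Submodule.subset_span (Or.inl ⟨j, hj, (funext h4).symm⟩))
        simp only [h5, AlgHom.commutes]
        rw [hEk]
        simp [h6]
      · have h4 := hu j hj
        rw [← h4]
        simp only [E, Finset.mul_sum, Finset.sum_mul]
        rw [Finset.sum_comm]
        exact Finset.sum_congr rfl fun v _ => Finset.sum_congr rfl fun i _ => by ring
    · rintro _ ⟨z, hz, rfl⟩
      rw [SetLike.mem_coe, LinearMap.mem_ker, hΛ, hEk]
      simp [hε z (Submodule.subset_span (Or.inr hz))]
  rw [htop, top_le_iff] at hker
  funext v'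
  have h4 : Λ (fun i => algebraMap k K (w v' i)) = 0 := by
    rw [← LinearMap.mem_ker, hker]
    trivial
  rw [hΛ, hEk] at h4
  simpa [hwε] using h4

/-- Along a line `x + τ ε₀` through the generic zero `x` of `f`, the forms `t v` vanish
identically. -/
theorem aeval_map_eq_zero (D : DualSetup f φ x F deg res) {K : Type} [Field K] [Algebra k K]
    (g : O →ₐ[k] K) (hf : ∀ j, g (f j) = 0) (hli : LinearIndependent K (fun j i => g (φ j i)))
    {l : List (Fin N → k)}
    (htop : adjoinList (Submodule.span K
      (Set.range fun (j : {j // deg j ≤ 2}) i => g (φ j i))) l = ⊤)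
    {r : ℕ} {w ε : Fin r → Fin N → k} (hwε : ∀ v v', w v ⬝ᵥ ε v' = if v = v' then 1 else 0)
    (hε : ∀ u ∈ linSpan φ deg res l, ∀ v, u ⬝ᵥ ε v = 0)
    {t : Fin r → MvPolynomial (Fin N) O}
    (hmem : ∀ j, ∑ v, C (∑ i, φ j i * algebraMap k O (ε v i)) * t v ∈ relIdeal f φ m)
    (v₀ v : Fin r) {c : ℕ} (ht : (t v).IsHomogeneous c) :
    aeval (fun i => algebraMap k K (ε v₀ i)) (map (res : O →+* k) (t v)) = 0 := by
  classical
  have hφ : ∀ j i, g (φ j i) = aeval (fun i => g (x i)) (pderiv i (F j)) := fun j i => by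
    rw [D.φ_eq, comp_aeval_apply]
  have hf' : ∀ j, aeval (fun i => g (x i)) (F j) = 0 := fun j => by
    rw [← comp_aeval_apply, ← D.f_eq, hf]
  let y : Fin N → Polynomial K := fun i =>
    Polynomial.C (g (x i)) + Polynomial.X * Polynomial.C (algebraMap k K (ε v₀ i))
  have heval : ∀ (z : Fin N → Polynomial K) (P : MvPolynomial (Fin N) k),
      (aeval z P).eval 0 = aeval (fun i => (z i).eval 0) P := fun z P => by
    have := comp_aeval_apply z (Polynomial.aeval (R := K) (0 : K) |>.restrictScalars k) P
    simpa [Polynomial.coe_aeval_eq_eval] using this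
  have hy0 : (fun i => (y i).eval 0) = fun i => g (x i) := by
    funext i
    simp [y]
  let M : Matrix {j // deg j ≤ 2} (Fin N) (Polynomial K) := Matrix.of fun j i =>
    aeval y (pderiv i (F j))
  have hM0 : M.map (Polynomial.eval 0) = fun (j : {j // deg j ≤ 2}) i => g (φ j i) := by
    funext j i
    rw [hφ, ← hy0, ← heval]
    rfl
  obtain ⟨η, hη, hη0⟩ := Matrix.exists_mulVec_eq_zero (M := M) (u := fun i => g (x i))
    (by
      rw [hM0]
      exact hli.comp (fun j : {j // deg j ≤ 2} => j.1) Subtype.val_injective)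
    (by
      rw [hM0]
      funext j
      have := sum_mul_aeval_pderiv (D.isHomogeneous j) fun i => g (x i)
      rw [hf', mul_zero] at this
      refine Eq.trans (show _ = ∑ i, g (φ j i) * g (x i) from rfl) (Eq.trans ?_ this)
      exact Finset.sum_congr rfl fun i _ => by rw [hφ, mul_comm])
  have hηM : ∀ j, deg j ≤ 2 → ∑ i, η i * aeval y (pderiv i (F j)) = 0 := fun j hj => by
    have := congrFun hη ⟨j, hj⟩
    simpa [M, Matrix.mulVec, dotProduct, mul_comm] using this
  have hlin : ∀ j, deg j = 1 → ∀ (z z' : Fin N → Polynomial K) i,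
      aeval z (pderiv i (F j)) = aeval z' (pderiv i (F j)) := fun j hj z z' i => by
    have := IsHomogeneous.pderiv (i := i) (D.isHomogeneous j)
    rw [hj] at this
    exact aeval_eq_of_isHomogeneous_zero this _ _
  have h1 : ∀ j, deg j = 1 → aeval η (F j) = 0 := fun j hj => by
    have := sum_mul_aeval_pderiv (D.isHomogeneous j) η
    rw [hj, Nat.cast_one, one_mul] at this
    rw [← this, ← hηM j (by omega)]
    exact Finset.sum_congr rfl fun i _ => by rw [hlin j hj η y]
  have h1' : ∀ j, deg j = 1 → aeval y (F j) = 0 := fun j hj => by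
    obtain ⟨α, h3, h4, -⟩ := D.φ_eq_algebraMap hj
    have h5 := sum_mul_aeval_pderiv (D.isHomogeneous j) y
    have h6 := sum_mul_aeval_pderiv (D.isHomogeneous j) fun i => g (x i)
    have h7 := hε α (Submodule.subset_span (Or.inl ⟨j, hj, (funext h4).symm⟩)) v₀
    rw [hj, Nat.cast_one, one_mul] at h5
    rw [hf', mul_zero] at h6
    simp only [h3, aeval_C] at h5 h6
    rw [← h5]
    have h8 : ∑ i, y i * algebraMap k (Polynomial K) (α i) =
        Polynomial.C (∑ i, g (x i) * algebraMap k K (α i)) +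
        Polynomial.X * Polynomial.C (algebraMap k K (α ⬝ᵥ ε v₀)) := by
      simp only [y, add_mul, Finset.sum_add_distrib, map_sum, dotProduct, Finset.mul_sum, map_mul,
        Polynomial.algebraMap_apply]
      congr 1
      exact Finset.sum_congr rfl fun i _ => by ring
    rw [h8, h6, h7]
    simp
  have h2 : ∀ j, deg j = 2 → ∑ i, aeval η (pderiv i (F j)) * y i = 0 := fun j hj => by
    have h3 := D.isHomogeneous j
    rw [hj] at h3
    rw [← hηM j (by omega), ← sum_mul_aeval_pderiv_comm h3 η y]
    exact Finset.sum_congr rfl fun i _ => mul_comm _ _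
  have hBT : ∀ j, deg j = 2 → ∑ v, (∑ i, aeval η (pderiv i (F j)) *
      algebraMap k (Polynomial K) (ε v i)) * aeval y (map (res : O →+* k) (t v)) = 0 :=
    fun j hj => D.sum_mul_aeval_eq_zero h1 h1' h2 hj (hmem j)
  have hev : ∀ j v, Polynomial.eval 0 (∑ i, aeval η (pderiv i (F j)) *
      algebraMap k (Polynomial K) (ε v i)) = ∑ i, g (φ j i) * algebraMap k K (ε v i) :=
    fun j v => by
      rw [Polynomial.eval_finsetSum]
      refine Finset.sum_congr rfl fun i _ => ?_
      rw [Polynomial.eval_mul, heval, hφ]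
      simp only [hη0, Polynomial.algebraMap_apply, Polynomial.eval_C]
  have hT := Matrix.eq_zero_of_forall_sum_eq_zero
    (fun (j : {j // deg j = 2}) v => ∑ i, aeval η (pderiv i (F j)) *
      algebraMap k (Polynomial K) (ε v i))
    (fun u hu => D.eq_zero_of_forall_sum_eq_zero g htop hwε hε fun j hj => by
      have := hu ⟨j, hj⟩
      simp only [hev] at this
      exact this)
    (fun v => aeval y (map (res : O →+* k) (t v))) (fun j => hBT j j.2) v
  have h4 := coeff_aeval_add_X_mul (ht.map (res : O →+* k)) (fun i => g (x i))
    fun i => algebraMap k K (ε v₀ i)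
  rw [← h4]
  exact (congrArg (fun p => Polynomial.coeff p c) hT).trans (Polynomial.coeff_zero c)

theorem lt_rankAt_add [CharZero k] [IsRegularLocalRing O] [IsRegularRing O] {c : ℕ}
    {I : Ideal (MvPolynomial (Fin N) O)} (D : DualSetup f φ x F deg res)
    (S : LocalSetup c c f φ I) : m < rankAt (maximalIdeal O) φ + c := by
  classical
  by_contra! hrank
  have hN := S.eq_add
  have hc := S.one_le_c
  obtain ⟨K, _, _, g, hgf, hli⟩ := S.exists_field (k := k)
  let W := Submodule.span K (Set.range fun (j : {j // deg j ≤ 2}) i => g (φ j i))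
  have hW : Module.finrank K W = Fintype.card {j // deg j ≤ 2} :=
    finrank_span_eq_card (hli.comp (fun j : {j // deg j ≤ 2} => j.1) Subtype.val_injective)
  obtain ⟨xs, hlen, hxs, hF⟩ := S.exists_general_list (k := k)
    (fun l => {V | V = descend (adjoinList W l) ∧ V ≠ ⊤})
    (fun l => (Set.finite_singleton _).subset fun V hV => hV.1) (fun l _ V hV => hV.2)
  obtain ⟨z, l, rfl⟩ : ∃ z l, xs = z :: l := by
    cases xs with
    | nil =>
      rw [List.length_nil] at hlen
      omega
    | cons z l => exact ⟨z, l, rfl⟩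
  have hsub := List.sublist_cons_self z l
  rw [List.length_cons] at hlen
  replace hF := hF l hsub hlen
  have ht : ∀ P : MvPolynomial (Fin N) O, P.IsHomogeneous c →
      ∃ t ∈ I, t.IsHomogeneous c ∧ t - P ∈ formIdeal O l := fun P hP => by
    obtain ⟨a, ha, b, hb, hah, -, hab⟩ := HomogIdeal.exists_isHomogeneous_add S.homogIdeal
      (homogIdeal_formIdeal l) hP (hF P hP).1
    refine ⟨a, ha, hah, ?_⟩
    rw [hab, sub_add_cancel_left]
    exact neg_mem hb
  obtain ⟨r, w, ε, hr, hwε, hε, hw⟩ := Submodule.exists_dual_complement (linSpan φ deg res l)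
  obtain ⟨hb1, hb2⟩ := D.finrank_linSpan_le l
  have hkw : ∀ v, (kForm O (w v) ^ c).IsHomogeneous c := fun v => by
    have := (isHomogeneous_kForm (O := O) (w v)).pow c
    rwa [one_mul] at this
  choose t' ht'I ht'h ht'w using fun v => ht _ (hkw v)
  have hrQ := D.card_le S hwε hε ht'h ht'I ht'w
  have hcard : Fintype.card {j // deg j ≤ 2} =
      Fintype.card {j // deg j = 1} + Fintype.card {j // deg j = 2} := by
    rw [← Fintype.card_subtype_or_disjoint]
    · refine Fintype.card_congr (Equiv.subtypeEquivRight fun j => ?_)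
      have := D.one_le j
      omega
    · rw [Pi.disjoint_iff]
      intro j
      simp only [Prop.disjoint_iff]
      omega
  have htop : adjoinList W l = ⊤ := by
    by_contra hne
    have := le_finrank_add_of_adjoinList_ne_top W (fun x l' hl hl' hx =>
      hxs x l' (hl.trans hsub) _ ⟨rfl, descend_ne_top hl'⟩ hx) hne
    omega
  let v₀ : Fin r := ⟨0, by omega⟩
  have hkw' : ∀ v, (kForm O (w v) * kForm O (w v₀) ^ (c - 1)).IsHomogeneous c := fun v => by
    have := (isHomogeneous_kForm (O := O) (w v)).mul
      ((isHomogeneous_kForm (O := O) (w v₀)).pow (c - 1))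
    rwa [one_mul, Nat.add_sub_cancel' hc] at this
  choose t htI hth htw using fun v => ht _ (hkw' v)
  have h0 := D.aeval_map_eq_zero g hgf hli htop hwε hε
    (D.sum_C_mul_mem_relIdeal S (fun P hP => (hF P hP).2) hw hth htI htw) v₀ v₀ (hth v₀)
  have hsum : ∀ u : Fin N → k, ∑ i, algebraMap k K (u i) * algebraMap k K (ε v₀ i) =
      algebraMap k K (u ⬝ᵥ ε v₀) := fun u => by
    simp [dotProduct, map_sum]
  have h1 := aeval_map_eq_zero_of_mem_formIdeal (res := res) (l := l)
    (y := fun i => algebraMap k K (ε v₀ i)) (fun z hz => by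
      rw [hsum, hε z (Submodule.subset_span (Or.inr hz)), map_zero]) (htw v₀)
  rw [map_sub, map_sub, h0, zero_sub, neg_eq_zero, map_mul, map_mul, map_pow, map_pow,
    aeval_map_kForm, hsum, hwε] at h1
  simp at h1

end DualSetup

end

section

open MvPolynomial IsLocalRing

theorem mem_minimalPrimes_of_mem_associatedPrimes {A : Type} [CommRing A] [IsRegularRing A]
    {rs : List A} (h : RingTheory.Sequence.IsWeaklyRegular A rs) {Q : Ideal A}
    (hQ : Q ∈ associatedPrimes A (A ⧸ Ideal.ofList rs)) : Q ∈ (Ideal.ofList rs).minimalPrimes := by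
  have hp : Q.IsPrime := hQ.isPrime
  have hle : Ideal.ofList rs ≤ Q := by
    have := IsAssociatedPrime.annihilator_le hQ
    rwa [Submodule.annihilator_top, Ideal.annihilator_quotient] at this
  have hmem : ∀ (P : Ideal A), Ideal.ofList rs ≤ P → ∀ r ∈ rs, r ∈ P := fun P hP r hr =>
    hP (Ideal.subset_span hr)
  obtain ⟨t, ht⟩ := exists_nat_height_eq Q
  have h1 := length_le_height_of_isWeaklyRegular h Q (hmem Q hle)
  rw [ht, Nat.cast_le] at h1
  obtain ⟨s, rfl⟩ := Nat.exists_eq_add_of_le' h1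
  have hd := DepthAt.quotient_sup_ofList rs ⊥ (t := s)
    (.of_linearEquiv (Submodule.quotEquivOfEqBot _ rfl).symm (depthAt_height Q ht))
    (((Submodule.quotEquivOfEqBot (⊥ : Ideal A) rfl).isWeaklyRegular_congr rs).2 h)
  rw [bot_sup_eq] at hd
  have h2 := height_add_le_of_depthAt hd hQ le_rfl
  rw [ht, ← Nat.cast_add, Nat.cast_le] at h2
  obtain ⟨P, hP, hPQ⟩ := Ideal.exists_minimalPrimes_le hle
  have : P.IsPrime := hP.1.1
  have h3 := length_le_height_of_isWeaklyRegular h P (hmem P hP.1.2)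
  rcases hPQ.eq_or_lt with rfl | hlt
  · exact hP
  · have h4 := Ideal.height_add_one_le_of_lt_of_isPrime hlt
    rw [ht] at h4
    have h5 : ((rs.length : ℕ∞)) + 1 ≤ (s + rs.length : ℕ) := (add_le_add_left h3 1).trans h4
    rw [← Nat.cast_add_one, Nat.cast_le] at h5
    omega

theorem exists_pow_mul_mem_of_mem_minimalPrimes {A : Type*} [CommRing A] {J Q : Ideal A}
    (hQ : Q ∈ J.minimalPrimes) {w : A} (hw : w ∈ Q) : ∃ N, ∃ t ∉ Q, w ^ N * t ∈ J := by
  have hp : Q.IsPrime := hQ.1.1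
  by_contra! h
  obtain ⟨P, hP, hJP, hd⟩ := Ideal.exists_le_prime_disjoint J (Submonoid.powers w ⊔ Q.primeCompl) (by
    rw [Set.disjoint_left]
    rintro x hx hx'
    obtain ⟨y, ⟨N, rfl⟩, t, ht, rfl⟩ := Submonoid.mem_sup.1 hx'
    exact h N t ht hx)
  rw [Set.disjoint_left] at hd
  have hPQ : P ≤ Q := fun x hx => by
    by_contra hxQ
    exact hd hx (SetLike.le_def.1 le_sup_right hxQ)
  exact hd (hQ.2 ⟨hP, hJP⟩ hPQ hw) (SetLike.le_def.1 le_sup_left (Submonoid.mem_powers w))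

/-- An element which is regular modulo `J` locally at `P` divides, up to elements outside `P` and
modulo `J`, an element regular modulo `J`, if `J` has no embedded primes. -/
theorem exists_regular_mul_mem_of_regular_localization {A : Type} [CommRing A] [IsNoetherianRing A]
    {J P : Ideal A} [P.IsPrime] (hJ : ∀ Q ∈ associatedPrimes A (A ⧸ J), Q ∈ J.minimalPrimes) {r : A}
    (hr : ∀ a, ∀ s ∉ P, s * (r * a) ∈ J → ∃ s' ∉ P, s' * a ∈ J) :
    ∃ r', (∀ a, r' * a ∈ J → a ∈ J) ∧ ∃ u ∉ P, u * r' ∈ J ⊔ Ideal.span {r} := by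
  let a : Ideal A :=
    { carrier := {x | ∃ u ∉ P, u * x ∈ J ⊔ Ideal.span {r}}
      zero_mem' := ⟨1, (Ideal.ne_top_iff_one P).1 (Ideal.IsPrime.ne_top ‹_›), by simp⟩
      add_mem' := by
        rintro x y ⟨u, hu, hx⟩ ⟨v, hv, hy⟩
        refine ⟨u * v, fun h => (Ideal.IsPrime.mem_or_mem ‹_› h).elim hu hv, ?_⟩
        have h1 := Ideal.mul_mem_left _ v hx
        have h2 := Ideal.mul_mem_left _ u hy
        convert add_mem h1 h2 using 1
        ring
      smul_mem' := by
        rintro b x ⟨u, hu, hx⟩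
        refine ⟨u, hu, ?_⟩
        have h1 := Ideal.mul_mem_left _ b hx
        convert h1 using 1
        rw [smul_eq_mul]
        ring }
  have ha : ∀ x, x ∈ a ↔ ∃ u ∉ P, u * x ∈ J ⊔ Ideal.span {r} := fun x => Iff.rfl
  have hone : (1 : A) ∉ P := (Ideal.ne_top_iff_one P).1 (Ideal.IsPrime.ne_top ‹_›)
  have hra : r ∈ a := ⟨1, hone, by
    rw [one_mul]
    exact le_sup_right (a := J) (Ideal.mem_span_singleton_self r)⟩
  have hfin := associatedPrimes.finite A (A ⧸ J)
  have hnot : ¬ ((a : Set A) ⊆ ⋃ Q ∈ associatedPrimes A (A ⧸ J), (Q : Set A)) := by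
    intro hsub
    obtain ⟨Q, hQ, haQ⟩ := (Ideal.subset_union_prime_finite (f := id) hfin ⊥ ⊥
      (fun Q hQ _ _ => IsAssociatedPrime.isPrime hQ)).1 hsub
    have hmin := hJ Q hQ
    obtain ⟨z, hz⟩ := (mem_associatedPrimes_iff.1 hQ).2
    obtain ⟨b, rfl⟩ := Ideal.Quotient.mk_surjective z
    have hz' : ∀ x, x ∈ Q ↔ x * b ∈ J := fun x => by
      rw [hz, ← Ideal.Quotient.eq_zero_iff_mem]
      rfl
    by_cases hQP : Q ≤ P
    · obtain ⟨s, hs, hsb⟩ := hr b 1 hone (by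
        rw [one_mul]
        exact (hz' r).1 (haQ hra))
      exact hs (hQP ((hz' s).2 hsb))
    · obtain ⟨w, hwQ, hwP⟩ := SetLike.not_le_iff_exists.1 hQP
      obtain ⟨N, t, ht, hwt⟩ := exists_pow_mul_mem_of_mem_minimalPrimes hmin hwQ
      exact ht (haQ ⟨w ^ N, fun h => hwP (Ideal.IsPrime.mem_of_pow_mem ‹_› _ h),
        Ideal.mem_sup_left hwt⟩)
  obtain ⟨r', hr', hnr⟩ := Set.not_subset.1 hnot
  refine ⟨r', fun b hb => ?_, hr'⟩
  by_contra hbJ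
  obtain ⟨Q, hQ, hle⟩ := exists_le_isAssociatedPrime_of_isNoetherianRing A
    (Ideal.Quotient.mk J b) (by rwa [Ne, Ideal.Quotient.eq_zero_iff_mem])
  refine hnr (Set.mem_biUnion hQ (hle ?_))
  rw [Submodule.mem_colon_singleton, Submodule.mem_bot]
  exact Ideal.Quotient.eq_zero_iff_mem.2 hb

theorem isRegularRing_localization {A : Type} [CommRing A] [IsRegularRing A] (P : Ideal A)
    [P.IsPrime] : IsRegularRing (Localization.AtPrime P) := by
  have : IsNoetherianRing (Localization.AtPrime P) :=
    IsLocalization.isNoetherianRing P.primeCompl _ inferInstance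
  refine isRegularRing_iff.2 fun Q hQ => ?_
  exact IsRegularLocalRing.of_ringEquiv
    (IsLocalization.localizationLocalizationAtPrimeIsoLocalization P.primeCompl Q).toRingEquiv

/-- The quotient map of a localization at a prime, for the quotient by an ideal. -/
theorem localRingHom_mk_surjective {A : Type} [CommRing A] (J : Ideal A) (p : Ideal (A ⧸ J))
    [p.IsPrime] : Function.Surjective (Localization.localRingHom (p.comap (Ideal.Quotient.mk J)) p
      (Ideal.Quotient.mk J) rfl) :=
  RingHom.surjective_localRingHom_of_surjective _ Ideal.Quotient.mk_surjective p

theorem ker_localRingHom_mk {A : Type} [CommRing A] (J : Ideal A) (p : Ideal (A ⧸ J))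
    [p.IsPrime] : RingHom.ker (Localization.localRingHom (p.comap (Ideal.Quotient.mk J)) p
      (Ideal.Quotient.mk J) rfl) = J.map (algebraMap A _) := by
  have h : Submonoid.map (Ideal.Quotient.mk J) (p.comap (Ideal.Quotient.mk J)).primeCompl =
      p.primeCompl := Submonoid.map_comap_eq_of_surjective Ideal.Quotient.mk_surjective p.primeCompl
  have := IsLocalization.ker_map (S := Localization.AtPrime (p.comap (Ideal.Quotient.mk J)))
    (Localization.AtPrime p) (Ideal.Quotient.mk J) h
  rw [Ideal.mk_ker] at this
  exact this

theorem height_comap_mk_eq {A : Type} [CommRing A] [IsNoetherianRing A] {rs : List A}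
    (h : RingTheory.Sequence.IsWeaklyRegular A rs) (p : Ideal (A ⧸ Ideal.ofList rs)) [p.IsPrime] :
    (p.comap (Ideal.Quotient.mk (Ideal.ofList rs))).height = p.height + rs.length := by
  let P := p.comap (Ideal.Quotient.mk (Ideal.ofList rs))
  have h1 := h.isRegular_of_isLocalization_of_mem (Localization.AtPrime P) (p := P) fun r hr => by
    have h0 : Ideal.Quotient.mk (Ideal.ofList rs) r = 0 :=
      Ideal.Quotient.eq_zero_iff_mem.2 (Ideal.subset_span hr)
    rw [Ideal.mem_comap, h0]
    exact zero_mem _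
  have h2 := ringKrullDim_add_length_eq_ringKrullDim_of_isRegular _ h1
  have h3 := ringKrullDim_eq_of_ringEquiv ((Ideal.quotEquivOfEq
    ((Ideal.map_ofList _ rs).symm.trans (ker_localRingHom_mk (Ideal.ofList rs) p).symm)).trans
    (RingHom.quotientKerEquivOfSurjective (localRingHom_mk_surjective (Ideal.ofList rs) p)))
  rw [h3, IsLocalization.AtPrime.ringKrullDim_eq_height P (Localization.AtPrime P),
    IsLocalization.AtPrime.ringKrullDim_eq_height p (Localization.AtPrime p), List.length_map] at h2
  exact_mod_cast h2.symm

end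

section

open MvPolynomial IsLocalRing

theorem exists_card_eq_embDim (A : Type) [CommRing A] [IsLocalRing A] [IsNoetherianRing A] :
    ∃ s : Finset A, s.card = embDim A ∧ Ideal.span (s : Set A) = maximalIdeal A := by
  obtain ⟨s, hs⟩ := (maximalIdeal A).fg_of_isNoetherianRing
  exact Nat.sInf_mem (s := {n | ∃ s : Finset A, s.card = n ∧ Ideal.span (s : Set A) = maximalIdeal A})
    ⟨_, s, rfl, hs⟩

theorem embDim_le_card {A : Type} [CommRing A] [IsLocalRing A] (s : Finset A)
    (hs : Ideal.span (s : Set A) = maximalIdeal A) : embDim A ≤ s.card :=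
  Nat.sInf_le ⟨s, rfl, hs⟩

section

variable {O A : Type} [CommRing O] [IsLocalRing O] [IsNoetherianRing O] [CommRing A] [IsLocalRing A]
  {ι : Type}

omit [IsNoetherianRing O] in
theorem comap_maximalIdeal_of_surjective {π : O →+* A} (hπ : Function.Surjective π) :
    (maximalIdeal A).comap π = maximalIdeal O :=
  have := hπ.isLocalHom
  ((local_hom_TFAE π).out 0 4).1 this

theorem finrank_cotangentSpace_le {f : ι → maximalIdeal O} {π : O →+* A}
    (hπ : Function.Surjective π) (hker : RingHom.ker π = Ideal.span (Set.range fun j => (f j : O))) :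
    Module.finrank (ResidueField O) (CotangentSpace O) ≤ embDim A +
      Module.finrank (ResidueField O) (Submodule.span (ResidueField O)
        (Set.range fun j => (maximalIdeal O).toCotangent (f j))) := by
  have : IsNoetherianRing A := isNoetherianRing_of_surjective O A π hπ
  obtain ⟨s, hs, hspan⟩ := exists_card_eq_embDim A
  have hlift : ∀ a : s, ∃ g : maximalIdeal O, π g = a := fun a => by
    obtain ⟨g, hg⟩ := hπ a
    have : g ∈ (maximalIdeal A).comap π := by
      rw [Ideal.mem_comap, hg, ← hspan]
      exact Ideal.subset_span a.2
    rw [comap_maximalIdeal_of_surjective hπ] at this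
    exact ⟨⟨g, this⟩, hg⟩
  choose g hg using hlift
  have htop : Submodule.span O (Set.range g ∪ Set.range f) = ⊤ := by
    refine Submodule.map_injective_of_injective (maximalIdeal O).injective_subtype ?_
    rw [Submodule.map_span, Submodule.map_top, Submodule.range_subtype, Set.image_union,
      Submodule.span_union, ← Set.range_comp, ← Set.range_comp]
    have h1 : (maximalIdeal A) = (Ideal.span (Set.range ((maximalIdeal O).subtype ∘ g))).map π := by
      rw [Ideal.map_span, ← Set.range_comp, ← hspan]
      congr 1
      ext a
      constructor
      · intro ha
        exact ⟨⟨a, ha⟩, hg _⟩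
      · rintro ⟨b, rfl⟩
        have := hg b
        simp only [Function.comp_apply, Submodule.subtype_apply, this]
        exact b.2
    have h2 := congrArg (Ideal.comap π) h1
    rw [comap_maximalIdeal_of_surjective hπ, Ideal.comap_map_of_surjective' π hπ, hker] at h2
    exact h2.symm
  have h1 := CotangentSpace.span_image_eq_top_iff.2 htop
  rw [Set.image_union, Submodule.span_union, ← Set.range_comp, ← Set.range_comp] at h1
  rw [← finrank_top (ResidueField O) (CotangentSpace O), ← h1]
  refine (Submodule.finrank_add_le_finrank_add_finrank _ _).trans (Nat.add_le_add_right ?_ _)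
  refine (finrank_range_le_card _).trans ?_
  rw [Fintype.card_coe, hs]

theorem embDim_add_finrank_le {f : ι → maximalIdeal O} {π : O →+* A}
    (hπ : Function.Surjective π) (hker : RingHom.ker π = Ideal.span (Set.range fun j => (f j : O))) :
    embDim A + Module.finrank (ResidueField O) (Submodule.span (ResidueField O)
        (Set.range fun j => (maximalIdeal O).toCotangent (f j))) ≤
    Module.finrank (ResidueField O) (CotangentSpace O) := by
  classical
  obtain ⟨W, hW⟩ := Submodule.exists_isCompl (Submodule.span (ResidueField O)
        (Set.range fun j => (maximalIdeal O).toCotangent (f j)))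
  rw [← Submodule.finrank_add_eq_of_isCompl hW.symm]
  refine Nat.add_le_add_right ?_ _
  let b := Module.finBasis (ResidueField O) W
  choose g hg using fun i => (maximalIdeal O).toCotangent_surjective (b i : CotangentSpace O)
  have hspan : Submodule.span (ResidueField O) (Set.range fun i => (b i : CotangentSpace O)) = W := by
    have := congrArg (Submodule.map W.subtype) b.span_eq
    rwa [Submodule.map_span, ← Set.range_comp, Submodule.map_top, Submodule.range_subtype] at this
  have h1 : Submodule.span (ResidueField O)
      ((maximalIdeal O).toCotangent '' (Set.range g ∪ Set.range f)) = ⊤ := by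
    rw [Set.image_union, Submodule.span_union, ← Set.range_comp, ← Set.range_comp]
    have e : Submodule.span (ResidueField O) (Set.range ((maximalIdeal O).toCotangent ∘ g)) = W :=
      (congrArg (fun v => Submodule.span _ (Set.range v)) (funext hg)).trans hspan
    exact (congrArg₂ (· ⊔ ·) e rfl).trans hW.symm.sup_eq_top
  have htop := congrArg (Submodule.map (maximalIdeal O).subtype)
    (CotangentSpace.span_image_eq_top_iff.1 h1)
  rw [Submodule.map_span, Submodule.map_top, Submodule.range_subtype, Set.image_union,
      Submodule.span_union, ← Set.range_comp, ← Set.range_comp] at htop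
  have hA : maximalIdeal A = Ideal.span (Set.range fun i => π (g i)) := by
    rw [← Ideal.map_comap_of_surjective π hπ (maximalIdeal A), comap_maximalIdeal_of_surjective hπ]
    have h2 : maximalIdeal O = Ideal.span (Set.range fun i => (g i : O)) ⊔ RingHom.ker π := by
      rw [hker]
      exact htop.symm
    refine (congrArg (Ideal.map π) h2).trans ?_
    rw [Ideal.map_sup, (Ideal.map_eq_bot_iff_le_ker π).2 le_rfl, sup_bot_eq, Ideal.map_span,
      ← Set.range_comp]
    rfl
  refine (embDim_le_card (Finset.univ.image fun i => π (g i)) ?_).trans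
    (Finset.card_image_le.trans (by simp))
  rw [hA]
  simp

end

end

section

open MvPolynomial IsLocalRing

section

open KaehlerDifferential TensorProduct

variable {k O : Type} [Field k] [CommRing O] [IsLocalRing O] [Algebra k O] {ι τ : Type} [Fintype τ]

theorem finrank_span_toCotangent [Algebra.FormallySmooth k O]
    [Algebra.FormallySmooth k (ResidueField O)] (b : Module.Basis τ O (Ω[O⁄k]))
    (f : ι → maximalIdeal O) :
    Module.finrank (ResidueField O) (Submodule.span (ResidueField O)
        (Set.range fun j => (maximalIdeal O).toCotangent (f j))) =
    Module.finrank (ResidueField O) (Submodule.span (ResidueField O)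
        (Set.range fun j i => residue O (b.repr (D k O (f j)) i))) := by
  classical
  let c₀ : maximalIdeal O →ₗ[O] (τ → ResidueField O) :=
    { toFun := fun g i => residue O (b.repr (D k O g) i)
      map_add' := fun g h => by ext i; simp
      map_smul' := fun a g => by
        ext i
        have : residue O (g : O) = 0 := (residue_eq_zero_iff _).2 g.2
        simp [this, Algebra.smul_def] }
  have hc₀ : ∀ x y : maximalIdeal O, c₀ (x * y) = 0 := fun x y => by
    have : x * y = (x : O) • y := rfl
    rw [this, map_smul]
    ext i
    have : residue O (x : O) = 0 := (residue_eq_zero_iff _).2 x.2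
    simp [Algebra.smul_def, this]
  let c₁ := Ideal.Cotangent.lift (I := maximalIdeal O) c₀ hc₀
  let c : CotangentSpace O →ₗ[ResidueField O] (τ → ResidueField O) :=
    LinearMap.extendScalarsOfSurjective (residue_surjective (R := O)) c₁
  have hc : ∀ g, c ((maximalIdeal O).toCotangent g) = fun i => residue O (b.repr (D k O g) i) :=
    fun g => rfl
  have hker : ∀ y, c y = 0 → y = 0 := by
    intro y hy
    obtain ⟨g, rfl⟩ := (maximalIdeal O).toCotangent_surjective y
    rw [hc] at hy
    have h1 : (1 : ResidueField O) ⊗ₜ[O] D k O (g : O) = 0 := by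
      rw [← b.sum_repr (D k O (g : O)), TensorProduct.tmul_sum]
      refine Finset.sum_eq_zero fun i _ => ?_
      rw [TensorProduct.tmul_smul, TensorProduct.smul_tmul', Algebra.smul_def,
        show algebraMap O (ResidueField O) _ = 0 from congrFun hy i, zero_mul, TensorProduct.zero_tmul]
    have hinj := (Algebra.FormallySmooth.kerCotangentToTensor_injective_iff (R := k) (P := O)
      (A := ResidueField O) residue_surjective).2 inferInstance
    have hg : (g : O) ∈ RingHom.ker (algebraMap O (ResidueField O)) := (residue_eq_zero_iff _).2 g.2
    have h2 : (RingHom.ker (algebraMap O (ResidueField O))).toCotangent ⟨g, hg⟩ = 0 := by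
      refine hinj ?_
      rw [KaehlerDifferential.kerCotangentToTensor_toCotangent, map_zero]
      exact h1
    rw [Ideal.toCotangent_eq_zero] at h2 ⊢
    have h3 : RingHom.ker (algebraMap O (ResidueField O)) = maximalIdeal O := ker_residue
    exact (congrArg (fun I : Ideal O => (g : O) ∈ I ^ 2) h3).mp h2
  have hinj : Function.Injective c := (injective_iff_map_eq_zero c).2 hker
  rw [(Submodule.equivMapOfInjective c hinj _).finrank_eq, Submodule.map_span, ← Set.range_comp]
  rfl

end

theorem exists_basis_kaehlerDifferential_localization {k : Type} [Field k] {n : ℕ}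
    (P : Ideal (MvPolynomial (Fin n) k)) [P.IsPrime] :
    ∃ b : Module.Basis (Fin n) (Localization.AtPrime P)
      (KaehlerDifferential k (Localization.AtPrime P)), ∀ g i,
      b.repr (KaehlerDifferential.D k _ (algebraMap (MvPolynomial (Fin n) k) _ g)) i =
        algebraMap _ _ (pderiv i g) := by
  refine ⟨(KaehlerDifferential.mvPolynomialBasis k (Fin n)).ofIsLocalizedModule
    (Localization.AtPrime P) P.primeCompl
    (KaehlerDifferential.map k k (MvPolynomial (Fin n) k) (Localization.AtPrime P)), fun g i => ?_⟩
  rw [← KaehlerDifferential.map_D k k, Module.Basis.ofIsLocalizedModule_repr_apply,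
    KaehlerDifferential.mvPolynomialBasis_repr_apply]

theorem embDim_add_rankAt {k : Type} [Field k] [CharZero k] {n m : ℕ}
    (f : Fin m → MvPolynomial (Fin n) k) (P : Ideal (MvPolynomial (Fin n) k)) [P.IsPrime]
    (hfP : ∀ j, f j ∈ P) {A : Type} [CommRing A] [IsLocalRing A]
    (π : Localization.AtPrime P →+* A) (hπ : Function.Surjective π)
    (hker : RingHom.ker π = (Ideal.span (Set.range f)).map (algebraMap _ _)) :
    ((embDim A + rankAt P fun j i => pderiv i (f j) : ℕ) : ℕ∞) = P.height := by
  obtain ⟨b, hb⟩ := exists_basis_kaehlerDifferential_localization P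
  have : IsRegularRing (Localization.AtPrime P) := isRegularRing_localization P
  have : Algebra.FormallySmooth k (Localization.AtPrime P) :=
    have := Algebra.FormallyEtale.of_isLocalization (R := MvPolynomial (Fin n) k)
      (Rₘ := Localization.AtPrime P) P.primeCompl
    Algebra.FormallySmooth.comp k (MvPolynomial (Fin n) k) _
  have : Algebra.EssFiniteType k (Localization.AtPrime P) :=
    have := Algebra.EssFiniteType.of_isLocalization (R := MvPolynomial (Fin n) k)
      (Localization.AtPrime P) P.primeCompl
    Algebra.EssFiniteType.comp k (MvPolynomial (Fin n) k) _
  have : Algebra.EssFiniteType k (ResidueField (Localization.AtPrime P)) :=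
    have : Algebra.FiniteType (Localization.AtPrime P) (ResidueField (Localization.AtPrime P)) :=
      Algebra.FiniteType.of_surjective (Algebra.ofId _ _) residue_surjective
    Algebra.EssFiniteType.comp k (Localization.AtPrime P) _
  let g : Fin m → maximalIdeal (Localization.AtPrime P) := fun j => ⟨algebraMap _ _ (f j),
    (IsLocalization.AtPrime.to_map_mem_maximal_iff _ P _).2 (hfP j)⟩
  have hker' : RingHom.ker π = Ideal.span (Set.range fun j => (g j : Localization.AtPrime P)) := by
    rw [hker, Ideal.map_span, ← Set.range_comp]
    rfl
  have h1 := le_antisymm (finrank_cotangentSpace_le hπ hker') (embDim_add_finrank_le hπ hker')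
  rw [finrank_span_toCotangent b g] at h1
  have h2 : Module.finrank (ResidueField (Localization.AtPrime P)) (Submodule.span
      (ResidueField (Localization.AtPrime P)) (Set.range fun j i => residue (Localization.AtPrime P)
        (b.repr (KaehlerDifferential.D k _ (g j : Localization.AtPrime P)) i))) =
      rankAt P fun j i => pderiv i (f j) := by
    have h : (fun j i => residue (Localization.AtPrime P) (b.repr (KaehlerDifferential.D k _
        (g j : Localization.AtPrime P)) i)) = fun j i => algebraMap (MvPolynomial (Fin n) k)
          P.ResidueField (pderiv i (f j)) :=
      funext fun j => funext fun i => congrArg (residue _) (hb (f j) i)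
    rw [h]
    rfl
  rw [h2] at h1
  have h3 := (IsRegularLocalRing.iff_finrank_cotangentSpace (Localization.AtPrime P)).1 inferInstance
  rw [h1, IsLocalization.AtPrime.ringKrullDim_eq_height P] at h3
  exact_mod_cast h3

end

section

open MvPolynomial IsLocalRing

theorem SymmAlgebra.exists_lift {R M T : Type} [CommRing R] [AddCommGroup M] [Module R M]
    [CommRing T] [Algebra R T] (L : M →ₗ[R] T) :
    ∃ h : SymmAlgebra R M →+* T, (∀ r, h (Ideal.Quotient.mk _ (C r)) = algebraMap R T r) ∧
      ∀ x, h (Ideal.Quotient.mk _ (X x)) = L x := by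
  refine ⟨Ideal.Quotient.lift _ (eval₂Hom (algebraMap R T) L) ?_, fun r =>
    (Ideal.Quotient.lift_mk _ _ _).trans (eval₂Hom_C _ _ r), fun x =>
    (Ideal.Quotient.lift_mk _ _ _).trans (eval₂Hom_X' _ _ x)⟩
  intro a ha
  have : Ideal.span (symRels R M) ≤ RingHom.ker (eval₂Hom (algebraMap R T) L) := by
    rw [Ideal.span_le]
    rintro _ (⟨x, y, rfl⟩ | ⟨r, x, rfl⟩)
    · simp [RingHom.mem_ker]
    · simp [RingHom.mem_ker, Algebra.smul_def]
  exact this ha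

section

variable {R M : Type} [CommRing R] [AddCommGroup M] [Module R M]

theorem SymmAlgebra.mk_X_add (x y : M) : (Ideal.Quotient.mk (Ideal.span (symRels R M))) (X (x + y)) =
    Ideal.Quotient.mk _ (X x) + Ideal.Quotient.mk _ (X y) := by
  rw [← map_add, Ideal.Quotient.eq, ← sub_sub]
  exact Ideal.subset_span (Or.inl ⟨x, y, rfl⟩)

theorem SymmAlgebra.mk_X_smul (r : R) (x : M) :
    (Ideal.Quotient.mk (Ideal.span (symRels R M))) (X (r • x)) =
    Ideal.Quotient.mk _ (C r) * Ideal.Quotient.mk _ (X x) := by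
  rw [← map_mul, Ideal.Quotient.eq]
  exact Ideal.subset_span (Or.inr ⟨r, x, rfl⟩)

theorem SymmAlgebra.smul_eq (r : R) (y : SymmAlgebra R M) :
    r • y = Ideal.Quotient.mk _ (C r) * y := by
  obtain ⟨p, rfl⟩ := Ideal.Quotient.mk_surjective y
  rw [← map_mul, ← MvPolynomial.smul_eq_C_mul]
  rfl

theorem mem_span_torsion_iff (y : SymmAlgebra R M) :
    y ∈ Ideal.span ((Submodule.torsion R (SymmAlgebra R M) : Submodule R (SymmAlgebra R M)) :
      Set (SymmAlgebra R M)) ↔ ∃ r ∈ nonZeroDivisors R, Ideal.Quotient.mk _ (C r) * y = 0 := by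
  have key : ∀ (r : R) (y : SymmAlgebra R M), r • y = Ideal.Quotient.mk _ (C r) * y :=
    SymmAlgebra.smul_eq
  constructor
  · intro h
    suffices y ∈ Submodule.torsion R (SymmAlgebra R M) by
      obtain ⟨r, hr⟩ := (Submodule.mem_torsion_iff y).1 this
      exact ⟨r, r.2, (key r y).symm.trans hr⟩
    refine Submodule.span_induction (fun _ h => h) (zero_mem _) (fun _ _ _ _ => add_mem) ?_ h
    intro a x _ hx
    obtain ⟨r, hr⟩ := (Submodule.mem_torsion_iff x).1 hx
    refine (Submodule.mem_torsion_iff _).2 ⟨r, ?_⟩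
    have : (r : R) • x = 0 := hr
    change (r : R) • (a * x) = 0
    rw [key] at this ⊢
    rw [mul_left_comm, this, mul_zero]
  · rintro ⟨r, hr, h⟩
    exact Ideal.subset_span ((Submodule.mem_torsion_iff y).2 ⟨⟨r, hr⟩, (key r y).trans h⟩)

end

theorem KaehlerDifferential.D_aeval {k R : Type} [CommRing k] [CommRing R] [Algebra k R] {n : ℕ}
    (x : Fin n → R) (g : MvPolynomial (Fin n) k) :
    KaehlerDifferential.D k R (aeval x g) =
      ∑ i, aeval x (pderiv i g) • KaehlerDifferential.D k R (x i) := by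
  induction g using MvPolynomial.induction_on with
  | C a => simp
  | add p q hp hq => simp only [map_add, hp, hq, add_smul, Finset.sum_add_distrib]
  | mul_X p i hp =>
    simp only [map_mul, Derivation.leibniz, hp, pderiv_X, smul_eq_mul, map_add, add_smul,
      Finset.sum_add_distrib, Finset.smul_sum, mul_smul, aeval_X]
    congr 1
    rw [Finset.sum_eq_single i]
    · simp
    · intro j _ hj
      simp [hj.symm]
    · simp

section

variable {k R : Type} [Field k] [CommRing R] [Algebra k R] {n m : ℕ}
  {f : Fin m → MvPolynomial (Fin n) k} {p : MvPolynomial (Fin n) k →ₐ[k] R}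

theorem exists_lift_symmAlgebra_kaehler (hp : Function.Surjective p)
    (hker : RingHom.ker p = Ideal.span (Set.range f)) {T : Type} [CommRing T]
    (q : MvPolynomial (Fin n) (MvPolynomial (Fin n) k) →+* T) (hf : ∀ j, q (C (f j)) = 0)
    (hl : ∀ j, q (linForm fun i => pderiv i (f j)) = 0) :
    ∃ h : SymmAlgebra R (Ω[R⁄k]) →+* T,
      (∀ s, h (Ideal.Quotient.mk _ (C (p s))) = q (C s)) ∧
      ∀ i, h (Ideal.Quotient.mk _ (X (KaehlerDifferential.D k _ (p (X i))))) = q (X i) := by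
  have hJ : ∀ a ∈ Ideal.span (Set.range f), (q.comp C) a = 0 := fun a ha => by
    have : Ideal.span (Set.range f) ≤ RingHom.ker (q.comp C) := by
      rw [Ideal.span_le]
      rintro _ ⟨j, rfl⟩
      exact hf j
    exact this ha
  let _ : Algebra R T := (RingHom.liftOfSurjective (p : MvPolynomial (Fin n) k →+* R) hp
    ⟨q.comp C, fun a ha => hJ a (hker ▸ ha)⟩).toAlgebra
  have halg : ∀ s, algebraMap R T (p s) = q (C s) := fun s =>
    RingHom.liftOfRightInverse_comp_apply (p : MvPolynomial (Fin n) k →+* R) _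
      (Function.rightInverse_surjInv hp) ⟨q.comp C, fun a ha => hJ a (hker ▸ ha)⟩ s
  let _ : Algebra k T := (q.comp (C.comp C)).toAlgebra
  have halgk : ∀ s, algebraMap k T s = q (C (C s)) := fun s => rfl
  have : IsScalarTower k R T := IsScalarTower.of_algebraMap_eq fun a => by
    rw [halgk, ← halg, ← MvPolynomial.algebraMap_eq, AlgHom.commutes]
  let D₀ : MvPolynomial (Fin n) k → T := fun g => q (linForm fun i => pderiv i g)
  have hadd : ∀ a b, D₀ (a + b) = D₀ a + D₀ b := fun a b => by
    simp only [D₀, linForm, ← map_add, ← Finset.sum_add_distrib]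
    simp only [map_add, add_mul]
  have hmul : ∀ a b, D₀ (a * b) = q (C a) * D₀ b + q (C b) * D₀ a := fun a b => by
    simp only [D₀, linForm, ← map_mul, ← map_add, Finset.mul_sum, ← Finset.sum_add_distrib]
    congr 1
    refine Finset.sum_congr rfl fun i _ => ?_
    rw [Derivation.leibniz]
    simp only [smul_eq_mul, map_add, map_mul]
    ring
  have hC : ∀ a, D₀ (C a) = 0 := fun a => by simp [D₀, linForm]
  have hX : ∀ i, D₀ (X i) = q (X i) := fun i => by
    simp [D₀, linForm, pderiv_X, Pi.single_apply]
  have hJD : ∀ a ∈ Ideal.span (Set.range f), D₀ a = 0 := by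
    intro a ha
    induction ha using Submodule.span_induction with
    | mem a h =>
      obtain ⟨j, rfl⟩ := h
      exact hl j
    | zero => simpa using hC 0
    | add a b _ _ ha hb => rw [hadd, ha, hb, add_zero]
    | smul c a hmem ha => rw [smul_eq_mul, hmul, ha, show q (C a) = 0 from hJ a hmem]; simp
  have hwd : ∀ a b, p a = p b → D₀ a = D₀ b := fun a b h => by
    have h1 := hadd b (a - b)
    rw [add_sub_cancel, hJD (a - b) (by rw [← hker, RingHom.mem_ker, map_sub, h, sub_self]),
      add_zero] at h1
    exact h1
  let σ := Function.surjInv hp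
  have hσ : ∀ r, p (σ r) = r := Function.surjInv_eq _
  let D' : Derivation k R T :=
    Derivation.mk'
      { toFun := fun r => D₀ (σ r)
        map_add' := fun a b => by
          rw [← hadd]
          exact hwd _ _ (by rw [hσ, map_add, hσ, hσ])
        map_smul' := fun c a => by
          rw [RingHom.id_apply, Algebra.smul_def c (D₀ _), halgk,
            hwd (σ (c • a)) (C c * σ a) (by
              rw [hσ, map_mul, hσ, Algebra.smul_def, ← MvPolynomial.algebraMap_eq,
                AlgHom.commutes]), hmul, hC, mul_zero, add_zero] }
      (fun a b => by
        change D₀ (σ (a * b)) = a • D₀ (σ b) + b • D₀ (σ a)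
        rw [hwd (σ (a * b)) (σ a * σ b) (by rw [hσ, map_mul, hσ, hσ]), hmul,
          Algebra.smul_def, Algebra.smul_def, ← halg, ← halg, hσ, hσ])
  obtain ⟨h, h1, h2⟩ := SymmAlgebra.exists_lift D'.liftKaehlerDifferential
  refine ⟨h, fun s => (h1 _).trans (halg s), fun i => (h2 _).trans ?_⟩
  rw [Derivation.liftKaehlerDifferential_comp_D]
  exact (hwd _ _ (hσ _)).trans (hX i)

theorem exists_ringHom_symmAlgebra (hp : Function.Surjective p)
    (hker : RingHom.ker p = Ideal.span (Set.range f)) :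
    ∃ σ : MvPolynomial (Fin n) (MvPolynomial (Fin n) k) →+* SymmAlgebra R (Ω[R⁄k]),
      Function.Surjective σ ∧ (∀ s, σ (C s) = Ideal.Quotient.mk _ (C (p s))) ∧
      RingHom.ker σ = relIdeal f (fun j i => pderiv i (f j)) m := by
  let mk := Ideal.Quotient.mk (Ideal.span (symRels R (Ω[R⁄k])))
  let σ : MvPolynomial (Fin n) (MvPolynomial (Fin n) k) →+* SymmAlgebra R (Ω[R⁄k]) :=
    eval₂Hom ((mk.comp C).comp (p : MvPolynomial (Fin n) k →+* R))
      fun i => mk (X (KaehlerDifferential.D k R (p (X i))))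
  have hσC : ∀ s, σ (C s) = mk (C (p s)) := fun s => eval₂Hom_C _ _ s
  have hσX : ∀ i, σ (X i) = mk (X (KaehlerDifferential.D k R (p (X i)))) := fun i =>
    eval₂Hom_X' _ _ i
  let incl : Ω[R⁄k] →+ SymmAlgebra R (Ω[R⁄k]) :=
    AddMonoidHom.mk' (fun x => mk (X x)) SymmAlgebra.mk_X_add
  have hlin : ∀ g, σ (linForm fun i => pderiv i g) = mk (X (KaehlerDifferential.D k R (p g))) := by
    intro g
    have hpa : ∀ g, aeval (fun i => p (X i)) g = p g := fun g =>
      (DFunLike.congr_fun (MvPolynomial.aeval_unique p) g).symm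
    have h1 := KaehlerDifferential.D_aeval (k := k) (fun i => p (X i)) g
    simp only [hpa] at h1
    rw [h1, linForm, map_sum]
    refine Eq.trans ?_ (map_sum incl _ _).symm
    refine Finset.sum_congr rfl fun i _ => ?_
    rw [map_mul, hσC, hσX]
    exact (SymmAlgebra.mk_X_smul _ _).symm
  refine ⟨σ, ?_, hσC, le_antisymm ?_ ?_⟩
  · have hrange : ∀ ω : Ω[R⁄k], mk (X ω) ∈ σ.range := by
      intro ω
      have h := KaehlerDifferential.span_range_derivation k R
      have hω : ω ∈ Submodule.span R (Set.range (KaehlerDifferential.D k R)) := h ▸ trivial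
      induction hω using Submodule.span_induction with
      | mem x hx =>
        obtain ⟨r, rfl⟩ := hx
        obtain ⟨g, rfl⟩ := hp r
        exact ⟨_, hlin g⟩
      | zero => exact (map_zero incl : mk (X 0) = 0) ▸ zero_mem _
      | add x y _ _ hx hy => exact (SymmAlgebra.mk_X_add x y : mk _ = _) ▸ add_mem hx hy
      | smul r x _ hx =>
        obtain ⟨g, rfl⟩ := hp r
        exact (SymmAlgebra.mk_X_smul (p g) x : mk _ = _) ▸ mul_mem ⟨C g, hσC g⟩ hx
    intro y
    obtain ⟨F, rfl⟩ := Ideal.Quotient.mk_surjective y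
    change mk F ∈ σ.range
    induction F using MvPolynomial.induction_on with
    | C r =>
      obtain ⟨g, rfl⟩ := hp r
      exact ⟨C g, hσC g⟩
    | add a b ha hb => exact (map_add mk a b) ▸ add_mem ha hb
    | mul_X a i ha => exact (map_mul mk a (X i)) ▸ mul_mem ha (hrange i)
  · obtain ⟨h, h1, h2⟩ := exists_lift_symmAlgebra_kaehler hp hker
      (Ideal.Quotient.mk (relIdeal f (fun j i => pderiv i (f j)) m))
      (fun j => Ideal.Quotient.eq_zero_iff_mem.2 (C_mem_relIdeal _ _ _ j))
      (fun j => Ideal.Quotient.eq_zero_iff_mem.2 (linForm_mem_relIdeal _ _ j j.2))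
    have hc : h.comp σ = Ideal.Quotient.mk (relIdeal f (fun j i => pderiv i (f j)) m) := by
      refine MvPolynomial.ringHom_ext (fun s => ?_) fun i => ?_
      · rw [RingHom.comp_apply, hσC]
        exact h1 s
      · rw [RingHom.comp_apply, hσX]
        exact h2 i
    intro F hF
    rw [← Ideal.Quotient.eq_zero_iff_mem, ← hc, RingHom.comp_apply, (RingHom.mem_ker).1 hF, map_zero]
  · refine relIdeal_le_of_mem (fun j => ?_) fun j => ?_
    · rw [RingHom.mem_ker, hσC, show p (f j) = 0 from by
        rw [← RingHom.mem_ker, hker]; exact Ideal.subset_span ⟨j, rfl⟩, map_zero, map_zero]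
    · rw [RingHom.mem_ker, hlin, show p (f j) = 0 from by
        rw [← RingHom.mem_ker, hker]; exact Ideal.subset_span ⟨j, rfl⟩, map_zero]
      exact map_zero incl

theorem exists_ringHom_reesAlgebra (hp : Function.Surjective p)
    (hker : RingHom.ker p = Ideal.span (Set.range f)) :
    ∃ π : MvPolynomial (Fin n) (MvPolynomial (Fin n) k) →+* ReesAlgebraOfModule R (Ω[R⁄k]),
      Function.Surjective π ∧ ∀ F, π F = 0 ↔ ∃ r,
        (∀ a, r * a ∈ Ideal.span (Set.range f) → a ∈ Ideal.span (Set.range f)) ∧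
        C r * F ∈ relIdeal f (fun j i => pderiv i (f j)) m := by
  obtain ⟨σ, hσ, hσC, hσker⟩ := exists_ringHom_symmAlgebra hp hker
  refine ⟨(Ideal.Quotient.mk _).comp σ, Ideal.Quotient.mk_surjective.comp hσ, fun F => ?_⟩
  rw [RingHom.comp_apply, Ideal.Quotient.eq_zero_iff_mem, mem_span_torsion_iff]
  constructor
  · rintro ⟨r, hr, h⟩
    obtain ⟨s, rfl⟩ := hp r
    refine ⟨s, fun a ha => ?_, ?_⟩
    · rw [← hker, RingHom.mem_ker, map_mul] at ha
      rw [← hker, RingHom.mem_ker]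
      exact (mul_left_mem_nonZeroDivisors_eq_zero_iff hr).1 ha
    · rw [← hσker, RingHom.mem_ker, map_mul, hσC]
      exact h
  · rintro ⟨s, hs, h⟩
    refine ⟨p s, ?_, ?_⟩
    · rw [mem_nonZeroDivisors_iff_right]
      intro x hx
      obtain ⟨a, rfl⟩ := hp x
      have := hs a
      simp only [← hker, RingHom.mem_ker, map_mul] at this
      exact this ((mul_comm _ _).trans hx)
    · rw [← hσker, RingHom.mem_ker, map_mul, hσC] at h
      exact h

end

end

section

open MvPolynomial IsLocalRing

theorem exists_height_eq_of_natCast_succ_le {R : Type} [CommRing R] [IsNoetherianRing R] {q : Ideal R}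
    [q.IsPrime] {h : ℕ} (hq : q.height = (h + 1 : ℕ)) :
    ∃ q' : Ideal R, q'.IsPrime ∧ q' < q ∧ q'.height = h := by
  have h1 := (PrimeSpectrum.height_eq_orderHeight (⟨q, inferInstance⟩ : PrimeSpectrum R)).symm
  have h2 : (h : ℕ∞) < Order.height (⟨q, inferInstance⟩ : PrimeSpectrum R) := by
    rw [h1, hq]
    exact_mod_cast Nat.lt_succ_self h
  obtain ⟨y, hy, hh⟩ := (Order.coe_lt_height_iff (by
    rw [h1, hq]; exact WithTop.coe_lt_top _)).1 h2
  exact ⟨y.asIdeal, y.2, hy, by rw [← hh]; exact PrimeSpectrum.height_eq_orderHeight y⟩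

theorem height_le_of_forall_le_comap {A B C : Type} [CommRing A] [CommRing B] [CommRing C]
    {α : A →+* B} {β : A →+* C} (hα : Function.Surjective α) (hβ : Function.Surjective β)
    {P : Ideal B} {Q : Ideal C} [P.IsPrime] [Q.IsPrime] (h : Q.comap β ≤ P.comap α)
    (hle : ∀ Q' : Ideal C, Q'.IsPrime → Q' ≤ Q → RingHom.ker α ≤ Q'.comap β) :
    Q.height ≤ P.height := by
  rw [PrimeSpectrum.height_eq_orderHeight (⟨Q, inferInstance⟩ : PrimeSpectrum C),
    PrimeSpectrum.height_eq_orderHeight (⟨P, inferInstance⟩ : PrimeSpectrum B)]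
  refine Order.height_le fun s hs => ?_
  have hsQ : ∀ i, (s i).asIdeal ≤ Q := fun i => by
    have : s i ≤ s.last := s.monotone (Fin.le_last i)
    rw [hs] at this
    exact this
  have hp : ∀ i, ((s i).asIdeal.comap β).IsPrime := fun i => inferInstance
  have hker : ∀ i, RingHom.ker α ≤ (s i).asIdeal.comap β := fun i => hle _ (s i).2 (hsQ i)
  have hcm : ∀ i, (((s i).asIdeal.comap β).map α).comap α = (s i).asIdeal.comap β := fun i => by
    rw [Ideal.comap_map_of_surjective' α hα, sup_eq_left]
    exact hker i
  let t : LTSeries (PrimeSpectrum B) := LTSeries.mk s.length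
    (fun i => ⟨((s i).asIdeal.comap β).map α,
      Ideal.map_isPrime_of_surjective hα (hker i)⟩) (by
      intro i j hij
      have h1 : s i < s j := s.strictMono hij
      refine lt_of_le_of_ne (Ideal.map_mono (Ideal.comap_mono h1.le)) fun he => h1.ne ?_
      have h2 := congrArg (fun x : PrimeSpectrum B => x.asIdeal.comap α) he
      simp only [hcm] at h2
      exact PrimeSpectrum.ext (Ideal.comap_injective_of_surjective β hβ h2))
  refine Order.length_le_height (p := t) ?_
  change ((s.last).asIdeal.comap β).map α ≤ P
  rw [hs, Ideal.map_le_iff_le_comap]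
  exact h

section

variable {S R B : Type} [CommRing S] [IsNoetherianRing S] [CommRing R] [CommRing B] {n m : ℕ}
  {f : Fin m → S} {φ : Fin m → Fin n → S} {p : S →+* R} {π : MvPolynomial (Fin n) S →+* B}

omit [IsNoetherianRing S] in
theorem ker_le_comap_of_relIdeal_le
    (hπker : ∀ F, π F = 0 ↔ ∃ r, (∀ a, r * a ∈ Ideal.span (Set.range f) →
      a ∈ Ideal.span (Set.range f)) ∧ C r * F ∈ relIdeal f φ m)
    {Q : Ideal S} (hQ : Q ∈ (Ideal.span (Set.range f)).minimalPrimes)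
    {P : Ideal (MvPolynomial (Fin n) S)} [P.IsPrime] (hPQ : P.comap C ≤ Q)
    (hP : relIdeal f φ m ≤ P) : RingHom.ker π ≤ P := by
  intro F hF
  obtain ⟨r, hr, h⟩ := (hπker F).1 hF
  refine ((inferInstance : P.IsPrime).mem_or_mem (hP h)).resolve_left fun h1 => ?_
  obtain ⟨N, t, ht, h2⟩ := exists_pow_mul_mem_of_mem_minimalPrimes hQ (hPQ h1)
  have h3 : ∀ N, r ^ N * t ∈ Ideal.span (Set.range f) → t ∈ Ideal.span (Set.range f) := by
    intro N
    induction N with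
    | zero => simp
    | succ N ih => exact fun h => ih (hr _ (by rwa [← mul_assoc, ← pow_succ']))
  exact ht (hQ.1.2 (h3 N h2))

theorem natCast_le_height_map_irr_bot {D : Type} [CommRing D] [IsDomain D] [IsNoetherianRing D]
    (v : Fin m → Fin n → D) {L : Ideal (MvPolynomial (Fin n) D)}
    (hL' : L = Ideal.span (Set.range fun j => linForm (v j))) (hL : L ≤ irr n (⊥ : Ideal D)) :
    (n : ℕ∞) ≤ ((irr n (⊥ : Ideal D)).map (Ideal.Quotient.mk L)).height + m := by
  have h1 := Ideal.height_le_height_add_spanFinrank_of_le hL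
  have hfin : L.spanFinrank ≤ m := by
    rw [hL']
    refine (Submodule.spanFinrank_span_le_ncard_of_finite (Set.finite_range _)).trans ?_
    rw [← Set.image_univ]
    exact (Set.ncard_image_le (Set.finite_univ)).trans (by simp)
  rw [height_irr, Ideal.height_bot, zero_add] at h1
  exact h1.trans (add_le_add le_rfl (by exact_mod_cast hfin))

omit [IsNoetherianRing S] in
theorem le_height_add_of_surjective {D : Type} [CommRing D] [IsDomain D] [IsNoetherianRing D]
    (hπ : Function.Surjective π)
    (hπker : ∀ F, π F = 0 ↔ ∃ r, (∀ a, r * a ∈ Ideal.span (Set.range f) →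
      a ∈ Ideal.span (Set.range f)) ∧ C r * F ∈ relIdeal f φ m)
    {σ : S →+* D} (hσ : Function.Surjective σ)
    (hQ : RingHom.ker σ ∈ (Ideal.span (Set.range f)).minimalPrimes)
    {P : Ideal B} [P.IsPrime] (hP : irr n (RingHom.ker σ) ≤ P.comap π) :
    (n : ℕ∞) ≤ P.height + m := by
  obtain ⟨L, hL'⟩ : ∃ L, L = Ideal.span (Set.range fun j => linForm fun i => σ (φ j i)) := ⟨_, rfl⟩
  have hL : L ≤ irr n (⊥ : Ideal D) := by
    rw [hL', Ideal.span_le]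
    rintro _ ⟨j, rfl⟩
    simp [irr, linForm]
  have : ((irr n (⊥ : Ideal D)).map (Ideal.Quotient.mk L)).IsPrime :=
    Ideal.isPrime_map_quotientMk_of_isPrime hL
  refine (natCast_le_height_map_irr_bot _ hL' hL).trans (add_le_add ?_ le_rfl)
  have hγ : Function.Surjective (MvPolynomial.map σ : MvPolynomial (Fin n) S →+* _) :=
    MvPolynomial.map_surjective _ hσ
  have hcomap : ((irr n (⊥ : Ideal D)).map (Ideal.Quotient.mk L)).comap
      ((Ideal.Quotient.mk L).comp (MvPolynomial.map σ)) = irr n (RingHom.ker σ) := by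
    rw [← Ideal.comap_comap, Ideal.comap_map_of_surjective' _ Ideal.Quotient.mk_surjective,
      Ideal.mk_ker, sup_eq_left.2 hL]
    ext F
    simp [irr, constantCoeff_map]
  refine height_le_of_forall_le_comap hπ (β := (Ideal.Quotient.mk L).comp (MvPolynomial.map σ))
    (Ideal.Quotient.mk_surjective.comp hγ) (hcomap.le.trans hP) ?_
  intro Q' hQ' hle
  refine ker_le_comap_of_relIdeal_le hπker hQ ?_ (relIdeal_le_of_mem (fun j => ?_) fun j => ?_)
  · have := Ideal.comap_mono (f := C)
      (Ideal.comap_mono (f := (Ideal.Quotient.mk L).comp (MvPolynomial.map σ)) hle)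
    rwa [hcomap, comap_C_irr] at this
  · have h0 : σ (f j) = 0 := hQ.1.2 (Ideal.subset_span (Set.mem_range_self j))
    rw [Ideal.mem_comap, RingHom.comp_apply, MvPolynomial.map_C, h0, C_0, map_zero]
    exact Q'.zero_mem
  · have h0 : MvPolynomial.map σ (linForm (φ j)) ∈ L := by
      rw [hL']
      refine Ideal.subset_span ⟨j, ?_⟩
      simp [linForm]
    rw [Ideal.mem_comap, RingHom.comp_apply, Ideal.Quotient.eq_zero_iff_mem.2 h0]
    exact Q'.zero_mem

theorem le_height_add_of_mem_minimalPrimes (hπ : Function.Surjective π)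
    (hπker : ∀ F, π F = 0 ↔ ∃ r, (∀ a, r * a ∈ Ideal.span (Set.range f) →
      a ∈ Ideal.span (Set.range f)) ∧ C r * F ∈ relIdeal f φ m)
    {Q : Ideal S} [Q.IsPrime] (hQ : Q ∈ (Ideal.span (Set.range f)).minimalPrimes)
    {P : Ideal B} [P.IsPrime] (hP : irr n Q ≤ P.comap π) : (n : ℕ∞) ≤ P.height + m :=
  le_height_add_of_surjective hπ hπker (σ := Ideal.Quotient.mk Q) Ideal.Quotient.mk_surjective
    (by rwa [Ideal.mk_ker]) (by rwa [Ideal.mk_ker])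

omit [IsNoetherianRing S] in
theorem ker_le_irr_comap (hker : RingHom.ker p = Ideal.span (Set.range f))
    (hπker : ∀ F, π F = 0 ↔ ∃ r, (∀ a, r * a ∈ Ideal.span (Set.range f) →
      a ∈ Ideal.span (Set.range f)) ∧ C r * F ∈ relIdeal f φ m) (q : Ideal R) :
    RingHom.ker π ≤ irr n (q.comap p) := by
  intro F hF
  obtain ⟨r, hr, h⟩ := (hπker F).1 hF
  have h1 : relIdeal f φ m ≤ irr n (Ideal.span (Set.range f)) :=
    relIdeal_le_of_mem (fun j => by
        simpa [irr] using Ideal.subset_span (α := S) (Set.mem_range_self j))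
      fun j => by simp [irr, linForm]
  have h2 : constantCoeff F ∈ Ideal.span (Set.range f) := hr _ (by simpa [irr] using h1 h)
  rw [← hker, RingHom.mem_ker] at h2
  simp [irr, h2]

theorem height_add_le_height_add [IsNoetherianRing R] [IsNoetherianRing B]
    (hp : Function.Surjective p)
    (hker : RingHom.ker p = Ideal.span (Set.range f)) (hπ : Function.Surjective π)
    (hπker : ∀ F, π F = 0 ↔ ∃ r, (∀ a, r * a ∈ Ideal.span (Set.range f) →
      a ∈ Ideal.span (Set.range f)) ∧ C r * F ∈ relIdeal f φ m) {h : ℕ} :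
    ∀ {q : Ideal R} [q.IsPrime] {P : Ideal B} [P.IsPrime], irr n (q.comap p) = P.comap π →
      q.height = h → (h + n : ℕ∞) ≤ P.height + m := by
  induction h with
  | zero =>
    intro q _ P _ hP hq
    rw [Nat.cast_zero, zero_add]
    refine le_height_add_of_mem_minimalPrimes hπ hπker (Q := q.comap p) ?_ hP.le
    rw [← hker, RingHom.ker_eq_comap_bot, Ideal.comap_minimalPrimes_eq_of_surjective hp]
    exact ⟨q, (Ideal.height_eq_zero_iff).1 (by exact_mod_cast hq), rfl⟩
  | succ h ih =>
    intro q _ P _ hP hq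
    obtain ⟨q', hq', hlt, hh⟩ := exists_height_eq_of_natCast_succ_le hq
    have hkerP := ker_le_irr_comap hker hπker q'
    have hcm : ((irr n (q'.comap p)).map π).comap π = irr n (q'.comap p) := by
      rw [Ideal.comap_map_of_surjective' π hπ, sup_eq_left]
      exact hkerP
    have hprime : ((irr n (q'.comap p)).map π).IsPrime := Ideal.map_isPrime_of_surjective hπ hkerP
    have h1 := ih (q := q') (P := (irr n (q'.comap p)).map π) hcm.symm hh
    have hlt' : (irr n (q'.comap p)).map π < P := by
      refine lt_of_le_of_ne ?_ ?_
      · rw [Ideal.map_le_iff_le_comap, ← hP]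
        exact Ideal.comap_mono (Ideal.comap_mono hlt.le)
      · rintro rfl
        rw [hcm] at hP
        have := congrArg (Ideal.comap C) hP
        rw [comap_C_irr, comap_C_irr] at this
        exact hlt.ne (Ideal.comap_injective_of_surjective p hp this).symm
    have h2 := Ideal.height_add_one_le_of_lt_of_isPrime hlt'
    calc ((h + 1 : ℕ) + n : ℕ∞) = (h + n) + 1 := by push_cast; ring
      _ ≤ ((irr n (q'.comap p)).map π).height + m + 1 := by gcongr
      _ = ((irr n (q'.comap p)).map π).height + 1 + m := by ring
      _ ≤ _ := by gcongr

end

end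

section

open MvPolynomial IsLocalRing

/-- The elements of the polynomial ring killed, modulo the ideal `relIdeal f φ m`, by a
coefficient which is regular modulo `f`. -/
def torsIdeal {A : Type} [CommRing A] {n m : ℕ} (f : Fin m → A) (φ : Fin m → Fin n → A) :
    Ideal (MvPolynomial (Fin n) A) where
  carrier := {F | ∃ r, (∀ a, r * a ∈ Ideal.span (Set.range f) → a ∈ Ideal.span (Set.range f)) ∧
    C r * F ∈ relIdeal f φ m}
  zero_mem' := ⟨1, fun a ha => by rwa [one_mul] at ha, by simp⟩
  add_mem' := by
    rintro F G ⟨r, hr, hF⟩ ⟨s, hs, hG⟩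
    refine ⟨r * s, fun a ha => hs _ (hr _ (by rwa [mul_assoc] at ha)), ?_⟩
    have : C (r * s) * (F + G) = C s * (C r * F) + C r * (C s * G) := by
      rw [C_mul]; ring
    rw [this]
    exact add_mem (Ideal.mul_mem_left _ _ hF) (Ideal.mul_mem_left _ _ hG)
  smul_mem' := by
    rintro G F ⟨r, hr, hF⟩
    refine ⟨r, hr, ?_⟩
    rw [smul_eq_mul, mul_left_comm]
    exact Ideal.mul_mem_left _ _ hF

theorem mem_torsIdeal {A : Type} [CommRing A] {n m : ℕ} {f : Fin m → A} {φ : Fin m → Fin n → A}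
    {F : MvPolynomial (Fin n) A} : F ∈ torsIdeal f φ ↔
    ∃ r, (∀ a, r * a ∈ Ideal.span (Set.range f) → a ∈ Ideal.span (Set.range f)) ∧
    C r * F ∈ relIdeal f φ m := Iff.rfl

theorem map_relIdeal {A B : Type} [CommRing A] [CommRing B] (σ : A →+* B) {n m : ℕ} (f : Fin m → A)
    (φ : Fin m → Fin n → A) (g : ℕ) : (relIdeal f φ g).map (MvPolynomial.map σ) =
      relIdeal (fun j => σ (f j)) (fun j i => σ (φ j i)) g := by
  simp only [relIdeal, Ideal.map_sup, Ideal.map_span]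
  congr 2
  · rw [← Set.range_comp, ← Set.range_comp, ← Set.range_comp]
    congr 1
    ext j
    simp
  · ext z
    constructor
    · rintro ⟨_, ⟨i, hi, rfl⟩, rfl⟩
      exact ⟨i, hi, by simp [linForm]⟩
    · rintro ⟨i, hi, rfl⟩
      exact ⟨_, ⟨i, hi, rfl⟩, by simp [linForm]⟩

section

variable {S O : Type} [CommRing S] [CommRing O] [Algebra S O] {P : Ideal S} [P.IsPrime]
  [IsLocalization.AtPrime O P]

theorem span_range_algebraMap (O : Type) [CommRing O] [Algebra S O] {m : ℕ} (f : Fin m → S) :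
    Ideal.span (Set.range fun j => algebraMap S O (f j)) =
      (Ideal.span (Set.range f)).map (algebraMap S O) := by
  rw [Ideal.map_span, ← Set.range_comp]
  rfl

theorem exists_mul_eq_map (P : Ideal S) [P.IsPrime] [IsLocalization.AtPrime O P] {n : ℕ}
    (F : MvPolynomial (Fin n) O) : ∃ v ∉ P, ∃ G : MvPolynomial (Fin n) S,
      C (algebraMap S O v) * F = MvPolynomial.map (algebraMap S O) G := by
  have : IsLocalization P.primeCompl O := ‹_›
  let _ : Algebra (MvPolynomial (Fin n) S) (MvPolynomial (Fin n) O) :=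
    MvPolynomial.algebraMvPolynomial
  have := MvPolynomial.isLocalization (σ := Fin n) P.primeCompl O
  obtain ⟨⟨G, w, v, hv, rfl⟩, h⟩ := IsLocalization.surj (P.primeCompl.map (C (σ := Fin n))) F
  refine ⟨v, hv, G, ?_⟩
  rw [MvPolynomial.algebraMap_def, MvPolynomial.map_C] at h
  rw [mul_comm]
  exact h

theorem map_mem_relIdeal_iff (P : Ideal S) [P.IsPrime] [IsLocalization.AtPrime O P] {n m : ℕ}
    (f : Fin m → S) (φ : Fin m → Fin n → S) {F : MvPolynomial (Fin n) S} {g : ℕ} :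
    MvPolynomial.map (algebraMap S O) F ∈
      relIdeal (fun j => algebraMap S O (f j)) (fun j i => algebraMap S O (φ j i)) g ↔
    ∃ v ∉ P, C v * F ∈ relIdeal f φ g := by
  have : IsLocalization P.primeCompl O := ‹_›
  let _ : Algebra (MvPolynomial (Fin n) S) (MvPolynomial (Fin n) O) :=
    MvPolynomial.algebraMvPolynomial
  have := MvPolynomial.isLocalization (σ := Fin n) P.primeCompl O
  rw [← map_relIdeal, ← MvPolynomial.algebraMap_def,
    IsLocalization.algebraMap_mem_map_algebraMap_iff (P.primeCompl.map (C (σ := Fin n)))]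
  constructor
  · rintro ⟨_, ⟨v, hv, rfl⟩, h⟩
    exact ⟨v, hv, h⟩
  · rintro ⟨v, hv, h⟩
    exact ⟨_, ⟨v, hv, rfl⟩, h⟩

theorem algebraMap_mem_map_iff (P : Ideal S) [P.IsPrime] [IsLocalization.AtPrime O P] {J : Ideal S}
    {a : S} : algebraMap S O a ∈ J.map (algebraMap S O) ↔ ∃ v ∉ P, v * a ∈ J := by
  rw [IsLocalization.algebraMap_mem_map_algebraMap_iff P.primeCompl]
  rfl

theorem regular_map (P : Ideal S) [P.IsPrime] [IsLocalization.AtPrime O P] {J : Ideal S} {r : S}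
    (hr : ∀ a, r * a ∈ J → a ∈ J) (a : O)
    (ha : algebraMap S O r * a ∈ J.map (algebraMap S O)) : a ∈ J.map (algebraMap S O) := by
  obtain ⟨⟨b, v⟩, hb⟩ := IsLocalization.surj P.primeCompl a
  have hv := IsLocalization.map_units O v
  rw [← Ideal.mul_unit_mem_iff_mem _ hv, hb, algebraMap_mem_map_iff P]
  rw [← Ideal.mul_unit_mem_iff_mem _ hv, mul_assoc, hb, ← map_mul, algebraMap_mem_map_iff P] at ha
  obtain ⟨w, hw, h⟩ := ha
  exact ⟨w, hw, hr _ (by rwa [mul_left_comm])⟩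

theorem map_mem_torsIdeal_iff [IsRegularRing S] (P : Ideal S) [P.IsPrime]
    [IsLocalization.AtPrime O P] {n m : ℕ}
    {f : Fin m → S} (hf : RingTheory.Sequence.IsWeaklyRegular S (List.ofFn f))
    (φ : Fin m → Fin n → S) {F : MvPolynomial (Fin n) S} :
    MvPolynomial.map (algebraMap S O) F ∈
      torsIdeal (fun j => algebraMap S O (f j)) (fun j i => algebraMap S O (φ j i)) ↔
    ∃ v ∉ P, C v * F ∈ torsIdeal f φ := by
  rw [mem_torsIdeal, span_range_algebraMap]
  constructor
  · rintro ⟨r, hr, h⟩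
    obtain ⟨⟨b, v⟩, hb⟩ := IsLocalization.surj P.primeCompl r
    have hv := IsLocalization.map_units O v
    have h1 := Ideal.mul_mem_left _ (C (algebraMap S O v)) h
    rw [← mul_assoc, ← C_mul, mul_comm (algebraMap S O v), hb, ← MvPolynomial.map_C, ← map_mul,
      map_mem_relIdeal_iff P] at h1
    obtain ⟨w, hw, h1⟩ := h1
    obtain ⟨r', hr', u, hu, h2⟩ := exists_regular_mul_mem_of_regular_localization
      (P := P) (J := Ideal.span (Set.range f)) (r := b) (by
        rw [← ofList_ofFn]
        exact fun Q hQ => mem_minimalPrimes_of_mem_associatedPrimes hf hQ) (by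
      intro a s hs hsa
      rw [← algebraMap_mem_map_iff (O := O) P]
      refine hr _ ?_
      rw [← Ideal.unit_mul_mem_iff_mem _ hv, ← mul_assoc, mul_comm (algebraMap S O v), hb,
        ← map_mul, algebraMap_mem_map_iff P]
      exact ⟨s, hs, hsa⟩)
    refine ⟨u * w, fun h => ((inferInstance : P.IsPrime).mem_or_mem h).elim hu hw, r', hr', ?_⟩
    obtain ⟨y, hy, z, hz, hyz⟩ := Submodule.mem_sup.1 h2
    obtain ⟨c, rfl⟩ := Ideal.mem_span_singleton'.1 hz
    have h3 : C r' * (C (u * w) * F) = (C w * F) * C y + C c * (C w * (C b * F)) := by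
      have h4 := congrArg (C (σ := Fin n)) hyz
      simp only [C_mul, C_add] at h4 ⊢
      linear_combination (-(C w * F)) * h4
    rw [h3]
    exact add_mem (Ideal.mul_mem_left _ _ ((le_sup_left : _ ≤ relIdeal f φ m)
      (Ideal.mem_map_of_mem _ hy))) (Ideal.mul_mem_left _ _ h1)
  · rintro ⟨w, hw, r, hr, h⟩
    refine ⟨algebraMap S O r, regular_map P hr, ?_⟩
    rw [← MvPolynomial.map_C, ← map_mul, map_mem_relIdeal_iff P]
    exact ⟨w, hw, by rwa [mul_left_comm]⟩

theorem map_mem_irr_iff (P : Ideal S) [P.IsPrime] [IsLocalization.AtPrime O P] [IsLocalRing O]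
    {n : ℕ} {F : MvPolynomial (Fin n) S} :
    MvPolynomial.map (algebraMap S O) F ∈ irr n (maximalIdeal O) ↔ F ∈ irr n P := by
  simp only [irr, Ideal.mem_comap, constantCoeff_map]
  exact IsLocalization.AtPrime.to_map_mem_maximal_iff O P _

theorem depthAt_torsIdeal [IsRegularRing S] [IsLocalRing O] [IsNoetherianRing O]
    {n m : ℕ} {f : Fin m → S} (hf : RingTheory.Sequence.IsWeaklyRegular S (List.ofFn f))
    (φ : Fin m → Fin n → S) {B B' : Type} [CommRing B] [CommRing B'] [Algebra B B']
    {π : MvPolynomial (Fin n) S →+* B} (hπ : Function.Surjective π)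
    (hπker : ∀ F, π F = 0 ↔ F ∈ torsIdeal f φ) (p : Ideal B) [p.IsPrime]
    [IsLocalization.AtPrime B' p]
    (hp : p.comap π = irr n P) (rs : List B') (hrs : ∀ r ∈ rs, ¬ IsUnit r)
    (h : RingTheory.Sequence.IsWeaklyRegular B' rs) :
    DepthAt (irr n (maximalIdeal O)) rs.length (MvPolynomial (Fin n) O ⧸
      torsIdeal (fun j => algebraMap S O (f j)) (fun j i => algebraMap S O (φ j i))) := by
  have : IsLocalization P.primeCompl O := ‹_›
  let _ : Algebra (MvPolynomial (Fin n) S) (MvPolynomial (Fin n) O) :=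
    MvPolynomial.algebraMvPolynomial
  have := MvPolynomial.isLocalization (σ := Fin n) P.primeCompl O
  have hmem : ∀ F, π F ∈ p ↔ F ∈ irr n P := fun F => by rw [← hp, Ideal.mem_comap]
  have hunitG : ∀ G, G ∉ irr n P → IsUnit (algebraMap B B' (π G)) := fun G hG =>
    IsLocalization.map_units B' (⟨π G, fun h => hG ((hmem G).1 h)⟩ : p.primeCompl)
  have hC : ∀ v ∉ P, (C v : MvPolynomial (Fin n) S) ∉ irr n P := fun v hv => by simpa [irr] using hv
  have hM : ∀ y : P.primeCompl.map (C (σ := Fin n)), IsUnit (((algebraMap B B').comp π) y) := by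
    rintro ⟨_, v, hv, rfl⟩
    exact hunitG _ (hC v hv)
  obtain ⟨ψ, hψ⟩ : ∃ ψ : MvPolynomial (Fin n) O →+* B', ∀ F,
      ψ (MvPolynomial.map (algebraMap S O) F) = algebraMap B B' (π F) :=
    ⟨IsLocalization.lift hM, fun F => IsLocalization.lift_eq hM F⟩
  have hclear : ∀ s, s ∉ irr n (maximalIdeal O) → ∃ v ∉ P, ∃ G ∉ irr n P,
      C (algebraMap S O v) * s = MvPolynomial.map (algebraMap S O) G := fun s hs => by
    obtain ⟨v, hv, G, hG⟩ := exists_mul_eq_map P s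
    refine ⟨v, hv, G, fun h => hs ?_, hG⟩
    rw [← map_mem_irr_iff (O := O) P, ← hG] at h
    refine ((inferInstance : (irr n (maximalIdeal O)).IsPrime).mem_or_mem h).resolve_left ?_
    rw [← MvPolynomial.map_C, map_mem_irr_iff P]
    exact hC v hv
  have hψC : ∀ v ∉ P, IsUnit (ψ (C (algebraMap S O v))) := fun v hv => by
    rw [← MvPolynomial.map_C, hψ]
    exact hunitG _ (hC v hv)
  refine DepthAt.of_isWeaklyRegular ψ _ (fun b => ?_) (fun s hs => ?_) rs hrs _ ⊥ (fun a => ?_)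
    ((LinearEquiv.isWeaklyRegular_congr (Submodule.quotEquivOfEqBot _ rfl) rs).2 h)
  · obtain ⟨⟨x, y, hy⟩, hxy⟩ := IsLocalization.surj p.primeCompl b
    obtain ⟨F, rfl⟩ := hπ x
    obtain ⟨G, rfl⟩ := hπ y
    refine ⟨MvPolynomial.map (algebraMap S O) F, MvPolynomial.map (algebraMap S O) G, ?_, ?_⟩
    · rw [map_mem_irr_iff P, ← hmem]
      exact hy
    · rw [hψ, hψ, mul_comm]
      exact hxy
  · obtain ⟨v, hv, G, hG, h⟩ := hclear s hs
    have := hunitG G hG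
    rw [← hψ, ← h, map_mul] at this
    exact isUnit_of_mul_isUnit_right this
  · obtain ⟨v, hv, F, hF⟩ := exists_mul_eq_map P a
    rw [Ideal.mem_bot, ← (hψC v hv).mul_right_eq_zero, ← map_mul, hF, hψ]
    constructor
    · intro h
      rw [IsLocalization.map_eq_zero_iff p.primeCompl B'] at h
      obtain ⟨⟨y, hy⟩, h⟩ := h
      obtain ⟨G, rfl⟩ := hπ y
      refine ⟨MvPolynomial.map (algebraMap S O) (G * C v), ?_, ?_⟩
      · rw [map_mem_irr_iff P]
        exact fun h => ((inferInstance : (irr n P).IsPrime).mem_or_mem h).elim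
          (fun h => hy ((hmem G).2 h)) (hC v hv)
      · rw [map_mul, MvPolynomial.map_C, mul_assoc, hF, ← map_mul, map_mem_torsIdeal_iff P hf]
        refine ⟨1, fun h => (inferInstance : P.IsPrime).ne_top ((Ideal.eq_top_iff_one _).2 h), ?_⟩
        rw [C_1, one_mul, ← hπker, map_mul]
        exact h
    · rintro ⟨s, hs, h⟩
      obtain ⟨w, hw, G, hG, h1⟩ := hclear s hs
      have h2 : MvPolynomial.map (algebraMap S O) (G * F) ∈
          torsIdeal (fun j => algebraMap S O (f j)) (fun j i => algebraMap S O (φ j i)) := by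
        rw [map_mul, ← h1, ← hF, mul_mul_mul_comm]
        exact Ideal.mul_mem_left _ _ h
      rw [map_mem_torsIdeal_iff P hf] at h2
      obtain ⟨u, hu, h3⟩ := h2
      rw [← hπker, ← mul_assoc, map_mul] at h3
      have h4 := congrArg (algebraMap B B') h3
      rw [map_mul, map_zero, (hunitG (C u * G) fun h =>
        ((inferInstance : (irr n P).IsPrime).mem_or_mem h).elim (hC u hu) hG).mul_right_eq_zero] at h4
      exact h4

end

end

section

open MvPolynomial IsLocalRing

theorem Matrix.exists_det_submatrix_ne_zero {K : Type*} [Field K] {N ρ : ℕ}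
    {w : Fin ρ → Fin N → K} (hw : LinearIndependent K w) :
    ∃ t : Fin ρ → Fin N, (Matrix.of fun a b => w a (t b)).det ≠ 0 := by
  have h1 : Module.finrank K (Submodule.span K (Set.range (Matrix.of w).transpose.row)) = ρ := by
    rw [← Matrix.rank_eq_finrank_span_row, Matrix.rank_transpose]
    exact LinearIndependent.rank_matrix (M := Matrix.of w) hw |>.trans (by simp)
  obtain ⟨g', hg', -, hli'⟩ := Submodule.exists_fun_fin_finrank_span_eq K
    (Set.range (Matrix.of w).transpose.row)
  choose t ht using hg'
  refine ⟨fun b => t (Fin.cast h1.symm b), ?_⟩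
  rw [← Matrix.det_transpose]
  refine IsUnit.ne_zero ((Matrix.isUnit_iff_isUnit_det _).1
    (Matrix.linearIndependent_rows_iff_isUnit.1 ?_))
  have h2 : (Matrix.of fun a b => w a (t (Fin.cast h1.symm b))).transpose.row =
      g' ∘ Fin.cast h1.symm := by
    ext b a
    rw [Function.comp_apply, ← ht]
    rfl
  rw [h2]
  exact hli'.comp _ (Fin.cast_injective h1.symm)

theorem le_rankAt_iff_exists_det_notMem {O : Type*} [CommRing O] {N : ℕ} {ι : Type*} [Finite ι]
    (Q : Ideal O) [Q.IsPrime] (v : ι → Fin N → O) {ρ : ℕ} :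
    ρ ≤ rankAt Q v ↔ ∃ (s : Fin ρ → ι) (t : Fin ρ → Fin N),
      (Matrix.of fun a b => v (s a) (t b)).det ∉ Q := by
  have hdet : ∀ (s : Fin ρ → ι) (t : Fin ρ → Fin N),
      (Matrix.of fun a b => v (s a) (t b)).det ∈ Q ↔
      (Matrix.of fun a b => algebraMap O Q.ResidueField (v (s a) (t b))).det = 0 := by
    intro s t
    rw [← Ideal.algebraMap_residueField_eq_zero, RingHom.map_det]
    rfl
  constructor
  · intro h
    obtain ⟨g, hg, -, hli⟩ := Submodule.exists_fun_fin_finrank_span_eq Q.ResidueField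
      (Set.range fun j i => algebraMap O Q.ResidueField (v j i))
    choose s hs using hg
    replace hli := hli.comp _ (Fin.castLE_injective h)
    obtain ⟨t, ht⟩ := Matrix.exists_det_submatrix_ne_zero hli
    refine ⟨fun a => s (Fin.castLE h a), t, ?_⟩
    have h2 : (fun a b => algebraMap O Q.ResidueField (v (s (Fin.castLE h a)) (t b))) =
        fun a b => (g ∘ Fin.castLE h) a (t b) := by
      funext a b
      exact congrFun (hs (Fin.castLE h a)) (t b)
    rw [hdet, h2]
    exact ht
  · rintro ⟨s, t, h⟩
    rw [hdet] at h
    have h1 := Matrix.linearIndependent_rows_iff_isUnit.2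
      ((Matrix.isUnit_iff_isUnit_det _).2 (isUnit_iff_ne_zero.2 h))
    have h2 : LinearIndependent Q.ResidueField
        fun a i => algebraMap O Q.ResidueField (v (s a) i) :=
      LinearIndependent.of_comp (LinearMap.funLeft Q.ResidueField Q.ResidueField t) h1
    have h3 := finrank_span_eq_card h2
    rw [Fintype.card_fin] at h3
    rw [← h3]
    refine Submodule.finrank_mono (Submodule.span_mono ?_)
    rintro _ ⟨a, rfl⟩
    exact ⟨s a, rfl⟩

theorem rankAt_algebraMap {S O : Type*} [CommRing S] [CommRing O] [Algebra S O] {N : ℕ} {ι : Type*}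
    [Finite ι] (Q : Ideal O) [Q.IsPrime] (v : ι → Fin N → S) :
    rankAt Q (fun j i => algebraMap S O (v j i)) = rankAt (Q.comap (algebraMap S O)) v := by
  refine eq_of_forall_le_iff fun ρ => ?_
  rw [le_rankAt_iff_exists_det_notMem, le_rankAt_iff_exists_det_notMem]
  refine exists_congr fun s => exists_congr fun t => not_congr ?_
  rw [Ideal.mem_comap, RingHom.map_det]
  rfl

theorem isHomogeneous_det {k : Type*} [CommRing k] {N ρ : ℕ} {d : Fin ρ → ℕ}
    {M : Matrix (Fin ρ) (Fin ρ) (MvPolynomial (Fin N) k)}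
    (hM : ∀ a b, (M a b).IsHomogeneous (d a)) : M.det.IsHomogeneous (∑ a, d a) := by
  rw [Matrix.det_apply]
  refine IsHomogeneous.sum _ _ _ fun σ _ => ?_
  have h1 : (∏ i, M (σ i) i).IsHomogeneous (∑ a, d a) := by
    rw [← Equiv.sum_comp σ]
    exact IsHomogeneous.prod _ _ _ fun i _ => hM _ _
  rw [Units.smul_def, zsmul_eq_mul, ← zero_add (∑ a, d a)]
  refine IsHomogeneous.mul ?_ h1
  rw [← map_intCast (C : k →+* MvPolynomial (Fin N) k)]
  exact isHomogeneous_C _ _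

theorem rankAt_le_rankAt_of_homogIdeal {k : Type} [CommRing k] {N m : ℕ}
    {v : Fin m → Fin N → MvPolynomial (Fin N) k} {d : Fin m → ℕ}
    (hv : ∀ j i, (v j i).IsHomogeneous (d j)) {P Q : Ideal (MvPolynomial (Fin N) k)} [P.IsPrime]
    [Q.IsPrime] (h : ∀ J, HomogIdeal J → J ≤ Q → J ≤ P) : rankAt P v ≤ rankAt Q v := by
  obtain ⟨s, t, hst⟩ := (le_rankAt_iff_exists_det_notMem P v).1 le_rfl
  refine (le_rankAt_iff_exists_det_notMem Q v).2 ⟨s, t, fun hmem => hst ?_⟩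
  refine h (Ideal.span {_}) (HomogIdeal.span ?_) ((Ideal.span_singleton_le_iff_mem _).2 hmem)
    (Ideal.mem_span_singleton_self _)
  rintro z rfl
  exact ⟨_, isHomogeneous_det (d := fun a => d (s a)) fun a b => hv _ _⟩

end

section

open MvPolynomial IsLocalRing

variable {k : Type} [Field k] {n m : ℕ} {f : Fin m → MvPolynomial (Fin n) k}

theorem eq_irr_bot_of_X_mem {P : Ideal (MvPolynomial (Fin n) k)} [P.IsPrime]
    (h : ∀ i, X i ∈ P) : P = irr n ⊥ := by
  have := eq_irr_of_X_mem h
  rwa [(Ideal.eq_bot_or_top (P.comap C)).resolve_right (Ideal.IsPrime.ne_top inferInstance)] at this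

theorem height_le_natCast (P : Ideal (MvPolynomial (Fin n) k)) [P.IsPrime] : P.height ≤ n := by
  have h := Ideal.height_le_ringKrullDim_of_ne_top (Ideal.IsPrime.ne_top (I := P) inferInstance)
  rw [ringKrullDim_of_isNoetherianRing, ringKrullDim_eq_zero_of_field, zero_add,
    Nat.card_eq_fintype_card, Fintype.card_fin] at h
  exact_mod_cast h

theorem not_forall_X_mem_of_lt {P Q : Ideal (MvPolynomial (Fin n) k)} [P.IsPrime] [Q.IsPrime]
    (h : Q < P) : ¬ ∀ i, X i ∈ Q := fun hX =>
  h.ne (by rw [eq_irr_bot_of_X_mem hX, eq_irr_bot_of_X_mem fun i => h.le (hX i)])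

/-- The rank condition at all primes below a homogeneous prime, given the rank condition away from
the irrelevant ideal and its strict form at smaller homogeneous primes. -/
theorem natCast_succ_le_height_add_rankAt {e : Fin m → ℕ} (hf : ∀ j, (f j).IsHomogeneous (e j))
    (hF0 : ∀ (P : Ideal (MvPolynomial (Fin n) k)) [P.IsPrime], (∀ j, f j ∈ P) → (¬ ∀ i, X i ∈ P) →
      ((2 * m : ℕ) : ℕ∞) ≤ P.height + rankAt P fun j i => pderiv i (f j))
    {P : Ideal (MvPolynomial (Fin n) k)} [P.IsPrime]
    (ih : ∀ (P' : Ideal (MvPolynomial (Fin n) k)) [P'.IsPrime], HomogIdeal P' → (∀ j, f j ∈ P') →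
      P' < P → (m : ℕ∞) < P'.height →
      ((2 * m + 1 : ℕ) : ℕ∞) ≤ P'.height + rankAt P' fun j i => pderiv i (f j))
    {Q : Ideal (MvPolynomial (Fin n) k)} [Q.IsPrime] (hfQ : ∀ j, f j ∈ Q) (hlt : Q < P)
    (hm : (m : ℕ∞) < Q.height) :
    ((2 * m + 1 : ℕ) : ℕ∞) ≤ Q.height + rankAt Q fun j i => pderiv i (f j) := by
  by_cases hQ : HomogIdeal Q
  · exact ih Q hQ hfQ hlt hm
  obtain ⟨Q', hQ', hhom, hle, hmax⟩ := exists_homogIdeal_isPrime_le Q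
  have hlt' : Q' < Q := lt_of_le_of_ne hle fun h => hQ (h ▸ hhom)
  have hfQ' : ∀ j, f j ∈ Q' := fun j => hmax (Ideal.span {f j})
    (HomogIdeal.span (by rintro z rfl; exact ⟨_, hf j⟩))
    ((Ideal.span_singleton_le_iff_mem _).2 (hfQ j)) (Ideal.mem_span_singleton_self _)
  have h1 := hF0 Q' hfQ' (not_forall_X_mem_of_lt hlt')
  have h2 := rankAt_le_rankAt_of_homogIdeal (v := fun j i => pderiv i (f j))
    (d := fun j => e j - 1) (fun j i => (hf j).pderiv) hmax
  have h3 := Ideal.height_add_one_le_of_lt_of_isPrime hlt'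
  calc ((2 * m + 1 : ℕ) : ℕ∞) = (2 * m : ℕ) + 1 := by push_cast; rfl
    _ ≤ Q'.height + rankAt Q' (fun j i => pderiv i (f j)) + 1 := by gcongr
    _ = Q'.height + 1 + rankAt Q' (fun j i => pderiv i (f j)) := by ring
    _ ≤ _ := by gcongr

variable {R B : Type} [CommRing R] [CommRing B] {p : MvPolynomial (Fin n) k →+* R}
  {π : MvPolynomial (Fin n) (MvPolynomial (Fin n) k) →+* B}

theorem depthAt_torsIdeal_localization {f : Fin m → MvPolynomial (Fin n) k}
    {φ : Fin m → Fin n → MvPolynomial (Fin n) k}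
    (hreg : RingTheory.Sequence.IsWeaklyRegular (MvPolynomial (Fin n) k) (List.ofFn f))
    (hp : Function.Surjective p) (hker : RingHom.ker p = Ideal.span (Set.range f))
    (hπ : Function.Surjective π) (hπker : ∀ F, π F = 0 ↔ F ∈ torsIdeal f φ)
    (hCM : IsCohenMacaulayRing B) {q : Ideal R} [q.IsPrime]
    {P : Ideal (MvPolynomial (Fin n) k)} [P.IsPrime] (hP : q.comap p = P) {c d : ℕ}
    (hq : q.height = c) (hn : n = m + d) :
    DepthAt (irr n (maximalIdeal (Localization.AtPrime P))) (c + d)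
      (MvPolynomial (Fin n) (Localization.AtPrime P) ⧸
        torsIdeal (fun j => algebraMap _ (Localization.AtPrime P) (f j))
          (fun j i => algebraMap _ (Localization.AtPrime P) (φ j i))) := by
  subst hP
  have : IsNoetherianRing R := isNoetherianRing_of_surjective _ _ p hp
  have : IsNoetherianRing B := isNoetherianRing_of_surjective _ _ π hπ
  have hle := ker_le_irr_comap hker hπker q
  have hcm : ((irr n (q.comap p)).map π).comap π = irr n (q.comap p) := by
    rw [Ideal.comap_map_of_surjective' π hπ, sup_eq_left]
    exact hle
  have hprime : ((irr n (q.comap p)).map π).IsPrime := Ideal.map_isPrime_of_surjective hπ hle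
  obtain ⟨rs, hrs, hrs', hlen⟩ := hCM _ hprime
  have h1 := depthAt_torsIdeal (O := Localization.AtPrime (q.comap p)) hreg φ hπ hπker _ hcm rs
    (fun r hr => (mem_maximalIdeal r).1 (hrs r hr)) hrs'.1
  refine h1.mono ?_
  have h2 := height_add_le_height_add hp hker hπ hπker hcm.symm hq
  rw [IsLocalization.AtPrime.ringKrullDim_eq_height ((irr n (q.comap p)).map π)] at hlen
  have h3 : ((irr n (q.comap p)).map π).height = rs.length := by exact_mod_cast hlen.symm
  rw [h3] at h2
  have h4 : c + n ≤ rs.length + m := by exact_mod_cast h2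
  omega

/-- The localization of a polynomial ring at a homogeneous prime, at which the strict rank
condition fails, is a local setup. -/
theorem localSetup {e : Fin m → ℕ} (hf : ∀ j, (f j).IsHomogeneous (e j))
    (hreg : RingTheory.Sequence.IsWeaklyRegular (MvPolynomial (Fin n) k) (List.ofFn f))
    (hF0 : ∀ (P : Ideal (MvPolynomial (Fin n) k)) [P.IsPrime], (∀ j, f j ∈ P) → (¬ ∀ i, X i ∈ P) →
      ((2 * m : ℕ) : ℕ∞) ≤ P.height + rankAt P fun j i => pderiv i (f j))
    (hp : Function.Surjective p) (hker : RingHom.ker p = Ideal.span (Set.range f))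
    (hπ : Function.Surjective π)
    (hπker : ∀ F, π F = 0 ↔ F ∈ torsIdeal f fun j i => pderiv i (f j))
    (hCM : IsCohenMacaulayRing B) {P : Ideal (MvPolynomial (Fin n) k)} [P.IsPrime]
    (ih : ∀ (P' : Ideal (MvPolynomial (Fin n) k)) [P'.IsPrime], HomogIdeal P' → (∀ j, f j ∈ P') →
      P' < P → (m : ℕ∞) < P'.height →
      ((2 * m + 1 : ℕ) : ℕ∞) ≤ P'.height + rankAt P' fun j i => pderiv i (f j))
    {q : Ideal R} [q.IsPrime] (hP : q.comap p = P) {c : ℕ} (hq : q.height = c) (hc : 1 ≤ c)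
    (hPht : P.height = (c + m : ℕ)) :
    LocalSetup c (n - m) (fun j => algebraMap _ (Localization.AtPrime P) (f j))
      (fun j i => algebraMap _ (Localization.AtPrime P) (pderiv i (f j)))
      (torsIdeal (fun j => algebraMap _ (Localization.AtPrime P) (f j))
        (fun j i => algebraMap _ (Localization.AtPrime P) (pderiv i (f j)))) := by
  have hle : c + m ≤ n := by
    have := height_le_natCast P
    rw [hPht] at this
    exact_mod_cast this
  have hfP : ∀ j, f j ∈ P := fun j => by
    rw [← hP, Ideal.mem_comap, RingHom.mem_ker.1 (hker.ge (Ideal.subset_span ⟨j, rfl⟩))]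
    exact q.zero_mem
  have hlt : ∀ Q : Ideal (Localization.AtPrime P), Q.IsPrime → Q ≠ maximalIdeal _ →
      Q.comap (algebraMap _ (Localization.AtPrime P)) < P := by
    intro Q hQ hne
    have h1 := IsLocalization.AtPrime.under_maximalIdeal (Localization.AtPrime P) P
    have h2 : Q.comap (algebraMap _ (Localization.AtPrime P)) ≤ P := by
      conv_rhs => rw [← h1]
      exact Ideal.comap_mono (IsLocalRing.le_maximalIdeal hQ.ne_top)
    refine lt_of_le_of_ne h2 fun h => hne ?_
    have h3 := IsLocalization.map_under P.primeCompl (Localization.AtPrime P) Q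
    have h4 := IsLocalization.map_under P.primeCompl (Localization.AtPrime P)
      (maximalIdeal (Localization.AtPrime P))
    rw [h1] at h4
    rw [← h3, ← h4]
    exact congrArg _ h
  have hht : ∀ Q : Ideal (Localization.AtPrime P),
      (Q.comap (algebraMap _ (Localization.AtPrime P))).height = Q.height := fun Q =>
    IsLocalization.height_under P.primeCompl Q
  refine ⟨by omega, hc, by omega, ?_, fun j => ?_, ?_, fun Q _ hne hfQ => ?_,
    fun Q _ hne hfQ hm => ?_, fun F => Iff.rfl, ?_⟩
  · rw [← hht]
    change (Ideal.under _ _).height = _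
    rw [IsLocalization.AtPrime.under_maximalIdeal _ P, hPht]
  · rw [IsLocalization.AtPrime.to_map_mem_maximal_iff _ P]
    exact hfP j
  · have := hreg.of_isLocalization (Localization.AtPrime P) P.primeCompl
    rwa [List.map_ofFn] at this
  · rw [← hht, rankAt_algebraMap]
    exact hF0 _ hfQ (not_forall_X_mem_of_lt (hlt Q inferInstance hne))
  · rw [← hht] at hm
    rw [← hht, rankAt_algebraMap]
    exact natCast_succ_le_height_add_rankAt hf hF0 ih hfQ (hlt Q inferInstance hne) hm
  · exact depthAt_torsIdeal_localization hreg hp hker hπ hπker hCM hP hq (by omega)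

end

section

open MvPolynomial IsLocalRing

variable {k : Type} [Field k] {n m : ℕ} {f : Fin m → MvPolynomial (Fin n) k}

theorem aeval_algebraMap_X {A : Type} [CommRing A] [Algebra k A]
    [Algebra (MvPolynomial (Fin n) k) A] [IsScalarTower k (MvPolynomial (Fin n) k) A]
    (F : MvPolynomial (Fin n) k) :
    aeval (fun i => algebraMap (MvPolynomial (Fin n) k) A (X i)) F = algebraMap _ A F := by
  have h := aeval_unique (IsScalarTower.toAlgHom k (MvPolynomial (Fin n) k) A)
  exact (DFunLike.congr_fun h F).symm

theorem exists_dualSetup {e : Fin m → ℕ} (hf : ∀ j, (f j).IsHomogeneous (e j))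
    {P : Ideal (MvPolynomial (Fin n) k)} [P.IsPrime] (hX : ∀ i, X i ∈ P) (hfP : ∀ j, f j ∈ P) :
    ∃ (deg : Fin m → ℕ) (res : Localization.AtPrime P →ₐ[k] k),
      DualSetup (fun j => algebraMap _ (Localization.AtPrime P) (f j))
      (fun j i => algebraMap _ (Localization.AtPrime P) (pderiv i (f j)))
      (fun i => algebraMap (MvPolynomial (Fin n) k) (Localization.AtPrime P) (X i)) f deg res := by
  classical
  have hP := eq_irr_bot_of_X_mem hX
  have hmem : ∀ F, F ∈ P ↔ constantCoeff F = 0 := fun F => by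
    rw [hP, irr, Ideal.mem_comap, Ideal.mem_bot]
  have hunit : ∀ F : P.primeCompl,
      IsUnit (aeval (fun _ => 0 : Fin n → k) (F : MvPolynomial (Fin n) k)) := fun F => by
    rw [aeval_zero', isUnit_iff_ne_zero]
    exact fun h => F.2 ((hmem _).2 h)
  refine ⟨fun j => if f j = 0 then 1 else e j, IsLocalization.liftAlgHom (M := P.primeCompl) hunit,
    fun j => ?_, fun j => ?_, fun j => (aeval_algebraMap_X _).symm,
    fun j i => (aeval_algebraMap_X _).symm, fun A _ _ η => ?_⟩
  · split_ifs with h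
    · rw [h]
      exact isHomogeneous_zero _ _ _
    · exact hf j
  · split_ifs with h
    · exact le_rfl
    · rw [Nat.one_le_iff_ne_zero]
      intro h0
      have h1 := hf j
      rw [h0, ← totalDegree_zero_iff_isHomogeneous, totalDegree_eq_zero_iff_eq_C] at h1
      have h2 := (hmem _).1 (hfP j)
      rw [constantCoeff_eq] at h2
      rw [h2, C_0] at h1
      exact h h1
  · have hfst : ∀ F : MvPolynomial (Fin n) k, TrivSqZeroExt.fst
        (aeval (fun i => TrivSqZeroExt.inr (η i) : Fin n → DualNumber A) F) =
        algebraMap k A (aeval (fun _ => 0 : Fin n → k) F) := by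
      intro F
      have : (TrivSqZeroExt.fstHom k A A).comp
          (aeval (fun i => TrivSqZeroExt.inr (η i) : Fin n → DualNumber A)) =
          (Algebra.ofId k A).comp (aeval (fun _ => 0 : Fin n → k)) := by
        ext i
        simp
      exact DFunLike.congr_fun this F
    have hunit' : ∀ F : P.primeCompl, IsUnit (aeval (fun i => TrivSqZeroExt.inr (η i) :
        Fin n → DualNumber A) (F : MvPolynomial (Fin n) k)) := fun F => by
      rw [TrivSqZeroExt.isUnit_iff_isUnit_fst, hfst]
      exact (hunit F).map _
    refine ⟨IsLocalization.liftAlgHom (M := P.primeCompl) hunit', fun i => ?_, fun a => ?_⟩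
    · rw [IsLocalization.liftAlgHom_apply, IsLocalization.lift_eq]
      simp
    · have : (TrivSqZeroExt.fstHom k A A).comp
          (IsLocalization.liftAlgHom (M := P.primeCompl) (S := Localization.AtPrime P) hunit') =
          (Algebra.ofId k A).comp (IsLocalization.liftAlgHom (M := P.primeCompl) hunit) := by
        refine IsLocalization.algHom_ext P.primeCompl (AlgHom.ext fun F => ?_)
        change TrivSqZeroExt.fst (IsLocalization.lift _ (algebraMap _ _ F)) =
          algebraMap k A (IsLocalization.lift _ (algebraMap _ _ F))
        rw [IsLocalization.lift_eq, IsLocalization.lift_eq]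
        exact hfst F
      exact DFunLike.congr_fun this a

variable {R B : Type} [CommRing R] [CommRing B] {p : MvPolynomial (Fin n) k →+* R}
  {π : MvPolynomial (Fin n) (MvPolynomial (Fin n) k) →+* B}

theorem natCast_succ_le_height_add_rankAt_of_forall_lt [CharZero k] {e : Fin m → ℕ}
    (hf : ∀ j, (f j).IsHomogeneous (e j))
    (hreg : RingTheory.Sequence.IsWeaklyRegular (MvPolynomial (Fin n) k) (List.ofFn f))
    (hF0 : ∀ (P : Ideal (MvPolynomial (Fin n) k)) [P.IsPrime], (∀ j, f j ∈ P) → (¬ ∀ i, X i ∈ P) →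
      ((2 * m : ℕ) : ℕ∞) ≤ P.height + rankAt P fun j i => pderiv i (f j))
    (hp : Function.Surjective p) (hker : RingHom.ker p = Ideal.span (Set.range f))
    (hπ : Function.Surjective π)
    (hπker : ∀ F, π F = 0 ↔ F ∈ torsIdeal f fun j i => pderiv i (f j))
    (hCM : IsCohenMacaulayRing B) {P : Ideal (MvPolynomial (Fin n) k)} [P.IsPrime]
    (ih : ∀ (P' : Ideal (MvPolynomial (Fin n) k)) [P'.IsPrime], HomogIdeal P' → (∀ j, f j ∈ P') →
      P' < P → (m : ℕ∞) < P'.height →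
      ((2 * m + 1 : ℕ) : ℕ∞) ≤ P'.height + rankAt P' fun j i => pderiv i (f j))
    {q : Ideal R} [q.IsPrime] (hP : q.comap p = P) {c : ℕ} (hq : q.height = c) (hc : 1 ≤ c)
    (hPht : P.height = (c + m : ℕ)) :
    ((2 * m + 1 : ℕ) : ℕ∞) ≤ P.height + rankAt P fun j i => pderiv i (f j) := by
  have S := localSetup hf hreg hF0 hp hker hπ hπker hCM ih hP hq hc hPht
  have hfP : ∀ j, f j ∈ P := fun j => by
    rw [← hP, Ideal.mem_comap, RingHom.mem_ker.1 (hker.ge (Ideal.subset_span ⟨j, rfl⟩))]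
    exact q.zero_mem
  have hR : IsRegularRing (Localization.AtPrime P) := isRegularRing_localization P
  have hrank : rankAt (maximalIdeal (Localization.AtPrime P))
      (fun j i => algebraMap _ (Localization.AtPrime P) (pderiv i (f j))) =
      rankAt P fun j i => pderiv i (f j) := by
    rw [rankAt_algebraMap]
    congr 1
    exact IsLocalization.AtPrime.under_maximalIdeal (Localization.AtPrime P) P
  by_contra hcon
  rw [hPht] at hcon
  have hcon' : ¬ (2 * m + 1 ≤ c + m + rankAt P fun j i => pderiv i (f j)) := fun h =>
    hcon (by exact_mod_cast h)
  by_cases hX : ∀ i, X i ∈ P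
  · obtain ⟨deg, res, D⟩ := exists_dualSetup hf hX hfP
    have hn : c = n - m := by
      have h1 := hPht
      rw [eq_irr_bot_of_X_mem hX, height_irr, Ideal.height_bot, zero_add] at h1
      have h2 : n = c + m := by exact_mod_cast h1
      omega
    rw [← hn] at S
    have := D.lt_rankAt_add S
    rw [hrank] at this
    omega
  · have : Algebra.EssFiniteType k (Localization.AtPrime P) :=
      have := Algebra.EssFiniteType.of_isLocalization (Localization.AtPrime P) P.primeCompl
      Algebra.EssFiniteType.comp k (MvPolynomial (Fin n) k) _
    have h1 := hF0 P hfP hX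
    rw [hPht] at h1
    have h2 : 2 * m ≤ c + m + rankAt P fun j i => pderiv i (f j) := by exact_mod_cast h1
    refine S.rank_ne (k := k) (fun i => algebraMap (MvPolynomial (Fin n) k) (Localization.AtPrime P) (X i))
      (fun j => ?_) ?_
    · rw [← aeval_algebraMap_X (f j), KaehlerDifferential.D_aeval]
      simp only [aeval_algebraMap_X]
    · rw [hrank]
      omega

end

section

open MvPolynomial IsLocalRing

variable {k : Type} [Field k] {n m : ℕ} {f : Fin m → MvPolynomial (Fin n) k}

theorem height_comap_mk_span_eq
    (hreg : RingTheory.Sequence.IsWeaklyRegular (MvPolynomial (Fin n) k) (List.ofFn f))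
    (q : Ideal (MvPolynomial (Fin n) k ⧸ Ideal.span (Set.range f))) [q.IsPrime] :
    (q.comap (Ideal.Quotient.mk (Ideal.span (Set.range f)))).height = q.height + m := by
  have key : ∀ (J : Ideal (MvPolynomial (Fin n) k)), J = Ideal.ofList (List.ofFn f) →
      ∀ (q : Ideal (MvPolynomial (Fin n) k ⧸ J)) [q.IsPrime],
      (q.comap (Ideal.Quotient.mk J)).height = q.height + m := by
    rintro _ rfl q _
    rw [height_comap_mk_eq hreg q, List.length_ofFn]
  exact key _ (ofList_ofFn f).symm q

theorem mem_comap_mk_span (q : Ideal (MvPolynomial (Fin n) k ⧸ Ideal.span (Set.range f)))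
    (j : Fin m) : f j ∈ q.comap (Ideal.Quotient.mk (Ideal.span (Set.range f))) := by
  rw [Ideal.mem_comap, Ideal.Quotient.eq_zero_iff_mem.2 (Ideal.subset_span (Set.mem_range_self j))]
  exact q.zero_mem

theorem embDim_localization_add_rankAt [CharZero k] {J : Ideal (MvPolynomial (Fin n) k)}
    (hJ : J = Ideal.span (Set.range f)) (q : Ideal (MvPolynomial (Fin n) k ⧸ J)) [q.IsPrime] :
    ((embDim (Localization.AtPrime q) + rankAt (q.comap (Ideal.Quotient.mk J))
      (fun j i => pderiv i (f j)) : ℕ) : ℕ∞) = (q.comap (Ideal.Quotient.mk J)).height := by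
  refine embDim_add_rankAt f (q.comap (Ideal.Quotient.mk J)) (fun j => ?_) _
    (localRingHom_mk_surjective J q) ((ker_localRingHom_mk J q).trans ?_)
  · rw [Ideal.mem_comap, Ideal.Quotient.eq_zero_iff_mem.2]
    · exact q.zero_mem
    · rw [hJ]
      exact Ideal.subset_span (Set.mem_range_self j)
  · exact congrArg (Ideal.map _) hJ

/-- The height of a prime of a complete intersection and the embedding dimension there, in terms of
the preimage in the polynomial ring. -/
theorem exists_height_eq_and_embDim_add_rankAt_eq [CharZero k]
    (hreg : RingTheory.Sequence.IsWeaklyRegular (MvPolynomial (Fin n) k) (List.ofFn f))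
    (q : Ideal (MvPolynomial (Fin n) k ⧸ Ideal.span (Set.range f))) [hq : q.IsPrime] :
    ∃ c : ℕ, q.height = c ∧
      Order.height (⟨q, hq⟩ : PrimeSpectrum (MvPolynomial (Fin n) k ⧸ Ideal.span (Set.range f))) = c ∧
      (q.comap (Ideal.Quotient.mk (Ideal.span (Set.range f)))).height = (c + m : ℕ) ∧
      embDim (Localization.AtPrime q) +
        rankAt (q.comap (Ideal.Quotient.mk (Ideal.span (Set.range f))))
          (fun j i => pderiv i (f j)) = c + m := by
  have h1 := height_comap_mk_span_eq hreg q
  have h2 := height_le_natCast (q.comap (Ideal.Quotient.mk (Ideal.span (Set.range f))))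
  obtain ⟨c, hc⟩ : ∃ c : ℕ, q.height = c := by
    refine ENat.ne_top_iff_exists.1 (fun h => ?_) |>.imp fun _ h => h.symm
    rw [h1, h, top_add] at h2
    exact (ENat.natCast_lt_top n).not_ge h2
  have h3 : (q.comap (Ideal.Quotient.mk (Ideal.span (Set.range f)))).height = (c + m : ℕ) := by
    rw [h1, hc, Nat.cast_add]
  have h4 := embDim_localization_add_rankAt rfl q
  rw [h3] at h4
  refine ⟨c, hc, ?_, h3, by exact_mod_cast h4⟩
  rw [← PrimeSpectrum.height_eq_orderHeight]
  exact hc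

theorem exists_prime_comap_mk_eq {J P : Ideal (MvPolynomial (Fin n) k)} [P.IsPrime]
    (h : J ≤ P) : ∃ q : Ideal (MvPolynomial (Fin n) k ⧸ J), q.IsPrime ∧
      q.comap (Ideal.Quotient.mk J) = P :=
  ⟨P.map (Ideal.Quotient.mk J), Ideal.isPrime_map_quotientMk_of_isPrime h, by
    rw [Ideal.comap_map_mk h]⟩

end

open MvPolynomial in
/-- Main theorem: for a standard graded complete intersection `R` over a field of
characteristic zero with `edim R_p ≤ 2 dim R_p` away from the irrelevant ideal and with
Cohen-Macaulay Rees algebra of differentials, one has `edim R_p ≤ 2 dim R_p - 1` at every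
non-minimal homogeneous prime. -/
theorem main_theorem (k : Type) [Field k] [CharZero k] (n m : ℕ)
    (f : Fin m → MvPolynomial (Fin n) k) (e : Fin m → ℕ)
    (hf : ∀ j, (f j).IsHomogeneous (e j))
    (hreg : RingTheory.Sequence.IsRegular (MvPolynomial (Fin n) k) (List.ofFn f))
    (d : ℕ) (hd1 : 1 ≤ d)
    (hdim : ringKrullDim (MvPolynomial (Fin n) k ⧸ Ideal.span (Set.range f)) = (d : ℕ))
    (hF0 : ∀ (p : Ideal (MvPolynomial (Fin n) k ⧸ Ideal.span (Set.range f)))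
        (hp : p.IsPrime),
      ¬ (Ideal.map (Ideal.Quotient.mk (Ideal.span (Set.range f)))
          (Ideal.span (Set.range (X : Fin n → MvPolynomial (Fin n) k))) ≤ p) →
      letI := hp
      ((embDim (Localization.AtPrime p) : ℕ) : ℕ∞) ≤
        2 * Order.height (⟨p, hp⟩ : PrimeSpectrum (MvPolynomial (Fin n) k ⧸ Ideal.span (Set.range f))))
    (hCM : IsCohenMacaulayRing (ReesAlgebraOfModule
      (MvPolynomial (Fin n) k ⧸ Ideal.span (Set.range f))
      (Ω[(MvPolynomial (Fin n) k ⧸ Ideal.span (Set.range f))⁄k]))) :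
    ∀ (p : Ideal (MvPolynomial (Fin n) k ⧸ Ideal.span (Set.range f))) (hp : p.IsPrime),
      (∃ S : Set (MvPolynomial (Fin n) k), (∀ g ∈ S, ∃ j, g.IsHomogeneous j) ∧
        p.comap (Ideal.Quotient.mk (Ideal.span (Set.range f))) = Ideal.span S) →
      p ∉ minimalPrimes (MvPolynomial (Fin n) k ⧸ Ideal.span (Set.range f)) →
      letI := hp
      ((embDim (Localization.AtPrime p) : ℕ) : ℕ∞) + 1 ≤
        2 * Order.height (⟨p, hp⟩ : PrimeSpectrum (MvPolynomial (Fin n) k ⧸ Ideal.span (Set.range f))) := by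
  intro p hp hhom hmin
  have hwreg := hreg.toIsWeaklyRegular
  have hrank : ∀ (P : Ideal (MvPolynomial (Fin n) k)) [P.IsPrime], (∀ j, f j ∈ P) →
      (¬ ∀ i, X i ∈ P) → ((2 * m : ℕ) : ℕ∞) ≤ P.height + rankAt P fun j i => pderiv i (f j) := by
    intro P _ hfP hX
    obtain ⟨q, hq, rfl⟩ := exists_prime_comap_mk_eq (J := Ideal.span (Set.range f)) (P := P)
      (Ideal.span_le.2 (Set.range_subset_iff.2 hfP))
    obtain ⟨c, -, h2, h3, h4⟩ := exists_height_eq_and_embDim_add_rankAt_eq hwreg q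
    have h5 := hF0 q hq fun h => hX fun i => h (Ideal.mem_map_of_mem _ (Ideal.subset_span ⟨i, rfl⟩))
    rw [h2] at h5
    have h6 : embDim (Localization.AtPrime q) ≤ 2 * c := by exact_mod_cast h5
    rw [h3, ← Nat.cast_add, Nat.cast_le]
    omega
  have hsurj : Function.Surjective
      (Ideal.Quotient.mkₐ k (Ideal.span (Set.range f))) := Ideal.Quotient.mkₐ_surjective k _
  have hker : RingHom.ker (Ideal.Quotient.mkₐ k (Ideal.span (Set.range f))) =
      Ideal.span (Set.range f) := Ideal.Quotient.mkₐ_ker k _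
  obtain ⟨π, hπ, hπker⟩ := exists_ringHom_reesAlgebra hsurj hker
  have hstrict : ∀ (h : ℕ) (P : Ideal (MvPolynomial (Fin n) k)) [P.IsPrime], P.height = h →
      HomogIdeal P → (∀ j, f j ∈ P) → (m : ℕ∞) < P.height →
      ((2 * m + 1 : ℕ) : ℕ∞) ≤ P.height + rankAt P fun j i => pderiv i (f j) := by
    intro h
    induction h using Nat.strong_induction_on with
    | _ h ih =>
      intro P _ hh hPhom hfP hmP
      obtain ⟨q, hq, hqP⟩ := exists_prime_comap_mk_eq (J := Ideal.span (Set.range f)) (P := P)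
        (Ideal.span_le.2 (Set.range_subset_iff.2 hfP))
      obtain ⟨c, h1, -, h3, -⟩ := exists_height_eq_and_embDim_add_rankAt_eq hwreg q
      rw [hqP] at h3
      have hc : 1 ≤ c := by
        rw [h3, Nat.cast_lt] at hmP
        omega
      refine natCast_succ_le_height_add_rankAt_of_forall_lt hf hwreg hrank
        (p := Ideal.Quotient.mk (Ideal.span (Set.range f))) Ideal.Quotient.mk_surjective
        (Ideal.mk_ker) hπ hπker hCM (fun P' _ hP'hom hfP' hlt hmP' => ?_) hqP h1 hc h3
      have h5 := Ideal.height_add_one_le_of_lt_of_isPrime hlt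
      obtain ⟨h', hh'⟩ := ENat.ne_top_iff_exists.1
        ((height_le_natCast P').trans_lt (ENat.natCast_lt_top n)).ne
      rw [hh, ← hh'] at h5
      exact ih h' (Nat.lt_of_succ_le (by exact_mod_cast h5)) P' hh'.symm hP'hom hfP' hmP'
  obtain ⟨c, h1, h2, h3, h4⟩ := exists_height_eq_and_embDim_add_rankAt_eq hwreg p
  have hc : c ≠ 0 := by
    rintro rfl
    exact hmin (Ideal.height_eq_zero_iff.1 h1)
  obtain ⟨S, hS, hpS⟩ := hhom
  have h5 := hstrict _ _ h3 (hpS ▸ HomogIdeal.span hS) (mem_comap_mk_span p) (by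
    rw [h3, Nat.cast_lt]
    omega)
  rw [h3, ← Nat.cast_add, Nat.cast_le] at h5
  rw [h2]
  have h6 : embDim (Localization.AtPrime p) + 1 ≤ 2 * c := by omega
  exact_mod_cast h6
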